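/- For every ε > 0 there exists a homotopically non-trivial C¹ map from S^6 to S^3 with 3-dilation less than ε. (The class of such a map is a non-trivial element of π_6(S^3) ≅ ℤ/12 which is the suspension of a class in π_5(S^2).) -/

import Mathlib

/-!
Basic notions: the unit sphere `S^{d-1} ⊆ ℝ^d`, the norm `‖Λ^k A‖` of the induced map on
`k`-th exterior powers of a linear map between inner product spaces, and the `k`-dilation of a
`C¹` map between unit spheres.  A (`C¹`) map from `S^{d₁-1}` to `S^{d₂-1}` is represented by a
(`C¹`) ambient map `F : ℝ^{d₁} → ℝ^{d₂}` mapping the unit sphere into the unit sphere; its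
`k`-dilation only depends on the restriction of `F` to the sphere, since the derivative is
restricted to the tangent space of the sphere.
-/

open scoped RealInnerProductSpace
open Set

noncomputable section

abbrev EucA (d : ℕ) := EuclideanSpace ℝ (Fin d)

/-- The unit sphere `S^{d-1}` in `ℝ^d` (with the round metric induced from `ℝ^d`). -/
def usph (d : ℕ) : Set (EucA d) := Metric.sphere 0 1

/-- The operator norm `‖Λ^k A‖` of the induced map on `k`-th exterior powers (with their induced
inner products): the supremum, over orthonormal `k`-frames `v` of the domain, of the `k`-volume
`√ det (⟪A vᵢ, A vⱼ⟫)` of the image frame `A v₁, …, A v_k`. -/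
noncomputable def lamNorm {E F : Type*} [NormedAddCommGroup E] [InnerProductSpace ℝ E]
    [NormedAddCommGroup F] [InnerProductSpace ℝ F] (k : ℕ) (A : E →ₗ[ℝ] F) : ℝ :=
  ⨆ v : {v : Fin k → E // Orthonormal ℝ v},
    Real.sqrt (Matrix.of fun (i j : Fin k) => ⟪A (v.1 i), A (v.1 j)⟫).det

/-- The `k`-dilation of a map of the unit sphere `S^{d-1}` into an inner product space (e.g. into
`ℝ^{d₂}`, for a map to the sphere `S^{d₂-1}`), the map being given by an ambient map `F`: the
supremum over points `x` of the sphere of `‖Λ^k df_x‖`, where `df_x` is the derivative of `F` at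
`x` restricted to the tangent space `(ℝ∙x)ᗮ` of the sphere at `x`. -/
noncomputable def kDilation {d : ℕ} {F' : Type*} [NormedAddCommGroup F']
    [InnerProductSpace ℝ F'] (k : ℕ) (F : EucA d → F') : ℝ :=
  ⨆ x : usph d,
    lamNorm k ((fderiv ℝ F (x : EucA d)).toLinearMap ∘ₗ ((ℝ ∙ (x : EucA d))ᗮ).subtype)

/-- A free homotopy, through maps of the unit sphere `S^{d-1}` into `T`, between (the
restrictions to the sphere of) `f` and `g`: a map `H` on `[0,1] × S^{d-1}`, continuous there,
with values in `T`, starting at `f` and ending at `g`. -/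
def FreelyHomotopic {d : ℕ} {E : Type*} [NormedAddCommGroup E] (T : Set E)
    (f g : EucA d → E) : Prop :=
  ∃ H : ℝ → EucA d → E,
    ContinuousOn (fun q : ℝ × EucA d => H q.1 q.2) (Icc (0:ℝ) 1 ×ˢ usph d) ∧
    (∀ t ∈ Icc (0:ℝ) 1, MapsTo (H t) (usph d) T) ∧
    EqOn (H 0) f (usph d) ∧ EqOn (H 1) g (usph d)

/-- A based homotopy (rel the basepoint `x₀` of the sphere, with basepoint value `y₀`), through
maps of the unit sphere `S^{d-1}` into `T`, between `f` and `g`. -/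
def BasedHomotopic {d : ℕ} {E : Type*} [NormedAddCommGroup E] (T : Set E)
    (x₀ : EucA d) (y₀ : E) (f g : EucA d → E) : Prop :=
  ∃ H : ℝ → EucA d → E,
    ContinuousOn (fun q : ℝ × EucA d => H q.1 q.2) (Icc (0:ℝ) 1 ×ˢ usph d) ∧
    (∀ t ∈ Icc (0:ℝ) 1, MapsTo (H t) (usph d) T) ∧
    (∀ t ∈ Icc (0:ℝ) 1, H t x₀ = y₀) ∧
    EqOn (H 0) f (usph d) ∧ EqOn (H 1) g (usph d)

/-- A sphere-valued map is nullhomotopic if it is freely homotopic, through sphere maps, to a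
constant map; a map is homotopically non-trivial if it is not nullhomotopic. -/
def SphereNullhomotopic {d₁ d₂ : ℕ} (F : EucA d₁ → EucA d₂) : Prop :=
  ∃ y ∈ usph d₂, FreelyHomotopic (usph d₂) F (fun _ => y)

set_option linter.all false

namespace SD
open Filter Topology OnePoint
abbrev OP (X : Type*) := OnePoint X
abbrev I := unitInterval

section Good
variable {X Y Z S T : Type*} [TopologicalSpace X] [TopologicalSpace Y] [TopologicalSpace Z]
  [TopologicalSpace S] [TopologicalSpace T]

/-- Continuous maps tending to the base point `b` at infinity. -/
def Good (b : S) (f : X → S) : Prop := Continuous f ∧ Tendsto f (cocompact X) (𝓝 b)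

/-- Homotopy through maps tending to `b` at infinity. -/
def Htp (b : S) (f g : X → S) : Prop :=
  ∃ H : I × X → S, Good b H ∧ (∀ x, H (0, x) = f x) ∧ ∀ x, H (1, x) = g x

def Null (b : S) (f : X → S) : Prop := Htp b f fun _ => b

theorem Good.comp {b : S} {f : X → S} (hf : Good b f) {p : Y → X} (hp : Continuous p)
    (hp' : Tendsto p (cocompact Y) (cocompact X)) : Good b fun y => f (p y) :=
  ⟨hf.1.comp hp, hf.2.comp hp'⟩

theorem Good.post {b : S} {f : X → S} (hf : Good b f) {F : S → T} {c : T} (hF : Continuous F)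
    (hb : F b = c) : Good c fun x => F (f x) :=
  ⟨hF.comp hf.1, hb ▸ (hF.tendsto b).comp hf.2⟩

theorem tendsto_of_preimage {p : Y → X}
    (h : ∀ C : Set X, IsCompact C → ∃ D : Set Y, IsCompact D ∧ ∀ y, p y ∈ C → y ∈ D) :
    Tendsto p (cocompact Y) (cocompact X) := by
  intro s hs
  obtain ⟨C, hC, hCs⟩ := mem_cocompact.1 hs
  obtain ⟨D, hD, hDC⟩ := h C hC
  exact mem_cocompact.2 ⟨D, hD, fun y hy => hCs fun hc => hy (hDC y hc)⟩

theorem tendsto_cocompact_prodMk (K : Type*) [TopologicalSpace K] [CompactSpace K] {p : Y → X}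
    (hp' : Tendsto p (cocompact Y) (cocompact X)) :
    Tendsto (fun q : K × Y => (q.1, p q.2)) (cocompact (K × Y)) (cocompact (K × X)) := by
  apply tendsto_of_preimage
  intro C hC
  have h1 : (p ⁻¹' (Prod.snd '' C)ᶜ) ∈ cocompact Y := hp' (hC.image continuous_snd).compl_mem_cocompact
  obtain ⟨D, hD, h⟩ := mem_cocompact.1 h1
  refine ⟨univ ×ˢ D, isCompact_univ.prod hD, fun y hy => ⟨trivial, ?_⟩⟩
  by_contra hn
  exact h hn ⟨_, hy, rfl⟩

theorem tendsto_snd_cocompact (K : Type*) [TopologicalSpace K] [CompactSpace K] :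
    Tendsto (Prod.snd : K × X → X) (cocompact (K × X)) (cocompact X) :=
  tendsto_of_preimage fun C hC => ⟨univ ×ˢ C, isCompact_univ.prod hC, fun _ hy => ⟨trivial, hy⟩⟩

theorem Htp.refl {b : S} {f : X → S} (hf : Good b f) : Htp b f f :=
  ⟨fun q => f q.2, hf.comp continuous_snd (tendsto_snd_cocompact I), fun _ => rfl, fun _ => rfl⟩

theorem Htp.comp {b : S} {f g : X → S} (h : Htp b f g) {p : Y → X} (hp : Continuous p)
    (hp' : Tendsto p (cocompact Y) (cocompact X)) : Htp b (fun y => f (p y)) (fun y => g (p y)) := by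
  obtain ⟨H, hH, h0, h1⟩ := h
  exact ⟨fun q => H (q.1, p q.2), hH.comp (by fun_prop) (tendsto_cocompact_prodMk I hp'),
    fun _ => h0 _, fun _ => h1 _⟩

theorem Htp.post {b : S} {f g : X → S} (h : Htp b f g) {F : S → T} {c : T} (hF : Continuous F)
    (hb : F b = c) : Htp c (fun x => F (f x)) (fun x => F (g x)) := by
  obtain ⟨H, hH, h0, h1⟩ := h
  exact ⟨fun q => F (H q), hH.post hF hb, fun _ => by simp [h0], fun _ => by simp [h1]⟩

theorem Htp.good_left {b : S} {f g : X → S} (h : Htp b f g) : Good b f := by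
  obtain ⟨H, hH, h0, -⟩ := h
  have : f = fun x => H (0, x) := funext fun x => (h0 x).symm
  rw [this]
  refine hH.comp (by fun_prop) (tendsto_of_preimage fun C hC => ?_)
  exact ⟨Prod.snd '' C, hC.image continuous_snd, fun y hy => ⟨_, hy, rfl⟩⟩

theorem Htp.symm {b : S} {f g : X → S} (h : Htp b f g) : Htp b g f := by
  obtain ⟨H, hH, h0, h1⟩ := h
  refine ⟨fun q => H (unitInterval.symm q.1, q.2), hH.comp (by fun_prop) ?_, fun x => by simp [h1],
    fun x => by simp [h0]⟩
  refine tendsto_of_preimage fun C hC => ⟨univ ×ˢ (Prod.snd '' C),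
    isCompact_univ.prod (hC.image continuous_snd), fun y hy => ⟨trivial, _, hy, rfl⟩⟩

theorem Htp.good_right {b : S} {f g : X → S} (h : Htp b f g) : Good b g := h.symm.good_left

/-- Homotopies may be parametrised by the real line, constant outside `[0,1]`. -/
theorem Htp.exists_real {b : S} {f g : X → S} (h : Htp b f g) :
    ∃ H : I × X → S, Good b H ∧ Continuous (fun q : ℝ × X => H (projIcc 0 1 zero_le_one q.1, q.2)) ∧
      (∀ s ≤ 0, ∀ x, H (projIcc 0 1 zero_le_one s, x) = f x) ∧
      ∀ s ≥ 1, ∀ x, H (projIcc 0 1 zero_le_one s, x) = g x := by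
  obtain ⟨H, hH, h0, h1⟩ := h
  refine ⟨H, hH, hH.1.comp ((continuous_projIcc.comp continuous_fst).prodMk continuous_snd), ?_, ?_⟩
  · intro s hs x
    rw [projIcc_of_le_left _ hs]; exact h0 x
  · intro s hs x
    rw [projIcc_of_right_le _ hs]; exact h1 x

/-- Build a homotopy from a map defined for all real parameters. -/
theorem Htp.mk' {b : S} {f g : X → S} (H : ℝ → X → S) (hc : Good b fun q : I × X => H q.1 q.2)
    (h0 : ∀ x, H 0 x = f x) (h1 : ∀ x, H 1 x = g x) : Htp b f g :=
  ⟨fun q => H q.1 q.2, hc, fun x => by simpa using h0 x, fun x => by simpa using h1 x⟩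

theorem good_union {b : S} {C D : Set X} (hC : IsClosed C) (hD : IsClosed D) (hCD : C ∪ D = univ)
    {f : X → S} (h1 : Good b fun x : C => f x) (h2 : Good b fun x : D => f x) : Good b f := by
  constructor
  · rw [← continuousOn_univ, ← hCD]
    exact (continuousOn_iff_continuous_domRestrict.2 h1.1).union_of_isClosed
      (continuousOn_iff_continuous_domRestrict.2 h2.1) hC hD
  · intro s hs
    obtain ⟨K, hK, hKs⟩ := mem_cocompact.1 (h1.2 hs)
    obtain ⟨L, hL, hLs⟩ := mem_cocompact.1 (h2.2 hs)
    refine mem_cocompact.2 ⟨(↑) '' K ∪ (↑) '' L, (hK.image continuous_subtype_val).union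
      (hL.image continuous_subtype_val), fun x hx => ?_⟩
    rw [mem_compl_iff, mem_union, not_or] at hx
    rcases (hCD ▸ mem_univ x : x ∈ C ∪ D) with h | h
    · exact hKs (a := ⟨x, h⟩) fun hk => hx.1 ⟨_, hk, rfl⟩
    · exact hLs (a := ⟨x, h⟩) fun hk => hx.2 ⟨_, hk, rfl⟩

theorem Htp.trans {b : S} {f g k : X → S} (h : Htp b f g) (h' : Htp b g k) : Htp b f k := by
  obtain ⟨H, hH, hHc, h0, h1⟩ := h.exists_real
  obtain ⟨H', hH', hHc', h0', h1'⟩ := h'.exists_real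
  let F : ℝ → X → S := fun e x => if e ≤ 1 / 2 then H (projIcc 0 1 zero_le_one (2 * e), x) else
    H' (projIcc 0 1 zero_le_one (2 * e - 1), x)
  refine Htp.mk' F ⟨?_, ?_⟩ (fun x => ?_) (fun x => ?_)
  · refine Continuous.if_le (hHc.comp (f := fun q : I × X => ((2 * q.1 : ℝ), q.2)) (by fun_prop))
      (hHc'.comp (f := fun q : I × X => ((2 * q.1 - 1 : ℝ), q.2)) (by fun_prop)) (by fun_prop)
      (by fun_prop) ?_
    intro q hq
    have := h1 (2 * q.1) (by rw [hq]; norm_num) q.2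
    have h2 := h0' (2 * q.1 - 1) (by rw [hq]; norm_num) q.2
    rw [this, h2]
  · intro s hs
    obtain ⟨K, hK, hKs⟩ := mem_cocompact.1 (hH.2 hs)
    obtain ⟨L, hL, hLs⟩ := mem_cocompact.1 (hH'.2 hs)
    refine mem_cocompact.2 ⟨univ ×ˢ (Prod.snd '' K ∪ Prod.snd '' L), isCompact_univ.prod
      ((hK.image continuous_snd).union (hL.image continuous_snd)), fun q hq => ?_⟩
    have h1 : q.2 ∉ Prod.snd '' K := fun h => hq ⟨trivial, Or.inl h⟩
    have h2 : q.2 ∉ Prod.snd '' L := fun h => hq ⟨trivial, Or.inr h⟩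
    simp only [mem_preimage, F]
    split_ifs
    · exact hKs fun h => h1 ⟨_, h, rfl⟩
    · exact hLs fun h => h2 ⟨_, h, rfl⟩
  · simp only [F]; rw [if_pos (by norm_num)]; exact h0 _ (by norm_num) x
  · simp only [F]; rw [if_neg (by norm_num)]; exact h1' _ (by norm_num) x

theorem Htp.null {b : S} {f g : X → S} (h : Htp b f g) (hg : Null b g) : Null b f := h.trans hg

theorem Null.of_htp {b : S} {f g : X → S} (hf : Null b f) (h : Htp b f g) : Null b g := h.symm.trans hf

theorem Null.comp {b : S} {f : X → S} (h : Null b f) {p : Y → X} (hp : Continuous p)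
    (hp' : Tendsto p (cocompact Y) (cocompact X)) : Null b (fun y => f (p y)) := Htp.comp h hp hp'

theorem Null.post {b : S} {f : X → S} (h : Null b f) {F : S → T} {c : T} (hF : Continuous F)
    (hb : F b = c) : Null c (fun x => F (f x)) := by
  have := Htp.post h hF hb
  rwa [hb] at this

theorem tendsto_homeo (e : Y ≃ₜ X) : Tendsto e (cocompact Y) (cocompact X) :=
  e.isClosedEmbedding.tendsto_cocompact

theorem Null.homeo {b : S} {f : X → S} (h : Null b f) (e : Y ≃ₜ X) : Null b (fun y => f (e y)) :=
  h.comp e.continuous (tendsto_homeo e)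

/-- `Good` descends along proper surjections. -/
theorem Good.of_surj {b : S} {f : X → S} {p : Y → X} (hp : IsProperMap p)
    (hs : Function.Surjective p) (h : Good b fun y => f (p y)) : Good b f := by
  refine ⟨((hp.isClosedMap.isQuotientMap hp.continuous hs).continuous_iff).2 h.1, fun s hsb => ?_⟩
  obtain ⟨K, hK, hKs⟩ := mem_cocompact.1 (h.2 hsb)
  refine mem_cocompact.2 ⟨p '' K, hK.image hp.continuous, fun x hx => ?_⟩
  obtain ⟨y, rfl⟩ := hs x
  exact hKs fun hy => hx ⟨y, hy, rfl⟩

end Good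

section OnePt
variable {X Y Z S T : Type*} [TopologicalSpace X] [TopologicalSpace Y] [TopologicalSpace Z]
  [TopologicalSpace S] [TopologicalSpace T] [T2Space X]

theorem tendsto_infty {α : Type*} {l : Filter α} {f : α → OP X} :
    Tendsto f l (𝓝 ∞) ↔ ∀ C : Set X, IsCompact C → ∀ᶠ a in l, ∀ x ∈ C, f a ≠ ↑x := by
  rw [(hasBasis_nhds_infty (X := X)).tendsto_right_iff]
  constructor
  · intro h C hC
    filter_upwards [h C ⟨hC.isClosed, hC⟩] with a ha x hx e
    rw [e] at ha
    simp at ha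
    exact ha hx
  · rintro h C ⟨-, hC⟩
    filter_upwards [h C hC] with a ha
    induction hfa : f a using OnePoint.rec with
    | infty => simp
    | coe x => simp only [mem_union, mem_image, mem_compl_iff, coe_eq_coe, exists_eq_right]
               exact Or.inl fun hx => ha x hx hfa

theorem Good.ext [LocallyCompactSpace X] {b : S} {f : X → S} (hf : Good b f) :
    Continuous fun x : OP X => x.elim b f := by
  rw [OnePoint.continuous_iff]
  refine ⟨?_, hf.1⟩
  rw [Filter.coclosedCompact_eq_cocompact]; exact hf.2

/-- The pairing `K × X⁺ → (K × X)⁺`. -/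
def pr {K : Type*} (k : K) (x : OP X) : OP (K × X) := x.map fun x => (k, x)

@[simp] theorem pr_infty {K : Type*} (k : K) : pr k (∞ : OP X) = ∞ := rfl
@[simp] theorem pr_coe {K : Type*} (k : K) (x : X) : pr k (x : OP X) = ((k, x) : K × X) := rfl

theorem continuous_pr {K : Type*} [TopologicalSpace K] [T2Space K] :
    Continuous fun q : K × OP X => pr q.1 q.2 := by
  rw [continuous_iff_continuousAt]
  rintro ⟨k, x⟩
  induction x using OnePoint.rec with
  | infty =>
    rw [ContinuousAt, pr_infty, tendsto_infty]
    intro C hC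
    have h := (tendsto_infty (f := (id : OP X → OP X))).1 tendsto_id _ (hC.image continuous_snd)
    filter_upwards [(continuous_snd (X := K) (Y := OP X)).continuousAt.eventually h] with q hq x hx he
    rcases q with ⟨k', y⟩
    induction y using OnePoint.rec with
    | infty => simp at he
    | coe y =>
      simp only [pr_coe, coe_eq_coe] at he
      exact hq y ⟨x, hx, by rw [← he]⟩ rfl
  | coe x =>
    have h : IsOpenEmbedding (Prod.map id (↑) : K × X → K × OP X) :=
      IsOpenEmbedding.id.prodMap isOpenEmbedding_coe
    have := h.continuousAt_iff (g := fun q : K × OP X => pr q.1 q.2) (x := (k, x))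
    refine this.1 ?_
    exact (continuous_coe.comp (continuous_id (X := K × X))).continuousAt

theorem good_pr {K : Type*} [TopologicalSpace K] [T2Space K] [CompactSpace K] {F : Z → OP X}
    (hF : Good ∞ F) : Good ∞ fun q : K × Z => pr q.1 (F q.2) := by
  refine ⟨continuous_pr.comp (f := fun q : K × Z => (q.1, F q.2))
    (continuous_fst.prodMk (hF.1.comp continuous_snd)), ?_⟩
  rw [tendsto_infty]
  intro C hC
  have h := (tendsto_infty.1 hF.2) _ (hC.image continuous_snd)
  filter_upwards [(tendsto_snd_cocompact K).eventually h] with q hq x hx he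
  induction hy : F q.2 using OnePoint.rec with
  | infty => rw [hy] at he; simp at he
  | coe y =>
    rw [hy] at he
    simp only [pr_coe, coe_eq_coe] at he
    exact hq y ⟨x, hx, by rw [← he]⟩ hy

variable [LocallyCompactSpace X]

theorem Good.bind {b : S} {f : X → S} (hf : Good b f) {F : Z → OP X} (hF : Good ∞ F) :
    Good b fun z => (F z).elim b f :=
  hF.post (F := fun x : OP X => x.elim b f) hf.ext rfl

theorem Htp.bind {b : S} {f g : X → S} (h : Htp b f g) {F : Z → OP X} (hF : Good ∞ F) :
    Htp b (fun z => (F z).elim b f) (fun z => (F z).elim b g) := by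
  obtain ⟨H, hH, h0, h1⟩ := h
  refine ⟨fun q => (pr q.1 (F q.2)).elim b H, hH.bind (good_pr hF), fun x => ?_, fun x => ?_⟩
  · change (pr (0 : I) (F x)).elim b H = (F x).elim b f
    generalize F x = y
    induction y using OnePoint.rec <;> simp [h0]
  · change (pr (1 : I) (F x)).elim b H = (F x).elim b g
    generalize F x = y
    induction y using OnePoint.rec <;> simp [h1]

theorem Null.bind_left {b : S} {f : X → S} (hf : Good b f) {F : Z → OP X} (h : Null ∞ F) :
    Null b (fun z => (F z).elim b f) :=
  h.post (F := fun x : OP X => x.elim b f) hf.ext rfl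

theorem Good.isCompact_preimage {f : Z → OP X} (hf : Good ∞ f) {C : Set X} (hC : IsCompact C) :
    IsCompact {z | ∃ x ∈ C, f z = ↑x} := by
  have h1 : IsClosed {z | ∃ x ∈ C, f z = ↑x} := by
    have : {z | ∃ x ∈ C, f z = ↑x} = f ⁻¹' ((↑) '' C) := by
      ext z; simp [eq_comm]
    rw [this]
    exact (isClosed_image_coe.2 ⟨hC.isClosed, hC⟩).preimage hf.1
  obtain ⟨D, hD, h⟩ := mem_cocompact.1 (tendsto_infty.1 hf.2 C hC)
  refine hD.of_isClosed_subset h1 fun z hz => ?_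
  obtain ⟨x, hx, he⟩ := hz
  by_contra hn
  exact h hn x hx he

end OnePt

section Norm
variable {X Y Z : Type*} [TopologicalSpace X] [TopologicalSpace Y] [TopologicalSpace Z]
  {E F : Type*} [NormedAddCommGroup E] [ProperSpace E] [NormedAddCommGroup F] [ProperSpace F]

theorem tendsto_infty_norm {α : Type*} {l : Filter α} {f : α → OP E} :
    Tendsto f l (𝓝 ∞) ↔ ∀ R : ℝ, ∀ᶠ a in l, ∀ x : E, f a = ↑x → R < ‖x‖ := by
  rw [tendsto_infty]
  constructor
  · intro h R
    filter_upwards [h _ (isCompact_closedBall (0 : E) R)] with a ha x hx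
    by_contra hn
    exact ha x (by simpa using hn) hx
  · intro h C hC
    obtain ⟨R, hR⟩ := hC.isBounded.exists_norm_le
    filter_upwards [h R] with a ha x hx he
    exact absurd (hR x hx) (not_le.2 (ha x he))

theorem good_iff {f : X → OP E} : Good ∞ f ↔ Continuous f ∧
    ∀ R : ℝ, ∃ C : Set X, IsCompact C ∧ ∀ x, ∀ v : E, f x = ↑v → ‖v‖ ≤ R → x ∈ C := by
  refine and_congr_right fun hc => ?_
  rw [tendsto_infty_norm]
  refine forall_congr' fun R => ?_
  constructor
  · intro h
    obtain ⟨C, hC, hh⟩ := mem_cocompact.1 h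
    refine ⟨C, hC, fun x v hx hv => ?_⟩
    by_contra hn
    exact absurd hv (not_le.2 (hh hn v hx))
  · rintro ⟨C, hC, h⟩
    refine mem_cocompact.2 ⟨C, hC, fun x hx v hv => ?_⟩
    by_contra hn
    exact hx (h x v hv (not_lt.1 hn))

theorem Good.isCompact_le {f : X → OP E} (hf : Good ∞ f) (R : ℝ) :
    IsCompact {z | ∃ x : E, ‖x‖ ≤ R ∧ f z = ↑x} := by
  have := hf.isCompact_preimage (isCompact_closedBall (0 : E) R)
  simpa using this

open Classical in
/-- The partial map `φ` with domain `O`. -/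
def pm (O : Set X) (φ : X → E) (x : X) : OP E := if x ∈ O then ↑(φ x) else ∞

theorem pm_of_mem {O : Set X} {φ : X → E} {x : X} (h : x ∈ O) : pm O φ x = ↑(φ x) := if_pos h
theorem pm_of_notMem {O : Set X} {φ : X → E} {x : X} (h : x ∉ O) : pm O φ x = ∞ := if_neg h

theorem pm_eq_coe {O : Set X} {φ : X → E} {x : X} {v : E} : pm O φ x = ↑v ↔ x ∈ O ∧ φ x = v := by
  by_cases h : x ∈ O
  · simp [pm_of_mem h, h]
  · simp [pm_of_notMem h, h]

theorem continuous_pm {O : Set X} {φ : X → E} (hO : IsOpen O) (hφ : ContinuousOn φ O)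
    (h : ∀ R : ℝ, ∃ C : Set X, IsClosed C ∧ C ⊆ O ∧ ∀ x ∈ O, ‖φ x‖ ≤ R → x ∈ C) :
    Continuous (pm O φ) := by
  rw [continuous_iff_continuousAt]
  intro x
  by_cases hx : x ∈ O
  · have h1 : ContinuousAt (fun x => (φ x : OP E)) x :=
      continuous_coe.continuousAt.comp (hφ.continuousAt (hO.mem_nhds hx))
    refine h1.congr ?_
    filter_upwards [hO.mem_nhds hx] with y hy
    exact (pm_of_mem hy).symm
  · rw [ContinuousAt, pm_of_notMem hx, tendsto_infty_norm]
    intro R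
    obtain ⟨C, hC, hCO, hR⟩ := h R
    filter_upwards [hC.isOpen_compl.mem_nhds fun hc => hx (hCO hc)] with y hy v hv
    obtain ⟨hy', rfl⟩ := pm_eq_coe.1 hv
    by_contra hn
    exact hy (hR y hy' (not_lt.1 hn))

theorem good_pm [T2Space X] {O : Set X} {φ : X → E} (hO : IsOpen O) (hφ : ContinuousOn φ O)
    (h : ∀ R : ℝ, ∃ C : Set X, IsCompact C ∧ C ⊆ O ∧ ∀ x ∈ O, ‖φ x‖ ≤ R → x ∈ C) :
    Good ∞ (pm O φ) := by
  refine good_iff.2 ⟨continuous_pm hO hφ fun R => ?_, fun R => ?_⟩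
  · obtain ⟨C, hC, h1, h2⟩ := h R
    exact ⟨C, hC.isClosed, h1, h2⟩
  · obtain ⟨C, hC, h1, h2⟩ := h R
    refine ⟨C, hC, fun x v hv hR => ?_⟩
    obtain ⟨hx, rfl⟩ := pm_eq_coe.1 hv
    exact h2 x hx hR

/-- Totally defined proper maps. -/
theorem good_coe [T2Space X] {φ : X → E} (hφ : Continuous φ)
    (h : ∀ R : ℝ, ∃ C : Set X, IsCompact C ∧ ∀ x, ‖φ x‖ ≤ R → x ∈ C) :
    Good ∞ (fun x => (φ x : OP E)) := by
  refine good_iff.2 ⟨continuous_coe.comp hφ, fun R => ?_⟩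
  obtain ⟨C, hC, h⟩ := h R
  exact ⟨C, hC, fun x v hv hR => h x (by rw [coe_eq_coe.1 hv]; exact hR)⟩

/-- The smash product `E⁺ × F⁺ → (E × F)⁺`. -/
def sm {E F : Type*} (x : OP E) (y : OP F) : OP (E × F) := x.elim ∞ fun v => pr v y

@[simp] theorem sm_infty_left (y : OP F) : sm (∞ : OP E) y = ∞ := rfl
@[simp] theorem sm_infty_right (x : OP E) : sm x (∞ : OP F) = ∞ := by
  induction x using OnePoint.rec <;> rfl
@[simp] theorem sm_coe (x : E) (y : F) : sm (x : OP E) (y : OP F) = ((x, y) : E × F) := rfl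

theorem sm_eq_coe {x : OP E} {y : OP F} {v : E × F} :
    sm x y = ↑v ↔ x = ↑v.1 ∧ y = ↑v.2 := by
  induction x using OnePoint.rec with
  | infty => simp
  | coe x => induction y using OnePoint.rec with
    | infty => simp
    | coe y => simp [Prod.ext_iff]

theorem continuous_sm : Continuous fun q : OP E × OP F => sm q.1 q.2 := by
  rw [continuous_iff_continuousAt]
  have key : ∀ q : OP E × OP F, q.1 = ∞ ∨ q.2 = ∞ → ContinuousAt (fun q : OP E × OP F => sm q.1 q.2) q := by
    rintro ⟨x, y⟩ h
    have h0 : sm x y = ∞ := by rcases h with h | h <;> simp only at h <;> subst h <;> simp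
    rw [ContinuousAt, h0, tendsto_infty_norm]
    intro R
    rcases h with h | h
    · simp only at h; subst h
      have := tendsto_infty_norm.1 ((continuous_fst (X := OP E) (Y := OP F)).tendsto (∞, y)) R
      filter_upwards [this] with q hq v hv
      exact (hq _ (sm_eq_coe.1 hv).1).trans_le (norm_fst_le v)
    · simp only at h; subst h
      have := tendsto_infty_norm.1 ((continuous_snd (X := OP E) (Y := OP F)).tendsto (x, ∞)) R
      filter_upwards [this] with q hq v hv
      exact (hq _ (sm_eq_coe.1 hv).2).trans_le (norm_snd_le v)
  rintro ⟨x, y⟩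
  induction x using OnePoint.rec with
  | infty => exact key _ (Or.inl rfl)
  | coe x => induction y using OnePoint.rec with
    | infty => exact key _ (Or.inr rfl)
    | coe y =>
      have h : IsOpenEmbedding (Prod.map (↑) (↑) : E × F → OP E × OP F) :=
        isOpenEmbedding_coe.prodMap isOpenEmbedding_coe
      refine (h.continuousAt_iff (g := fun q : OP E × OP F => sm q.1 q.2) (x := (x, y))).1 ?_
      exact continuous_coe.continuousAt

theorem Continuous.sm {f : X → OP E} {g : X → OP F} (hf : Continuous f) (hg : Continuous g) :
    Continuous fun x => sm (f x) (g x) := continuous_sm.comp (hf.prodMk hg)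

theorem good_sm {f : X → OP E} {g : Y → OP F} (hf : Good ∞ f) (hg : Good ∞ g) :
    Good ∞ fun q : X × Y => sm (f q.1) (g q.2) := by
  refine good_iff.2 ⟨Continuous.sm (hf.1.comp continuous_fst) (hg.1.comp continuous_snd), fun R => ?_⟩
  obtain ⟨C, hC, h⟩ := (good_iff.1 hf).2 R
  obtain ⟨D, hD, h'⟩ := (good_iff.1 hg).2 R
  refine ⟨C ×ˢ D, hC.prod hD, fun x v hv hR => ?_⟩
  obtain ⟨h1, h2⟩ := sm_eq_coe.1 hv
  exact ⟨h _ _ h1 ((norm_fst_le v).trans hR), h' _ _ h2 ((norm_snd_le v).trans hR)⟩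

theorem good_id : Good ∞ (fun x : E => (x : OP E)) :=
  good_coe continuous_id fun R => ⟨_, isCompact_closedBall 0 R, fun x hx => by simpa using hx⟩

/-- Suspension. -/
def Sus (f : X → OP E) (q : X × ℝ) : OP (E × ℝ) := sm (f q.1) (q.2 : OP ℝ)

theorem good_Sus {f : X → OP E} (hf : Good ∞ f) : Good ∞ (Sus f) := good_sm hf good_id

theorem Htp.sus {f g : X → OP E} (h : Htp ∞ f g) : Htp ∞ (Sus f) (Sus g) := by
  obtain ⟨H, hH, h0, h1⟩ := h
  refine ⟨fun q => Sus H ((q.1, q.2.1), q.2.2), (good_Sus hH).comp (by fun_prop)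
    (tendsto_homeo (Homeomorph.prodAssoc I X ℝ).symm), fun x => ?_, fun x => ?_⟩
  · simp [Sus, h0]
  · simp [Sus, h1]

theorem Null.sus {f : X → OP E} (h : Null ∞ f) : Null ∞ (Sus f) := by
  have h' := Htp.sus h
  have : (Sus fun _ : X => (∞ : OP E)) = fun _ => ∞ := funext fun _ => rfl
  rwa [this] at h'

end Norm
end SD

namespace SD
open Filter Topology OnePoint
section Omap
variable {K X Y Z : Type*} [TopologicalSpace K] [TopologicalSpace X] [TopologicalSpace Y]
  [TopologicalSpace Z]
  {E F : Type*} [NormedAddCommGroup E] [ProperSpace E] [NormedAddCommGroup F] [ProperSpace F]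

theorem map_eq_coe {A B : Type*} {q : OP A} {g : A → B} {w : B} :
    q.map g = ↑w ↔ ∃ v : A, q = ↑v ∧ g v = w := by
  induction q using OnePoint.rec with
  | infty => simp
  | coe x => simp

theorem continuousAt_coe_right {f : K × OP E → Z} {k : K} {v : E}
    (h : ContinuousAt (fun p : K × E => f (p.1, ↑p.2)) (k, v)) : ContinuousAt f (k, (v : OP E)) := by
  have h1 : IsOpenEmbedding (Prod.map id (↑) : K × E → K × OP E) :=
    IsOpenEmbedding.id.prodMap isOpenEmbedding_coe
  exact (h1.continuousAt_iff (g := f) (x := (k, v))).1 h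

theorem continuous_omap {φ : K → E → F} (hF : Continuous fun p : K × E => φ p.1 p.2)
    (h : ∀ k R, ∃ R', ∀ᶠ k' in 𝓝 k, ∀ v, ‖φ k' v‖ ≤ R → ‖v‖ ≤ R') :
    Continuous fun p : K × OP E => p.2.map (φ p.1) := by
  rw [continuous_iff_continuousAt]
  rintro ⟨k, q⟩
  induction q using OnePoint.rec with
  | infty =>
    rw [ContinuousAt, OnePoint.map_infty, tendsto_infty_norm]
    intro R
    obtain ⟨R', hR⟩ := h k R
    have h1 := tendsto_infty_norm.1 ((continuous_snd (X := K) (Y := OP E)).tendsto (k, ∞)) R'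
    filter_upwards [h1, (continuous_fst (X := K) (Y := OP E)).continuousAt.eventually hR] with p hp hp' w hw
    obtain ⟨v, hv, rfl⟩ := map_eq_coe.1 hw
    by_contra hn
    exact absurd (hp' v (not_lt.1 hn)) (not_le.2 (hp v hv))
  | coe v =>
    apply continuousAt_coe_right
    exact (continuous_coe.comp hF).continuousAt

theorem good_omap {φ : K → E → F} (hF : Continuous fun p : K × E => φ p.1 p.2)
    (h : ∀ k R, ∃ R', ∀ᶠ k' in 𝓝 k, ∀ v, ‖φ k' v‖ ≤ R → ‖v‖ ≤ R') [CompactSpace K] {f : X → OP E}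
    (hf : Good ∞ f) : Good ∞ fun p : K × X => (f p.2).map (φ p.1) := by
  refine good_iff.2 ⟨(continuous_omap hF h).comp (f := fun p : K × X => (p.1, f p.2))
    (continuous_fst.prodMk (hf.1.comp continuous_snd)), fun R => ?_⟩
  have h1 : ∃ R', ∀ k v, ‖φ k v‖ ≤ R → ‖v‖ ≤ R' := by
    choose R' hR' using fun k => h k R
    obtain ⟨t, ht⟩ := isCompact_univ.elim_nhds_subcover' (fun k _ => {k' | ∀ v, ‖φ k' v‖ ≤ R → ‖v‖ ≤ R' k})
      (fun k _ => hR' k)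
    obtain ⟨M, hM⟩ := (t.image (fun k => R' k.1)).finite_toSet.bddAbove
    refine ⟨M, fun k v hv => ?_⟩
    obtain ⟨k', hk'⟩ := mem_iUnion.1 (ht (mem_univ k))
    obtain ⟨hk1, hk2⟩ := mem_iUnion.1 hk'
    exact (hk2 v hv).trans (hM (Finset.mem_coe.2 (Finset.mem_image_of_mem _ hk1)))
  obtain ⟨R', hR'⟩ := h1
  obtain ⟨C, hC, hCf⟩ := (good_iff.1 hf).2 R'
  refine ⟨univ ×ˢ C, isCompact_univ.prod hC, fun x w hw hwR => ⟨trivial, ?_⟩⟩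
  obtain ⟨v, hv, rfl⟩ := map_eq_coe.1 hw
  exact hCf _ v hv (hR' _ v hwR)

/-- Homotopy by a uniformly proper family of self-maps of the target. -/
theorem htp_omap {φ : I → E → F} (hF : Continuous fun p : I × E => φ p.1 p.2)
    (h : ∀ R, ∃ R', ∀ k, ∀ v, ‖φ k v‖ ≤ R → ‖v‖ ≤ R') {f : X → OP E} (hf : Good ∞ f) :
    Htp ∞ (fun x => (f x).map (φ 0)) (fun x => (f x).map (φ 1)) :=
  ⟨_, good_omap hF (fun k R => (h R).imp fun R' h' => Eventually.of_forall h') hf, fun _ => rfl,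
    fun _ => rfl⟩

/-- Translation. -/
def padd (q : OP E) (w : E) : OP E := q.map (· + w)

@[simp] theorem padd_infty (w : E) : padd (∞ : OP E) w = ∞ := rfl
@[simp] theorem padd_coe (v w : E) : padd (v : OP E) w = ↑(v + w) := rfl
theorem padd_eq_coe {q : OP E} {v w : E} : padd q w = ↑v ↔ q = ↑(v - w) := by
  induction q using OnePoint.rec with
  | infty => simp
  | coe x => simp [eq_sub_iff_add_eq]

theorem continuous_padd : Continuous fun q : OP E × E => padd q.1 q.2 := by
  have := continuous_omap (K := E) (φ := fun w v : E => v + w) (by fun_prop) (fun w R => by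
    refine ⟨R + (‖w‖ + 1), ?_⟩
    filter_upwards [(continuous_norm.tendsto w).eventually (gt_mem_nhds (lt_add_one ‖w‖))] with w' hw' v hv
    have := norm_sub_le (v + w') w'
    rw [add_sub_cancel_right] at this
    linarith)
  exact this.comp continuous_swap

theorem _root_.Continuous.padd {f : X → OP E} {g : X → E} (hf : Continuous f) (hg : Continuous g) :
    Continuous fun x => padd (f x) (g x) := continuous_padd.comp (hf.prodMk hg)

theorem good_padd {f : X → OP E} (hf : Good ∞ f) {D : X → E} (hD : Continuous D) {δ : ℝ}
    (hδ : ∀ x, ‖D x‖ ≤ δ) : Good ∞ fun x => padd (f x) (D x) := by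
  refine good_iff.2 ⟨hf.1.padd hD, fun R => ?_⟩
  obtain ⟨C, hC, h⟩ := (good_iff.1 hf).2 (R + δ)
  refine ⟨C, hC, fun x v hv hR => h x _ (padd_eq_coe.1 hv) ?_⟩
  exact (norm_sub_le _ _).trans (add_le_add hR (hδ x))

end Omap

section Dv
variable {K X Y Z : Type*} [TopologicalSpace K] [TopologicalSpace X] [TopologicalSpace Y]
  [TopologicalSpace Z]
  {E F : Type*} [NormedAddCommGroup E] [NormedSpace ℝ E] [ProperSpace E]

open Classical in
/-- Division by a nonnegative scalar. -/
def dv (q : OP E) (p : ℝ) : OP E := if 0 < p then q.map (p⁻¹ • ·) else ∞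

theorem dv_eq_coe {q : OP E} {p : ℝ} {v : E} : dv q p = ↑v ↔ 0 < p ∧ q = ↑(p • v) := by
  unfold dv
  split_ifs with h
  · simp only [h, true_and, map_eq_coe]
    constructor
    · rintro ⟨w, hw, rfl⟩; rw [hw, smul_inv_smul₀ h.ne']
    · intro hw; exact ⟨p • v, hw, inv_smul_smul₀ h.ne' _⟩
  · simp [h]

@[simp] theorem dv_one (q : OP E) : dv q 1 = q := by
  induction q using OnePoint.rec <;> simp [dv]
@[simp] theorem dv_infty (p : ℝ) : dv (∞ : OP E) p = ∞ := by simp [dv]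
theorem dv_nonpos (q : OP E) {p : ℝ} (hp : p ≤ 0) : dv q p = ∞ := by simp [dv, hp]
theorem dv_coe (v : E) {p : ℝ} (hp : 0 < p) : dv (v : OP E) p = ↑(p⁻¹ • v) := by simp [dv, hp]

theorem continuousAt_dv {q : OP E} {p : ℝ} (h : q ≠ ↑(0 : E) ∨ p ≠ 0) :
    ContinuousAt (fun x : OP E × ℝ => dv x.1 x.2) (q, p) := by
  rcases lt_trichotomy p 0 with hp | hp | hp
  · refine (continuousAt_const (y := (∞ : OP E))).congr ?_
    filter_upwards [(continuous_snd (X := OP E) (Y := ℝ)).continuousAt.eventually (gt_mem_nhds hp)] with x hx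
    exact (dv_nonpos _ (le_of_lt hx)).symm
  · subst hp
    have hq : q ≠ ↑(0 : E) := by simpa using h
    rw [ContinuousAt, dv_nonpos _ le_rfl, tendsto_infty_norm]
    intro R
    -- a neighbourhood where `‖w‖ > r`
    have h1 : ∃ r > 0, ∀ᶠ x in 𝓝 q, ∀ w : E, x = ↑w → r < ‖w‖ := by
      rcases eq_or_ne q ∞ with rfl | hne
      · exact ⟨1, one_pos, tendsto_infty_norm.1 tendsto_id 1⟩
      · obtain ⟨v, rfl⟩ := ne_infty_iff_exists.1 hne
        have hv : 0 < ‖v‖ := norm_pos_iff.2 fun h => hq (by rw [h])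
        refine ⟨‖v‖ / 2, by positivity, ?_⟩
        have : {x : OP E | ∃ w : E, ‖v‖ / 2 < ‖w‖ ∧ (w : OP E) = x} ∈ 𝓝 (v : OP E) := by
          refine (isOpenEmbedding_coe.isOpenMap _ (isOpen_lt continuous_const continuous_norm)).mem_nhds
            (s := (fun w : E => (w : OP E)) '' {w : E | ‖v‖ / 2 < ‖w‖}) ⟨v, ?_, rfl⟩
          show ‖v‖ / 2 < ‖v‖
          linarith
        filter_upwards [this] with x hx w hw
        obtain ⟨w', hw', rfl⟩ := hx
        rwa [← coe_eq_coe.1 hw]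
    obtain ⟨r, hr, hr'⟩ := h1
    have h2 : ∀ᶠ p : ℝ in 𝓝 0, p * (|R| + 1) < r := by
      have : Tendsto (fun p : ℝ => p * (|R| + 1)) (𝓝 0) (𝓝 (0 * (|R| + 1))) :=
        (continuous_mul_const _).tendsto 0
      rw [zero_mul] at this
      exact this.eventually (gt_mem_nhds hr)
    filter_upwards [(continuous_fst (X := OP E) (Y := ℝ)).continuousAt.eventually hr',
      (continuous_snd (X := OP E) (Y := ℝ)).continuousAt.eventually h2] with x hx hx' v hv
    obtain ⟨hp, hv'⟩ := dv_eq_coe.1 hv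
    have h3 := hx _ hv'
    rw [norm_smul, Real.norm_of_nonneg hp.le] at h3
    have h4 := h3.trans' hx'
    have h5 := lt_of_mul_lt_mul_left h4 hp.le
    linarith [le_abs_self R]
  · have hc : ContinuousAt (fun y : {p : ℝ // 0 < p} × OP E => y.2.map (fun v => y.1.1⁻¹ • v)) (⟨p, hp⟩, q) := by
      refine Continuous.continuousAt ?_
      refine continuous_omap (K := {p : ℝ // 0 < p}) (φ := fun p v => p.1⁻¹ • v) ?_ ?_
      · refine Continuous.smul (Continuous.inv₀ (by fun_prop) fun x => x.1.2.ne') continuous_snd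
      · intro k R
        refine ⟨(k.1 + 1) * |R|, ?_⟩
        filter_upwards [(continuous_subtype_val.tendsto k).eventually (gt_mem_nhds (lt_add_one k.1))] with k' hk' v hv
        rw [norm_smul, norm_inv, Real.norm_of_nonneg k'.2.le, inv_mul_le_iff₀ k'.2] at hv
        calc ‖v‖ ≤ k' * R := hv
          _ ≤ k' * |R| := by gcongr; exact k'.2.le; exact le_abs_self R
          _ ≤ _ := by gcongr
    have he : IsOpenEmbedding (Prod.map Subtype.val id : {p : ℝ // 0 < p} × OP E → ℝ × OP E) :=
      (isOpen_Ioi.isOpenEmbedding_subtypeVal).prodMap IsOpenEmbedding.id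
    have h2 := (he.continuousAt_iff (g := fun y : ℝ × OP E => dv y.2 y.1) (x := (⟨p, hp⟩, q))).1 (by
      refine hc.congr (Eventually.of_forall fun y => ?_)
      simp [dv, y.1.2])
    exact ContinuousAt.comp (x := (q, p)) (f := Prod.swap) (g := fun y : ℝ × OP E => dv y.2 y.1) h2 continuous_swap.continuousAt

theorem continuous_dv_comp {f : X → OP E} {p : X → ℝ} (hf : Continuous f) (hp : Continuous p)
    (h : ∀ x, f x ≠ ↑(0 : E) ∨ p x ≠ 0) : Continuous fun x => dv (f x) (p x) :=
  continuous_iff_continuousAt.2 fun x =>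
    ContinuousAt.comp (f := fun x => (f x, p x)) (continuousAt_dv (h x)) (hf.prodMk hp).continuousAt

/-- Dividing by bounded scalars keeps maps good. -/
theorem good_dv {f : X → OP E} {p : X → ℝ} (hf : Good ∞ f) (hp : Continuous p)
    (h : ∀ x, f x ≠ ↑(0 : E) ∨ p x ≠ 0) {M : ℝ} (hM : ∀ x, p x ≤ M) : Good ∞ fun x => dv (f x) (p x) := by
  refine good_iff.2 ⟨continuous_dv_comp hf.1 hp h, fun R => ?_⟩
  obtain ⟨C, hC, h⟩ := (good_iff.1 hf).2 (M * R)
  refine ⟨C, hC, fun x v hv hR => ?_⟩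
  obtain ⟨h1, h2⟩ := dv_eq_coe.1 hv
  refine h x _ h2 ?_
  rw [norm_smul, Real.norm_of_nonneg h1.le]
  have : 0 ≤ R := (norm_nonneg v).trans hR
  exact mul_le_mul (hM x) hR (norm_nonneg _) (h1.le.trans (hM x))
end Dv
end SD

namespace SD
open Filter Topology OnePoint
section Approx
open Module
variable {X Z P : Type*} [MetricSpace X] [MetricSpace Z]
  [NormedAddCommGroup P] [NormedSpace ℝ P] [FiniteDimensional ℝ P]
  {E : Type*} [NormedAddCommGroup E] [NormedSpace ℝ E] [FiniteDimensional ℝ E]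

theorem lip_approx_real {φ : Z → ℝ} (hφ : UniformContinuous φ) {M : ℝ} (hM : ∀ z, |φ z| ≤ M) {δ : ℝ}
    (hδ : 0 < δ) : ∃ K, ∃ Λ : Z → ℝ, LipschitzWith K Λ ∧ ∀ z, |Λ z - φ z| ≤ δ := by
  obtain ⟨η, hη, hη'⟩ := Metric.uniformContinuous_iff.1 hφ δ hδ
  rcases isEmpty_or_nonempty Z with hZ | ⟨⟨z0⟩⟩
  · exact ⟨0, φ, LipschitzWith.of_dist_le_mul fun x => hZ.elim x, fun x => hZ.elim x⟩
  have hM0 : 0 ≤ M := (abs_nonneg _).trans (hM z0)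
  set n : ℝ := 2 * M / η with hn
  have hn0 : 0 ≤ n := by positivity
  have hbd : ∀ z, BddBelow (range fun w => φ w + n * dist z w) := by
    intro z
    refine ⟨-M, ?_⟩
    rintro _ ⟨w, rfl⟩
    have := (abs_le.1 (hM w)).1
    have : 0 ≤ n * dist z w := by positivity
    show -M ≤ φ w + n * dist z w
    linarith
  haveI : Nonempty Z := ⟨z0⟩
  refine ⟨⟨n, hn0⟩, fun z => ⨅ w, (φ w + n * dist z w), LipschitzWith.of_le_add_mul _ ?_, ?_⟩
  · intro x y
    rw [← sub_le_iff_le_add]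
    refine le_ciInf fun w => ?_
    have h1 := ciInf_le (hbd x) w
    have h2 : n * dist x w ≤ n * (dist x y + dist y w) := by gcongr; exact dist_triangle _ _ _
    show _ - n * dist x y ≤ _
    linarith
  · intro z
    rw [abs_le]
    constructor
    · rw [neg_le_sub_iff_le_add]
      rw [← sub_le_iff_le_add]
      refine le_ciInf fun w => ?_
      rcases lt_or_ge (dist z w) η with h | h
      · have := hη' h
        rw [Real.dist_eq, abs_lt] at this
        have : 0 ≤ n * dist z w := by positivity
        linarith
      · have h1 : n * η ≤ n * dist z w := by gcongr
        have h2 : n * η = 2 * M := by rw [hn]; field_simp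
        have := (abs_le.1 (hM w)).1
        have := (abs_le.1 (hM z)).2
        linarith
    · have h1 := ciInf_le (hbd z) z
      simp only [dist_self, mul_zero, add_zero] at h1
      linarith

theorem lip_approx {φ : Z → E} (hφ : UniformContinuous φ) {M : ℝ} (hM : ∀ z, ‖φ z‖ ≤ M) {δ : ℝ}
    (hδ : 0 < δ) : ∃ K, ∃ Λ : Z → E, LipschitzWith K Λ ∧ ∀ z, ‖Λ z - φ z‖ ≤ δ := by
  let e : E ≃L[ℝ] (Fin (finrank ℝ E) → ℝ) := (finBasis ℝ E).equivFunL
  let s : (Fin (finrank ℝ E) → ℝ) →L[ℝ] E := e.symm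
  let r : E →L[ℝ] (Fin (finrank ℝ E) → ℝ) := e
  have hd : 0 < δ / (‖s‖ + 1) := by positivity
  have h : ∀ i, ∃ K, ∃ Λ : Z → ℝ, LipschitzWith K Λ ∧ ∀ z, |Λ z - r (φ z) i| ≤ δ / (‖s‖ + 1) := by
    intro i
    refine lip_approx_real (M := ‖r‖ * M) ?_ (fun z => ?_) hd
    · exact (((ContinuousLinearMap.proj (R := ℝ) (φ := fun _ : Fin (finrank ℝ E) => ℝ) i).comp r).uniformContinuous).comp hφ
    · rw [← Real.norm_eq_abs]
      calc ‖r (φ z) i‖ ≤ ‖r (φ z)‖ := norm_le_pi_norm _ _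
        _ ≤ ‖r‖ * ‖φ z‖ := r.le_opNorm _
        _ ≤ _ := by gcongr; exact hM z
  choose K Λ hK hΛ using h
  refine ⟨‖s‖₊ * (Finset.univ.sup K), fun z => s fun i => Λ i z, ?_, fun z => ?_⟩
  · refine s.lipschitz.comp (LipschitzWith.of_dist_le_mul fun x y => ?_)
    refine (dist_pi_le_iff (by positivity)).2 fun i => ?_
    exact ((hK i).weaken (Finset.le_sup (Finset.mem_univ i))).dist_le_mul x y
  · have h1 : φ z = s (r (φ z)) := (e.symm_apply_apply _).symm
    rw [h1, ← map_sub]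
    calc _ ≤ ‖s‖ * ‖(fun i => Λ i z) - r (φ z)‖ := s.le_opNorm _
      _ ≤ ‖s‖ * (δ / (‖s‖ + 1)) := by
          gcongr
          refine (pi_norm_le_iff_of_nonneg hd.le).2 fun i => ?_
          exact hΛ i z
      _ ≤ (‖s‖ + 1) * (δ / (‖s‖ + 1)) := by gcongr; linarith
      _ = δ := by field_simp

/-- A good map is Lipschitz on a given bounded part of the target up to a small displacement. -/
theorem Good.approx {F : Z → OP E} (hF : Good ∞ F) {R δ : ℝ} (hR : 0 < R) (hδ : 0 < δ) :
    ∃ D Λ : Z → E, Continuous D ∧ (∀ z, ‖D z‖ ≤ δ) ∧ (∃ K, LipschitzWith K Λ) ∧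
      ∀ z, ∀ v : E, F z = ↑v → ‖v‖ ≤ R → v + D z = Λ z := by
  haveI : ProperSpace E := FiniteDimensional.proper_real E
  let c : E → E := fun v => (max 0 (min 1 (2 - ‖v‖ / R)) : ℝ) • v
  have hc : Good (0 : E) c := by
    refine ⟨by fun_prop, ?_⟩
    refine Tendsto.congr' (f₁ := fun _ => 0) ?_ tendsto_const_nhds
    filter_upwards [(isCompact_closedBall (0 : E) (2 * R)).compl_mem_cocompact] with v hv
    have h1 : 2 * R < ‖v‖ := by simpa using hv
    have h2 : 2 - ‖v‖ / R ≤ 0 := by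
      rw [sub_nonpos, le_div_iff₀ hR]; exact h1.le
    have : (max 0 (min 1 (2 - ‖v‖ / R)) : ℝ) = 0 := max_eq_left ((min_le_right _ _).trans h2)
    simp [c, this]
  have hcF : Good (0 : E) fun z => (F z).elim 0 c := hc.bind hF
  have hu := hcF.1.uniformContinuous_of_tendsto_cocompact hcF.2
  obtain ⟨K, Λ, hK, hΛ⟩ := lip_approx hu (M := 2 * R) (fun z => by
    induction F z using OnePoint.rec with
    | infty => simp; positivity
    | coe v =>
      simp only [OnePoint.elim_some, c, norm_smul]
      rcases le_or_gt (‖v‖) (2 * R) with h | h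
      · have h1 : ‖(max 0 (min 1 (2 - ‖v‖ / R)) : ℝ)‖ ≤ 1 := by
          rw [Real.norm_of_nonneg (le_max_left _ _)]
          exact max_le zero_le_one (min_le_left _ _)
        calc _ ≤ 1 * ‖v‖ := by gcongr
          _ ≤ _ := by rw [one_mul]; exact h
      · have h2 : 2 - ‖v‖ / R ≤ 0 := by
          rw [sub_nonpos, le_div_iff₀ hR]; exact h.le
        have : (max 0 (min 1 (2 - ‖v‖ / R)) : ℝ) = 0 := max_eq_left ((min_le_right _ _).trans h2)
        rw [this]; simp; positivity) hδ
  refine ⟨fun z => Λ z - (F z).elim 0 c, Λ, hK.continuous.sub hcF.1, hΛ, ⟨K, hK⟩, fun z v hv hvR => ?_⟩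
  have h1 : 1 ≤ 2 - ‖v‖ / R := by
    have : ‖v‖ / R ≤ 1 := (div_le_one hR).2 hvR
    linarith
  have : (max 0 (min 1 (2 - ‖v‖ / R)) : ℝ) = 1 := by rw [min_eq_left h1]; simp
  simp [hv, c, this]

/-- `P` covers `X` by a Lipschitz map. -/
def LipCov (P X : Type*) [NormedAddCommGroup P] [NormedSpace ℝ P] [MetricSpace X] : Prop :=
  ∃ c : P → X, (∃ K, LipschitzWith K c) ∧ Function.Surjective c

theorem LipCov.self : LipCov P P := ⟨id, ⟨1, LipschitzWith.id⟩, Function.surjective_id⟩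

theorem LipCov.prod {P' X' : Type*} [NormedAddCommGroup P'] [NormedSpace ℝ P'] [MetricSpace X']
    (h : LipCov P X) (h' : LipCov P' X') : LipCov (P × P') (X × X') := by
  obtain ⟨c, ⟨K, hK⟩, hs⟩ := h
  obtain ⟨c', ⟨K', hK'⟩, hs'⟩ := h'
  exact ⟨Prod.map c c', ⟨_, (hK.comp LipschitzWith.prod_fst).prodMk (hK'.comp LipschitzWith.prod_snd)⟩,
    hs.prodMap hs'⟩

theorem lipCov_I : LipCov ℝ I :=
  ⟨projIcc 0 1 zero_le_one, ⟨1, LipschitzWith.projIcc zero_le_one⟩, projIcc_surjective _⟩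

/-- Lipschitz images of low-dimensional spaces can be avoided. -/
theorem LipCov.exists_notMem (h : LipCov P X) {g : X → E} {K} (hg : LipschitzWith K g)
    (hd : finrank ℝ P < finrank ℝ E) {O : Set E} (hO : IsOpen O) (hne : O.Nonempty) :
    ∃ a ∈ O, ∀ x, g x ≠ a := by
  obtain ⟨c, ⟨L, hL⟩, hs⟩ := h
  have h1 : dimH (range g) ≤ finrank ℝ P := by
    rw [← Real.dimH_univ_eq_finrank, ← hs.range_comp g]
    exact (hg.comp hL).dimH_range_le
  have h2 := dense_compl_of_dimH_lt_finrank (E := E) (s := range g)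
    (h1.trans_lt (by exact_mod_cast hd))
  obtain ⟨a, ha, ha'⟩ := h2.inter_open_nonempty O hO hne
  exact ⟨a, ha, fun x hx => ha' ⟨x, hx⟩⟩
end Approx
end SD

namespace SD
open Filter Topology OnePoint
open Module
theorem tendsto_of_leftInv {X Y : Type*} [TopologicalSpace X] [TopologicalSpace Y] {p : Y → X}
    {r : X → Y} (hr : Continuous r) (h : ∀ y, r (p y) = y) : Tendsto p (cocompact Y) (cocompact X) :=
  tendsto_of_preimage fun C hC => ⟨r '' C, hC.image hr, fun y hy => ⟨_, hy, h y⟩⟩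

theorem Good.postAt {X S T : Type*} [TopologicalSpace X] [TopologicalSpace S] [TopologicalSpace T]
    {b : S} {f : X → S} (hf : Good b f) {F : S → T} {c : T} (hF : ∀ x, ContinuousAt F (f x))
    (hb : ContinuousAt F b) (hbc : F b = c) : Good c fun x => F (f x) :=
  ⟨continuous_iff_continuousAt.2 fun x => ContinuousAt.comp (hF x) hf.1.continuousAt,
    hbc ▸ hb.tendsto.comp hf.2⟩

section Freud
variable {X P : Type*} [MetricSpace X] [ProperSpace X]
  [NormedAddCommGroup P] [NormedSpace ℝ P] [FiniteDimensional ℝ P]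
  {E : Type*} [NormedAddCommGroup E] [NormedSpace ℝ E] [FiniteDimensional ℝ E]

theorem htp_affine {Z : Type*} [TopologicalSpace Z] [ProperSpace E] {f : Z → OP E} (hf : Good ∞ f)
    {c : ℝ} (hc : 0 < c) (w : E) : Htp ∞ f (fun x => (f x).map fun v => c • v + w) := by
  have h := htp_omap (φ := fun e : I => fun v : E => ((1 - e : ℝ) + e * c) • v + (e : ℝ) • w)
    (by fun_prop) (fun R => ⟨(min 1 c)⁻¹ * (R + ‖w‖), fun e v hv => ?_⟩) hf
  · have hid : ∀ q : OP E, q.map (fun v => v) = q := fun q => congrFun OnePoint.map_id q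
    simpa [hid] using h
  · have he0 := e.2.1
    have he1 := e.2.2
    have h1 : min 1 c ≤ (1 - e : ℝ) + e * c := by
      have := min_le_left 1 c
      have := min_le_right 1 c
      nlinarith
    have h0 : 0 < min 1 c := by positivity
    rw [← div_eq_inv_mul, le_div_iff₀ h0]
    have h2 : ‖((1 - e : ℝ) + e * c) • v‖ ≤ R + ‖w‖ := by
      calc _ = ‖(((1 - e : ℝ) + e * c) • v + (e : ℝ) • w) - (e : ℝ) • w‖ := by rw [add_sub_cancel_right]
        _ ≤ _ := norm_sub_le _ _
        _ ≤ R + ‖w‖ := by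
          gcongr
          rw [norm_smul, Real.norm_of_nonneg he0]
          exact mul_le_of_le_one_left (norm_nonneg _) he1
    rw [norm_smul, Real.norm_of_nonneg (h0.le.trans h1)] at h2
    rw [mul_comm]
    exact (mul_le_mul_of_nonneg_right h1 (norm_nonneg _)).trans h2

/-- Projection of the complement of two points. -/
def rho (a b : E × ℝ) (q : OP (E × ℝ)) : OP E :=
  q.elim ∞ fun p => dv ↑(p.1 - a.1 - ((p.2 - a.2) / (b.2 - a.2)) • (b.1 - a.1)) ((a.2 - p.2) * (p.2 - b.2))

theorem continuousAt_rho {a b : E × ℝ} (hab : b.2 < a.2) {q : OP (E × ℝ)} (ha : q ≠ ↑a) (hb : q ≠ ↑b) :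
    ContinuousAt (rho a b) q := by
  haveI : ProperSpace E := FiniteDimensional.proper_real E
  rcases eq_or_ne q ∞ with rfl | hne
  · show Tendsto (rho a b) (𝓝 ∞) (𝓝 ∞)
    rw [tendsto_infty_norm]
    intro R
    let M := |a.2| + |b.2|
    let R' := M + (2 * M) ^ 2 * |R| + ‖a.1‖ + ‖b.1 - a.1‖
    filter_upwards [tendsto_infty_norm.1 (tendsto_id (α := OP (E × ℝ)) (x := 𝓝 ∞)) R'] with q hq w hw
    rcases eq_or_ne q ∞ with rfl | hne
    · simp [rho] at hw
    obtain ⟨p, rfl⟩ := ne_infty_iff_exists.1 hne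
    obtain ⟨h1, h2⟩ := dv_eq_coe.1 (show dv _ _ = _ from hw)
    by_contra hn
    have h3 : b.2 < p.2 ∧ p.2 < a.2 := by
      rcases pos_and_pos_or_neg_and_neg_of_mul_pos h1 with ⟨h, h'⟩ | ⟨h, h'⟩
      · constructor <;> linarith
      · linarith
    have hM : |p.2| ≤ M := abs_le.2 ⟨by have := neg_abs_le b.2; have := abs_nonneg a.2; simp only [M]; linarith,
      by have := le_abs_self a.2; have := abs_nonneg b.2; simp only [M]; linarith⟩
    have h4 := coe_eq_coe.1 h2
    have h5 : p.1 = ((a.2 - p.2) * (p.2 - b.2)) • w + a.1 + ((p.2 - a.2) / (b.2 - a.2)) • (b.1 - a.1) := by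
      rw [← h4]; abel
    have h6 : |(p.2 - a.2) / (b.2 - a.2)| ≤ 1 := by
      rw [abs_div, div_le_one (abs_pos.2 (by linarith)), abs_of_neg (by linarith), abs_of_neg (by linarith)]
      linarith
    have h7 : ‖((a.2 - p.2) * (p.2 - b.2)) • w‖ ≤ (2 * M) ^ 2 * |R| := by
      rw [norm_smul, Real.norm_eq_abs, abs_mul, sq]
      have h71 : |a.2 - p.2| ≤ 2 * M := by
        have := abs_sub a.2 p.2
        have := abs_nonneg b.2
        simp only [M] at *; linarith
      have h72 : |p.2 - b.2| ≤ 2 * M := by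
        have := abs_sub p.2 b.2
        have := abs_nonneg a.2
        simp only [M] at *; linarith
      have : ‖w‖ ≤ |R| := (not_lt.1 hn).trans (le_abs_self R)
      gcongr
    have h8 : ‖p.1‖ ≤ (2 * M) ^ 2 * |R| + ‖a.1‖ + ‖b.1 - a.1‖ := by
      rw [h5]
      refine (norm_add₃_le).trans ?_
      gcongr
      rw [norm_smul]
      exact mul_le_of_le_one_left (norm_nonneg _) h6
    have h9 := hq p rfl
    rw [Prod.norm_def, lt_max_iff] at h9
    have hM0 : 0 ≤ M := by positivity
    rcases h9 with h9 | h9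
    · simp only [R'] at h9; linarith
    · rw [Real.norm_eq_abs] at h9
      have : 0 ≤ (2 * M) ^ 2 * |R| + ‖a.1‖ + ‖b.1 - a.1‖ := by positivity
      simp only [R'] at h9; linarith
  · obtain ⟨p, rfl⟩ := ne_infty_iff_exists.1 hne
    rw [← isOpenEmbedding_coe.continuousAt_iff (g := rho a b)]
    refine ContinuousAt.comp (f := fun p : E × ℝ => (((p.1 - a.1 - ((p.2 - a.2) / (b.2 - a.2)) • (b.1 - a.1) : E) : OP E),
      (a.2 - p.2) * (p.2 - b.2))) (g := fun x : OP E × ℝ => dv x.1 x.2) (x := p) (continuousAt_dv ?_) ?_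
    · by_contra! h
      obtain ⟨h1, h2⟩ := h
      rcases mul_eq_zero.1 h2 with h | h
      · have h3 : p.2 = a.2 := by linarith
        refine ha (congrArg _ (Prod.ext ?_ h3))
        have := coe_eq_coe.1 h1
        simpa [h3, sub_eq_zero] using this
      · have h3 : p.2 = b.2 := by linarith
        refine hb (congrArg _ (Prod.ext ?_ h3))
        have := coe_eq_coe.1 h1
        rw [h3, div_self (by linarith), one_smul] at this
        simpa [sub_eq_zero] using this
    · refine Continuous.continuousAt (Continuous.prodMk (continuous_coe.comp ?_) (by fun_prop))
      have : b.2 - a.2 ≠ 0 := by linarith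
      fun_prop

theorem rho_slice {a b : E × ℝ} (ha : 0 < a.2) (hb : b.2 < 0) : ∃ c : ℝ, 0 < c ∧ ∃ w : E, ∀ q : OP E,
    rho a b (sm q ((0 : ℝ) : OP ℝ)) = q.map fun v => c • v + w := by
  have h : 0 < (a.2 - 0) * (0 - b.2) := mul_pos (by linarith) (by linarith)
  refine ⟨((a.2 - 0) * (0 - b.2))⁻¹, by positivity, ((a.2 - 0) * (0 - b.2))⁻¹ • (- a.1 - ((0 - a.2) / (b.2 - a.2)) • (b.1 - a.1)), fun q => ?_⟩
  induction q using OnePoint.rec with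
  | infty => rfl
  | coe v =>
    simp only [sm_coe, rho, OnePoint.elim_some, OnePoint.map_some, dv_coe _ h]
    rw [← smul_add]; congr 2; abel
end Freud
end SD

namespace SD
open Filter Topology OnePoint
open Module
section Freud
variable {X P : Type*} [MetricSpace X] [ProperSpace X]
  [NormedAddCommGroup P] [NormedSpace ℝ P] [FiniteDimensional ℝ P]
  {E : Type*} [NormedAddCommGroup E] [NormedSpace ℝ E] [FiniteDimensional ℝ E]

theorem freud_inj (hc : LipCov P X) (hd : finrank ℝ P + 3 < 2 * (finrank ℝ E + 1)) {f : X → OP E}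
    (hf : Good ∞ f) (h : Null ∞ (Sus f)) : Null ∞ f := by
  haveI : ProperSpace E := FiniteDimensional.proper_real E
  haveI : Nontrivial E := finrank_pos_iff.1 (show 0 < finrank ℝ E by omega)
  obtain ⟨H, hH, H0, H1⟩ := h
  obtain ⟨D, Λ, hD, hDn, ⟨K, hΛ⟩, hDΛ⟩ := hH.approx (R := 4) (δ := 1/8) (by norm_num) (by norm_num)
  have hF := good_padd hH hD hDn
  obtain ⟨e1, he1⟩ := exists_norm_eq E zero_le_one
  have hcov : LipCov ((ℝ × (P × ℝ)) × ℝ) ((I × (X × ℝ)) × ℝ) :=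
    (lipCov_I.prod (hc.prod LipCov.self)).prod LipCov.self
  have hg : LipschitzWith _ fun q : (I × (X × ℝ)) × ℝ =>
      (Λ q.1, Λ (q.1.1, (q.1.2.1, q.2))) :=
    (hΛ.comp LipschitzWith.prod_fst).prodMk (hΛ.comp
      ((LipschitzWith.prod_fst.comp LipschitzWith.prod_fst).prodMk
        ((LipschitzWith.prod_fst.comp (LipschitzWith.prod_snd.comp LipschitzWith.prod_fst)).prodMk
          LipschitzWith.prod_snd)))
  obtain ⟨⟨a, b⟩, ⟨ha, hb⟩, hab⟩ := hcov.exists_notMem hg (by simp; omega)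
    (O := Metric.ball ((e1, 1) : E × ℝ) (1/8) ×ˢ Metric.ball ((-e1, -1) : E × ℝ) (1/8))
    (Metric.isOpen_ball.prod Metric.isOpen_ball)
    ⟨((e1, 1), (-e1, -1)), by simp, by simp⟩
  rw [mem_ball_iff_norm, Prod.norm_def, max_lt_iff] at ha hb
  simp only [Prod.fst_sub, Prod.snd_sub] at ha hb
  obtain ⟨ha1, ha2⟩ := ha
  obtain ⟨hb1, hb2⟩ := hb
  rw [Real.norm_eq_abs, abs_lt] at ha2 hb2
  have han : ‖a‖ ≤ 3 := by
    rw [Prod.norm_def, max_le_iff, Real.norm_eq_abs, abs_le]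
    refine ⟨?_, by linarith, by linarith⟩
    have := norm_add_le (a.1 - e1) e1
    rw [sub_add_cancel] at this; linarith
  have hbn : ‖b‖ ≤ 3 := by
    rw [Prod.norm_def, max_le_iff, Real.norm_eq_abs, abs_le]
    refine ⟨?_, by linarith, by linarith⟩
    have := norm_add_le (b.1 - -e1) (-e1)
    rw [sub_add_cancel, norm_neg] at this; linarith
  have hab1 : ∀ v : E, ‖v - a.1‖ ≤ 1/8 → ‖v - b.1‖ ≤ 1/8 → False := fun v h1 h2 => by
    have h3 : (2 : ℝ) = ‖(a.1 - v) + (v - b.1) + ((b.1 - -e1) - (a.1 - e1))‖ := by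
      rw [show (a.1 - v) + (v - b.1) + ((b.1 - -e1) - (a.1 - e1)) = (2 : ℝ) • e1 by
        rw [two_smul]; abel]
      rw [norm_smul, he1]; norm_num
    have h4 := norm_add_le ((a.1 - v) + (v - b.1)) ((b.1 - -e1) - (a.1 - e1))
    have h5 := norm_add_le (a.1 - v) (v - b.1)
    have h6 := norm_sub_le (b.1 - -e1) (a.1 - e1)
    rw [norm_sub_rev a.1 v] at h5
    linarith
  have hΛF : ∀ z, ∀ p : E × ℝ, padd (H z) (D z) = ↑p → ‖p‖ ≤ 3 → Λ z = p := fun z p hz hp => by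
    have h1 := padd_eq_coe.1 hz
    have h2 := hDΛ z _ h1 ((norm_sub_le _ _).trans (by linarith [hDn z]))
    rw [← h2, sub_add_cancel]
  -- hitting sets
  let Z : E × ℝ → Set (I × X) := fun a =>
    (fun z : I × (X × ℝ) => (z.1, z.2.1)) '' {z | ∃ x ∈ ({a} : Set (E × ℝ)), padd (H z) (D z) = ↑x}
  let W : E × ℝ → Set (I × X) := fun a =>
    {0} ×ˢ {x | ∃ v ∈ Metric.closedBall a.1 (1/8), f x = ↑v}
  have hZc : ∀ a, IsCompact (Z a) := fun a =>
    (hF.isCompact_preimage isCompact_singleton).image (by fun_prop)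
  have hWc : ∀ a, IsCompact (W a) := fun a =>
    isCompact_singleton.prod (hf.isCompact_preimage (isCompact_closedBall _ _))
  have hZW : ∀ a x, (0, x) ∈ Z a → (0, x) ∈ W a := by
    rintro a x ⟨⟨s, x', t⟩, ⟨a', ha', hz⟩, h⟩
    simp only [Prod.mk.injEq] at h
    obtain ⟨rfl, rfl⟩ := h
    rw [mem_singleton_iff] at ha'
    subst ha'
    have h1 := padd_eq_coe.1 hz
    rw [H0, Sus, sm_eq_coe] at h1
    refine ⟨rfl, _, ?_, h1.1⟩
    rw [mem_closedBall_iff_norm]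
    have := (norm_fst_le _).trans (hDn (0, (x', t)))
    simpa using this
  have hdisj : Disjoint (Z a ∪ W a) (Z b ∪ W b) := by
    have hWW : ∀ y, y ∈ W a → y ∈ W b → False := by
      rintro ⟨s, x⟩ ⟨_, v, hv, hfv⟩ ⟨_, v', hv', hfv'⟩
      obtain rfl := coe_eq_coe.1 (hfv.symm.trans hfv')
      exact hab1 v (mem_closedBall_iff_norm.1 hv) (mem_closedBall_iff_norm.1 hv')
    rw [Set.disjoint_left]
    rintro ⟨s, x⟩ (h1 | h1) (h2 | h2)
    · obtain ⟨⟨s', x', t⟩, ⟨a', rfl, hz⟩, h⟩ := h1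
      simp only [Prod.mk.injEq] at h
      obtain ⟨rfl, rfl⟩ := h
      obtain ⟨⟨s'', x'', t'⟩, ⟨b', rfl, hz'⟩, h⟩ := h2
      simp only [Prod.mk.injEq] at h
      obtain ⟨rfl, rfl⟩ := h
      refine hab ((s'', (x'', t)), t') (Prod.ext ?_ ?_)
      · exact hΛF _ _ hz han
      · exact hΛF _ _ hz' hbn
    · obtain rfl : s = 0 := h2.1
      exact hWW _ (hZW _ _ h1) h2
    · obtain rfl : s = 0 := h1.1
      exact hWW _ h1 (hZW _ _ h2)
    · exact hWW _ h1 h2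
  obtain ⟨u, hu0, hu1, -⟩ := exists_continuous_zero_one_of_isClosed
    ((hZc a).union (hWc a)).isClosed ((hZc b).union (hWc b)).isClosed hdisj
  obtain ⟨T, hT1, hT⟩ : ∃ T : ℝ, 1 ≤ T ∧ ∀ z, (padd (H z) (D z) = ↑a ∨ padd (H z) (D z) = ↑b) → |z.2.2| < T := by
    have hcp : IsCompact ({z | ∃ x ∈ ({a, b} : Set (E × ℝ)), padd (H z) (D z) = ↑x}) :=
      hF.isCompact_preimage (by simp)
    obtain ⟨C, hC⟩ := hcp.exists_bound_of_continuousOn (f := fun z => z.2.2) (by fun_prop)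
    refine ⟨max 1 (C + 1), le_max_left _ _, fun z hz => ?_⟩
    have := hC z (by simpa using hz)
    rw [Real.norm_eq_abs] at this
    exact (this.trans_lt (lt_add_one C)).trans_le (le_max_right _ _)
  let l : I × X → ℝ := fun y => T * (2 * u y - 1)
  have hl : Continuous l := by fun_prop
  have hla : ∀ y, y ∈ Z a ∪ W a → l y = -T := fun y hy => by
    have : u y = 0 := hu0 hy
    simp [l, this]
  have hlb : ∀ y, y ∈ Z b ∪ W b → l y = T := fun y hy => by
    have : u y = 1 := hu1 hy
    simp [l, this]; norm_num
  have hba : b.2 < a.2 := by linarith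
  have hρ : ∀ {Y : Type _} [TopologicalSpace Y] {m : Y → OP (E × ℝ)}, Good ∞ m → (∀ y, m y ≠ ↑a) →
      (∀ y, m y ≠ ↑b) → Good ∞ fun y => rho a b (m y) := fun hm h1 h2 =>
    hm.postAt (fun y => continuousAt_rho hba (h1 y) (h2 y))
      (continuousAt_rho hba (infty_ne_coe _) (infty_ne_coe _)) rfl
  have step1 : Null ∞ fun x => rho a b (padd (H (0, (x, l (0, x)))) (D (0, (x, l (0, x))))) := by
    refine ⟨fun y => rho a b (padd (H (y.1, (y.2, l y))) (D (y.1, (y.2, l y)))), ?_, fun x => rfl, fun x => ?_⟩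
    · refine hρ (hF.comp (p := fun y : I × X => (y.1, (y.2, l y))) (by fun_prop)
        (tendsto_of_leftInv (r := fun z => (z.1, z.2.1)) (by fun_prop) fun y => rfl)) ?_ ?_
      · intro y hy
        have h1 := hla y (Or.inl ⟨_, ⟨a, rfl, hy⟩, rfl⟩)
        have h2 := hT _ (Or.inl hy)
        simp only [h1, abs_neg, abs_of_pos (zero_lt_one.trans_le hT1), lt_irrefl] at h2
      · intro y hy
        have h1 := hlb y (Or.inl ⟨_, ⟨b, rfl, hy⟩, rfl⟩)
        have h2 := hT _ (Or.inr hy)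
        simp only [h1, abs_of_pos (zero_lt_one.trans_le hT1), lt_irrefl] at h2
    · simp only [H1]; rfl
  have hDe : ∀ (e : I) x, ‖((1 - e : ℝ) • D (0, (x, l (0, x)))).1‖ ≤ 1/8 ∧
      ‖((1 - e : ℝ) • D (0, (x, l (0, x)))).2‖ ≤ 1/8 := fun e x => by
    rw [← max_le_iff, ← Prod.norm_def, norm_smul, Real.norm_of_nonneg (by linarith [e.2.2])]
    exact (mul_le_of_le_one_left (norm_nonneg _) (by linarith [e.2.1])).trans (hDn _)
  have step2 : Htp ∞ (fun x => rho a b (padd (H (0, (x, l (0, x)))) (D (0, (x, l (0, x))))))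
      fun x => rho a b (sm (f x) ((0 : ℝ) : OP ℝ)) := by
    refine ⟨fun y => rho a b (padd (Sus f (y.2, (1 - y.1) * l (0, y.2)))
      ((1 - y.1 : ℝ) • D (0, (y.2, l (0, y.2))))), hρ ?_ ?_ ?_, fun x => ?_, fun x => ?_⟩
    · refine good_padd (δ := 1/8) (((good_Sus hf).comp continuous_snd (tendsto_snd_cocompact I)).comp
        (p := fun y : I × X => (y.1, (y.2, (1 - y.1 : ℝ) * l (0, y.2)))) (by fun_prop)
        (tendsto_of_leftInv (r := fun z => (z.1, z.2.1)) (by fun_prop) fun y => rfl)) (by fun_prop) fun y => ?_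
      rw [norm_smul, Real.norm_of_nonneg (by linarith [y.1.2.2])]
      exact (mul_le_of_le_one_left (norm_nonneg _) (by linarith [y.1.2.1])).trans (hDn _)
    · rintro ⟨e, x⟩ hy
      have h1 := padd_eq_coe.1 hy
      rw [Sus, sm_eq_coe] at h1
      obtain ⟨h2, h3⟩ := h1
      obtain ⟨h4, h5⟩ := hDe e x
      obtain ⟨ha21, ha22⟩ := ha2
      obtain ⟨hb21, hb22⟩ := hb2
      have h6 := hla (0, x) (Or.inr ⟨rfl, _, by
        rw [mem_closedBall_iff_norm, Prod.fst_sub, sub_sub_cancel_left, norm_neg]; exact h4, h2⟩)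
      have h7 := coe_eq_coe.1 h3
      simp only [h6, Prod.snd_sub] at h7
      rw [Real.norm_eq_abs, abs_le] at h5
      rw [h6] at h5
      obtain ⟨h51, h52⟩ := h5
      nlinarith [mul_nonneg (sub_nonneg.2 e.2.2) (zero_le_one.trans hT1)]
    · rintro ⟨e, x⟩ hy
      have h1 := padd_eq_coe.1 hy
      rw [Sus, sm_eq_coe] at h1
      obtain ⟨h2, h3⟩ := h1
      obtain ⟨h4, h5⟩ := hDe e x
      obtain ⟨ha21, ha22⟩ := ha2
      obtain ⟨hb21, hb22⟩ := hb2
      have h6 := hlb (0, x) (Or.inr ⟨rfl, _, by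
        rw [mem_closedBall_iff_norm, Prod.fst_sub, sub_sub_cancel_left, norm_neg]; exact h4, h2⟩)
      have h7 := coe_eq_coe.1 h3
      simp only [h6, Prod.snd_sub] at h7
      rw [Real.norm_eq_abs, abs_le] at h5
      rw [h6] at h5
      obtain ⟨h51, h52⟩ := h5
      nlinarith [mul_nonneg (sub_nonneg.2 e.2.2) (zero_le_one.trans hT1)]
    · simp [H0]
    · have hz : ∀ q : OP (E × ℝ), padd q 0 = q := fun q => by induction q using OnePoint.rec <;> simp
      simp [Sus, hz]
  obtain ⟨c, hc0, w, hw⟩ := rho_slice (a := a) (b := b) (by linarith) (by linarith)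
  have step3 := htp_affine hf hc0 w
  simp only [hw] at step2
  exact step3.trans (step2.symm.trans step1)
end Freud
end SD

namespace SD
open Filter Topology OnePoint
open Module
section Surj0
variable {V : Type*} [NormedAddCommGroup V] [NormedSpace ℝ V] [FiniteDimensional ℝ V]
  {Z W : Type*} [TopologicalSpace Z] [TopologicalSpace W]

theorem Good.away {N : Z → OP V} (hN : Good ∞ N) {S : Set Z} (hS : IsClosed S) {a : V}
    (ha : ∀ z ∈ S, N z ≠ ↑a) : ∃ c : ℝ, 0 < c ∧ ∀ z ∈ S, ∀ v : V, N z = ↑v → c ≤ ‖v - a‖ := by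
  haveI : ProperSpace V := FiniteDimensional.proper_real V
  have hK : IsCompact (N '' ({z | ∃ v : V, ‖v‖ ≤ ‖a‖ + 1 ∧ N z = ↑v} ∩ S)) :=
    ((hN.isCompact_le (‖a‖ + 1)).inter_right hS).image hN.1
  have hm : ((↑) : V → OP V) ⁻¹' (N '' ({z | ∃ v : V, ‖v‖ ≤ ‖a‖ + 1 ∧ N z = ↑v} ∩ S))ᶜ ∈ 𝓝 a := by
    refine (hK.isClosed.isOpen_compl.preimage continuous_coe).mem_nhds ?_
    rintro ⟨z, ⟨-, hz⟩, h⟩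
    exact ha z hz h
  obtain ⟨c, hc, hcs⟩ := Metric.mem_nhds_iff.1 hm
  refine ⟨min c 1, by positivity, fun z hz v hv => ?_⟩
  by_contra! h
  rw [lt_min_iff] at h
  refine hcs (mem_ball_iff_norm.2 h.1) ⟨z, ⟨⟨v, ?_, hv⟩, hz⟩, hv⟩
  have := norm_add_le (v - a) a
  rw [sub_add_cancel] at this
  linarith

/-- Expansion away from `a` for `s ≤ 0` and from `b` for `s ≥ 0`. -/
def expd (a b : V) (s : ℝ) (v : V) : V := (1 + |s|) • v + (min s 0) • a - (max s 0) • b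

theorem expd_nonpos {a b : V} {s : ℝ} (hs : s ≤ 0) (v : V) : expd a b s v = a + (1 - s) • (v - a) := by
  simp only [expd, abs_of_nonpos hs, min_eq_left hs, max_eq_right hs]; module
theorem expd_nonneg {a b : V} {s : ℝ} (hs : 0 ≤ s) (v : V) : expd a b s v = b + (1 + s) • (v - b) := by
  simp only [expd, abs_of_nonneg hs, min_eq_right hs, max_eq_left hs]; module
@[simp] theorem expd_zero (a b : V) : expd a b 0 = id := by ext v; simp [expd]

theorem norm_le_expd (a b : V) (s : ℝ) (v : V) : ‖v‖ ≤ ‖expd a b s v‖ + |s| * (‖a‖ + ‖b‖) := by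
  have h1 : (1 + |s|) • v = expd a b s v - (min s 0) • a + (max s 0) • b := by simp only [expd]; abel
  have h2 : ‖(1 + |s|) • v‖ ≤ ‖expd a b s v‖ + |s| * ‖a‖ + |s| * ‖b‖ := by
    rw [h1]
    refine (norm_add_le _ _).trans (add_le_add ((norm_sub_le _ _).trans (add_le_add le_rfl ?_)) ?_)
    · rw [norm_smul]
      refine mul_le_mul_of_nonneg_right ?_ (norm_nonneg _)
      rw [Real.norm_eq_abs]
      rcases le_total s 0 with h | h <;> simp [h]
    · rw [norm_smul]
      refine mul_le_mul_of_nonneg_right ?_ (norm_nonneg _)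
      rw [Real.norm_eq_abs]
      rcases le_total s 0 with h | h <;> simp [h]
  rw [norm_smul, Real.norm_of_nonneg (by positivity)] at h2
  nlinarith [abs_nonneg s, norm_nonneg v]

theorem continuous_expd (a b : V) : Continuous fun p : ℝ × OP V => p.2.map (expd a b p.1) := by
  refine continuous_omap (by unfold expd; fun_prop) fun s R => ⟨R + (|s| + 1) * (‖a‖ + ‖b‖), ?_⟩
  filter_upwards [(continuous_abs.tendsto s).eventually (gt_mem_nhds (lt_add_one |s|))] with s' hs' v hv
  refine (norm_le_expd a b s' v).trans ?_
  gcongr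

theorem good_expd {N : Z → OP V} (hN : Good ∞ N) {a b : V} {p : W → Z} {τ : W → ℝ} (hp : Continuous p)
    (hτ : Continuous τ) (hpr : Tendsto (fun w => (p w, τ w)) (cocompact W) (cocompact (Z × ℝ)))
    {A B : Set Z} (hA : IsClosed A) (hB : IsClosed B) (hNA : ∀ z ∈ A, N z ≠ ↑a) (hNB : ∀ z ∈ B, N z ≠ ↑b)
    (h1 : ∀ w, (τ w ≤ 0 ∧ p w ∈ A) ∨ (0 ≤ τ w ∧ p w ∈ B)) :
    Good ∞ fun w => (N (p w)).map (expd a b (τ w)) := by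
  suffices h : Good (S := OP V) ∞ (fun q : {q : Z × ℝ // (q.2 ≤ 0 ∧ q.1 ∈ A) ∨ (0 ≤ q.2 ∧ q.1 ∈ B)} =>
      (N q.1.1).map (expd a b q.1.2)) by
    refine h.comp (p := fun w => ⟨(p w, τ w), h1 w⟩) (by fun_prop) ?_
    refine tendsto_of_preimage fun C hC => ?_
    have h3 : (fun w => (p w, τ w)) ⁻¹' (Subtype.val '' C)ᶜ ∈ cocompact W :=
      hpr (hC.image continuous_subtype_val).compl_mem_cocompact
    obtain ⟨D, hD, hDs⟩ := mem_cocompact.1 h3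
    refine ⟨D, hD, fun w hw => ?_⟩
    by_contra hn
    exact hDs hn ⟨_, hw, rfl⟩
  refine good_iff.2 ⟨(continuous_expd a b).comp (f := fun q : {q : Z × ℝ // _} => (q.1.2, N q.1.1))
    ((continuous_snd.comp continuous_subtype_val).prodMk
      (hN.1.comp (continuous_fst.comp continuous_subtype_val))), fun R => ?_⟩
  obtain ⟨c, hc, hca⟩ := hN.away hA hNA
  obtain ⟨d, hd, hdb⟩ := hN.away hB hNB
  let R' := |R| + 2 * ‖a‖ + 2 * ‖b‖
  let T := R' / c + R' / d
  have hR0 : 0 ≤ R' := by positivity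
  have hK := (hN.isCompact_le R').prod (isCompact_Icc (a := -T) (b := T))
  have hcl : IsClosed {q : Z × ℝ | (q.2 ≤ 0 ∧ q.1 ∈ A) ∨ (0 ≤ q.2 ∧ q.1 ∈ B)} :=
    ((isClosed_le continuous_snd continuous_const).inter (hA.preimage continuous_fst)).union
      ((isClosed_le continuous_const continuous_snd).inter (hB.preimage continuous_fst))
  refine ⟨_, hcl.isClosedEmbedding_subtypeVal.isCompact_preimage hK, ?_⟩
  rintro ⟨⟨z, t⟩, hzt⟩ v hv hvR
  obtain ⟨u, hu, huv⟩ := map_eq_coe.1 hv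
  simp only at hu huv
  have hRR : R ≤ |R| := le_abs_self R
  have key : ∀ (e : V) (c' : ℝ), 0 < c' → (‖e‖ = ‖a‖ ∨ ‖e‖ = ‖b‖) → c' ≤ ‖u - e‖ → v = e + (1 + |t|) • (u - e) →
      ‖u‖ ≤ R' ∧ |t| ≤ R' / c' := by
    intro e c' hc' he hle hve
    have he' : 2 * ‖e‖ ≤ 2 * ‖a‖ + 2 * ‖b‖ := by
      have := norm_nonneg a
      have := norm_nonneg b
      rcases he with he | he <;> rw [he] <;> linarith
    have h3 : ‖(1 + |t|) • (u - e)‖ ≤ R + ‖e‖ := by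
      rw [show (1 + |t|) • (u - e) = v - e by rw [hve]; abel]
      exact (norm_sub_le _ _).trans (by linarith)
    rw [norm_smul, Real.norm_of_nonneg (by positivity)] at h3
    have h4 := norm_add_le (u - e) e
    rw [sub_add_cancel] at h4
    have h5 := norm_nonneg e
    have h6 := mul_nonneg (abs_nonneg t) (norm_nonneg (u - e))
    constructor
    · simp only [R']; nlinarith
    · rw [le_div_iff₀ hc']
      have := mul_le_mul_of_nonneg_left hle (abs_nonneg t)
      have := norm_nonneg (u - e)
      simp only [R']; linarith
  have hTc : R' / c ≤ T := le_add_of_nonneg_right (by positivity)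
  have hTd : R' / d ≤ T := le_add_of_nonneg_left (by positivity)
  rcases hzt with ⟨ht, hz⟩ | ⟨ht, hz⟩
  · obtain ⟨h3, h4⟩ := key a c hc (Or.inl rfl) (hca z hz u hu) (by rw [abs_of_nonpos ht, ← huv, expd_nonpos ht]; rfl)
    exact ⟨⟨u, h3, hu⟩, abs_le.1 (h4.trans hTc)⟩
  · obtain ⟨h3, h4⟩ := key b d hd (Or.inr rfl) (hdb z hz u hu) (by rw [abs_of_nonneg ht, ← huv, expd_nonneg ht])
    exact ⟨⟨u, h3, hu⟩, abs_le.1 (h4.trans hTd)⟩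
end Surj0
end SD

namespace SD
open Filter Topology OnePoint
open Module
section Mu
variable {E : Type*} [NormedAddCommGroup E] [NormedSpace ℝ E] [FiniteDimensional ℝ E]

/-- The point of the segment `[a,b]` at (clamped) height `h`. -/
def seg (a b : E × ℝ) (h : ℝ) : E × ℝ := a + ((max b.2 (min a.2 h) - a.2) / (b.2 - a.2)) • (b - a)

theorem seg_snd {a b : E × ℝ} (hab : b.2 < a.2) (h : ℝ) : (seg a b h).2 = max b.2 (min a.2 h) := by
  have : b.2 - a.2 ≠ 0 := by linarith
  simp only [seg, Prod.snd_add, Prod.smul_snd, Prod.snd_sub, smul_eq_mul]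
  field_simp; ring

theorem continuous_seg (a b : E × ℝ) : Continuous (seg a b) := by unfold seg; fun_prop

theorem norm_seg_le {a b : E × ℝ} (hab : b.2 < a.2) (h : ℝ) : ‖seg a b h‖ ≤ ‖a‖ + ‖b - a‖ := by
  refine (norm_add_le _ _).trans (add_le_add le_rfl ?_)
  rw [norm_smul]
  refine mul_le_of_le_one_left (norm_nonneg _) ?_
  rw [Real.norm_eq_abs, abs_div, div_le_one (abs_pos.2 (by linarith)), abs_of_neg (by linarith : b.2 - a.2 < 0),
    abs_le]
  have h1 := le_max_left b.2 (min a.2 h)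
  have h2 : max b.2 (min a.2 h) ≤ a.2 := max_le hab.le (min_le_left _ _)
  constructor <;> linarith

/-- Deformation of the complement of `{a, b}` onto a hyperplane. -/
def mu (a b : E × ℝ) (k : I × I) (q : OP (E × ℝ)) : OP (E × ℝ) :=
  q.elim ∞ fun p => padd (dv ↑(p - seg a b p.2) ((1 - k.1) + k.1 * ((a.2 - p.2) * (p.2 - b.2))))
    ((1 - k.2 : ℝ) • seg a b p.2)

theorem mu_bound {a b : E × ℝ} (hab : b.2 < a.2) (R : ℝ) : ∃ R', ∀ k (p w : E × ℝ), mu a b k ↑p = ↑w → ‖w‖ ≤ R →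
    ‖p‖ ≤ R' := by
  refine ⟨(1 + (a.2 - b.2) ^ 2) * (|R| + (‖a‖ + ‖b - a‖)) + (‖a‖ + ‖b - a‖), fun k p w h hw => ?_⟩
  obtain ⟨h1, h2⟩ := dv_eq_coe.1 (padd_eq_coe.1 (show padd _ _ = _ from h))
  have h3 := coe_eq_coe.1 h2
  have hs := norm_seg_le hab p.2
  have hk1 := k.1.2.1
  have hk1' := k.1.2.2
  have hk2 := k.2.2.1
  have hk2' := k.2.2.2
  have hpe : (1 - k.1) + k.1 * ((a.2 - p.2) * (p.2 - b.2)) ≤ 1 + (a.2 - b.2) ^ 2 := by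
    nlinarith [sq_nonneg (a.2 - p.2 - (p.2 - b.2)), sq_nonneg (a.2 - b.2)]
  rw [show p = (((1 - k.1) + k.1 * ((a.2 - p.2) * (p.2 - b.2)) : ℝ) • (w - (1 - k.2 : ℝ) • seg a b p.2)) + seg a b p.2 by
    rw [← h3]; abel]
  refine (norm_add_le _ _).trans (add_le_add ?_ hs)
  rw [norm_smul, Real.norm_of_nonneg h1.le]
  have h4 : ‖w - (1 - k.2 : ℝ) • seg a b p.2‖ ≤ |R| + (‖a‖ + ‖b - a‖) := by
    refine (norm_sub_le _ _).trans (add_le_add (hw.trans (le_abs_self R)) ?_)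
    rw [norm_smul, Real.norm_of_nonneg (by linarith)]
    exact (mul_le_of_le_one_left (norm_nonneg _) (by linarith)).trans hs
  gcongr

theorem continuousAt_mu {a b : E × ℝ} (hab : b.2 < a.2) (k : I × I) {q : OP (E × ℝ)} (ha : q ≠ ↑a) (hb : q ≠ ↑b) :
    ContinuousAt (fun x : (I × I) × OP (E × ℝ) => mu a b x.1 x.2) (k, q) := by
  rcases eq_or_ne q ∞ with rfl | hne
  · show Tendsto _ _ (𝓝 ∞)
    rw [tendsto_infty_norm]
    intro R
    obtain ⟨R', hR'⟩ := mu_bound hab R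
    have h0 : Tendsto (fun x : (I × I) × OP (E × ℝ) => x.2) (𝓝 (k, ∞)) (𝓝 ∞) := continuous_snd.tendsto _
    filter_upwards [tendsto_infty_norm.1 h0 R'] with x hx w hw
    by_contra hn
    rcases eq_or_ne x.2 ∞ with h | h
    · simp [h, mu] at hw
    obtain ⟨p, hp⟩ := ne_infty_iff_exists.1 h
    rw [← hp] at hw
    exact (hx p hp.symm).not_ge (hR' _ _ _ hw (not_lt.1 hn))
  · obtain ⟨p, rfl⟩ := ne_infty_iff_exists.1 hne
    refine continuousAt_coe_right ?_
    have hc := continuous_seg a b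
    refine ContinuousAt.comp (f := fun x : (I × I) × (E × ℝ) =>
      ((dv ↑(x.2 - seg a b x.2.2) ((1 - x.1.1) + x.1.1 * ((a.2 - x.2.2) * (x.2.2 - b.2))) : OP (E × ℝ)),
      ((1 - x.1.2 : ℝ) • seg a b x.2.2))) (g := fun x : OP (E × ℝ) × (E × ℝ) => padd x.1 x.2) (x := (k, p))
      continuous_padd.continuousAt (ContinuousAt.prodMk ?_ (Continuous.continuousAt (by fun_prop)))
    refine ContinuousAt.comp (f := fun x : (I × I) × (E × ℝ) =>
      (((x.2 - seg a b x.2.2 : E × ℝ) : OP (E × ℝ)), ((1 - x.1.1) + x.1.1 * ((a.2 - x.2.2) * (x.2.2 - b.2)) : ℝ)))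
      (g := fun x : OP (E × ℝ) × ℝ => dv x.1 x.2) (x := (k, p)) (continuousAt_dv ?_)
      (Continuous.continuousAt ((continuous_coe.comp (by fun_prop)).prodMk (by fun_prop)))
    by_contra! h
    obtain ⟨h1, h2⟩ := h
    have h3 : p = seg a b p.2 := sub_eq_zero.1 (coe_eq_coe.1 h1)
    have h4 := seg_snd hab p.2
    rw [← h3] at h4
    have h5 : b.2 ≤ p.2 := h4 ▸ le_max_left _ _
    have h6 : p.2 ≤ a.2 := h4 ▸ max_le hab.le (min_le_left _ _)
    simp only at h2
    have hk0 := k.1.2.1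
    have hk1 := k.1.2.2
    have h7 : (a.2 - p.2) * (p.2 - b.2) = 0 := by
      have h8 := mul_nonneg (sub_nonneg.2 h6) (sub_nonneg.2 h5)
      have h9 : (k.1 : ℝ) = 1 := by nlinarith
      rw [h9] at h2; linarith
    have hba : b.2 - a.2 ≠ 0 := by linarith
    rcases mul_eq_zero.1 h7 with h | h
    · refine ha (congrArg _ ?_)
      have : p.2 = a.2 := by linarith
      rw [h3, this]; simp [seg, hab.le]
    · refine hb (congrArg _ ?_)
      have : p.2 = b.2 := by linarith
      rw [h3, this]; simp [seg, hab.le, div_self hba]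

theorem mu_zero (a b : E × ℝ) (q : OP (E × ℝ)) : mu a b (0, 0) q = q := by
  induction q using OnePoint.rec <;> simp [mu]

theorem mem_of_mul_pos {a b h : ℝ} (hab : b < a) (H : 0 < (a - h) * (h - b)) : b < h ∧ h < a := by
  rcases pos_and_pos_or_neg_and_neg_of_mul_pos H with ⟨h, h'⟩ | ⟨h, h'⟩ <;> constructor <;> linarith

theorem mu_one {a b : E × ℝ} (hab : b.2 < a.2) (q : OP (E × ℝ)) :
    mu a b (1, 1) q = sm (rho a b q) ((0 : ℝ) : OP ℝ) := by
  induction q using OnePoint.rec with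
  | infty => rfl
  | coe p =>
    by_cases h : 0 < (a.2 - p.2) * (p.2 - b.2)
    · obtain ⟨h1, h2⟩ := mem_of_mul_pos hab h
      have h3 := seg_snd hab p.2
      rw [min_eq_right h2.le, max_eq_right h1.le] at h3
      simp [mu, rho, dv_coe, h, h3, Prod.ext_iff]
      simp [seg, min_eq_right h2.le, max_eq_right h1.le, sub_sub]
    · simp [mu, rho, dv_nonpos _ (not_lt.1 h)]

theorem mu_ne {a b : E × ℝ} (ha : 0 < a.2) (hb : b.2 < 0) {k : I × I} (hk : k.1 = 1 ∨ k.2 = 0)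
    {q : OP (E × ℝ)} (hqa : q ≠ ↑a) (hqb : q ≠ ↑b) : mu a b k q ≠ ↑a ∧ mu a b k q ≠ ↑b := by
  have hab : b.2 < a.2 := by linarith
  have hba : b.2 - a.2 ≠ 0 := by linarith
  induction q using OnePoint.rec with
  | infty => exact ⟨infty_ne_coe _, infty_ne_coe _⟩
  | coe p =>
    have key : ∀ c : E × ℝ, mu a b k ↑p = ↑c → ∃ P : ℝ, 0 < P ∧
        P = (1 - k.1) + k.1 * ((a.2 - p.2) * (p.2 - b.2)) ∧ p - seg a b p.2 = P • (c - (1 - k.2 : ℝ) • seg a b p.2) := fun c h => by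
      obtain ⟨h1, h2⟩ := dv_eq_coe.1 (padd_eq_coe.1 (show padd _ _ = _ from h))
      exact ⟨_, h1, rfl, coe_eq_coe.1 h2⟩
    have hs := seg_snd hab p.2
    have hk0 := k.2.2.1
    have hk1 := k.2.2.2
    constructor <;> intro h <;> obtain ⟨P, hP, hPe, h1⟩ := key _ h
    · have h2 := congrArg Prod.snd h1
      simp only [Prod.snd_sub, Prod.smul_snd, hs, smul_eq_mul] at h2
      rcases hk with hk | hk
      · have hP' := hP
        rw [hPe, hk] at hP'
        obtain ⟨h3, h4⟩ := mem_of_mul_pos hab (by simpa using hP')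
        rw [min_eq_right h4.le, max_eq_right h3.le, sub_self] at h2
        rcases mul_eq_zero.1 h2.symm with h5 | h5
        · exact hP.ne' h5
        · rcases le_total p.2 0 with h6 | h6 <;> nlinarith
      · simp only [hk, Icc.coe_zero, sub_zero, one_smul, one_mul] at h1 h2
        rcases lt_or_ge a.2 p.2 with h3 | h3
        · rw [min_eq_left h3.le, max_eq_right hab.le] at h2
          nlinarith
        rw [min_eq_right h3] at h2
        rcases lt_or_ge p.2 b.2 with h4 | h4
        · rw [max_eq_left h4.le] at h2
          nlinarith
        rw [max_eq_right h4, sub_self] at h2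
        rcases mul_eq_zero.1 h2.symm with h5 | h5
        · exact hP.ne' h5
        · have h6 : p.2 = a.2 := by linarith
          have h7 : seg a b p.2 = a := by rw [h6]; simp [seg, hab.le]
          rw [h7, sub_self, smul_zero, sub_eq_zero] at h1
          exact hqa (by rw [h1])
    · have h2 := congrArg Prod.snd h1
      simp only [Prod.snd_sub, Prod.smul_snd, hs, smul_eq_mul] at h2
      rcases hk with hk | hk
      · have hP' := hP
        rw [hPe, hk] at hP'
        obtain ⟨h3, h4⟩ := mem_of_mul_pos hab (by simpa using hP')
        rw [min_eq_right h4.le, max_eq_right h3.le, sub_self] at h2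
        rcases mul_eq_zero.1 h2.symm with h5 | h5
        · exact hP.ne' h5
        · rcases le_total p.2 0 with h6 | h6 <;> nlinarith
      · simp only [hk, Icc.coe_zero, sub_zero, one_smul, one_mul] at h1 h2
        rcases lt_or_ge a.2 p.2 with h3 | h3
        · rw [min_eq_left h3.le, max_eq_right hab.le] at h2
          nlinarith
        rw [min_eq_right h3] at h2
        rcases lt_or_ge p.2 b.2 with h4 | h4
        · rw [max_eq_left h4.le] at h2
          nlinarith
        rw [max_eq_right h4, sub_self] at h2
        rcases mul_eq_zero.1 h2.symm with h5 | h5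
        · exact hP.ne' h5
        · have h6 : p.2 = b.2 := by linarith
          have h7 : seg a b p.2 = b := by rw [h6]; simp [seg, hab.le, div_self hba]
          rw [h7, sub_self, smul_zero, sub_eq_zero] at h1
          exact hqb (by rw [h1])

theorem good_mu {Z W : Type*} [TopologicalSpace Z] [TopologicalSpace W] {a b : E × ℝ} (hab : b.2 < a.2)
    {m : Z → OP (E × ℝ)} (hm : Good ∞ m) (ha : ∀ z, m z ≠ ↑a) (hb : ∀ z, m z ≠ ↑b) {k : W → I × I} (hk : Continuous k)
    {p : W → Z} (hp : Continuous p) (hp' : Tendsto p (cocompact W) (cocompact Z)) :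
    Good ∞ fun w => mu a b (k w) (m (p w)) := by
  have hg := hm.comp hp hp'
  refine good_iff.2 ⟨continuous_iff_continuousAt.2 fun w => ContinuousAt.comp
    (f := fun w => (k w, m (p w))) (g := fun x : (I × I) × OP (E × ℝ) => mu a b x.1 x.2)
    (continuousAt_mu hab _ (ha _) (hb _)) (hk.prodMk hg.1).continuousAt, fun R => ?_⟩
  obtain ⟨R', hR'⟩ := mu_bound hab R
  obtain ⟨C, hC, h⟩ := (good_iff.1 hg).2 R'
  refine ⟨C, hC, fun w v hv hR => ?_⟩
  rcases eq_or_ne (m (p w)) ∞ with h0 | h0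
  · simp [h0, mu] at hv
  obtain ⟨u, hu⟩ := ne_infty_iff_exists.1 h0
  rw [← hu] at hv
  exact h w u hu.symm (hR' _ _ _ hv hR)
end Mu
end SD

namespace SD
open Filter Topology OnePoint
open Module
section Surj
variable {X P : Type*} [MetricSpace X] [ProperSpace X]
  [NormedAddCommGroup P] [NormedSpace ℝ P] [FiniteDimensional ℝ P]
  {E : Type*} [NormedAddCommGroup E] [NormedSpace ℝ E] [FiniteDimensional ℝ E]

theorem padd_zero (q : OP E) : padd q 0 = q := by induction q using OnePoint.rec <;> simp

theorem htp_padd {Z : Type*} [TopologicalSpace Z] {f : Z → OP E} (hf : Good ∞ f) {D : Z → E}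
    (hD : Continuous D) {δ : ℝ} (hδ : ∀ x, ‖D x‖ ≤ δ) : Htp ∞ f (fun x => padd (f x) (D x)) := by
  refine ⟨fun y => padd (f y.2) ((y.1 : ℝ) • D y.2), good_padd (δ := δ)
    (hf.comp continuous_snd (tendsto_snd_cocompact I)) (by fun_prop) fun y => ?_, fun x => ?_, fun x => ?_⟩
  · rw [norm_smul, Real.norm_of_nonneg y.1.2.1]
    exact (mul_le_of_le_one_left (norm_nonneg _) y.1.2.2).trans (hδ _)
  · simp [padd_zero]
  · simp

theorem null_of_dim_lt (hc : LipCov P X) (hd : finrank ℝ P < finrank ℝ E) {f : X → OP E}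
    (hf : Good ∞ f) : Null ∞ f := by
  obtain ⟨D, Λ, hD, hDn, ⟨K, hΛ⟩, hDΛ⟩ := hf.approx (R := 4) (δ := 1) (by norm_num) (by norm_num)
  have hF := good_padd hf hD hDn
  obtain ⟨a, ha, hab⟩ := hc.exists_notMem hΛ hd (Metric.isOpen_ball (x := (0 : E)) (ε := 1)) ⟨0, by simp⟩
  rw [mem_ball_zero_iff] at ha
  have hFa : ∀ x, padd (f x) (D x) ≠ ↑a := fun x hx => by
    have h1 := padd_eq_coe.1 hx
    refine hab x ?_
    rw [← hDΛ x _ h1 ((norm_sub_le _ _).trans (by linarith [hDn x])), sub_add_cancel]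
  have hG := good_padd hF (continuous_const (y := -a)) (δ := ‖a‖) fun x => (norm_neg a).le
  refine ((htp_padd hf hD hDn).trans (htp_padd hF (continuous_const (y := -a)) (δ := ‖a‖) fun x => (norm_neg a).le)).trans
    ⟨fun y => dv (padd (padd (f y.2) (D y.2)) (-a)) (1 - y.1), good_dv (M := 1)
      (hG.comp continuous_snd (tendsto_snd_cocompact I)) (by fun_prop) (fun y => Or.inl fun h => ?_) (fun y => ?_),
      fun x => ?_, fun x => ?_⟩
  · have h1 := padd_eq_coe.1 h
    rw [zero_sub, neg_neg] at h1
    exact hFa _ h1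
  · linarith [y.1.2.1]
  · simp
  · simp [dv_nonpos]

theorem freud_surj (hc : LipCov P X) (hd : finrank ℝ P + 2 < 2 * (finrank ℝ E + 1)) {F : X × ℝ → OP (E × ℝ)}
    (hF0 : Good ∞ F) : ∃ f : X → OP E, Good ∞ f ∧ Htp ∞ F (Sus f) := by
  haveI : ProperSpace E := FiniteDimensional.proper_real E
  obtain ⟨D, Λ, hD, hDn, ⟨K, hΛ⟩, hDΛ⟩ := hF0.approx (R := 4) (δ := 1/8) (by norm_num) (by norm_num)
  have step1 := htp_padd hF0 hD hDn
  have hF := good_padd hF0 hD hDn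
  obtain ⟨N, hN⟩ : ∃ N : X × ℝ → OP (E × ℝ), N = fun x => padd (F x) (D x) := ⟨_, rfl⟩
  rw [← hN] at hF step1
  have hcov : LipCov ((P × ℝ) × ℝ) ((X × ℝ) × ℝ) := (hc.prod LipCov.self).prod LipCov.self
  have hg : LipschitzWith _ fun q : (X × ℝ) × ℝ => (Λ q.1, Λ (q.1.1, q.2)) :=
    (hΛ.comp LipschitzWith.prod_fst).prodMk (hΛ.comp
      ((LipschitzWith.prod_fst.comp LipschitzWith.prod_fst).prodMk LipschitzWith.prod_snd))
  obtain ⟨⟨a, b⟩, ⟨ha, hb⟩, hab⟩ := hcov.exists_notMem hg (by simp; omega)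
    (O := Metric.ball ((0, 1) : E × ℝ) (1/8) ×ˢ Metric.ball ((0, -1) : E × ℝ) (1/8))
    (Metric.isOpen_ball.prod Metric.isOpen_ball)
    ⟨((0, 1), (0, -1)), by simp, by simp⟩
  rw [mem_ball_iff_norm, Prod.norm_def, max_lt_iff] at ha hb
  simp only [Prod.fst_sub, Prod.snd_sub, sub_zero] at ha hb
  obtain ⟨ha1, ha2⟩ := ha
  obtain ⟨hb1, hb2⟩ := hb
  rw [Real.norm_eq_abs, abs_lt] at ha2 hb2
  obtain ⟨ha2, ha3⟩ := ha2
  obtain ⟨hb2, hb3⟩ := hb2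
  have han : ‖a‖ ≤ 3 := by
    rw [Prod.norm_def, max_le_iff, Real.norm_eq_abs, abs_le]
    refine ⟨?_, by linarith, by linarith⟩
    linarith
  have hbn : ‖b‖ ≤ 3 := by
    rw [Prod.norm_def, max_le_iff, Real.norm_eq_abs, abs_le]
    refine ⟨?_, by linarith, by linarith⟩
    linarith
  have hΛF : ∀ z, ∀ p : E × ℝ, N z = ↑p → ‖p‖ ≤ 3 → Λ z = p := fun z p hz hp => by
    rw [hN] at hz
    have h1 := padd_eq_coe.1 hz
    have h2 := hDΛ z _ h1 ((norm_sub_le _ _).trans (by linarith [hDn z]))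
    rw [← h2, sub_add_cancel]
  let Z : E × ℝ → Set X := fun a => Prod.fst '' {z | ∃ x ∈ ({a} : Set (E × ℝ)), N z = ↑x}
  have hZc : ∀ a, IsCompact (Z a) := fun a =>
    (hF.isCompact_preimage isCompact_singleton).image (by fun_prop)
  have hdisj : Disjoint (Z a) (Z b) := by
    rw [Set.disjoint_left]
    rintro x ⟨⟨_, t⟩, ⟨_, rfl, h1⟩, rfl⟩ ⟨⟨x, t'⟩, ⟨_, rfl, h2⟩, rfl⟩
    refine hab ((x, t), t') (Prod.ext ?_ ?_)
    · exact hΛF _ _ h1 han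
    · exact hΛF _ _ h2 hbn
  obtain ⟨u, hu0, hu1, -⟩ := exists_continuous_zero_one_of_isClosed (hZc a).isClosed (hZc b).isClosed hdisj
  obtain ⟨T, hT⟩ : ∃ T : ℝ, ∀ z, (N z = ↑a ∨ N z = ↑b) → |z.2| < T := by
    have hcp : IsCompact ({z | ∃ x ∈ ({a, b} : Set (E × ℝ)), N z = ↑x}) := hF.isCompact_preimage (by simp)
    obtain ⟨C, hC⟩ := hcp.exists_bound_of_continuousOn (f := fun z => z.2) (by fun_prop)
    refine ⟨C + 1, fun z hz => ?_⟩
    have := hC z (by simpa using hz)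
    exact this.trans_lt (lt_add_one C)
  let l : X → ℝ := fun y => T * (2 * u y - 1)
  have hl : Continuous l := by fun_prop
  have hla : ∀ x t, t ≤ l x → N (x, t) ≠ ↑a := fun x t ht h => by
    have h1 : u x = 0 := hu0 ⟨_, ⟨_, rfl, h⟩, rfl⟩
    simp only [l, h1] at ht
    have := (abs_lt.1 (hT _ (Or.inl h))).1
    simp only at this; linarith
  have hlb : ∀ x t, l x ≤ t → N (x, t) ≠ ↑b := fun x t ht h => by
    have h1 : u x = 1 := hu1 ⟨_, ⟨_, rfl, h⟩, rfl⟩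
    simp only [l, h1] at ht
    have := (abs_lt.1 (hT _ (Or.inr h))).2
    simp only at this; linarith
  have hba : b.2 < a.2 := by linarith
  let m : X → OP (E × ℝ) := fun x => N (x, l x)
  have hm : Good ∞ m := hF.comp (p := fun x => (x, l x)) (by fun_prop)
    (tendsto_of_leftInv (r := Prod.fst) (by fun_prop) fun y => rfl)
  have hma : ∀ x, m x ≠ ↑a := fun x => hla x _ le_rfl
  have hmb : ∀ x, m x ≠ ↑b := fun x => hlb x _ le_rfl
  have step2 : Htp ∞ N fun z => (m z.1).map (expd a b (z.2 - l z.1)) := by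
    refine ⟨fun y => (N (y.2.1, l y.2.1 + (1 - y.1) * (y.2.2 - l y.2.1))).map (expd a b (y.1 * (y.2.2 - l y.2.1))),
      good_expd hF (p := fun y : I × (X × ℝ) => (y.2.1, l y.2.1 + (1 - y.1) * (y.2.2 - l y.2.1)))
        (τ := fun y : I × (X × ℝ) => (y.1 * (y.2.2 - l y.2.1))) (by fun_prop) (by fun_prop) ?_
        (A := {z | z.2 ≤ l z.1}) (B := {z | l z.1 ≤ z.2}) (isClosed_le (by fun_prop) (by fun_prop))
        (isClosed_le (by fun_prop) (by fun_prop)) (fun z hz => hla _ _ hz) (fun z hz => hlb _ _ hz) ?_,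
        fun z => ?_, fun z => ?_⟩
    · refine (tendsto_snd_cocompact I).comp (tendsto_of_leftInv (p := fun y : I × (X × ℝ) =>
        (y.1, ((y.2.1, l y.2.1 + (1 - y.1) * (y.2.2 - l y.2.1)), y.1 * (y.2.2 - l y.2.1))))
        (r := fun z : I × ((X × ℝ) × ℝ) => (z.1, (z.2.1.1, z.2.1.2 + z.2.2))) (by fun_prop) fun y => ?_)
      refine Prod.ext rfl (Prod.ext rfl ?_)
      simp only; ring
    · rintro ⟨e, x, t⟩
      have h0 := e.2.1
      have h1 := sub_nonneg.2 e.2.2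
      rcases le_total t (l x) with h | h
      · left
        simp only [mem_setOf_eq]
        constructor <;> nlinarith
      · right
        simp only [mem_setOf_eq]
        constructor <;> nlinarith
    · simp
    · simp [m]
  have step3 : Htp ∞ (fun z : X × ℝ => (m z.1).map (expd a b (z.2 - l z.1)))
      fun z => (m z.1).map (expd a b z.2) := by
    refine ⟨fun y => (m y.2.1).map (expd a b (y.2.2 - (1 - y.1) * l y.2.1)),
      good_expd hm (p := fun y : I × (X × ℝ) => y.2.1) (τ := fun y : I × (X × ℝ) => y.2.2 - (1 - y.1) * l y.2.1)
        (by fun_prop) (by fun_prop) ?_ isClosed_univ isClosed_univ (fun z _ => hma z) (fun z _ => hmb z) ?_,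
        fun z => ?_, fun z => ?_⟩
    · refine (tendsto_snd_cocompact I).comp (tendsto_of_leftInv (p := fun y : I × (X × ℝ) =>
        (y.1, (y.2.1, y.2.2 - (1 - y.1) * l y.2.1)))
        (r := fun z : I × (X × ℝ) => (z.1, (z.2.1, z.2.2 + (1 - z.1) * l z.2.1))) (by fun_prop) fun y => ?_)
      refine Prod.ext rfl (Prod.ext rfl ?_)
      simp only; ring
    · intro w
      simpa using le_total _ _
    · simp
    · simp
  have step4 : ∀ k : I → I × I, Continuous k → (∀ e, (k e).1 = 1 ∨ (k e).2 = 0) →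
      Htp ∞ (fun z : X × ℝ => (mu a b (k 0) (m z.1)).map (expd a b z.2))
        fun z => (mu a b (k 1) (m z.1)).map (expd a b z.2) := fun k hk hk' => by
    have hne := fun (y : I × X) => mu_ne (k := k y.1) (by linarith : 0 < a.2) (by linarith : b.2 < 0) (hk' _)
      (hma y.2) (hmb y.2)
    refine ⟨fun y => (mu a b (k y.1) (m y.2.1)).map (expd a b y.2.2),
      good_expd (N := fun y : I × X => mu a b (k y.1) (m y.2))
        (good_mu hba hm hma hmb (hk.comp continuous_fst) continuous_snd (tendsto_snd_cocompact I))
        (p := fun y : I × (X × ℝ) => (y.1, y.2.1)) (τ := fun y : I × (X × ℝ) => y.2.2)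
        (by fun_prop) (by fun_prop) (tendsto_homeo (Homeomorph.prodAssoc I X ℝ).symm) isClosed_univ isClosed_univ
        (fun z _ => (hne z).1) (fun z _ => (hne z).2) ?_, fun z => rfl, fun z => rfl⟩
    intro w
    simpa using le_total _ _
  have step5 := step4 (fun e => (e, 0)) (by fun_prop) (fun e => Or.inr rfl)
  have step6 := step4 (fun e => (1, e)) (by fun_prop) (fun e => Or.inl rfl)
  simp only [mu_zero] at step5
  simp only [mu_one hba] at step6
  let f : X → OP E := fun x => rho a b (m x)
  have hf : Good ∞ f := hm.postAt (fun y => continuousAt_rho hba (hma y) (hmb y))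
      (continuousAt_rho hba (infty_ne_coe _) (infty_ne_coe _)) rfl
  have step7 : Htp ∞ (fun z : X × ℝ => (sm (f z.1) ((0 : ℝ) : OP ℝ)).map (expd a b z.2)) (Sus f) := by
    have h := htp_omap (φ := fun (e : I) (v : E × ℝ) =>
      (((1 + (1 - e : ℝ) * |v.2|) • v.1 + (1 - e : ℝ) • (min v.2 0 • a.1 - max v.2 0 • b.1),
        (1 - e : ℝ) * (min v.2 0 * a.2 - max v.2 0 * b.2) + e * v.2) : E × ℝ)) (by fun_prop) (fun R => ?_) (good_Sus hf)
    · convert h using 2 with z z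
      · rw [Sus]
        generalize f z.1 = q
        induction q using OnePoint.rec with
        | infty => rfl
        | coe w => simp [expd, smul_sub, add_sub_assoc, Prod.ext_iff]
      · generalize Sus f z = q
        induction q using OnePoint.rec with
        | infty => rfl
        | coe w => simp
    · refine ⟨|R| + 2 * |R| * (‖a.1‖ + ‖b.1‖) + 2 * |R|, fun e v hv => ?_⟩
      have hv' := hv.trans (le_abs_self R)
      rw [Prod.norm_def, max_le_iff] at hv'
      obtain ⟨h1, h2⟩ := hv'
      have he0 := e.2.1
      have he1 := sub_nonneg.2 e.2.2
      have h3 : |v.2| ≤ 2 * |R| := by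
        simp only [Real.norm_eq_abs] at h2
        rcases le_total v.2 0 with h | h
        · have q1 := mul_nonneg (mul_nonneg he1 (neg_nonneg.2 h)) (by linarith : 0 ≤ a.2 - 7/8)
          have q2 := mul_nonneg he0 (neg_nonneg.2 h)
          rw [min_eq_left h, max_eq_right h, abs_of_nonpos] at h2
          · rw [abs_of_nonpos h]
            linarith
          · linarith
        · have q1 := mul_nonneg (mul_nonneg he1 h) (by linarith : 0 ≤ -b.2 - 7/8)
          have q2 := mul_nonneg he0 h
          rw [min_eq_right h, max_eq_left h, abs_of_nonneg] at h2
          · rw [abs_of_nonneg h]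
            linarith
          · linarith
      have h4 : ‖(1 - e : ℝ) • (min v.2 0 • a.1 - max v.2 0 • b.1)‖ ≤ 2 * |R| * (‖a.1‖ + ‖b.1‖) := by
        rw [norm_smul, Real.norm_of_nonneg he1]
        refine (mul_le_of_le_one_left (norm_nonneg _) (by linarith)).trans ((norm_sub_le _ _).trans ?_)
        rw [norm_smul, norm_smul, mul_add]
        have h5 : ‖min v.2 0‖ ≤ |v.2| := by rcases le_total v.2 0 with h | h <;> simp [h]
        have h6 : ‖max v.2 0‖ ≤ |v.2| := by rcases le_total v.2 0 with h | h <;> simp [h]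
        exact add_le_add (mul_le_mul_of_nonneg_right (h5.trans h3) (norm_nonneg _))
          (mul_le_mul_of_nonneg_right (h6.trans h3) (norm_nonneg _))
      have h5 : ‖v.1‖ ≤ |R| + 2 * |R| * (‖a.1‖ + ‖b.1‖) := by
        have h6 := norm_sub_le ((1 + (1 - e : ℝ) * |v.2|) • v.1 + (1 - e : ℝ) • (min v.2 0 • a.1 - max v.2 0 • b.1))
          ((1 - e : ℝ) • (min v.2 0 • a.1 - max v.2 0 • b.1))
        rw [add_sub_cancel_right, norm_smul, Real.norm_of_nonneg (by positivity)] at h6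
        have := mul_nonneg (mul_nonneg he1 (abs_nonneg v.2)) (norm_nonneg v.1)
        simp only at h1
        nlinarith
      rw [Prod.norm_def, max_le_iff]
      have : 0 ≤ 2 * |R| * (‖a.1‖ + ‖b.1‖) := by positivity
      have := abs_nonneg R
      constructor
      · linarith
      · rw [Real.norm_eq_abs]; linarith
  refine ⟨f, hf, ?_⟩
  exact step1.trans (step2.trans (step3.trans (step5.trans (step6.trans step7))))
end Surj
end SD

namespace SD
open Filter Topology OnePoint
section Hol
variable {E A : Type*} [NormedAddCommGroup E] [NormedSpace ℝ E] [FiniteDimensional ℝ E]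
  [NormedDivisionRing A] [NormedAlgebra ℝ A] [FiniteDimensional ℝ A]

/-- A normed division algebra split into imaginary and real parts. -/
structure ImRe (E A : Type*) [NormedAddCommGroup E] [NormedSpace ℝ E]
    [NormedDivisionRing A] [NormedAlgebra ℝ A] where
  σ : (E × ℝ) ≃L[ℝ] A
  one : σ (0, 1) = 1
  sq : ∀ ξ, σ (ξ, 0) * σ (ξ, 0) = -((‖σ (ξ, 0)‖ ^ 2) • (1 : A))
  nrm : ∀ ξ t, ‖σ (ξ, t)‖ ^ 2 = ‖σ (ξ, 0)‖ ^ 2 + t ^ 2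

namespace ImRe
variable (j : ImRe E A)

def u (ξ : E) : A := j.σ (ξ, 0)

theorem σ_eq (ξ : E) (t : ℝ) : j.σ (ξ, t) = j.u ξ + t • 1 := by
  rw [u, ← j.one, ← _root_.map_smul, ← map_add]; simp

theorem u_mul (ξ : E) : j.u ξ * j.u ξ = -((‖j.u ξ‖ ^ 2) • (1 : A)) := j.sq ξ

theorem u_neg (ξ : E) : j.u (-ξ) = -j.u ξ := by rw [u, u, ← map_neg]; simp

def bar (p : E × ℝ) : A := j.σ (-p.1, p.2)

def den (p : E × ℝ) : ℝ := ‖j.σ p‖ ^ 2 + 1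

theorem den_pos (p : E × ℝ) : 0 < j.den p := by unfold den; positivity

theorem bar_mul_self (p : E × ℝ) : j.bar p * j.σ p = (‖j.σ p‖ ^ 2) • (1 : A) := by
  obtain ⟨ξ, t⟩ := p
  rw [bar, j.nrm, j.σ_eq, j.σ_eq, u_neg, add_mul, mul_add, mul_add, neg_mul, j.u_mul]
  simp only [smul_mul_assoc, mul_smul_comm, mul_one, one_mul, u]
  module

/-- Orthogonal projection of `A²` to the line spanned by `(z, 1)`. -/
def P0 (p : E × ℝ) : A × A →L[ℝ] A × A :=
  (ContinuousLinearMap.inl ℝ A A).comp ((1 - (j.den p)⁻¹) • ContinuousLinearMap.fst ℝ A A +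
    (ContinuousLinearMap.mul ℝ A ((j.den p)⁻¹ • j.σ p)).comp (ContinuousLinearMap.snd ℝ A A)) +
  (ContinuousLinearMap.inr ℝ A A).comp ((ContinuousLinearMap.mul ℝ A ((j.den p)⁻¹ • j.bar p)).comp
    (ContinuousLinearMap.fst ℝ A A) + (j.den p)⁻¹ • ContinuousLinearMap.snd ℝ A A)

def Pinf : A × A →L[ℝ] A × A :=
  (ContinuousLinearMap.inl ℝ A A).comp (ContinuousLinearMap.fst ℝ A A)

def P (q : OP (E × ℝ)) : A × A →L[ℝ] A × A := q.elim Pinf j.P0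

theorem tendsto_norm : Tendsto (fun p => ‖j.σ p‖) (cocompact (E × ℝ)) atTop := by
  haveI : ProperSpace A := FiniteDimensional.proper_real A
  exact (tendsto_norm_cocompact_atTop (E := A)).comp (tendsto_homeo j.σ.toHomeomorph)

theorem tendsto_den : Tendsto (fun p => (j.den p)⁻¹) (cocompact (E × ℝ)) (𝓝 0) := by
  refine tendsto_inv_atTop_zero.comp ?_
  exact tendsto_atTop_add_const_right _ _ ((tendsto_pow_atTop two_ne_zero).comp j.tendsto_norm)

theorem norm_bar (p : E × ℝ) : ‖j.bar p‖ = ‖j.σ p‖ := by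
  have h1 : ‖j.bar p‖ ^ 2 = ‖j.σ p‖ ^ 2 := by
    rw [bar, j.nrm, show p = (p.1, p.2) from rfl, j.nrm p.1]
    have : j.σ (-p.1, 0) = - j.σ (p.1, 0) := j.u_neg p.1
    rw [this, norm_neg]
  exact (sq_eq_sq₀ (norm_nonneg _) (norm_nonneg _)).1 h1

theorem tendsto_den_mul {f : E × ℝ → A} (hf : ∀ p, ‖f p‖ = ‖j.σ p‖) :
    Tendsto (fun p => (j.den p)⁻¹ • f p) (cocompact (E × ℝ)) (𝓝 0) := by
  rw [tendsto_zero_iff_norm_tendsto_zero]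
  refine squeeze_zero (fun _ => norm_nonneg _) (fun p => ?_) (tendsto_inv_atTop_zero.comp j.tendsto_norm)
  rw [norm_smul, hf, Function.comp, Real.norm_of_nonneg (inv_nonneg.2 (j.den_pos p).le)]
  rcases (norm_nonneg (j.σ p)).eq_or_lt with h | h
  · rw [← h]; simp
  · rw [inv_mul_eq_div, div_le_iff₀ (j.den_pos p), den]
    have : ‖j.σ p‖⁻¹ * (‖j.σ p‖ ^ 2 + 1) = ‖j.σ p‖ + ‖j.σ p‖⁻¹ := by field_simp
    rw [this]
    have := inv_pos.2 h
    linarith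

theorem continuous_den : Continuous fun p => (j.den p)⁻¹ :=
  Continuous.inv₀ (by unfold den; fun_prop) fun p => (j.den_pos p).ne'

theorem good_P0 : Good Pinf j.P0 := by
  have key : Continuous fun w : ℝ × A × A => (ContinuousLinearMap.inl ℝ A A).comp ((1 - w.1) • ContinuousLinearMap.fst ℝ A A +
    (ContinuousLinearMap.mul ℝ A w.2.1).comp (ContinuousLinearMap.snd ℝ A A)) +
  (ContinuousLinearMap.inr ℝ A A).comp ((ContinuousLinearMap.mul ℝ A w.2.2).comp
    (ContinuousLinearMap.fst ℝ A A) + w.1 • ContinuousLinearMap.snd ℝ A A) := by fun_prop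
  have hg : Good (0, 0, 0) fun p => ((j.den p)⁻¹, (j.den p)⁻¹ • j.σ p, (j.den p)⁻¹ • j.bar p) := by
    constructor
    · have := j.continuous_den
      unfold bar
      fun_prop
    · exact j.tendsto_den.prodMk_nhds ((j.tendsto_den_mul fun _ => rfl).prodMk_nhds (j.tendsto_den_mul j.norm_bar))
  refine hg.post key ?_
  ext v <;> simp [Pinf]

theorem continuous_P : Continuous j.P := j.good_P0.ext

@[simp] theorem P_infty : j.P ∞ = Pinf := rfl
@[simp] theorem P_coe (p : E × ℝ) : j.P (p : OP (E × ℝ)) = j.P0 p := rfl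

theorem P0_apply (p : E × ℝ) (v : A × A) :
    j.P0 p v = (j.den p)⁻¹ • (j.σ p * (j.bar p * v.1 + v.2), j.bar p * v.1 + v.2) := by
  have h : j.σ p * j.bar p = (‖j.σ p‖ ^ 2) • (1 : A) := by
    have := j.bar_mul_self (-p.1, p.2)
    have h2 : j.bar (-p.1, p.2) = j.σ p := by simp [bar]
    rw [h2] at this
    rw [← j.norm_bar]
    exact this
  have h' := (j.den_pos p).ne'
  ext
  · simp only [P0, Pinf, mul_add, ← mul_assoc, h]
    simp
    have : (1 - (j.den p)⁻¹) = (j.den p)⁻¹ * ‖j.σ p‖ ^ 2 := by field_simp; unfold den; ring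
    rw [this, mul_smul]
  · simp [P0]

theorem P_idem (q : OP (E × ℝ)) (v : A × A) : j.P q (j.P q v) = j.P q v := by
  induction q using OnePoint.rec with
  | infty => simp [Pinf]
  | coe p =>
    have h' := (j.den_pos p).ne'
    have h1 : ∀ c : A, j.P0 p (j.σ p * c, c) = (j.σ p * c, c) := fun c => by
      rw [P0_apply]
      simp only [← mul_assoc, j.bar_mul_self]
      have : (‖j.σ p‖ ^ 2) • (1 : A) * c + c = j.den p • c := by
        rw [smul_mul_assoc, one_mul, den]; module
      rw [this, mul_smul_comm, Prod.smul_mk, inv_smul_smul₀ h', inv_smul_smul₀ h']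
    rw [P_coe, j.P0_apply p v, _root_.map_smul, h1]

/-- Transport of `(1, 0)` through the lines `z 0, …, z k`. -/
def V (z : ℕ → OP (E × ℝ)) : ℕ → A × A
  | 0 => j.P (z 0) (1, 0)
  | k + 1 => j.P (z (k + 1)) (V z k)

theorem P_V (z : ℕ → OP (E × ℝ)) (k : ℕ) : j.P (z k) (j.V z k) = j.V z k := by
  cases k <;> exact j.P_idem _ _

theorem ne_zero_of_close {L M : A × A →L[ℝ] A × A} {v : A × A} (hv : v ≠ 0) (h : L v = v)
    (hLM : ‖M - L‖ < 1 / 2) : M v ≠ 0 := fun h0 => by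
  have h1 := (M - L).le_opNorm v
  rw [ContinuousLinearMap.sub_apply, h0, h, zero_sub, norm_neg] at h1
  have := norm_pos_iff.2 hv
  nlinarith

theorem V_ne_zero {z : ℕ → OP (E × ℝ)} (h0 : ‖j.P (z 0) - Pinf‖ < 1 / 2) {n : ℕ}
    (h : ∀ k < n, ‖j.P (z (k + 1)) - j.P (z k)‖ < 1 / 2) : j.V z n ≠ 0 := by
  induction n with
  | zero => exact ne_zero_of_close (by simp) (by simp [Pinf]) h0
  | succ k ih => exact ne_zero_of_close (ih fun i hi => h i (by omega)) (j.P_V z k) (h k (by omega))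

theorem V_fst_ne_zero {z : ℕ → OP (E × ℝ)} (h0 : ‖j.P (z 0) - Pinf‖ < 1 / 2) {n : ℕ}
    (h : ∀ k < n, ‖j.P (z (k + 1)) - j.P (z k)‖ < 1 / 2) (h1 : ‖j.P (z n) - Pinf‖ < 1 / 2) : (j.V z n).1 ≠ 0 := by
  have := ne_zero_of_close (M := Pinf) (j.V_ne_zero h0 h) (j.P_V z n) (by rw [← neg_sub, ContinuousLinearMap.opNorm_neg]; exact h1)
  intro h; apply this; simp [Pinf, h]

theorem good_V {Z : Type*} [TopologicalSpace Z] {z : ℕ → Z → OP (E × ℝ)} (hz : ∀ k, Good ∞ (z k)) (n : ℕ) :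
    Good ((1, 0) : A × A) fun y => j.V (fun k => z k y) n := by
  have hP : ∀ k, Good Pinf fun y => j.P (z k y) := fun k => (hz k).post j.continuous_P rfl
  induction n with
  | zero =>
    refine ⟨(hP 0).1.clm_apply continuous_const, ?_⟩
    have := ((isBoundedBilinearMap_apply (𝕜 := ℝ) (E := A × A) (F := A × A)).continuous.tendsto _).comp
      ((hP 0).2.prodMk_nhds (tendsto_const_nhds (x := ((1, 0) : A × A))))
    simpa [Pinf, Function.comp_def, V] using this
  | succ k ih =>
    refine ⟨(hP (k + 1)).1.clm_apply ih.1, ?_⟩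
    have := ((isBoundedBilinearMap_apply (𝕜 := ℝ) (E := A × A) (F := A × A)).continuous.tendsto _).comp
      ((hP (k + 1)).2.prodMk_nhds ih.2)
    simpa [Pinf, Function.comp_def, V] using this

end ImRe
end Hol
end SD

namespace SD
open Filter Topology OnePoint
theorem tendsto_of_comp {X Y Z : Type*} [TopologicalSpace X] [TopologicalSpace Y] [TopologicalSpace Z]
    {p : Y → X} {r : X → Z} (hr : Continuous r) (h : Tendsto (fun y => r (p y)) (cocompact Y) (cocompact Z)) :
    Tendsto p (cocompact Y) (cocompact X) := by
  refine tendsto_of_preimage fun C hC => ?_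
  obtain ⟨D, hD, hDs⟩ := mem_cocompact.1 (h (hC.image hr).compl_mem_cocompact)
  exact ⟨D, hD, fun y hy => by_contra fun hn => hDs hn ⟨_, hy, rfl⟩⟩

section Hol
variable {E A : Type*} [NormedAddCommGroup E] [NormedSpace ℝ E] [FiniteDimensional ℝ E]
  [NormedDivisionRing A] [NormedAlgebra ℝ A] [FiniteDimensional ℝ A]

namespace ImRe
variable (j : ImRe E A)

theorem u_smul (c : ℝ) (ξ : E) : j.u (c • ξ) = c • j.u ξ := by
  rw [u, u, ← _root_.map_smul]; simp

theorem lin_mul (ξ : E) (a b c d : ℝ) :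
    j.σ (b • ξ, a) * j.σ (d • ξ, c) = j.σ ((a * d + b * c) • ξ, a * c - b * d * ‖j.u ξ‖ ^ 2) := by
  simp only [j.σ_eq, u_smul, add_mul, mul_add, smul_mul_assoc, mul_smul_comm, mul_one, one_mul, u_mul]
  module

theorem bar_mul (ξ : E) (t t' : ℝ) :
    j.bar (ξ, t') * j.σ (ξ, t) + 1 = j.σ ((t' - t) • ξ, t * t' + ‖j.u ξ‖ ^ 2 + 1) := by
  have h := j.lin_mul ξ t' (-1) t 1
  simp only [neg_smul, one_smul] at h
  rw [bar, h, ← j.one, ← map_add]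
  congr 1
  ext <;> simp <;> ring_nf

theorem σ_ne_zero {p : E × ℝ} (h : p ≠ 0) : j.σ p ≠ 0 := fun h0 =>
  h (j.σ.injective (by rw [h0, map_zero]))

theorem bar_mul_ne_zero (ξ : E) {t t' : ℝ} (h : |t' - t| < 2) : j.bar (ξ, t') * j.σ (ξ, t) + 1 ≠ 0 := by
  rw [bar_mul]
  refine j.σ_ne_zero fun h0 => ?_
  obtain ⟨h1, h2⟩ := Prod.ext_iff.1 h0
  simp only [Prod.fst_zero, Prod.snd_zero] at h1 h2
  have h3 : (t' - t) ^ 2 < 4 := by nlinarith [sq_abs (t' - t), abs_nonneg (t' - t)]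
  nlinarith [sq_nonneg ‖j.u ξ‖, sq_nonneg (t + t')]

theorem P0_line (p p' : E × ℝ) (c : A) :
    j.P0 p' (j.σ p * c, c) = (j.σ p' * ((j.den p')⁻¹ • ((j.bar p' * j.σ p + 1) * c)),
      (j.den p')⁻¹ • ((j.bar p' * j.σ p + 1) * c)) := by
  rw [P0_apply, Prod.smul_mk, mul_smul_comm, add_mul, one_mul, mul_assoc (j.bar p')]

theorem V_line {ξ : E} {t : ℕ → ℝ} {n : ℕ} (h0 : t 0 ≠ 0) (h : ∀ k < n, |t (k + 1) - t k| < 2) :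
    ∃ c ≠ 0, j.V (fun k => ((ξ, t k) : E × ℝ)) n = (j.σ (ξ, t n) * c, c) := by
  induction n with
  | zero =>
    refine ⟨(j.den (ξ, t 0))⁻¹ • j.bar (ξ, t 0), ?_, ?_⟩
    · rw [← norm_pos_iff, norm_smul, norm_bar]
      have h2 := j.σ_ne_zero (p := (ξ, t 0)) (by simp [h0])
      exact mul_pos (norm_pos_iff.2 (inv_ne_zero (j.den_pos _).ne')) (norm_pos_iff.2 h2)
    · simp [V, P0_apply]
  | succ k ih =>
    obtain ⟨c, hc, hV⟩ := ih fun i hi => h i (by omega)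
    refine ⟨(j.den (ξ, t (k + 1)))⁻¹ • ((j.bar (ξ, t (k + 1)) * j.σ (ξ, t k) + 1) * c),
      smul_ne_zero (inv_ne_zero (j.den_pos _).ne') (mul_ne_zero (j.bar_mul_ne_zero ξ (h k (by omega))) hc), ?_⟩
    rw [V, hV, P_coe, P0_line]

theorem V_infty (n : ℕ) : j.V (fun _ => (∞ : OP (E × ℝ))) n = (1, 0) := by
  induction n with
  | zero => simp [V, Pinf]
  | succ k ih => simp [V, ih, Pinf]

theorem V_sm_ne_zero (q : OP E) {t : ℕ → ℝ} {n : ℕ} (h0 : t 0 ≠ 0) (h1 : t n ≠ 0)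
    (h : ∀ k < n, |t (k + 1) - t k| < 2) : (j.V (fun k => sm q (t k : OP ℝ)) n).1 ≠ 0 := by
  induction q using OnePoint.rec with
  | infty => simp [V_infty]
  | coe ξ =>
    obtain ⟨c, hc, hV⟩ := j.V_line (ξ := ξ) h0 h
    have : (fun k => sm (ξ : OP E) (t k : OP ℝ)) = fun k => (((ξ, t k) : E × ℝ) : OP (E × ℝ)) := by
      funext k; simp [sm]
    rw [this, hV]
    exact mul_ne_zero (j.σ_ne_zero (by simp [h1])) hc

/-- Half the stereographic projection of the direction of `a`. -/
def kap : A → OP E := pm {a | (j.σ.symm a).2 < ‖a‖}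
  fun a => (-(1 / 2) * (‖a‖ - (j.σ.symm a).2)⁻¹) • (j.σ.symm a).1

theorem kap_pos {a : A} (h : (j.σ.symm a).2 < ‖a‖) :
    j.kap a = ((-(1 / 2) * (‖a‖ - (j.σ.symm a).2)⁻¹) • (j.σ.symm a).1 : E) := if_pos h

theorem kap_neg {a : A} (h : ¬ (j.σ.symm a).2 < ‖a‖) : j.kap a = ∞ := if_neg h

theorem norm_sq_eq (a : A) : ‖a‖ ^ 2 = ‖j.u (j.σ.symm a).1‖ ^ 2 + (j.σ.symm a).2 ^ 2 := by
  rw [u, ← j.nrm]; simp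

theorem re_le (a : A) : (j.σ.symm a).2 ≤ ‖a‖ := by
  have := j.norm_sq_eq a
  nlinarith [norm_nonneg a, sq_nonneg ‖j.u (j.σ.symm a).1‖]

theorem continuousAt_kap {a : A} (ha : a ≠ 0) : ContinuousAt j.kap a := by
  rcases (j.re_le a).lt_or_eq with h | h
  · have hO : IsOpen {a | (j.σ.symm a).2 < ‖a‖} := isOpen_lt (by fun_prop) (by fun_prop)
    have h1 : ContinuousAt (fun a => (((-(1 / 2) * (‖a‖ - (j.σ.symm a).2)⁻¹) • (j.σ.symm a).1 : E) : OP E)) a := by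
      refine continuous_coe.continuousAt.comp ?_
      refine ContinuousAt.smul (continuousAt_const.mul (ContinuousAt.inv₀ (by fun_prop) ?_)) (by fun_prop)
      linarith
    refine h1.congr ?_
    filter_upwards [hO.mem_nhds h] with b hb
    exact (if_pos hb : j.kap b = _).symm
  · have h1 : j.kap a = ∞ := j.kap_neg (by simp [h])
    haveI : ProperSpace E := FiniteDimensional.proper_real E
    rw [ContinuousAt, h1, tendsto_infty_norm (E := E)]
    intro R
    obtain ⟨C, hC0, hC⟩ : ∃ C : ℝ, 0 ≤ C ∧ ∀ x, ‖j.u x‖ ≤ C * ‖x‖ := by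
      refine ⟨‖(j.σ : E × ℝ →L[ℝ] A)‖, norm_nonneg _, fun x => ?_⟩
      refine ((j.σ : E × ℝ →L[ℝ] A).le_opNorm (x, 0)).trans_eq ?_
      simp [Prod.norm_def]
    have h2 : ∀ᶠ b in 𝓝 a, 4 * (C * R) ^ 2 * (‖b‖ - (j.σ.symm b).2) < ‖b‖ + (j.σ.symm b).2 := by
      refine ContinuousAt.eventually_lt (by fun_prop) (by fun_prop) ?_
      rw [h]
      have := norm_pos_iff.2 ha
      nlinarith
    filter_upwards [h2] with b hb x hx
    obtain ⟨h3, rfl⟩ := pm_eq_coe.1 hx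
    by_contra! hR
    have h4 : 0 < ‖b‖ - (j.σ.symm b).2 := sub_pos.2 h3
    have h5 := (hC _).trans (mul_le_mul_of_nonneg_left hR hC0)
    rw [u_smul, norm_smul, Real.norm_eq_abs, abs_mul, abs_neg, abs_of_nonneg (by norm_num : (0:ℝ) ≤ 1/2),
      abs_of_pos (inv_pos.2 h4)] at h5
    have h6 := j.norm_sq_eq b
    have h7 : ‖j.u (j.σ.symm b).1‖ ≤ 2 * (C * R) * (‖b‖ - (j.σ.symm b).2) := by
      rw [← div_eq_mul_inv, div_mul_eq_mul_div, div_le_iff₀ h4] at h5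
      linarith
    have h8 : ‖j.u (j.σ.symm b).1‖ ^ 2 ≤ (2 * (C * R) * (‖b‖ - (j.σ.symm b).2)) ^ 2 :=
      pow_le_pow_left₀ (norm_nonneg _) h7 2
    nlinarith

theorem kap_one : j.kap 1 = ∞ := j.kap_neg (by
  have : j.σ.symm 1 = (0, 1) := by rw [← j.one]; simp
  simp [this])

theorem kap_smul {c : ℝ} (hc : 0 < c) (a : A) : j.kap (c • a) = j.kap a := by
  have h1 : j.σ.symm (c • a) = c • j.σ.symm a := _root_.map_smul _ _ _
  have h2 : ‖c • a‖ = c * ‖a‖ := by rw [norm_smul, Real.norm_of_nonneg hc.le]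
  by_cases h : (j.σ.symm a).2 < ‖a‖
  · rw [j.kap_pos h, kap_pos _ (by simpa [h1, h2, hc] using h), h1, h2]
    simp only [Prod.smul_fst, Prod.smul_snd, smul_eq_mul, ← mul_sub, smul_smul, mul_inv]
    congr 2
    field_simp
  · rw [j.kap_neg h, kap_neg _ (by simpa [h1, h2, hc] using h)]

theorem good_kap {Z : Type*} [TopologicalSpace Z] {a : Z → A} (ha : Good 1 a) (h : ∀ z, a z ≠ 0) :
    Good ∞ fun z => j.kap (a z) := by
  refine ⟨continuous_iff_continuousAt.2 fun z => (j.continuousAt_kap (h z)).comp ha.1.continuousAt, ?_⟩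
  have := (j.continuousAt_kap (one_ne_zero (α := A))).tendsto.comp ha.2
  rwa [kap_one] at this

end ImRe
end Hol
end SD

namespace SD
open Filter Topology OnePoint
section Hol
variable {E A : Type*} [NormedAddCommGroup E] [NormedSpace ℝ E] [FiniteDimensional ℝ E]
  [NormedDivisionRing A] [NormedAlgebra ℝ A] [FiniteDimensional ℝ A]

namespace ImRe
variable (j : ImRe E A)

def nrm' (ξ : E) : ℝ := ‖j.u ξ‖ ^ 2 + 1 / 4

theorem nrm'_pos (ξ : E) : 0 < j.nrm' ξ := by unfold nrm'; positivity

theorem norm_half (ξ : E) : ‖j.σ (ξ, 1 / 2)‖ ^ 2 = j.nrm' ξ := by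
  rw [j.nrm, nrm', u]; norm_num

def m (ξ : E) : A := 1 - (j.nrm' ξ)⁻¹ • j.σ (ξ, 1 / 2)
def w (ξ : E) : A := (j.nrm' ξ + 1 / 2)⁻¹ • j.u ξ

theorem tendsto_half : Tendsto (fun ξ => ‖j.σ (ξ, 1 / 2)‖) (cocompact E) atTop :=
  j.tendsto_norm.comp (tendsto_of_leftInv (p := fun ξ : E => (ξ, (1 / 2 : ℝ))) (r := Prod.fst) (by fun_prop) fun _ => rfl)

theorem continuous_u : Continuous j.u := by unfold u; fun_prop

theorem continuous_nrm' : Continuous j.nrm' := by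
  have := j.continuous_u
  unfold nrm'; fun_prop

theorem good_m : Good 1 j.m := by
  have h0 := j.continuous_nrm'
  constructor
  · unfold m
    exact continuous_const.sub ((h0.inv₀ fun ξ => (j.nrm'_pos ξ).ne').smul (by fun_prop))
  · have : Tendsto (fun ξ => (j.nrm' ξ)⁻¹ • j.σ (ξ, 1 / 2)) (cocompact E) (𝓝 0) := by
      rw [tendsto_zero_iff_norm_tendsto_zero]
      refine (tendsto_inv_atTop_zero.comp j.tendsto_half).congr fun ξ => ?_
      rw [norm_smul, norm_inv, Real.norm_of_nonneg (j.nrm'_pos ξ).le, ← norm_half, Function.comp]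
      have := (j.σ_ne_zero (p := (ξ, 1 / 2)) (by simp))
      have := norm_ne_zero_iff.2 this
      field_simp
    have h2 := (tendsto_const_nhds (x := (1 : A))).sub this
    rw [sub_zero] at h2
    exact h2

theorem good_w : Good 0 j.w := by
  have h0 := j.continuous_nrm'
  have h1 := j.continuous_u
  constructor
  · unfold w
    exact ((h0.add continuous_const).inv₀ fun ξ => (add_pos (j.nrm'_pos ξ) (by norm_num)).ne').smul h1
  · rw [tendsto_zero_iff_norm_tendsto_zero]
    refine squeeze_zero (fun _ => norm_nonneg _) (fun ξ => ?_) (tendsto_inv_atTop_zero.comp j.tendsto_half)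
    have h2 := j.nrm'_pos ξ
    have h3 := norm_pos_iff.2 (j.σ_ne_zero (p := (ξ, 1 / 2)) (by simp))
    have h4 : ‖j.u ξ‖ ≤ ‖j.σ (ξ, 1 / 2)‖ := by
      refine le_of_sq_le_sq ?_ h3.le
      rw [norm_half, nrm']; linarith
    rw [w, norm_smul, norm_inv, Real.norm_of_nonneg (by positivity), Function.comp, inv_mul_eq_div,
      div_le_iff₀ (by positivity), inv_mul_eq_div, le_div_iff₀ h3]
    have := j.norm_half ξ
    nlinarith

theorem m_eq (ξ : E) : j.m ξ = (j.nrm' ξ)⁻¹ • j.σ (-ξ, ‖j.u ξ‖ ^ 2 - 1 / 4) := by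
  have h := (j.nrm'_pos ξ).ne'
  rw [m, ← j.one, ← _root_.map_smul, ← _root_.map_smul, ← map_sub]
  congr 1
  ext
  · simp
  · simp; field_simp; unfold nrm'; ring

theorem m_ne_zero (ξ : E) : j.m ξ ≠ 0 := by
  rw [m_eq]
  refine smul_ne_zero (inv_ne_zero (j.nrm'_pos ξ).ne') (j.σ_ne_zero fun h => ?_)
  obtain ⟨h1, h2⟩ := Prod.ext_iff.1 h
  simp only [Prod.fst_zero, Prod.snd_zero, neg_eq_zero] at h1 h2
  subst h1
  have h3 : j.u 0 = 0 := by rw [u, Prod.mk_zero_zero, map_zero]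
  rw [h3] at h2
  norm_num at h2

theorem kap_m (ξ : E) : j.kap (j.m ξ) = ξ := by
  rw [m_eq, kap_smul _ (inv_pos.2 (j.nrm'_pos ξ))]
  have h1 : ‖j.σ (-ξ, ‖j.u ξ‖ ^ 2 - 1 / 4)‖ = j.nrm' ξ := by
    refine (sq_eq_sq₀ (norm_nonneg _) (j.nrm'_pos ξ).le).1 ?_
    rw [j.nrm]
    have := j.u_neg ξ
    simp only [u] at this
    rw [this, norm_neg, nrm', u]; ring
  have h2 : j.σ.symm (j.σ (-ξ, ‖j.u ξ‖ ^ 2 - 1 / 4)) = (-ξ, ‖j.u ξ‖ ^ 2 - 1 / 4) := j.σ.symm_apply_apply _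
  rw [kap_pos]
  · rw [h1, h2]
    simp only [nrm']
    rw [show ‖j.u ξ‖ ^ 2 + 1 / 4 - (‖j.u ξ‖ ^ 2 - 1 / 4) = 1 / 2 by ring]
    norm_num
  · rw [h1, h2]
    simp only [nrm']; linarith

theorem one_add_w_ne_zero (ξ : E) (s : ℝ) : 1 + s • j.w ξ ≠ 0 := by
  have h : 1 + s • j.w ξ = j.σ ((s * (j.nrm' ξ + 1 / 2)⁻¹) • ξ, 1) := by
    rw [σ_eq, u_smul, w, smul_smul, one_smul, add_comm]
  rw [h]
  exact j.σ_ne_zero (by simp)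

theorem P0_pair (ξ : E) : ∃ c : ℝ, 0 < c ∧ (j.P0 (ξ, 1 / 2) (j.P0 (ξ, -1 / 2) (1, 0))).1 = c • (j.m ξ * (1 + j.w ξ)) := by
  have h := j.nrm'_pos ξ
  refine ⟨(j.den (ξ, 1 / 2))⁻¹ * (j.den (ξ, -1 / 2))⁻¹ * j.nrm' ξ * (j.nrm' ξ + 1 / 2), ?_, ?_⟩
  · have := inv_pos.2 (j.den_pos (ξ, 1 / 2))
    have := inv_pos.2 (j.den_pos (ξ, -1 / 2))
    positivity
  · have h1 : j.P0 (ξ, -1 / 2) (1, 0) = (j.den (ξ, -1 / 2))⁻¹ • (j.σ (ξ, -1 / 2) * j.bar (ξ, -1 / 2), j.bar (ξ, -1 / 2)) := by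
      simp [P0_apply]
    rw [h1, _root_.map_smul, P0_line, bar_mul]
    simp only [Prod.smul_fst, mul_smul_comm, smul_smul]
    rw [m_eq, smul_mul_assoc, smul_smul, mul_comm (j.den (ξ, -1 / 2))⁻¹, mul_assoc (_ * _), mul_assoc (_ * _)]
    rw [← smul_smul _ (_ * _)]
    congr 1
    have h3 : (1 : A) + j.w ξ = (j.nrm' ξ + 1 / 2)⁻¹ • j.σ (ξ, j.nrm' ξ + 1 / 2) := by
      rw [σ_eq, w, smul_add, smul_smul, inv_mul_cancel₀ (by positivity), one_smul, add_comm]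
    rw [h3, mul_smul_comm, smul_smul, mul_assoc (j.nrm' ξ), mul_comm (_ + _ : ℝ) (_)⁻¹, ← mul_assoc, mul_comm (j.nrm' ξ),
      mul_assoc]
    have e1 := j.lin_mul ξ (1 * -1 / 2 + -1 / 2 * -1 / 2) 0 0 0
    have e2 := fun a b c d => j.lin_mul ξ a b c d
    have f1 : j.σ ((1 / 2 - -1 / 2 : ℝ) • ξ, -1 / 2 * (1 / 2) + ‖j.u ξ‖ ^ 2 + 1) * j.bar (ξ, -1 / 2) =
        j.bar (ξ, -1 / 2) * j.σ (ξ, j.nrm' ξ + 1 / 2) := by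
      have a1 := j.lin_mul ξ (-1 / 2 * (1 / 2) + ‖j.u ξ‖ ^ 2 + 1) 1 (-1 / 2) (-1)
      have a2 := j.lin_mul ξ (-1 / 2) (-1) (j.nrm' ξ + 1 / 2) 1
      simp only [neg_smul, one_smul] at a1 a2
      rw [bar, show (1 / 2 - -1 / 2 : ℝ) = 1 by norm_num, one_smul, a1, a2]
      congr 1
      unfold nrm'
      ext <;> simp <;> ring_nf
    have f2 : j.σ (ξ, 1 / 2) * j.bar (ξ, -1 / 2) = j.σ (-ξ, ‖j.u ξ‖ ^ 2 - 1 / 4) := by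
      have a1 := j.lin_mul ξ (1 / 2) 1 (-1 / 2) (-1)
      simp only [neg_smul, one_smul] at a1
      rw [bar, a1]
      congr 1
      ext
      · simp only; module
      · simp only; ring
    rw [f1, ← mul_assoc, f2]
    have h5 : (j.nrm' ξ + 1 / 2) * (j.nrm' ξ)⁻¹ * (j.nrm' ξ * (j.nrm' ξ + 1 / 2)⁻¹) = 1 := by field_simp
    first
      | rw [h5, one_smul]
      | (convert (one_smul ℝ _).symm using 2; field_simp)

end ImRe
end Hol
end SD

namespace SD
open Filter Topology OnePoint
section Hol
variable {E A : Type*} [NormedAddCommGroup E] [NormedSpace ℝ E] [FiniteDimensional ℝ E]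
  [NormedDivisionRing A] [NormedAlgebra ℝ A] [FiniteDimensional ℝ A]

namespace ImRe
variable (j : ImRe E A)

theorem V_std {a b : OP (E × ℝ)} {n : ℕ} {z : ℕ → OP (E × ℝ)} (ha : ∀ k < n, z k = a) (hb : ∀ k, n ≤ k → z k = b)
    (hn : 0 < n) (k : ℕ) : j.V z (n + k) = j.P b (j.P a (1, 0)) := by
  have h1 : ∀ k < n, j.V z k = j.P a (1, 0) := fun k hk => by
    induction k with
    | zero => rw [V, ha 0 hk]
    | succ k ih => rw [V, ha _ hk, ih (by omega), P_idem]
  induction k with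
  | zero =>
    obtain ⟨m, rfl⟩ := Nat.exists_eq_add_of_lt hn
    rw [zero_add, add_zero, V, hb _ (by omega), h1 _ (by omega)]
  | succ k ih => rw [← add_assoc, V, hb _ (by omega), ih, P_idem]

theorem htp_std {X : Type*} [TopologicalSpace X] {f : X → OP E} (hf : Good ∞ f) :
    Htp ∞ (fun x => j.kap (j.P (sm (f x) ((1 / 2 : ℝ) : OP ℝ)) (j.P (sm (f x) ((-1 / 2 : ℝ) : OP ℝ)) (1, 0))).1) f := by
  let M : OP E → A := fun q => q.elim 1 j.m
  let W : OP E → A := fun q => q.elim 0 j.w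
  have hM : Continuous M := j.good_m.ext
  have hW : Continuous W := j.good_w.ext
  have hM0 : ∀ q, M q ≠ 0 := fun q => by
    induction q using OnePoint.rec with
    | infty => exact one_ne_zero
    | coe ξ => exact j.m_ne_zero ξ
  have hW0 : ∀ q (s : ℝ), 1 + s • W q ≠ 0 := fun q s => by
    induction q using OnePoint.rec with
    | infty => simp [W]
    | coe ξ => exact j.one_add_w_ne_zero ξ s
  refine ⟨fun y => j.kap (M (f y.2) * (1 + (1 - y.1 : ℝ) • W (f y.2))), j.good_kap ?_ fun y =>
    mul_ne_zero (hM0 _) (hW0 _ _), fun x => ?_, fun x => ?_⟩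
  · have h2 := hf.comp continuous_snd (tendsto_snd_cocompact I)
    constructor
    · have := hf.1
      fun_prop
    · have h3 := (hM.tendsto _).comp h2.2
      have h4 : Tendsto (fun y : I × X => W (f y.2)) (cocompact _) (𝓝 0) := (hW.tendsto _).comp h2.2
      have h5 : Tendsto (fun y : I × X => (1 - y.1 : ℝ) • W (f y.2)) (cocompact _) (𝓝 0) := by
        rw [tendsto_zero_iff_norm_tendsto_zero] at h4 ⊢
        refine squeeze_zero (fun _ => norm_nonneg _) (fun y => ?_) h4
        rw [norm_smul, Real.norm_of_nonneg (by linarith [y.1.2.2])]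
        exact mul_le_of_le_one_left (norm_nonneg _) (by linarith [y.1.2.1])
      have h6 := h3.mul (h5.const_add 1)
      simpa [M] using h6
  · simp only [Set.Icc.coe_zero, sub_zero, one_smul]
    generalize f x = q
    induction q using OnePoint.rec with
    | infty => simp [M, W, Pinf, kap_one]
    | coe ξ =>
      obtain ⟨c, hc, h⟩ := j.P0_pair ξ
      have e : ∀ t : ℝ, sm (ξ : OP E) (t : OP ℝ) = ((ξ, t) : E × ℝ) := fun t => rfl
      rw [e, e, P_coe, P_coe, h, j.kap_smul hc]
      rfl
  · simp only [Set.Icc.coe_one, sub_self, zero_smul, add_zero, mul_one]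
    generalize f x = q
    induction q using OnePoint.rec with
    | infty => exact j.kap_one
    | coe ξ => exact j.kap_m ξ

theorem _root_.SD.good_nodes {X : Type*} [TopologicalSpace X] {f : X → OP E} (hf : Good ∞ f) {t : I → ℝ}
    (ht : Continuous t) : Good ∞ fun y : I × X => sm (f y.2) (t y.1 : OP ℝ) :=
  (good_Sus hf).comp (p := fun y : I × X => (y.2, t y.1)) (by fun_prop)
    (tendsto_of_comp (r := Prod.fst) continuous_fst (tendsto_snd_cocompact I))

theorem _root_.SD.good_unif {Y M : Type*} [MetricSpace Y] [NormedAddCommGroup M] {g : Y → M} {a : M} (h : Good a g) :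
    (∃ δ > 0, ∀ y y', dist y y' < δ → ‖g y - g y'‖ < 1 / 2) ∧ ∃ C, IsCompact C ∧ ∀ y, y ∉ C → ‖g y - a‖ < 1 / 2 := by
  constructor
  · obtain ⟨δ, hδ, hd⟩ := Metric.uniformContinuous_iff.1 (h.1.uniformContinuous_of_tendsto_cocompact h.2) (1 / 2) (by norm_num)
    exact ⟨δ, hδ, fun y y' hy => by rw [← dist_eq_norm]; exact hd hy⟩
  · obtain ⟨C, hC, hCs⟩ := mem_cocompact.1 (h.2 (Metric.ball_mem_nhds a (by norm_num : (0 : ℝ) < 1 / 2)))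
    exact ⟨C, hC, fun y hy => by rw [← dist_eq_norm]; exact hCs hy⟩

theorem null_V {X : Type*} [TopologicalSpace X] {H : I × (X × ℝ) → OP (E × ℝ)} (hH : Good ∞ H)
    (hH1 : ∀ x, H (1, x) = ∞) (t : ℕ → ℝ) (n : ℕ)
    (h0 : ∀ y : I × X, (j.V (fun k => H (y.1, (y.2, t k))) n).1 ≠ 0) :
    Null ∞ fun x => j.kap (j.V (fun k => H (0, (x, t k))) n).1 := by
  have hz : ∀ k, Good ∞ fun y : I × X => H (y.1, (y.2, t k)) := fun k =>
    hH.comp (p := fun y : I × X => (y.1, (y.2, t k))) (by fun_prop)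
      (tendsto_of_leftInv (r := fun z : I × (X × ℝ) => (z.1, z.2.1)) (by fun_prop) fun y => rfl)
  refine ⟨fun y => j.kap (j.V (fun k => H (y.1, (y.2, t k))) n).1,
    j.good_kap ((j.good_V hz _).post continuous_fst rfl) h0, fun x => rfl, fun x => ?_⟩
  simp only [hH1, V_infty, kap_one]

theorem htp_V {X : Type*} [TopologicalSpace X] {f : X → OP E} (hf : Good ∞ f) (t t' : ℕ → ℝ) (n : ℕ)
    (h0 : ∀ (e : I) (x : X), (j.V (fun k => sm (f x) (((1 - e) * t k + e * t' k : ℝ) : OP ℝ)) n).1 ≠ 0) :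
    Htp ∞ (fun x => j.kap (j.V (fun k => sm (f x) (t k : OP ℝ)) n).1)
      (fun x => j.kap (j.V (fun k => sm (f x) (t' k : OP ℝ)) n).1) := by
  have hz : ∀ k, Good ∞ fun y : I × X => sm (f y.2) (((1 - y.1) * t k + y.1 * t' k : ℝ) : OP ℝ) := fun k =>
    good_nodes hf (t := fun e => (1 - e) * t k + e * t' k) (by fun_prop)
  refine ⟨fun y => j.kap (j.V (fun k => sm (f y.2) (((1 - y.1) * t k + y.1 * t' k : ℝ) : OP ℝ)) n).1,
    j.good_kap ((j.good_V hz _).post continuous_fst rfl) fun y => h0 _ _, fun x => ?_, fun x => ?_⟩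
  · simp
  · simp

theorem unif_P {Y : Type*} [MetricSpace Y] {H : Y → OP (E × ℝ)} (hH : Good ∞ H) :
    (∃ δ > 0, ∀ y y', dist y y' < δ → ‖j.P (H y) - j.P (H y')‖ < 1 / 2) ∧
      ∃ C, IsCompact C ∧ ∀ y, y ∉ C → ‖j.P (H y) - Pinf‖ < 1 / 2 := by
  have hP : Good Pinf fun y => j.P (H y) := hH.post j.continuous_P rfl
  exact good_unif (M := A × A →L[ℝ] A × A) (g := fun y => j.P (H y)) (a := Pinf) (by exact hP)

theorem null_of_null_Sus (j : ImRe E A) {X : Type*} [MetricSpace X] {f : X → OP E} (hf : Good ∞ f) (h : Null ∞ (Sus f)) :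
    Null ∞ f := by
  obtain ⟨H, hH, hH0, hH1⟩ := h
  obtain ⟨⟨δ, hδ, hd⟩, C, hC, hCs⟩ := j.unif_P hH
  obtain ⟨T, hT⟩ := hC.exists_bound_of_continuousOn (f := fun y : I × (X × ℝ) => y.2.2) (by fun_prop)
  have hfar : ∀ y : I × (X × ℝ), T < |y.2.2| → ‖j.P (H y) - Pinf‖ < 1 / 2 := fun y hy =>
    hCs y fun hyC => hy.not_ge (hT y hyC)
  set s := min (δ / 2) 1 with hs
  have hs0 : 0 < s := by positivity
  have hs1 : s ≤ 1 := min_le_right _ _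
  have hs2 : s < δ := (min_le_left _ _).trans_lt (by linarith)
  obtain ⟨N, hN⟩ := exists_nat_gt (T / s)
  set n := N + 1 with hn
  have hnT : T < (n - 1 / 2 : ℝ) * s := by
    rw [div_lt_iff₀ hs0] at hN
    have : (n : ℝ) = N + 1 := by rw [hn]; push_cast; ring
    rw [this]; nlinarith
  have hnp : (1 : ℝ) ≤ n := by rw [hn]; push_cast; linarith [(Nat.cast_nonneg N : (0 : ℝ) ≤ N)]
  obtain ⟨t, ht, hlast, hfirst⟩ : ∃ t : ℕ → ℝ, (∀ k, t (k + 1) - t k = s) ∧ t (n + N) = (n - 1 / 2) * s ∧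
      t 0 = -((n - 1 / 2) * s) :=
    ⟨fun k => (k - n + 1 / 2) * s, fun k => by push_cast; ring, by rw [hn]; push_cast; ring, by push_cast; ring⟩
  obtain ⟨t', ht0, ht1, ht2⟩ : ∃ t' : ℕ → ℝ, (∀ k < n, t' k = -1 / 2) ∧ (∀ k, n ≤ k → t' k = 1 / 2) ∧
      ∀ k, 0 ≤ t' (k + 1) - t' k ∧ t' (k + 1) - t' k ≤ 1 :=
    ⟨fun k => if k < n then -1 / 2 else 1 / 2, fun k hk => if_pos hk, fun k hk => if_neg (by omega), fun k => by
      dsimp only; split_ifs <;> first | (exfalso; omega) | norm_num⟩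
  have hn0 : 0 < n := by omega
  have hnN : n ≤ n + N := by omega
  clear_value n s
  have hpos : 0 < (n - 1 / 2 : ℝ) * s := mul_pos (by linarith) hs0
  have A1 : Null ∞ fun x => j.kap (j.V (fun k => H (0, (x, t k))) (n + N)).1 := by
    refine j.null_V hH (fun x => hH1 x) t _ fun y => ?_
    refine j.V_fst_ne_zero (z := fun k => H (y.1, (y.2, t k))) (hfar (y.1, (y.2, t 0)) ?_) (fun k _ => ?_)
      (hfar (y.1, (y.2, t (n + N))) ?_)
    · simp only [hfirst, abs_neg, abs_of_pos hpos, hnT]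
    · refine hd (y.1, (y.2, t (k + 1))) (y.1, (y.2, t k)) ?_
      simp only [Prod.dist_eq, dist_self, Real.dist_eq, ht, abs_of_pos hs0]
      simp [hs2, hδ]
    · simp only [hlast, abs_of_pos hpos, hnT]
  have A2 : Htp ∞ (fun x => j.kap (j.V (fun k => sm (f x) (t k : OP ℝ)) (n + N)).1)
      (fun x => j.kap (j.V (fun k => sm (f x) (t' k : OP ℝ)) (n + N)).1) := by
    refine j.htp_V hf t t' _ fun e x => ?_
    have e0 := e.2.1
    have e1 := sub_nonneg.2 e.2.2
    have hc : 0 < (1 - e : ℝ) * ((n - 1 / 2) * s) + e * (1 / 2) := by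
      rcases e0.eq_or_lt with h | h
      · rw [← h]; linarith
      · have := mul_nonneg e1 hpos.le
        linarith
    refine j.V_sm_ne_zero _ ?_ ?_ fun k _ => ?_
    · have := ht0 0 hn0
      simp only [this, hfirst]
      exact ne_of_lt (by linarith)
    · have := ht1 _ hnN
      simp only [this, hlast]
      exact hc.ne'
    · have h1 : ((1 - e) * t (k + 1) + e * t' (k + 1) : ℝ) - ((1 - e) * t k + e * t' k) = (1 - e) * s + e * (t' (k + 1) - t' k) := by
        rw [← ht k]; ring
      have h2 := ht2 k
      rw [h1, abs_lt]
      constructor <;> nlinarith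
  have A4 : (fun x => j.kap (j.V (fun k => sm (f x) (t' k : OP ℝ)) (n + N)).1) =
      (fun x => j.kap (j.P (sm (f x) ((1 / 2 : ℝ) : OP ℝ)) (j.P (sm (f x) ((-1 / 2 : ℝ) : OP ℝ)) (1, 0))).1) := by
    funext x
    rw [j.V_std (a := sm (f x) ((-1 / 2 : ℝ) : OP ℝ)) (b := sm (f x) ((1 / 2 : ℝ) : OP ℝ)) (n := n)]
    · intro k hk; simp only [ht0 k hk]
    · intro k hk; simp only [ht1 k hk]
    · exact hn0
  rw [A4] at A2
  simp only [hH0] at A1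
  exact (A1.of_htp A2).of_htp (j.htp_std hf)

end ImRe
end Hol
end SD

namespace SD
open Filter Topology OnePoint

section KGen
variable {X Y Z A B : Type*} [TopologicalSpace X] [TopologicalSpace Y] [TopologicalSpace Z] [TopologicalSpace A] [TopologicalSpace B]
variable {E F : Type*} [NormedAddCommGroup E] [NormedSpace ℝ E] [ProperSpace E]
  [NormedAddCommGroup F] [NormedSpace ℝ F] [ProperSpace F]

/-- Properness of `F` follows from that of `G` when the finite values of `F` lift to `G`. -/
theorem good_of_lift {F : X → OP E} (hF : Continuous F) {G : Z → OP E} (hG : Good ∞ G) {r : Z → X} (hr : Continuous r)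
    (h : ∀ x v, F x = ↑(v : E) → ∃ z, r z = x ∧ G z = ↑v) : Good ∞ F := by
  refine good_iff.2 ⟨hF, fun R => ⟨_, (hG.isCompact_le R).image hr, fun x v hx hv => ?_⟩⟩
  obtain ⟨z, hz, hzv⟩ := h x v hx
  exact ⟨z, ⟨v, hv, hzv⟩, hz⟩

theorem good_pair {f : A → OP E} {g : B → OP F} (hf : Good ∞ f) (hg : Good ∞ g) {p : X → A} {q : X → B} {r : A × B → X}
    (hp : Continuous p) (hq : Continuous q) (hr : Continuous r) (h : ∀ x, r (p x, q x) = x) :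
    Good ∞ fun x => sm (f (p x)) (g (q x)) :=
  (good_sm hf hg).comp (p := fun x => (p x, q x)) (by fun_prop) (tendsto_of_leftInv hr h)

theorem good_ite {F G : X → OP E} (hF : Good ∞ F) (hG : Good ∞ G) {σ : X → ℝ} (hσ : Continuous σ)
    (h : ∀ x, σ x = 0 → F x = G x) : Good ∞ fun x => if 0 < σ x then F x else G x := by
  have h1 : IsClosed {x | 0 ≤ σ x} := isClosed_le continuous_const hσ
  have h2 : IsClosed {x | σ x ≤ 0} := isClosed_le hσ continuous_const
  refine good_union h1 h2 (by ext x; simpa using le_total 0 (σ x)) ?_ ?_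
  · have : (fun x : {x | 0 ≤ σ x} => if 0 < σ x then F x else G x) = fun x : {x | 0 ≤ σ x} => F x := by
      funext x
      split_ifs with hx
      · rfl
      · exact (h x (le_antisymm (not_lt.1 hx) x.2)).symm
    rw [this]
    exact hF.comp continuous_subtype_val h1.isClosedEmbedding_subtypeVal.tendsto_cocompact
  · have : (fun x : {x | σ x ≤ 0} => if 0 < σ x then F x else G x) = fun x : {x | σ x ≤ 0} => G x := by
      funext x
      exact if_neg (not_lt.2 x.2)
    rw [this]
    exact hG.comp continuous_subtype_val h2.isClosedEmbedding_subtypeVal.tendsto_cocompact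

theorem good_exp [T2Space X] {f : X × ℝ → OP E} (hf : Good ∞ f) (h : ∀ x, f (x, 0) = ∞) :
    Good ∞ fun q : X × ℝ => f (q.1, Real.exp q.2) := by
  refine good_iff.2 ⟨hf.1.comp (by fun_prop), fun R => ?_⟩
  have hK := (hf.isCompact_le R).inter_right (isClosed_le continuous_const continuous_snd : IsClosed {q : X × ℝ | (0 : ℝ) ≤ q.2})
  refine ⟨_, hK.image_of_continuousOn (f := fun q : X × ℝ => (q.1, Real.log q.2)) ?_, fun q v hq hv => ?_⟩
  · refine continuousOn_fst.prodMk (continuousOn_snd.log ?_)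
    rintro ⟨x, δ⟩ ⟨⟨v, -, hv⟩, -⟩ (rfl : δ = 0)
    exact OnePoint.infty_ne_coe v ((h x).symm.trans hv)
  · exact ⟨(q.1, Real.exp q.2), ⟨⟨v, hv, hq⟩, (Real.exp_pos _).le⟩, by simp⟩

def unlog (f : X × ℝ → OP E) (q : X × ℝ) : OP E := if 0 < q.2 then f (q.1, Real.log q.2) else ∞

theorem good_unlog [T2Space X] {f : X × ℝ → OP E} (hf : Good ∞ f) : Good ∞ (unlog f) := by
  have hc : ∀ R, IsCompact ((fun q : X × ℝ => (q.1, Real.exp q.2)) '' {z | ∃ x : E, ‖x‖ ≤ R ∧ f z = ↑x}) :=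
    fun R => (hf.isCompact_le R).image (by fun_prop)
  have key : ∀ R, ∀ x, ∀ v : E, unlog f x = ↑v → ‖v‖ ≤ R →
      x ∈ ((fun q : X × ℝ => (q.1, Real.exp q.2)) '' {z | ∃ x : E, ‖x‖ ≤ R ∧ f z = ↑x}) := fun R x v hx hv => by
    rw [unlog] at hx
    split_ifs at hx with h0
    · exact ⟨(x.1, Real.log x.2), ⟨v, hv, hx⟩, by simp [Real.exp_log h0]⟩
    · exact absurd hx (OnePoint.infty_ne_coe v)
  refine good_iff.2 ⟨continuous_iff_continuousAt.2 fun q => ?_, fun R => ⟨_, hc R, key R⟩⟩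
  by_cases hq : 0 < q.2
  · have h1 : ContinuousAt (fun q : X × ℝ => f (q.1, Real.log q.2)) q :=
      hf.1.continuousAt.comp (continuousAt_fst.prodMk (continuousAt_snd.log hq.ne'))
    refine h1.congr ?_
    filter_upwards [(isOpen_lt continuous_const continuous_snd).mem_nhds hq] with z hz
    exact (if_pos hz).symm
  · have : unlog f q = ∞ := if_neg hq
    rw [ContinuousAt, this, tendsto_infty_norm]
    intro R
    have hn : q ∈ ((fun q : X × ℝ => (q.1, Real.exp q.2)) '' {z | ∃ x : E, ‖x‖ ≤ R ∧ f z = ↑x})ᶜ := by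
      rintro ⟨z, -, rfl⟩
      exact hq (Real.exp_pos _)
    filter_upwards [(hc R).isClosed.isOpen_compl.mem_nhds hn] with x hx v hv
    by_contra hR
    exact hx (key R x v hv (not_lt.1 hR))

end KGen
end SD

namespace SD
open Filter Topology OnePoint

section Zoom
variable {V W : Type*} [NormedAddCommGroup V] [NormedSpace ℝ V] [NormedAddCommGroup W] [NormedSpace ℝ W]

def zoom (f : V → W) (M : V →L[ℝ] W) (p : V) (q : ℝ × V) : W :=
  if q.1 = 0 then M q.2 else q.1⁻¹ • (f (p + q.1 • q.2) - f p)

theorem continuousAt_zoom_zero {f : V → W} {M : V →L[ℝ] W} {p : V} (h : HasFDerivAt f M p) (u : V) :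
    ContinuousAt (zoom f M p) (0, u) := by
  have h0 : zoom f M p (0, u) = M u := if_pos rfl
  have h2 : Tendsto (fun q : ℝ × V => zoom f M p q - M q.2) (𝓝 (0, u)) (𝓝 0) := by
    rw [Metric.tendsto_nhds]
    intro ε hε
    have hd : 0 < ε / (‖u‖ + 2) := by positivity
    have hh := (hasFDerivAt_iff_isLittleO_nhds_zero.1 h).def hd
    have hc : Tendsto (fun q : ℝ × V => q.1 • q.2) (𝓝 (0, u)) (𝓝 0) := by
      have : Continuous fun q : ℝ × V => q.1 • q.2 := by fun_prop
      simpa using this.tendsto (0, u)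
    have hb : ∀ᶠ q : ℝ × V in 𝓝 (0, u), ‖q.2‖ < ‖u‖ + 1 :=
      (continuous_snd.norm.tendsto (0, u)).eventually (gt_mem_nhds (by simp))
    filter_upwards [hc.eventually hh, hb] with q hq hqb
    rw [dist_zero_right, zoom]
    split_ifs with h1
    · simpa using hε
    · have e : q.1⁻¹ • (f (p + q.1 • q.2) - f p) - M q.2 = q.1⁻¹ • (f (p + q.1 • q.2) - f p - M (q.1 • q.2)) := by
        rw [_root_.map_smul, smul_sub _ _ (q.1 • M q.2), inv_smul_smul₀ h1]
      rw [e, norm_smul, norm_inv]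
      have h1' : 0 < ‖q.1‖ := norm_pos_iff.2 h1
      rw [norm_smul] at hq
      calc ‖q.1‖⁻¹ * ‖f (p + q.1 • q.2) - f p - M (q.1 • q.2)‖
          ≤ ‖q.1‖⁻¹ * (ε / (‖u‖ + 2) * (‖q.1‖ * ‖q.2‖)) := by gcongr
        _ = ε / (‖u‖ + 2) * ‖q.2‖ := by field_simp
        _ ≤ ε / (‖u‖ + 2) * (‖u‖ + 1) := by gcongr
        _ < ε / (‖u‖ + 2) * (‖u‖ + 2) := by gcongr; linarith
        _ = ε := by field_simp
  rw [ContinuousAt, h0]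
  have h3 : Tendsto (fun q : ℝ × V => M q.2) (𝓝 (0, u)) (𝓝 (M u)) :=
    (M.continuous.comp continuous_snd).tendsto _
  simpa using h2.add h3

theorem continuousOn_zoom {f : V → W} {M : V →L[ℝ] W} {p : V} (h : HasFDerivAt f M p) {U : Set V} (hU : IsOpen U)
    (hf : ContinuousOn f U) : ContinuousOn (zoom f M p) {q : ℝ × V | p + q.1 • q.2 ∈ U} := by
  rintro ⟨c, u⟩ hq
  apply ContinuousAt.continuousWithinAt
  rcases eq_or_ne c 0 with rfl | hc
  · exact continuousAt_zoom_zero h u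
  · have h1 : ContinuousAt (fun q : ℝ × V => q.1⁻¹ • (f (p + q.1 • q.2) - f p)) (c, u) := by
      have h2 : ContinuousAt (fun q : ℝ × V => f (p + q.1 • q.2)) (c, u) :=
        ContinuousAt.comp (f := fun q : ℝ × V => p + q.1 • q.2) (hf.continuousAt (hU.mem_nhds hq)) (by fun_prop)
      have h3 : ContinuousAt (fun q : ℝ × V => q.1⁻¹) (c, u) := continuousAt_fst.inv₀ hc
      exact h3.smul (h2.sub continuousAt_const)
    refine h1.congr ?_
    filter_upwards [(isOpen_ne.preimage continuous_fst).mem_nhds (show (c, u) ∈ Prod.fst ⁻¹' {x : ℝ | x ≠ 0} from hc)] with z hz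
    exact (if_neg hz).symm

variable [FiniteDimensional ℝ V] [FiniteDimensional ℝ W]

/-- Alexander's trick: a collapse map along a chart onto an open set is homotopic to an affine map. -/
theorem htp_zoom {O : Set V} (hO : IsOpen O) {φ : V → W} {ψ : W → V} (hφ : ContinuousOn φ O) (hψ : Continuous ψ)
    (h1 : ∀ w, ψ w ∈ O) (h2 : ∀ w, φ (ψ w) = w) (h3 : ∀ v ∈ O, ψ (φ v) = v)
    (hd : DifferentiableAt ℝ φ (ψ 0)) (hd' : DifferentiableAt ℝ ψ 0) :
    ∃ A : V ≃ₜ W, Htp ∞ (pm O φ) (fun v => (A v : OP W)) := by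
  haveI : ProperSpace W := FiniteDimensional.proper ℝ W
  set p := ψ 0 with hp
  have hpO : p ∈ O := h1 0
  have hφp : φ p = 0 := h2 0
  set M := fderiv ℝ φ p
  set M' := fderiv ℝ ψ 0
  have hM : HasFDerivAt φ M p := hd.hasFDerivAt
  have hM' : HasFDerivAt ψ M' 0 := hd'.hasFDerivAt
  have c1 : ∀ v, M' (M v) = v := fun v => by
    have e1 : HasFDerivAt (fun v => ψ (φ v)) (M'.comp M) p := by
      have : HasFDerivAt ψ M' (φ p) := by rwa [hφp]
      exact this.comp p hM
    have e2 : HasFDerivAt (fun v => ψ (φ v)) (ContinuousLinearMap.id ℝ V) p :=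
      (hasFDerivAt_id p).congr_of_eventuallyEq (by filter_upwards [hO.mem_nhds hpO] with v hv; exact h3 v hv)
    exact DFunLike.congr_fun (e1.unique e2) v
  have c2 : ∀ w, M (M' w) = w := fun w => by
    have e1 : HasFDerivAt (fun w => φ (ψ w)) (M.comp M') 0 := by
      have : HasFDerivAt φ M (ψ 0) := hM
      exact this.comp 0 hM'
    have e2 : HasFDerivAt (fun w => φ (ψ w)) (ContinuousLinearMap.id ℝ W) 0 := by
      simp only [h2]; exact hasFDerivAt_id 0
    exact DFunLike.congr_fun (e1.unique e2) w
  let A : V ≃ₜ W :=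
    { toFun := fun v => M (v - p), invFun := fun w => M' w + p
      left_inv := fun v => by simp [c1], right_inv := fun w => by simp [c2]
      continuous_toFun := by fun_prop, continuous_invFun := by fun_prop }
  refine ⟨A, ?_⟩
  let cc : I × V → ℝ × V := fun q => (1 - q.1, q.2 - p)
  have hcc : Continuous cc := by fun_prop
  let Ω : Set (I × V) := cc ⁻¹' {q | p + q.1 • q.2 ∈ O}
  have hΩ : IsOpen Ω := (hO.preimage (by fun_prop : Continuous fun q : ℝ × V => p + q.1 • q.2)).preimage hcc
  let Ψ : I × W → I × V := fun q => (q.1, zoom ψ M' 0 (1 - q.1, q.2) + p)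
  have hΨ : Continuous Ψ := by
    have : Continuous (zoom ψ M' 0) := by
      rw [← continuousOn_univ]
      simpa using continuousOn_zoom hM' isOpen_univ hψ.continuousOn
    fun_prop
  have hg : Good ∞ (pm Ω fun q => zoom φ M p (cc q)) := by
    refine good_pm hΩ ((continuousOn_zoom hM hO hφ).comp hcc.continuousOn fun q hq => hq) fun R =>
      ⟨Ψ '' (univ ×ˢ Metric.closedBall 0 R), (isCompact_univ.prod (isCompact_closedBall _ _)).image hΨ, ?_, ?_⟩
    · rintro _ ⟨⟨e, w⟩, -, rfl⟩
      show p + (1 - e : ℝ) • (zoom ψ M' 0 (1 - e, w) + p - p) ∈ O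
      rw [add_sub_cancel_right, zoom]
      split_ifs with he
      · simp only at he
        simpa [he] using hpO
      · simp only at he
        rw [smul_inv_smul₀ he, zero_add, ← hp, add_sub_cancel]
        exact h1 _
    · rintro ⟨e, v⟩ hq hR
      refine ⟨(e, zoom φ M p (cc (e, v))), ⟨mem_univ _, by simpa using hR⟩, Prod.ext rfl ?_⟩
      show zoom ψ M' 0 (1 - e, zoom φ M p (1 - e, v - p)) + p = v
      have hq : p + (1 - e : ℝ) • (v - p) ∈ O := hq
      by_cases he : (1 - e : ℝ) = 0
      · simp [zoom, he, c1]
      · simp only [zoom, he, if_false, hφp, sub_zero]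
        rw [smul_inv_smul₀ he, zero_add, h3 _ hq, ← hp, add_sub_cancel_left, inv_smul_smul₀ he, sub_add_cancel]
  refine ⟨_, hg, fun v => ?_, fun v => ?_⟩
  · have e : zoom φ M p (cc (0, v)) = φ v := by simp [zoom, cc, hφp]
    by_cases hv : v ∈ O
    · rw [pm_of_mem hv, pm_of_mem (by simpa [Ω, cc] using hv), e]
    · rw [pm_of_notMem hv, pm_of_notMem (by simpa [Ω, cc] using hv)]
  · rw [pm_of_mem (by simpa [Ω, cc] using hpO)]
    simp [zoom, cc, A]

end Zoom
end SD

namespace SD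
open Filter Topology OnePoint

section KUniv

def reta (a b x : ℝ) : ℝ := ((a ^ 2 + b ^ 2 - 1) * a - x * (a ^ 2 + b ^ 2 + 1) * b) / (2 * (a ^ 2 + b ^ 2))
def imeta (a b x : ℝ) : ℝ := ((a ^ 2 + b ^ 2 - 1) * b + x * (a ^ 2 + b ^ 2 + 1) * a) / (2 * (a ^ 2 + b ^ 2))

/-- The Hopf-type pairing in stereographic coordinates. -/
def etab : ℂ × ℝ → OP ℂ := pm {q | q.1 ≠ 0} fun q => ⟨reta q.1.re q.1.im q.2, imeta q.1.re q.1.im q.2⟩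

theorem sq_ne {z : ℂ} (h : z ≠ 0) : z.re ^ 2 + z.im ^ 2 ≠ 0 := fun h0 => h <| by
  apply Complex.ext <;> simp <;> nlinarith [sq_nonneg z.re, sq_nonneg z.im]

theorem reta_sq_add (a b x : ℝ) (h : a ^ 2 + b ^ 2 ≠ 0) : reta a b x ^ 2 + imeta a b x ^ 2 =
    ((a ^ 2 + b ^ 2 - 1) ^ 2 + x ^ 2 * (a ^ 2 + b ^ 2 + 1) ^ 2) / (4 * (a ^ 2 + b ^ 2)) := by
  rw [reta, imeta]; field_simp; ring

theorem good_etab : Good ∞ etab := by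
  refine good_pm (isOpen_ne_fun continuous_fst continuous_const) ?_ fun R => ?_
  · have h1 : ContinuousOn (fun q : ℂ × ℝ => reta q.1.re q.1.im q.2) {q | q.1 ≠ 0} := by
      refine ContinuousOn.div (by fun_prop) (by fun_prop) fun q hq => ?_
      have := sq_ne hq
      positivity
    have h2 : ContinuousOn (fun q : ℂ × ℝ => imeta q.1.re q.1.im q.2) {q | q.1 ≠ 0} := by
      refine ContinuousOn.div (by fun_prop) (by fun_prop) fun q hq => ?_
      have := sq_ne hq
      positivity
    exact Complex.equivRealProdCLM.symm.continuous.comp_continuousOn (h1.prodMk h2)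
  · have hM : 0 < 2 + 4 * R ^ 2 := by positivity
    refine ⟨{q | 1 ≤ (2 + 4 * R ^ 2) * (q.1.re ^ 2 + q.1.im ^ 2) ∧ q.1.re ^ 2 + q.1.im ^ 2 ≤ 2 + 4 * R ^ 2 ∧ q.2 ^ 2 ≤ R ^ 2}, ?_, ?_, ?_⟩
    · refine Metric.isCompact_of_isClosed_isBounded ?_ ?_
      · simp only [setOf_and]
        exact IsClosed.inter (isClosed_le (by fun_prop) (by fun_prop)) (IsClosed.inter (isClosed_le (by fun_prop) (by fun_prop)) (isClosed_le (by fun_prop) (by fun_prop)))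
      · refine (Metric.isBounded_iff_subset_closedBall 0).2 ⟨max (2 + 4 * R ^ 2) |R|, fun q hq => ?_⟩
        rw [mem_closedBall_zero_iff, Prod.norm_def]
        refine max_le_max ?_ (sq_le_sq.1 hq.2.2)
        refine abs_le_of_sq_le_sq' ?_ hM.le |>.2
        rw [← Complex.normSq_eq_norm_sq, Complex.normSq_apply]
        nlinarith [hq.2.1]
    · rintro q hq (h0 : q.1 = 0)
      have := hq.1
      simp [h0] at this
      linarith
    · intro q hq hR
      have hn := sq_ne hq
      have hn0 : 0 < q.1.re ^ 2 + q.1.im ^ 2 := lt_of_le_of_ne (by positivity) hn.symm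
      have h1 : reta q.1.re q.1.im q.2 ^ 2 + imeta q.1.re q.1.im q.2 ^ 2 ≤ R ^ 2 := by
        have := pow_le_pow_left₀ (norm_nonneg _) hR 2
        rw [← Complex.normSq_eq_norm_sq, Complex.normSq_apply] at this
        simp only at this
        nlinarith
      rw [reta_sq_add _ _ _ hn, div_le_iff₀ (by positivity)] at h1
      set n := q.1.re ^ 2 + q.1.im ^ 2
      have h2 : 0 ≤ q.2 ^ 2 * (n + 1) ^ 2 := by positivity
      refine ⟨?_, ?_, ?_⟩
      · nlinarith
      · by_contra hc
        have := not_le.1 hc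
        nlinarith
      · have h3 : q.2 ^ 2 * (4 * n) ≤ R ^ 2 * (4 * n) := by nlinarith [sq_nonneg (n - 1), sq_nonneg (q.2 * (n - 1))]
        exact le_of_mul_le_mul_right h3 (by positivity)

def alpha0 : ℂ × ℝ → OP (ℝ × ℝ × ℝ) := pm {q | 0 < q.1.re} fun q => (q.1.re - q.1.re⁻¹, q.1.im, q.2)

theorem good_alpha0 : Good ∞ alpha0 := by
  refine good_pm (isOpen_lt (by fun_prop) (by fun_prop)) ?_ fun R => ?_
  · have h1 : ContinuousOn (fun q : ℂ × ℝ => q.1.re⁻¹) {q | 0 < q.1.re} :=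
      ContinuousOn.inv₀ (by fun_prop) fun q hq => ne_of_gt hq
    have h2 : ContinuousOn (fun q : ℂ × ℝ => q.1.re) {q | 0 < q.1.re} := by fun_prop
    exact (h2.sub h1).prodMk (by fun_prop)
  · refine ⟨(fun q : ℝ × ℝ × ℝ => (Complex.equivRealProdCLM.symm (q.1, q.2.1), q.2.2)) ''
      (Icc (|R| + 1)⁻¹ (|R| + 1) ×ˢ Icc (-|R|) |R| ×ˢ Icc (-|R|) |R|), ?_, ?_, ?_⟩
    · exact (isCompact_Icc.prod (isCompact_Icc.prod isCompact_Icc)).image (by fun_prop)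
    · rintro _ ⟨q, hq, rfl⟩
      have : 0 < (|R| + 1)⁻¹ := by positivity
      exact this.trans_le hq.1.1
    · intro q hq hR
      have hR := hR.trans (le_abs_self R)
      rw [Prod.norm_def, Prod.norm_def, max_le_iff, max_le_iff] at hR
      obtain ⟨h1, h2, h3⟩ := hR
      refine ⟨(q.1.re, q.1.im, q.2), ⟨?_, abs_le.1 h2, abs_le.1 h3⟩, rfl⟩
      have hq : 0 < q.1.re := hq
      have h1 := abs_le.1 h1
      simp only at h1
      set X := q.1.re
      have hX : X * X⁻¹ = 1 := mul_inv_cancel₀ hq.ne'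
      have hX' : 0 < X⁻¹ := inv_pos.2 hq
      have h0 := abs_nonneg R
      constructor
      · rw [inv_le_comm₀ (by positivity) hq]
        by_contra hc
        nlinarith
      · show X ≤ |R| + 1
        by_contra hc
        nlinarith

def alpha (q : OP (ℂ × ℝ)) : OP (ℝ × ℝ × ℝ) := q.elim ∞ alpha0

theorem continuous_alpha : Continuous alpha := good_alpha0.ext
@[simp] theorem alpha_infty : alpha ∞ = ∞ := rfl

def rot (c : ℂ) (q : OP (ℂ × ℝ)) : OP (ℂ × ℝ) := q.map fun v => (c * v.1, v.2)

@[simp] theorem rot_one (q : OP (ℂ × ℝ)) : rot 1 q = q := by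
  induction q using OnePoint.rec <;> simp [rot]

@[simp] theorem rot_infty (c : ℂ) : rot c ∞ = ∞ := rfl
theorem rot_coe (c : ℂ) (v : ℂ × ℝ) : rot c v = ((c * v.1, v.2) : ℂ × ℝ) := rfl

/-- The coordinates `alpha` after opposite rotations are never both finite. -/
theorem sm_rot_same (c z : ℂ) (t t' : ℝ) :
    sm (alpha (rot c ((z, t) : ℂ × ℝ))) (alpha (rot (-c) ((z, t') : ℂ × ℝ))) = ∞ := by
  rw [rot_coe, rot_coe]
  by_cases h : 0 < (c * z).re
  · have : alpha (((-c * z, t') : ℂ × ℝ) : OP (ℂ × ℝ)) = ∞ := if_neg (by simp at h ⊢; linarith)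
    rw [this, sm_infty_right]
  · have : alpha (((c * z, t) : ℂ × ℝ) : OP (ℂ × ℝ)) = ∞ := if_neg h
    rw [this, sm_infty_left]

theorem sm_rot_self (c : ℂ) (q : OP (ℂ × ℝ)) : sm (alpha (rot c q)) (alpha (rot (-c) q)) = ∞ := by
  induction q using OnePoint.rec with
  | infty => rfl
  | coe z => exact sm_rot_same c z.1 z.2 z.2

theorem sm_rot_sm (c : ℂ) (q : OP ℂ) (t t' : ℝ) : sm (alpha (rot c (sm q (t : OP ℝ)))) (alpha (rot (-c) (sm q (t' : OP ℝ)))) = ∞ := by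
  induction q using OnePoint.rec with
  | infty => rfl
  | coe z => exact sm_rot_same c z t t'

end KUniv
end SD

namespace SD
open Filter Topology OnePoint

section KEnd

local notation "T3" => ℝ × ℝ × ℝ
local notation "T4" => ℝ × ℝ × ℝ × ℝ

def upos (p : ℝ) : ℝ := (p + √(p ^ 2 + 4)) / 2

theorem upos_pos (p : ℝ) : 0 < upos p := by
  have h : |p| < √(p ^ 2 + 4) := by
    rw [← Real.sqrt_sq_eq_abs]
    exact Real.sqrt_lt_sqrt (sq_nonneg _) (by linarith)
  have := neg_abs_le p
  rw [upos]; linarith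

theorem upos_sub_inv (p : ℝ) : upos p - (upos p)⁻¹ = p := by
  have h0 := (upos_pos p).ne'
  have h : √(p ^ 2 + 4) ^ 2 = p ^ 2 + 4 := Real.sq_sqrt (by positivity)
  have : upos p * upos p = p * upos p + 1 := by rw [upos]; linear_combination h / 4
  field_simp
  linear_combination this

theorem upos_of_pos {X : ℝ} (h : 0 < X) : upos (X - X⁻¹) = X := by
  have : (X - X⁻¹) ^ 2 + 4 = (X + X⁻¹) ^ 2 := by field_simp; ring
  rw [upos, this, Real.sqrt_sq (by positivity)]; ring

def endO : Set (ℂ × T4) := {v | 0 < v.1.im ∧ 0 < reta v.1.re v.1.im v.2.1 ∧ 0 < -reta v.1.re v.1.im (v.2.1 + 2 * v.2.2.1)}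

def endφ (v : ℂ × T4) : T3 × T3 :=
  ((reta v.1.re v.1.im v.2.1 - (reta v.1.re v.1.im v.2.1)⁻¹, imeta v.1.re v.1.im v.2.1, v.2.2.2.1),
    (-reta v.1.re v.1.im (v.2.1 + 2 * v.2.2.1) - (-reta v.1.re v.1.im (v.2.1 + 2 * v.2.2.1))⁻¹,
      -imeta v.1.re v.1.im (v.2.1 + 2 * v.2.2.1), v.2.2.2.2))

def eκ (w : T3 × T3) : ℝ := -(w.1.2.1 + w.2.2.1) / (upos w.1.1 + upos w.2.1)
def ey (w : T3 × T3) : ℝ := w.1.2.1 + eκ w * upos w.1.1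
def eb (w : T3 × T3) : ℝ := (ey w + √(ey w ^ 2 + eκ w ^ 2 + 1)) / (eκ w ^ 2 + 1)
def en (w : T3 × T3) : ℝ := (eκ w * eb w) ^ 2 + eb w ^ 2
def eρ (w : T3 × T3) : ℝ := (en w + 1) * eb w / (2 * en w)
def eψ (w : T3 × T3) : ℂ × T4 :=
  (Complex.equivRealProdCLM.symm (eκ w * eb w, eb w),
    (en w - 1) * (eκ w * eb w) / ((en w + 1) * eb w) - upos w.1.1 / eρ w,
    (upos w.1.1 + upos w.2.1) / (2 * eρ w), w.1.2.2, w.2.2.2)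

theorem eb_pos (w : T3 × T3) : 0 < eb w := by
  have h : |ey w| < √(ey w ^ 2 + eκ w ^ 2 + 1) := by
    rw [← Real.sqrt_sq_eq_abs]
    exact Real.sqrt_lt_sqrt (sq_nonneg _) (by nlinarith [sq_nonneg (eκ w)])
  have := neg_abs_le (ey w)
  exact div_pos (by linarith) (by positivity)

theorem en_pos (w : T3 × T3) : 0 < en w := by
  have := eb_pos w
  rw [en]; positivity

theorem eρ_pos (w : T3 × T3) : 0 < eρ w := by
  have := eb_pos w
  have := en_pos w
  rw [eρ]; positivity

theorem en_sub_one (w : T3 × T3) : en w - 1 = 2 * ey w * eb w := by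
  have h : √(ey w ^ 2 + eκ w ^ 2 + 1) ^ 2 = ey w ^ 2 + eκ w ^ 2 + 1 := Real.sq_sqrt (by positivity)
  rw [en, eb]
  have : eκ w ^ 2 + 1 ≠ 0 := by positivity
  field_simp
  linear_combination h

theorem differentiable_upos : Differentiable ℝ upos := fun p =>
  ((differentiableAt_id.add (DifferentiableAt.sqrt (by fun_prop) (by positivity))).div_const 2)

theorem diffAt_div {E : Type*} [NormedAddCommGroup E] [NormedSpace ℝ E] {f g : E → ℝ} {x : E} (hf : DifferentiableAt ℝ f x)
    (hg : DifferentiableAt ℝ g x) (h : g x ≠ 0) : DifferentiableAt ℝ (fun x => f x / g x) x := by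
  simp only [div_eq_mul_inv]
  exact hf.mul (hg.inv h)

theorem diff_div {E : Type*} [NormedAddCommGroup E] [NormedSpace ℝ E] {f g : E → ℝ} (hf : Differentiable ℝ f) (hg : Differentiable ℝ g)
    (h : ∀ x, g x ≠ 0) : Differentiable ℝ fun x => f x / g x := fun x => diffAt_div (hf x) (hg x) (h x)

theorem differentiable_eκ : Differentiable ℝ eκ := by
  have := differentiable_upos
  unfold eκ
  refine diff_div ?_ ?_ fun w => ?_
  · fun_prop
  · fun_prop
  · have := upos_pos w.1.1
    have := upos_pos w.2.1
    positivity

theorem differentiable_ey : Differentiable ℝ ey := by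
  have := differentiable_upos
  have := differentiable_eκ
  unfold ey
  fun_prop

theorem differentiable_eb : Differentiable ℝ eb := by
  have h1 := differentiable_ey
  have h2 := differentiable_eκ
  unfold eb
  refine diff_div (h1.add (Differentiable.sqrt ?_ fun w => ?_)) ?_ fun w => ?_
  · fun_prop
  · positivity
  · fun_prop
  · positivity

theorem differentiable_en : Differentiable ℝ en := by
  have := differentiable_eb
  have := differentiable_eκ
  unfold en
  fun_prop

theorem differentiable_eρ : Differentiable ℝ eρ := by
  have := differentiable_eb
  have := differentiable_en
  unfold eρ
  refine diff_div ?_ ?_ fun w => ?_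
  · fun_prop
  · fun_prop
  · have := en_pos w
    positivity

theorem differentiable_eψ : Differentiable ℝ eψ := by
  have h1 := differentiable_eb
  have h2 := differentiable_en
  have h3 := differentiable_eκ
  have h4 := differentiable_eρ
  have h5 := differentiable_upos
  refine Differentiable.prodMk ?_ (Differentiable.prodMk ?_ (Differentiable.prodMk ?_ (by fun_prop)))
  · exact Complex.equivRealProdCLM.symm.differentiable.comp (by fun_prop)
  · refine Differentiable.sub (diff_div ?_ ?_ fun w => ?_) (diff_div ?_ ?_ fun w => (eρ_pos w).ne')
    · fun_prop
    · fun_prop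
    · have := en_pos w
      have := eb_pos w
      positivity
    · fun_prop
    · fun_prop
  · refine diff_div ?_ ?_ fun w => ?_
    · fun_prop
    · fun_prop
    · have := eρ_pos w
      positivity

theorem isOpen_endO_aux : ContinuousOn (fun v : ℂ × T4 => (reta v.1.re v.1.im v.2.1, reta v.1.re v.1.im (v.2.1 + 2 * v.2.2.1)))
    {v | 0 < v.1.im} := by
  refine ContinuousOn.prodMk (ContinuousOn.div (by fun_prop) (by fun_prop) fun v hv => ?_)
    (ContinuousOn.div (by fun_prop) (by fun_prop) fun v hv => ?_) <;>
  · have : 0 < v.1.im := hv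
    positivity

theorem isOpen_endO : IsOpen endO := by
  have h := isOpen_endO_aux.isOpen_inter_preimage (t := {p : ℝ × ℝ | 0 < p.1 ∧ 0 < -p.2})
    (isOpen_lt (by fun_prop) (by fun_prop)) ?_
  · exact h
  · rw [setOf_and]
    exact (isOpen_lt (by fun_prop) (by fun_prop)).inter (isOpen_lt (by fun_prop) (by fun_prop))

theorem reta_eq {a b x : ℝ} (hb : 0 < b) : reta a b x =
    (a ^ 2 + b ^ 2 + 1) * b / (2 * (a ^ 2 + b ^ 2)) * ((a ^ 2 + b ^ 2 - 1) * a / ((a ^ 2 + b ^ 2 + 1) * b) - x) := by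
  have : 0 < a ^ 2 + b ^ 2 := by positivity
  rw [reta]; field_simp

theorem imeta_eq {a b x : ℝ} (hb : 0 < b) : imeta a b x = (a ^ 2 + b ^ 2 - 1) / (2 * b) - a / b * reta a b x := by
  have : 0 < a ^ 2 + b ^ 2 := by positivity
  rw [imeta, reta]; field_simp; ring

theorem eψ_re (w : T3 × T3) : (eψ w).1.re = eκ w * eb w := rfl
theorem eψ_im (w : T3 × T3) : (eψ w).1.im = eb w := rfl

theorem reta_eψ (w : T3 × T3) : reta (eψ w).1.re (eψ w).1.im (eψ w).2.1 = upos w.1.1 := by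
  have h1 := eb_pos w
  have h2 := eρ_pos w
  have h3 := en_pos w
  rw [eψ_re, eψ_im, reta_eq h1, ← en, ← eρ]
  show eρ w * (_ - (_ - _)) = _
  field_simp
  ring

theorem reta_eψ' (w : T3 × T3) : reta (eψ w).1.re (eψ w).1.im ((eψ w).2.1 + 2 * (eψ w).2.2.1) = -upos w.2.1 := by
  have h1 := eb_pos w
  have h2 := eρ_pos w
  have h3 := en_pos w
  rw [eψ_re, eψ_im, reta_eq h1, ← en, ← eρ]
  show eρ w * (_ - (_ - _ + 2 * (_ / _))) = _
  field_simp
  ring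

theorem eκ_mul (w : T3 × T3) : eκ w * (upos w.1.1 + upos w.2.1) = -(w.1.2.1 + w.2.2.1) := by
  have := upos_pos w.1.1
  have := upos_pos w.2.1
  rw [eκ]; field_simp

theorem endφ_eψ (w : T3 × T3) : endφ (eψ w) = w := by
  have h1 := eb_pos w
  have h4 : eκ w * eb w / eb w = eκ w := by field_simp
  have h5 : (en w - 1) / (2 * eb w) = ey w := by rw [en_sub_one]; field_simp
  have h6 : imeta (eψ w).1.re (eψ w).1.im (eψ w).2.1 = w.1.2.1 := by
    rw [imeta_eq (by exact h1), reta_eψ, eψ_re, eψ_im, ← en, h4, h5, ey]; ring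
  have h7 : -imeta (eψ w).1.re (eψ w).1.im ((eψ w).2.1 + 2 * (eψ w).2.2.1) = w.2.2.1 := by
    rw [imeta_eq (by exact h1), reta_eψ', eψ_re, eψ_im, ← en, h4, h5, ey]
    linear_combination -eκ_mul w
  rw [endφ, h6, h7, reta_eψ, reta_eψ', neg_neg, upos_sub_inv, upos_sub_inv]
  rfl

theorem eψ_mem (w : T3 × T3) : eψ w ∈ endO := by
  refine ⟨eb_pos w, ?_, ?_⟩
  · rw [reta_eψ]; exact upos_pos _
  · rw [reta_eψ', neg_neg]; exact upos_pos _

theorem eψ_endφ (v : ℂ × T4) (hv : v ∈ endO) : eψ (endφ v) = v := by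
  obtain ⟨⟨a, b⟩, x, r, t, t'⟩ := v
  obtain ⟨hb, hX, hX'⟩ := hv
  simp only at hb hX hX'
  have hn : 0 < a ^ 2 + b ^ 2 := by positivity
  have hi := imeta_eq (a := a) (x := x) hb
  have hi' := imeta_eq (a := a) (x := x + 2 * r) hb
  have hr := reta_eq (a := a) (x := x) hb
  have hr' := reta_eq (a := a) (x := x + 2 * r) hb
  set X := reta a b x with hXd
  set X' := reta a b (x + 2 * r) with hXd'
  set w := endφ (⟨a, b⟩, x, r, t, t') with hw
  have u1 : upos w.1.1 = X := upos_of_pos hX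
  have u2 : upos w.2.1 = -X' := upos_of_pos hX'
  have w1 : w.1.2.1 = imeta a b x := rfl
  have w2 : w.2.2.1 = -imeta a b (x + 2 * r) := rfl
  have k1 : eκ w = a / b := by
    have : X + -X' ≠ 0 := by positivity
    rw [eκ, u1, u2, w1, w2, hi, hi', div_eq_iff this]; ring
  have k2 : ey w = (a ^ 2 + b ^ 2 - 1) / (2 * b) := by
    rw [ey, k1, u1, w1, hi]; ring
  have k3 : eb w = b := by
    have : ((a ^ 2 + b ^ 2 - 1) / (2 * b)) ^ 2 + (a / b) ^ 2 + 1 = ((a ^ 2 + b ^ 2 + 1) / (2 * b)) ^ 2 := by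
      field_simp; ring
    rw [eb, k1, k2, this, Real.sqrt_sq (by positivity)]
    field_simp
    ring
  have k4 : eκ w * eb w = a := by rw [k1, k3]; field_simp
  have k5 : en w = a ^ 2 + b ^ 2 := by rw [en, k4, k3]
  have k6 : eρ w = (a ^ 2 + b ^ 2 + 1) * b / (2 * (a ^ 2 + b ^ 2)) := by rw [eρ, k5, k3]
  rw [← k6] at hr hr'
  have k7 := eρ_pos w
  rw [eψ, k4, u1, u2, k5, k3]
  refine Prod.ext rfl (Prod.ext ?_ (Prod.ext ?_ rfl))
  · show _ - X / eρ w = x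
    rw [hr]; field_simp; ring
  · show (X + -X') / (2 * eρ w) = r
    rw [hr, hr']; field_simp; ring

theorem continuousOn_endφ : ContinuousOn endφ endO := by
  have h := isOpen_endO_aux.mono (show endO ⊆ _ from fun v hv => hv.1)
  have h1 := continuous_fst.comp_continuousOn h
  have h2 := continuous_snd.comp_continuousOn h
  have h3 : ∀ f : ℂ × T4 → ℝ, Continuous f → ContinuousOn (fun v => imeta v.1.re v.1.im (f v)) endO := fun f hf => by
    refine ContinuousOn.div (by fun_prop) (by fun_prop) fun v hv => ?_
    have : 0 < v.1.im := hv.1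
    positivity
  refine ContinuousOn.prodMk (ContinuousOn.prodMk (h1.sub (h1.inv₀ fun v hv => hv.2.1.ne')) (ContinuousOn.prodMk (h3 _ (by fun_prop)) (by fun_prop)))
    (ContinuousOn.prodMk (h2.neg.sub (h2.neg.inv₀ fun v hv => hv.2.2.ne')) (ContinuousOn.prodMk (h3 _ (by fun_prop)).neg (by fun_prop)))

theorem differentiableAt_endφ (v : ℂ × T4) (hv : v ∈ endO) : DifferentiableAt ℝ endφ v := by
  have hre : DifferentiableAt ℝ (fun v : ℂ × T4 => v.1.re) v :=
    Complex.reCLM.differentiableAt.comp v differentiableAt_fst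
  have him : DifferentiableAt ℝ (fun v : ℂ × T4 => v.1.im) v :=
    Complex.imCLM.differentiableAt.comp v differentiableAt_fst
  have hn : 2 * (v.1.re ^ 2 + v.1.im ^ 2) ≠ 0 := by
    have : 0 < v.1.im := hv.1
    positivity
  have h0 : ∀ f : ℂ × T4 → ℝ, DifferentiableAt ℝ f v → DifferentiableAt ℝ (fun v => reta v.1.re v.1.im (f v)) v := fun f hf =>
    diffAt_div (by fun_prop) (by fun_prop) hn
  have h3 : ∀ f : ℂ × T4 → ℝ, DifferentiableAt ℝ f v → DifferentiableAt ℝ (fun v => imeta v.1.re v.1.im (f v)) v := fun f hf =>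
    diffAt_div (by fun_prop) (by fun_prop) hn
  have h1 := h0 (fun v => v.2.1) (by fun_prop)
  have h2 := h0 (fun v => v.2.1 + 2 * v.2.2.1) (by fun_prop)
  exact DifferentiableAt.prodMk (DifferentiableAt.prodMk (h1.sub (h1.inv hv.2.1.ne')) (DifferentiableAt.prodMk (h3 _ (by fun_prop)) (by fun_prop)))
    (DifferentiableAt.prodMk (h2.neg.sub (h2.neg.inv hv.2.2.ne')) (DifferentiableAt.prodMk (h3 _ (by fun_prop)).neg (by fun_prop)))

theorem htp_end : ∃ A : (ℂ × T4) ≃ₜ (T3 × T3), Htp ∞ (pm endO endφ) (fun v => (A v : OP (T3 × T3))) :=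
  htp_zoom isOpen_endO continuousOn_endφ differentiable_eψ.continuous eψ_mem endφ_eψ eψ_endφ
    (differentiableAt_endφ _ (eψ_mem 0)) (differentiable_eψ 0)

end KEnd
end SD

namespace SD
open Filter Topology OnePoint

section KHom

local notation "T3" => ℝ × ℝ × ℝ
local notation "T4" => ℝ × ℝ × ℝ × ℝ

variable {Y : Type*} [TopologicalSpace Y] [T2Space Y] [LocallyCompactSpace Y]

def gplus (g : Y → OP ℂ) (q : Y × ℝ) : OP ℂ := (Sus g q).elim ∞ etab

theorem good_gplus {g : Y → OP ℂ} (hg : Good ∞ g) : Good ∞ (gplus g) := good_etab.bind (good_Sus hg)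

theorem good_alpha_rot {K Z : Type*} [TopologicalSpace K] [CompactSpace K] [TopologicalSpace Z] {c : K → ℂ} (hc : Continuous c)
    (h1 : ∀ k, ‖c k‖ = 1) {f : Z → OP (ℂ × ℝ)} (hf : Good ∞ f) : Good ∞ fun p : K × Z => alpha (rot (c p.1) (f p.2)) := by
  refine Good.post (b := ∞) (good_omap (φ := fun k (v : ℂ × ℝ) => (c k * v.1, v.2)) (by fun_prop) (fun k R => ⟨R, ?_⟩) hf) continuous_alpha rfl
  refine Eventually.of_forall fun k v hv => ?_
  rw [Prod.norm_def] at hv ⊢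
  simpa [h1] using hv

/-- Time-`s` slices of a homotopy, extended to all real times. -/
def slice (H : I × ((Y × ℝ) × ℝ) → OP (ℂ × ℝ)) (s : ℝ) (z : (Y × ℝ) × ℝ) : OP (ℂ × ℝ) := H (projIcc 0 1 zero_le_one s, z)

variable {H : I × ((Y × ℝ) × ℝ) → OP (ℂ × ℝ)} {g : Y → OP ℂ}

theorem slice_nonpos (h0 : ∀ z, H (0, z) = Sus (gplus g) z) {s : ℝ} (hs : s ≤ 0) (z) : slice H s z = Sus (gplus g) z := by
  rw [slice, projIcc_of_le_left _ hs]; exact h0 z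

theorem slice_ge (h1 : ∀ z, H (1, z) = ∞) {s : ℝ} (hs : 1 ≤ s) (z) : slice H s z = ∞ := by
  rw [slice, projIcc_of_right_le _ hs]; exact h1 z

theorem continuous_slice (hH : Good ∞ H) {W : Type*} [TopologicalSpace W] {σ : W → ℝ} {z : W → (Y × ℝ) × ℝ} (hσ : Continuous σ)
    (hz : Continuous z) : Continuous fun w => slice H (σ w) (z w) :=
  hH.1.comp ((continuous_projIcc.comp hσ).prodMk hz)

def two (c : ℂ) (p q : OP (ℂ × ℝ)) : OP (T3 × T3) := sm (alpha (rot c p)) (alpha (rot (-c) q))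

theorem two_infty_right (c : ℂ) (p) : two c p ∞ = ∞ := sm_infty_right _
theorem two_infty_left (c : ℂ) (p) : two c ∞ p = ∞ := sm_infty_left _

theorem continuous_rot : Continuous fun p : Metric.sphere (0 : ℂ) 1 × OP (ℂ × ℝ) => rot p.1 p.2 := by
  refine continuous_omap (φ := fun (k : Metric.sphere (0 : ℂ) 1) (v : ℂ × ℝ) => ((k : ℂ) * v.1, v.2)) (by fun_prop) fun k R => ⟨R, ?_⟩
  refine Eventually.of_forall fun k v hv => ?_
  rw [Prod.norm_def] at hv ⊢
  simpa using hv

theorem continuous_two {W : Type*} [TopologicalSpace W] {c : W → ℂ} (hc : Continuous c) (h1 : ∀ k, ‖c k‖ = 1) {p q : W → OP (ℂ × ℝ)}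
    (hp : Continuous p) (hq : Continuous q) : Continuous fun w => two (c w) (p w) (q w) := by
  refine Continuous.sm ?_ ?_
  · have : Continuous fun w => ((⟨c w, by simp [h1]⟩ : Metric.sphere (0 : ℂ) 1), p w) := (hc.subtype_mk _).prodMk hp
    exact continuous_alpha.comp (continuous_rot.comp this)
  · have : Continuous fun w => ((⟨-c w, by simp [h1]⟩ : Metric.sphere (0 : ℂ) 1), q w) := (hc.neg.subtype_mk _).prodMk hq
    exact continuous_alpha.comp (continuous_rot.comp this)

theorem good_two (hH : Good ∞ H) {W : Type*} [TopologicalSpace W] {c : I → ℂ} (hc : Continuous c) (h1 : ∀ k, ‖c k‖ = 1)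
    {κ : W → I} (hκ : Continuous κ) {σ σ' : W → ℝ} {z z' : W → (Y × ℝ) × ℝ} (hσ : Continuous σ) (hσ' : Continuous σ')
    (hz : Continuous z) (hz' : Continuous z') {r : I × ((ℝ × ((Y × ℝ) × ℝ)) × (ℝ × ((Y × ℝ) × ℝ))) → W} (hr : Continuous r)
    (h : ∀ w, two (c (κ w)) (slice H (σ w) (z w)) (slice H (σ' w) (z' w)) ≠ ∞ →
      r (κ w, ((projIcc 0 1 zero_le_one (σ w) : I), z w), ((projIcc 0 1 zero_le_one (σ' w) : I), z' w)) = w) :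
    Good ∞ fun w => two (c (κ w)) (slice H (σ w) (z w)) (slice H (σ' w) (z' w)) := by
  have hG : Good ∞ fun p : I × ((I × ((Y × ℝ) × ℝ)) × (I × ((Y × ℝ) × ℝ))) => two (c p.1) (H p.2.1) (H p.2.2) :=
    good_pair (good_alpha_rot hc h1 hH) (good_alpha_rot hc.neg (fun k => by simp [h1]) hH)
      (p := fun p : I × ((I × ((Y × ℝ) × ℝ)) × (I × ((Y × ℝ) × ℝ))) => (p.1, p.2.1)) (q := fun p => (p.1, p.2.2))
      (r := fun p => (p.1.1, p.1.2, p.2.2)) (by fun_prop) (by fun_prop) (by fun_prop) fun x => rfl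
  refine good_of_lift (continuous_two (hc.comp hκ) (fun _ => h1 _) (continuous_slice hH hσ hz) (continuous_slice hH hσ' hz')) hG
    (r := fun p => r (p.1, ((p.2.1.1 : ℝ), p.2.1.2), ((p.2.2.1 : ℝ), p.2.2.2))) (by fun_prop) fun w v hv => ?_
  exact ⟨(κ w, (projIcc 0 1 zero_le_one (σ w), z w), (projIcc 0 1 zero_le_one (σ' w), z' w)),
    h w (by rw [hv]; exact coe_ne_infty _), hv⟩

def psi (H : I × ((Y × ℝ) × ℝ) → OP (ℂ × ℝ)) (c : ℂ) (q : Y × T4) : OP (T3 × T3) :=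
  two c (slice H q.2.2.1 ((q.1, q.2.1), q.2.2.2.1)) (slice H q.2.2.1 ((q.1, q.2.1), q.2.2.2.2))

def cs (e : I) : ℂ := Complex.exp ((Real.pi * (e : ℝ) : ℝ) * Complex.I)

theorem continuous_cs : Continuous cs := by unfold cs; fun_prop
theorem norm_cs (e : I) : ‖cs e‖ = 1 := Complex.norm_exp_ofReal_mul_I _
theorem cs_zero : cs 0 = 1 := by simp [cs]

theorem good_psi (hH : Good ∞ H) (h0 : ∀ z, H (0, z) = Sus (gplus g) z) (h1 : ∀ z, H (1, z) = ∞) : Good ∞ fun q : I × (Y × T4) => psi H (cs q.1) q.2 := by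
  refine good_two hH continuous_cs norm_cs (κ := fun q : I × (Y × T4) => q.1) (by fun_prop) (by fun_prop) (by fun_prop) (by fun_prop) (by fun_prop)
    (r := fun p => (p.1, p.2.1.2.1.1, p.2.1.2.1.2, p.2.1.1, p.2.1.2.2, p.2.2.2.2)) (by fun_prop) fun w hw => ?_
  have hs : w.2.2.2.1 ∈ Icc (0 : ℝ) 1 := by
    constructor <;> by_contra hc <;> apply hw
    · rw [slice_nonpos h0 (by linarith), slice_nonpos h0 (by linarith)]
      exact sm_rot_sm _ _ _ _
    · rw [slice_ge h1 (by linarith), two_infty_left]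
  rw [projIcc_of_mem _ hs]

theorem htp_psi_slide (hH : Good ∞ H) (h0 : ∀ z, H (0, z) = Sus (gplus g) z) (h1 : ∀ z, H (1, z) = ∞) : Htp ∞ (psi H 1) fun q : Y × T4 => two 1 (slice H 0 ((q.1, q.2.1), q.2.2.2.1)) (slice H q.2.2.1 ((q.1, q.2.1), q.2.2.2.2)) := by
  refine Htp.mk' (fun e q => two 1 (slice H ((1 - e) * q.2.2.1) ((q.1, q.2.1), q.2.2.2.1)) (slice H q.2.2.1 ((q.1, q.2.1), q.2.2.2.2)))
    ?_ (fun q => by simp [psi]) (fun q => by simp)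
  refine good_two hH (c := fun _ => 1) continuous_const (by simp) (κ := fun q : I × (Y × T4) => q.1) (by fun_prop) (by fun_prop) (by fun_prop) (by fun_prop) (by fun_prop)
    (r := fun p => (p.1, p.2.1.2.1.1, p.2.1.2.1.2, p.2.2.1, p.2.1.2.2, p.2.2.2.2)) (by fun_prop) fun w hw => ?_
  have hs : w.2.2.2.1 ∈ Icc (0 : ℝ) 1 := by
    constructor <;> by_contra hc <;> apply hw
    · have : (1 - (w.1 : ℝ)) * w.2.2.2.1 ≤ 0 := mul_nonpos_of_nonneg_of_nonpos (sub_nonneg.2 w.1.2.2) (by linarith)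
      rw [slice_nonpos h0 this, slice_nonpos h0 (by linarith)]
      exact sm_rot_sm _ _ _ _
    · rw [slice_ge h1 (s := w.2.2.2.1) (by linarith), two_infty_right]
  rw [projIcc_of_mem _ hs]

theorem htp_slide_shift (hH : Good ∞ H) (h0 : ∀ z, H (0, z) = Sus (gplus g) z) (h1 : ∀ z, H (1, z) = ∞) : Htp ∞ (fun q : Y × T4 => two 1 (slice H 0 ((q.1, q.2.1), q.2.2.2.1)) (slice H q.2.2.1 ((q.1, q.2.1), q.2.2.2.2)))
    fun q => two 1 (slice H 0 ((q.1, q.2.1), q.2.2.2.1)) (slice H 0 ((q.1, q.2.1 + 2 * max q.2.2.1 0), q.2.2.2.2)) := by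
  refine Htp.mk' (fun e q => two 1 (slice H 0 ((q.1, q.2.1), q.2.2.2.1)) (slice H (min 1 (2 - 2 * e) * q.2.2.1)
    ((q.1, q.2.1 + 2 * (min (2 * e) 1 * max q.2.2.1 0)), q.2.2.2.2)))
    ?_ (fun q => by simp) (fun q => by simp)
  have hm : ∀ e : I, 1 ≤ min 1 (2 - 2 * (e : ℝ)) + 2 * min (2 * (e : ℝ)) 1 := fun e => by
    have h1 := e.2.1
    have h2 := e.2.2
    rcases min_cases 1 (2 - 2 * (e : ℝ)) with h | h <;> rcases min_cases (2 * (e : ℝ)) 1 with h' | h' <;> linarith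
  refine good_two hH (c := fun _ => 1) continuous_const (by simp) (κ := fun q : I × (Y × T4) => q.1) (by fun_prop) (by fun_prop) (by fun_prop) (by fun_prop) (by fun_prop)
    (r := fun p => (p.1, p.2.1.2.1.1, p.2.1.2.1.2, (p.2.2.1 + p.2.2.2.1.2 - p.2.1.2.1.2) / (min 1 (2 - 2 * (p.1 : ℝ)) + 2 * min (2 * (p.1 : ℝ)) 1), p.2.1.2.2, p.2.2.2.2)) ?_ fun w hw => ?_
  · have : Continuous fun p : I × ((ℝ × ((Y × ℝ) × ℝ)) × (ℝ × ((Y × ℝ) × ℝ))) =>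
      (p.2.2.1 + p.2.2.2.1.2 - p.2.1.2.1.2) / (min 1 (2 - 2 * (p.1 : ℝ)) + 2 * min (2 * (p.1 : ℝ)) 1) :=
      Continuous.div (by fun_prop) (by fun_prop) fun p => by linarith [hm p.1]
    fun_prop
  have e0 := w.1.2.1
  have e1 := w.1.2.2
  have hs0 : 0 ≤ w.2.2.2.1 := by
    by_contra hc
    have : min 1 (2 - 2 * (w.1 : ℝ)) * w.2.2.2.1 ≤ 0 := mul_nonpos_of_nonneg_of_nonpos (le_min zero_le_one (by linarith)) (by linarith)
    apply hw
    rw [slice_nonpos h0 le_rfl, slice_nonpos h0 this, max_eq_right (by linarith)]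
    simp only [mul_zero, add_zero]
    exact sm_rot_sm _ _ _ _
  have hs1 : min 1 (2 - 2 * (w.1 : ℝ)) * w.2.2.2.1 ≤ 1 := by
    by_contra hc
    apply hw
    rw [slice_ge h1 (s := min 1 (2 - 2 * (w.1 : ℝ)) * w.2.2.2.1) (by linarith), two_infty_right]
  rw [projIcc_of_mem _ ⟨mul_nonneg (le_min zero_le_one (by linarith)) hs0, hs1⟩]
  have := hm w.1
  refine Prod.ext rfl (Prod.ext rfl (Prod.ext rfl (Prod.ext ?_ rfl)))
  show (_ * _ + (_ + _) - _) / _ = _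
  rw [max_eq_left hs0, div_eq_iff (by linarith)]
  ring

end KHom
end SD

namespace SD
open Filter Topology OnePoint

section KFin

local notation "T3" => ℝ × ℝ × ℝ
local notation "T4" => ℝ × ℝ × ℝ × ℝ

variable {Y : Type*} [TopologicalSpace Y] [T2Space Y] [LocallyCompactSpace Y]
variable {H : I × ((Y × ℝ) × ℝ) → OP (ℂ × ℝ)} {g : Y → OP ℂ}

theorem two_eq_elim (q : Y × T4) : two 1 (Sus (gplus g) ((q.1, q.2.1), q.2.2.2.1)) (Sus (gplus g) ((q.1, q.2.1 + 2 * max q.2.2.1 0), q.2.2.2.2))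
    = (sm (g q.1) (q.2 : OP T4)).elim ∞ (pm endO endφ) := by
  obtain ⟨y, x, r, t, t'⟩ := q
  simp only [Sus, gplus]
  induction g y using OnePoint.rec with
  | infty => rfl
  | coe z =>
    show two 1 (sm (etab (z, x)) (t : OP ℝ)) (sm (etab (z, x + 2 * max r 0)) (t' : OP ℝ)) = pm endO endφ (z, x, r, t, t')
    by_cases hz : z = 0
    · have h : ∀ x, etab (z, x) = ∞ := fun x => pm_of_notMem (by simp [hz])
      rw [h, h, pm_of_notMem]
      · rfl
      · intro h
        simpa [hz] using h.1
    have h : ∀ x, etab (z, x) = (⟨reta z.re z.im x, imeta z.re z.im x⟩ : ℂ) := fun x => pm_of_mem (show z ≠ 0 from hz)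
    rw [h, h]
    show sm (alpha (rot 1 (((⟨reta z.re z.im x, imeta z.re z.im x⟩, t) : ℂ × ℝ) : OP (ℂ × ℝ))))
      (alpha (rot (-1) (((⟨reta z.re z.im (x + 2 * max r 0), imeta z.re z.im (x + 2 * max r 0)⟩, t') : ℂ × ℝ) : OP (ℂ × ℝ)))) = _
    rw [rot_one, rot_coe, neg_one_mul]
    show sm (alpha0 _) (alpha0 _) = _
    have hn := sq_ne hz
    have hn0 : 0 < z.re ^ 2 + z.im ^ 2 := lt_of_le_of_ne (by positivity) hn.symm
    have hd : ∀ r, reta z.re z.im (x + 2 * r) = reta z.re z.im x - (z.re ^ 2 + z.im ^ 2 + 1) * z.im / (z.re ^ 2 + z.im ^ 2) * r := by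
      intro r; rw [reta, reta]; field_simp; ring
    by_cases hO : ((z, x, r, t, t') : ℂ × T4) ∈ endO
    · have hr : 0 < r := by
        obtain ⟨h1, h2, h3⟩ := hO
        simp only at h1 h2 h3
        rw [hd] at h3
        have : 0 < (z.re ^ 2 + z.im ^ 2 + 1) * z.im / (z.re ^ 2 + z.im ^ 2) := by positivity
        by_contra hc
        nlinarith
      rw [max_eq_left hr.le, pm_of_mem hO, alpha0, pm_of_mem (show _ ∈ {q : ℂ × ℝ | 0 < q.1.re} from hO.2.1),
        pm_of_mem (show _ ∈ {q : ℂ × ℝ | 0 < q.1.re} from hO.2.2)]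
      rfl
    · rw [pm_of_notMem hO]
      by_contra hc
      obtain ⟨v, hv⟩ := OnePoint.ne_infty_iff_exists.1 hc
      obtain ⟨e1, e2⟩ := sm_eq_coe.1 hv.symm
      rw [alpha0, pm_eq_coe] at e1 e2
      have h1 : 0 < reta z.re z.im x := e1.1
      have h2 : 0 < -reta z.re z.im (x + 2 * max r 0) := e2.1
      have hr : 0 < r := by
        by_contra hr
        rw [max_eq_right (by linarith)] at h2
        simp only [mul_zero, add_zero] at h2
        linarith
      rw [max_eq_left hr.le] at h2
      refine hO ⟨?_, h1, h2⟩
      rw [hd] at h2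
      by_contra hb
      have : (z.re ^ 2 + z.im ^ 2 + 1) * z.im / (z.re ^ 2 + z.im ^ 2) ≤ 0 :=
        div_nonpos_of_nonpos_of_nonneg (mul_nonpos_of_nonneg_of_nonpos (by positivity) (not_lt.1 hb)) hn0.le
      nlinarith

def swp (q : Y × T4) : Y × T4 := (q.1, q.2.1, q.2.2.1, q.2.2.2.2, q.2.2.2.1)

theorem psi_neg_one (q : Y × T4) : psi H (-1) q = (psi H 1 (swp q)).map Prod.swap := by
  show sm (alpha (rot (-1) (slice H q.2.2.1 ((q.1, q.2.1), q.2.2.2.1)))) (alpha (rot (- -1) (slice H q.2.2.1 ((q.1, q.2.1), q.2.2.2.2)))) =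
    (sm (alpha (rot 1 (slice H q.2.2.1 ((q.1, q.2.1), q.2.2.2.2)))) (alpha (rot (-1) (slice H q.2.2.1 ((q.1, q.2.1), q.2.2.2.1))))).map Prod.swap
  rw [neg_neg]
  generalize alpha (rot (-1) _) = a
  generalize alpha (rot 1 _) = b
  induction a using OnePoint.rec <;> induction b using OnePoint.rec <;> rfl

theorem psi_diag (c : ℂ) {q : Y × T4} (h : q.2.2.2.1 = q.2.2.2.2) : psi H c q = ∞ := by
  rw [psi, h]; exact sm_rot_self _ _

/-- Rotation from the swap of two copies of `T3` to the reflection of the last coordinate. -/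
def arot (e : ℝ) (v : (T3 × T3) × ℝ) : (T3 × T3) × ℝ :=
  let C := Real.cos (Real.pi * e)
  let S := Real.sin (Real.pi * e)
  let s : T3 := v.1.1 + v.1.2
  let d : T3 := v.1.1 - v.1.2
  let d' : T3 := (-(C * d.1) + S * d.2.1, -(S * d.1) - C * d.2.1, -(C * d.2.2) - S * v.2)
  (((2⁻¹ : ℝ) • (s + d'), (2⁻¹ : ℝ) • (s - d')), -(S * d.2.2) + C * v.2)

theorem continuous_arot : Continuous fun p : I × ((T3 × T3) × ℝ) => arot p.1 p.2 := by unfold arot; fun_prop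

def arotInv (e : ℝ) (v : (T3 × T3) × ℝ) : (T3 × T3) × ℝ :=
  let C := Real.cos (Real.pi * e)
  let S := Real.sin (Real.pi * e)
  let s : T3 := v.1.1 + v.1.2
  let d : T3 := v.1.1 - v.1.2
  let d' : T3 := (-(C * d.1) - S * d.2.1, (S * d.1) - C * d.2.1, -(C * d.2.2) - S * v.2)
  (((2⁻¹ : ℝ) • (s + d'), (2⁻¹ : ℝ) • (s - d')), -(S * d.2.2) + C * v.2)

theorem continuous_arotInv : Continuous fun p : I × ((T3 × T3) × ℝ) => arotInv p.1 p.2 := by unfold arotInv; fun_prop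

theorem arotInv_arot (e : ℝ) (v : (T3 × T3) × ℝ) : arotInv e (arot e v) = v := by
  have h := Real.sin_sq_add_cos_sq (Real.pi * e)
  obtain ⟨⟨⟨a1, a2, a3⟩, b1, b2, b3⟩, u⟩ := v
  simp only [arot, arotInv, Prod.mk_add_mk, Prod.mk_sub_mk, Prod.smul_mk, smul_eq_mul, Prod.mk.injEq]
  set C := Real.cos (Real.pi * e)
  set S := Real.sin (Real.pi * e)
  refine ⟨⟨⟨?_, ?_, ?_⟩, ?_, ?_, ?_⟩, ?_⟩
  · linear_combination (a1 - b1) / 2 * h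
  · linear_combination (a2 - b2) / 2 * h
  · linear_combination (a3 - b3) / 2 * h
  · linear_combination -(a1 - b1) / 2 * h
  · linear_combination -(a2 - b2) / 2 * h
  · linear_combination -(a3 - b3) / 2 * h
  · linear_combination u * h

theorem arot_zero (v : (T3 × T3) × ℝ) : arot 0 v = (v.1.swap, v.2) := by
  obtain ⟨⟨⟨a1, a2, a3⟩, b1, b2, b3⟩, u⟩ := v
  simp [arot]
  refine ⟨⟨?_, ?_, ?_⟩, ?_, ?_, ?_⟩ <;> ring

theorem arot_one (v : (T3 × T3) × ℝ) : arot 1 v = (v.1, -v.2) := by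
  obtain ⟨⟨⟨a1, a2, a3⟩, b1, b2, b3⟩, u⟩ := v
  simp [arot]
  refine ⟨⟨?_, ?_, ?_⟩, ?_, ?_, ?_⟩ <;> ring

/-- A family of proper homeomorphisms has the compactness property needed for `good_omap`. -/
theorem good_arot {X : Type*} [TopologicalSpace X] {f : X → OP ((T3 × T3) × ℝ)} (hf : Good ∞ f) :
    Good ∞ fun p : I × X => (f p.2).map (arot p.1) := by
  refine good_omap (φ := fun (k : I) v => arot k v) continuous_arot (fun k R => ?_) hf
  have hK : IsCompact ((fun p : I × ((T3 × T3) × ℝ) => arotInv p.1 p.2) '' (univ ×ˢ Metric.closedBall 0 R)) :=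
    (isCompact_univ.prod (isCompact_closedBall _ _)).image continuous_arotInv
  obtain ⟨R', hR'⟩ := (Metric.isBounded_iff_subset_closedBall 0).1 hK.isBounded
  refine ⟨R', Eventually.of_forall fun k v hv => ?_⟩
  simpa using hR' ⟨(k, arot k v), ⟨mem_univ _, by simpa using hv⟩, arotInv_arot _ _⟩

def dbl {B T : Type*} (k : B × (ℝ × ℝ) → OP T) (p : B × ℂ) : OP T :=
  if 0 < p.2.re then k (p.1, (Real.log p.2.re, p.2.im)) else
    if p.2.re < 0 then k (p.1, (Real.log (-p.2.re), -p.2.im)) else ∞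

theorem sm_map_left {A B C : Type*} (f : A → B) (p : OP A) (q : OP C) : sm (p.map f) q = (sm p q).map (Prod.map f id) := by
  induction p using OnePoint.rec <;> induction q using OnePoint.rec <;> rfl

theorem sm_neg_coe {A : Type*} (p : OP A) (u : ℝ) : (sm p (u : OP ℝ)).map (fun v => (v.1, -v.2)) = sm p ((-u : ℝ) : OP ℝ) := by
  induction p using OnePoint.rec <;> rfl

theorem htp_halves (hH : Good ∞ H) (h0 : ∀ z, H (0, z) = Sus (gplus g) z) (h1 : ∀ z, H (1, z) = ∞) : Htp ∞ (fun q : (Y × T4) × ℝ => if 0 < q.1.2.2.2.2 - q.1.2.2.2.1 then sm (psi H 1 q.1) (q.2 : OP ℝ) else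
    sm (psi H 1 (swp q.1)) ((-q.2 : ℝ) : OP ℝ)) (Sus (psi H 1)) := by
  have hp := good_psi hH h0 h1
  have hp1 : Good ∞ (psi H 1) := by
    have := hp.comp (p := fun q : Y × T4 => ((0 : I), q)) (by fun_prop)
      (tendsto_of_leftInv (r := fun q : I × (Y × T4) => q.2) (by fun_prop) fun _ => rfl)
    simpa [cs_zero] using this
  have hsw : Good ∞ fun q => psi H 1 (swp q) := hp1.comp (p := swp) (by unfold swp; fun_prop)
    (tendsto_of_leftInv (r := swp) (by unfold swp; fun_prop) fun _ => rfl)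
  have hl : ∀ {K : Type} [TopologicalSpace K] [CompactSpace K], Good ∞ fun p : K × ((Y × T4) × ℝ) => sm (psi H 1 p.2.1) (p.2.2 : OP ℝ) :=
    (good_Sus hp1).comp (by fun_prop) (tendsto_snd_cocompact _)
  refine Htp.trans (g := fun q : (Y × T4) × ℝ => if 0 < q.1.2.2.2.2 - q.1.2.2.2.1 then sm (psi H 1 q.1) (q.2 : OP ℝ) else
    sm (psi H (-1) q.1) (q.2 : OP ℝ)) (Htp.symm ?_) (Htp.symm ?_)
  · refine Htp.mk' (fun e q => if 0 < q.1.2.2.2.2 - q.1.2.2.2.1 then sm (psi H 1 q.1) (q.2 : OP ℝ) else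
      (sm (psi H 1 (swp q.1)) (q.2 : OP ℝ)).map (arot e)) ?_ (fun q => ?_) (fun q => ?_)
    · refine good_ite hl (good_arot (good_Sus hsw)) (σ := fun p : I × ((Y × T4) × ℝ) => p.2.1.2.2.2.2 - p.2.1.2.2.2.1) (by fun_prop) fun p hp => ?_
      rw [psi_diag _ (sub_eq_zero.1 hp).symm]
      show _ = OnePoint.map _ (sm (psi H 1 (swp p.2.1)) _)
      rw [psi_diag _ (sub_eq_zero.1 hp)]
      rfl
    · congr 1
      rw [psi_neg_one, sm_map_left]
      congr 1
      funext v
      exact arot_zero v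
    · congr 1
      rw [← sm_neg_coe]
      congr 1
      funext v
      exact arot_one v
  · refine Htp.mk' (fun e q => if 0 < q.1.2.2.2.2 - q.1.2.2.2.1 then sm (psi H 1 q.1) (q.2 : OP ℝ) else
      sm (psi H (Complex.exp ((Real.pi * e : ℝ) * Complex.I)) q.1) (q.2 : OP ℝ)) ?_ (fun q => ?_) (fun q => ?_)
    · refine good_ite hl ?_ (σ := fun p : I × ((Y × T4) × ℝ) => p.2.1.2.2.2.2 - p.2.1.2.2.2.1) (by fun_prop) fun p hp => ?_
      · exact (good_Sus hp).comp (p := fun p : I × ((Y × T4) × ℝ) => ((p.1, p.2.1), p.2.2)) (by fun_prop)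
          (tendsto_homeo (Homeomorph.prodAssoc _ _ _).symm)
      · rw [psi_diag _ (sub_eq_zero.1 hp).symm, psi_diag _ (sub_eq_zero.1 hp).symm]
    · simp [Sus]
    · simp

theorem k_lemma (hH : Good ∞ H) (h0 : ∀ z, H (0, z) = Sus (gplus g) z) (h1 : ∀ z, H (1, z) = ∞) (hg : Good ∞ g) : ∃ k : (Y × T3) × (ℝ × ℝ) → OP ((T3 × T3) × ℝ), Good ∞ k ∧
    (∀ y, (∀ e x t, H (e, ((y, x), t)) = ∞) → ∀ a b, k ((y, a), b) = ∞) ∧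
    (Null ∞ (dbl k) → Null ∞ fun q : Y × (T4 × ℝ) => sm (g q.1) (q.2 : OP (T4 × ℝ))) := by
  have hp := good_psi hH h0 h1
  have hp1 : Good ∞ (psi H 1) := by
    have := hp.comp (p := fun q : Y × T4 => ((0 : I), q)) (by fun_prop)
      (tendsto_of_leftInv (r := fun q : I × (Y × T4) => q.2) (by fun_prop) fun _ => rfl)
    simpa [cs_zero] using this
  set f : ((Y × T3) × ℝ) × ℝ → OP ((T3 × T3) × ℝ) := fun q =>
    sm (psi H 1 (q.1.1.1, q.1.1.2.1, q.1.1.2.2.1, q.1.1.2.2.2 - q.2 / 2, q.1.1.2.2.2 + q.2 / 2)) (q.1.2 : OP ℝ) with hf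
  have hfg : Good ∞ f := (good_Sus hp1).comp
    (p := fun q : ((Y × T3) × ℝ) × ℝ => ((q.1.1.1, q.1.1.2.1, q.1.1.2.2.1, q.1.1.2.2.2 - q.2 / 2, q.1.1.2.2.2 + q.2 / 2), q.1.2))
    (by fun_prop) (tendsto_of_leftInv (r := fun q : (Y × T4) × ℝ =>
      (((q.1.1, q.1.2.1, q.1.2.2.1, (q.1.2.2.2.1 + q.1.2.2.2.2) / 2), q.2), q.1.2.2.2.2 - q.1.2.2.2.1)) (by fun_prop) fun y => by
        obtain ⟨⟨⟨y, x, s, m⟩, u⟩, δ⟩ := y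
        simp)
  have hf0 : ∀ x, f (x, 0) = ∞ := fun x => by
    rw [hf]
    show sm _ _ = _
    rw [psi_diag, sm_infty_left]
    simp
  refine ⟨fun q => f ((q.1, q.2.2), Real.exp q.2.1), (good_exp hfg hf0).comp (p := fun q : (Y × T3) × (ℝ × ℝ) => ((q.1, q.2.2), q.2.1))
    (by fun_prop) (tendsto_of_leftInv (r := fun q : ((Y × T3) × ℝ) × ℝ => (q.1.1, q.2, q.1.2)) (by fun_prop) fun _ => rfl), ?_, ?_⟩
  · intro y hy a b
    show sm (two _ (slice H _ _) _) _ = _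
    rw [slice, hy, two_infty_left, sm_infty_left]
  · intro hN
    have hN1 := hN.comp (p := fun q : (Y × T4) × ℝ => ((q.1.1, q.1.2.1, q.1.2.2.1, (q.1.2.2.2.1 + q.1.2.2.2.2) / 2),
      Complex.equivRealProdCLM.symm (q.1.2.2.2.2 - q.1.2.2.2.1, q.2))) (by fun_prop) (tendsto_of_leftInv
        (r := fun q : (Y × T3) × ℂ => ((q.1.1, q.1.2.1, q.1.2.2.1, q.1.2.2.2 - q.2.re / 2, q.1.2.2.2 + q.2.re / 2), q.2.im)) (by fun_prop)
        fun y => by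
          obtain ⟨⟨y, x, s, t, t'⟩, u⟩ := y
          simp
          constructor <;> ring)
    have hN2 : Null ∞ (Sus (psi H 1)) := by
      refine Null.of_htp (f := _) ?_ (htp_halves hH h0 h1)
      convert hN1 using 1
      funext q
      obtain ⟨⟨y, x, s, t, t'⟩, u⟩ := q
      simp only [dbl, Complex.equivRealProdCLM_symm_apply_re, Complex.equivRealProdCLM_symm_apply_im, hf, swp]
      rcases lt_trichotomy t t' with h | h | h
      · rw [if_pos (by linarith), if_pos (by linarith), Real.exp_log (by linarith)]
        congr 4 <;> simp <;> constructor <;> ring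
      · subst h
        simp only [sub_self, lt_irrefl, if_false]
        rw [psi_diag _ rfl, sm_infty_left]
      · rw [if_neg (by linarith), if_neg (by linarith), if_pos (by linarith), Real.exp_log (by linarith)]
        congr 4 <;> simp <;> constructor <;> ring
    obtain ⟨A, hA⟩ := htp_end
    have hE : Htp ∞ (psi H 1) fun q : Y × T4 => (sm (g q.1) (q.2 : OP T4)).elim ∞ fun v => (A v : OP (T3 × T3)) := by
      refine (htp_psi_slide hH h0 h1).trans ((htp_slide_shift hH h0 h1).trans ?_)
      have := hA.bind (good_sm hg (good_id (E := T4)))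
      convert this using 1
      funext q
      rw [slice_nonpos h0 le_rfl, slice_nonpos h0 le_rfl]
      exact two_eq_elim q
    have hN3 := hN2.of_htp hE.sus
    set B : ((T3 × T3) × ℝ) ≃ₜ (ℂ × (T4 × ℝ)) := (A.symm.prodCongr (Homeomorph.refl ℝ)).trans (Homeomorph.prodAssoc _ _ _)
    have hN4 := (hN3.post (F := B.onePointCongr) B.onePointCongr.continuous rfl).homeo (Homeomorph.prodAssoc Y T4 ℝ).symm
    have hN5 : Null ∞ _ := hN4
    convert hN5 using 1
    funext q
    obtain ⟨y, w, u⟩ := q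
    show sm (g y) _ = B.onePointCongr (sm ((sm (g y) (w : OP T4)).elim ∞ fun v => (A v : OP (T3 × T3))) (u : OP ℝ))
    induction g y using OnePoint.rec with
    | infty => rfl
    | coe z =>
      show _ = ((((A.symm (A (z, w))).1, ((A.symm (A (z, w))).2, u)) : ℂ × (T4 × ℝ)) : OP (ℂ × (T4 × ℝ)))
      rw [A.symm_apply_apply]
      rfl

end KFin
end SD

namespace SD
open Filter Topology OnePoint

section Proj

/-- The Veronese-type map whose restriction to the closed disc identifies antipodal boundary points. -/
def iota (v : ℂ) : ℂ × ℂ := (v ^ 2, (1 - ‖v‖ ^ 2 : ℝ) • v)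

theorem continuous_iota : Continuous iota := by unfold iota; fun_prop

abbrev Disc := Metric.closedBall (0 : ℂ) 1
abbrev Circ := Metric.sphere (0 : ℂ) 1

/-- The real projective plane inside `ℂ × ℂ`. -/
abbrev RP := (iota '' Metric.closedBall (0 : ℂ) 1 : Set (ℂ × ℂ))

instance : CompactSpace Disc := isCompact_iff_compactSpace.1 (isCompact_closedBall _ _)
instance : CompactSpace RP := isCompact_iff_compactSpace.1 ((isCompact_closedBall _ _).image continuous_iota)

def toRP (v : Disc) : RP := ⟨iota v, v, v.2, rfl⟩

theorem continuous_toRP : Continuous toRP := (continuous_iota.comp continuous_subtype_val).subtype_mk _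
theorem toRP_surjective : Function.Surjective toRP := fun ⟨_, v, hv, h⟩ => ⟨⟨v, hv⟩, Subtype.ext h⟩

theorem norm_disc (v : Disc) : ‖(v : ℂ)‖ ≤ 1 := mem_closedBall_zero_iff.1 v.2

theorem iota_eq {v w : ℂ} (hv : ‖v‖ ≤ 1) (h : iota v = iota w) : v = w ∨ (‖v‖ = 1 ∧ v = -w) := by
  have h1 : v ^ 2 = w ^ 2 := congrArg Prod.fst h
  have h2 : (1 - ‖v‖ ^ 2 : ℝ) • v = (1 - ‖w‖ ^ 2 : ℝ) • w := congrArg Prod.snd h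
  rcases sq_eq_sq_iff_eq_or_eq_neg.1 h1 with h3 | h3
  · exact .inl h3
  · subst h3
    rw [norm_neg] at h2 hv ⊢
    rw [smul_neg, neg_eq_iff_add_eq_zero, ← two_smul ℝ, smul_smul, smul_eq_zero] at h2
    rcases h2 with h2 | h2
    · refine .inr ⟨?_, rfl⟩
      have := norm_nonneg w
      nlinarith
    · simp [h2]

/-- The antipodal circle at the boundary of the disc. -/
def toRP1 (c : Circ) : RP := ⟨((c : ℂ), 0), by
  obtain ⟨z, hz⟩ := IsAlgClosed.exists_pow_nat_eq (c : ℂ) two_pos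
  have hn : ‖z‖ ^ 2 = 1 := by rw [← norm_pow, hz]; exact mem_sphere_zero_iff_norm.1 c.2
  refine ⟨z, ?_, ?_⟩
  · rw [mem_closedBall_zero_iff]; nlinarith [norm_nonneg z]
  · rw [iota, hz, hn]; simp⟩

theorem continuous_toRP1 : Continuous toRP1 := by
  refine Continuous.subtype_mk ?_ _
  fun_prop

theorem toRP_of_norm {v : Disc} (h : ‖(v : ℂ)‖ = 1) : toRP v = toRP1 ⟨(v : ℂ) ^ 2, by simp [h]⟩ :=
  Subtype.ext (by simp [toRP, toRP1, iota, h])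

theorem tendsto_compact_fst {K L Z : Type*} [TopologicalSpace K] [TopologicalSpace L] [TopologicalSpace Z] [CompactSpace K]
    {p : K × Z → L × Z} (h : ∀ q, (p q).2 = q.2) : Tendsto p (cocompact (K × Z)) (cocompact (L × Z)) :=
  tendsto_of_preimage fun C hC => ⟨univ ×ˢ (Prod.snd '' C), isCompact_univ.prod (hC.image continuous_snd),
    fun y hy => ⟨mem_univ _, _, hy, h y⟩⟩

theorem isProperMap_toRP (Z : Type*) [TopologicalSpace Z] : IsProperMap fun q : Disc × Z => (toRP q.1, q.2) :=
  continuous_toRP.isProperMap.prodMap isProperMap_id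

def rr (c : Disc) : OP ℂ := pm {c : Disc | ‖(c : ℂ)‖ < 1} (fun c => ((1 - ‖(c : ℂ)‖)⁻¹ ^ 2 : ℝ) • (c : ℂ)) c

theorem good_rr : Good ∞ rr := by
  refine good_pm (isOpen_lt (by fun_prop) (by fun_prop)) ?_ fun R => ?_
  · have h : Continuous fun c : Disc => 1 - ‖(c : ℂ)‖ := by fun_prop
    exact ContinuousOn.smul ((h.continuousOn.inv₀ fun c hc => (sub_pos.2 hc).ne').pow 2) (by fun_prop)
  · refine ⟨{c | ‖(c : ℂ)‖ ≤ R * (1 - ‖(c : ℂ)‖) ^ 2 ∧ ‖(c : ℂ)‖ ≤ 1} ∩ {c | ‖(c : ℂ)‖ ≤ R * (1 - ‖(c : ℂ)‖) ^ 2}, ?_, ?_, ?_⟩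
    · refine IsClosed.isCompact (IsClosed.inter ?_ (isClosed_le (by fun_prop) (by fun_prop)))
      rw [setOf_and]
      exact IsClosed.inter (isClosed_le (by fun_prop) (by fun_prop)) (isClosed_le (by fun_prop) (by fun_prop))
    · rintro c ⟨⟨h, h1⟩, -⟩
      rcases h1.lt_or_eq with h1 | h1
      · exact h1
      · rw [h1] at h; norm_num at h
    · intro c hc hR
      have hc : 0 < 1 - ‖(c : ℂ)‖ := sub_pos.2 hc
      rw [norm_smul, Real.norm_of_nonneg (by positivity), inv_pow, inv_mul_le_iff₀ (by positivity), mul_comm] at hR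
      exact ⟨⟨hR, by linarith⟩, hR⟩

def qmap (p : RP) : OP ℂ := pm {p : RP | ‖(p : ℂ × ℂ).1‖ < 1} (fun p => ((1 - ‖(p : ℂ × ℂ).1‖)⁻¹ ^ 2 : ℝ) • (p : ℂ × ℂ).2) p

theorem qmap_toRP (v : Disc) (h : ‖(v : ℂ)‖ < 1) : qmap (toRP v) = (((1 - ‖(v : ℂ)‖ ^ 2)⁻¹ : ℝ) • (v : ℂ) : ℂ) := by
  have h2 : ‖(v : ℂ) ^ 2‖ < 1 := by rw [norm_pow]; nlinarith [norm_nonneg (v : ℂ)]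
  have h3 : 1 - ‖(v : ℂ)‖ ^ 2 ≠ 0 := by rw [norm_pow] at h2; linarith
  rw [qmap, pm_of_mem (by exact h2)]
  simp only [toRP, iota, norm_pow, smul_smul]
  congr 2
  field_simp

theorem qmap_toRP_one (v : Disc) (h : ‖(v : ℂ)‖ = 1) : qmap (toRP v) = ∞ :=
  pm_of_notMem (by simp [toRP, iota, h])

theorem good_qmap : Good ∞ qmap := by
  refine good_pm (isOpen_lt (by fun_prop) (by fun_prop)) ?_ fun R => ?_
  · have h : Continuous fun c : RP => 1 - ‖(c : ℂ × ℂ).1‖ := by fun_prop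
    exact ContinuousOn.smul ((h.continuousOn.inv₀ fun c hc => (sub_pos.2 hc).ne').pow 2) (by fun_prop)
  · refine ⟨{p | √‖(p : ℂ × ℂ).1‖ ≤ R * (1 - ‖(p : ℂ × ℂ).1‖)}, ?_, ?_, ?_⟩
    · exact IsClosed.isCompact (isClosed_le (by fun_prop) (by fun_prop))
    · rintro ⟨_, v, hv, rfl⟩ (h : √‖v ^ 2‖ ≤ R * (1 - ‖v ^ 2‖))
      show ‖v ^ 2‖ < 1
      rw [mem_closedBall_zero_iff] at hv
      rcases hv.lt_or_eq with h1 | h1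
      · rw [norm_pow]; nlinarith [norm_nonneg v]
      · simp [h1] at h
        linarith
    · rintro ⟨_, v, hv, rfl⟩ (h : ‖v ^ 2‖ < 1) hR
      show √‖v ^ 2‖ ≤ R * (1 - ‖v ^ 2‖)
      rw [norm_pow] at h ⊢
      have h3 : 0 < 1 - ‖v‖ ^ 2 := by linarith
      simp only [iota, norm_pow, smul_smul, norm_smul] at hR
      rw [Real.norm_of_nonneg (by positivity)] at hR
      rw [Real.sqrt_sq (norm_nonneg _)]
      calc ‖v‖ = (1 - ‖v‖ ^ 2)⁻¹ ^ 2 * (1 - ‖v‖ ^ 2) * ‖v‖ * (1 - ‖v‖ ^ 2) := by field_simp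
        _ ≤ _ := mul_le_mul_of_nonneg_right hR h3.le

theorem lipCov_RP : LipCov ℂ RP := by
  have h1 : LipschitzWith 2 fun v : ℂ => ((max 1 ‖v‖)⁻¹ : ℝ) • v := LipschitzWith.of_dist_le_mul fun v w => by
    rw [dist_eq_norm, dist_eq_norm]
    have hm : 1 ≤ max 1 ‖v‖ := le_max_left _ _
    have hn : 1 ≤ max 1 ‖w‖ := le_max_left _ _
    have hw : ‖w‖ ≤ max 1 ‖w‖ := le_max_right _ _
    have hmn : |max 1 ‖w‖ - max 1 ‖v‖| ≤ ‖v - w‖ := by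
      rw [max_comm 1, max_comm 1]; exact (abs_max_sub_max_le_abs _ _ _).trans ((abs_norm_sub_norm_le w v).trans (norm_sub_rev _ _).le)
    set m := max 1 ‖v‖
    set n := max 1 ‖w‖
    have e : (m⁻¹ : ℝ) • v - (n⁻¹ : ℝ) • w = (m⁻¹ : ℝ) • (v - w) + (m⁻¹ * (n - m) : ℝ) • ((n⁻¹ : ℝ) • w) := by
      have : m⁻¹ * (n - m) * n⁻¹ = m⁻¹ - n⁻¹ := by field_simp
      rw [smul_smul, this, smul_sub, sub_smul]; abel
    have i1 : m⁻¹ ≤ 1 := inv_le_one_of_one_le₀ hm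
    have i2 : ‖(n⁻¹ : ℝ) • w‖ ≤ 1 := by
      rw [norm_smul, Real.norm_of_nonneg (by positivity), inv_mul_le_iff₀ (by positivity), mul_one]; exact hw
    have i3 : 0 < m⁻¹ := by positivity
    rw [e]
    refine (norm_add_le _ _).trans ?_
    rw [norm_smul, norm_smul, Real.norm_of_nonneg i3.le, norm_mul, Real.norm_of_nonneg i3.le, Real.norm_eq_abs]
    have := norm_nonneg (v - w)
    have a1 : m⁻¹ * ‖v - w‖ ≤ ‖v - w‖ := mul_le_of_le_one_left this i1
    have a2 : m⁻¹ * |n - m| * ‖(n⁻¹ : ℝ) • w‖ ≤ ‖v - w‖ := by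
      calc _ ≤ m⁻¹ * |n - m| * 1 := by gcongr
        _ ≤ 1 * ‖v - w‖ * 1 := by gcongr
        _ = _ := by ring
    push_cast
    linarith
  have hb : ∀ v : ℂ, ‖((max 1 ‖v‖)⁻¹ : ℝ) • v‖ ≤ 1 := fun v => by
    rw [norm_smul, Real.norm_of_nonneg (by positivity), inv_mul_le_iff₀ (by positivity), mul_one]; exact le_max_right _ _
  have h2 : ∀ v w : ℂ, ‖v‖ ≤ 1 → ‖w‖ ≤ 1 → dist (iota v) (iota w) ≤ 4 * dist v w := fun v w hv hw => by
    rw [dist_eq_norm, dist_eq_norm, Prod.norm_def]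
    have hd := norm_nonneg (v - w)
    refine max_le ?_ ?_
    · show ‖v ^ 2 - w ^ 2‖ ≤ _
      rw [sq_sub_sq, norm_mul]
      nlinarith [norm_add_le v w]
    · show ‖(1 - ‖v‖ ^ 2 : ℝ) • v - (1 - ‖w‖ ^ 2 : ℝ) • w‖ ≤ _
      have e : (1 - ‖v‖ ^ 2 : ℝ) • v - (1 - ‖w‖ ^ 2 : ℝ) • w = (1 - ‖v‖ ^ 2 : ℝ) • (v - w) + ((‖w‖ - ‖v‖) * (‖w‖ + ‖v‖) : ℝ) • w := by
        rw [smul_sub, show (‖w‖ - ‖v‖) * (‖w‖ + ‖v‖) = (1 - ‖v‖ ^ 2) - (1 - ‖w‖ ^ 2) by ring, sub_smul (1 - ‖v‖ ^ 2)]; abel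
      rw [e]
      refine (norm_add_le _ _).trans ?_
      rw [norm_smul, norm_smul, norm_mul, Real.norm_eq_abs, Real.norm_eq_abs, Real.norm_eq_abs]
      have b1 : |1 - ‖v‖ ^ 2| ≤ 1 := abs_le.2 ⟨by nlinarith [norm_nonneg v], by nlinarith [norm_nonneg v]⟩
      have b2 : |‖w‖ - ‖v‖| ≤ ‖v - w‖ := (abs_norm_sub_norm_le w v).trans (norm_sub_rev _ _).le
      have b3 : |‖w‖ + ‖v‖| ≤ 2 := by rw [abs_of_nonneg (by positivity)]; linarith
      have c1 : |1 - ‖v‖ ^ 2| * ‖v - w‖ ≤ 1 * ‖v - w‖ := by gcongr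
      have c2 : |‖w‖ - ‖v‖| * |‖w‖ + ‖v‖| * ‖w‖ ≤ ‖v - w‖ * 2 * 1 := by gcongr
      linarith
  refine ⟨fun v => toRP ⟨((max 1 ‖v‖)⁻¹ : ℝ) • v, mem_closedBall_zero_iff.2 (hb v)⟩, ⟨4 * 2, LipschitzWith.of_dist_le_mul fun v w => ?_⟩, fun p => ?_⟩
  · have := h1.dist_le_mul v w
    have h3 := h2 _ _ (hb v) (hb w)
    rw [Subtype.dist_eq]
    push_cast at this ⊢
    refine h3.trans ?_
    linarith
  · obtain ⟨v, rfl⟩ := toRP_surjective p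
    refine ⟨v, ?_⟩
    congr 1
    ext1
    simp [max_eq_left (norm_disc v)]

end Proj

section Dbl
variable {B E : Type*} [TopologicalSpace B] [T2Space B] [NormedAddCommGroup E] [NormedSpace ℝ E] [ProperSpace E]

theorem good_dbl {k : B × (ℝ × ℝ) → OP E} (hk : Good ∞ k) : Good ∞ (dbl k) := by
  have h1 : Good ∞ fun q : (B × ℝ) × ℝ => k (q.1.1, (q.2, q.1.2)) := hk.comp (by fun_prop)
    (tendsto_of_leftInv (r := fun q : B × (ℝ × ℝ) => ((q.1, q.2.2), q.2.1)) (by fun_prop) fun _ => rfl)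
  have h2 := good_unlog h1
  have h3 : Good ∞ fun p : B × ℂ => unlog (fun q : (B × ℝ) × ℝ => k (q.1.1, (q.2, q.1.2))) ((p.1, p.2.im), p.2.re) :=
    h2.comp (by fun_prop) (tendsto_of_leftInv (r := fun q : (B × ℝ) × ℝ => (q.1.1, Complex.equivRealProdCLM.symm (q.2, q.1.2)))
      (by fun_prop) fun _ => rfl)
  have h4 : Good ∞ fun p : B × ℂ => unlog (fun q : (B × ℝ) × ℝ => k (q.1.1, (q.2, q.1.2))) ((p.1, -p.2.im), -p.2.re) :=
    h2.comp (by fun_prop) (tendsto_of_leftInv (r := fun q : (B × ℝ) × ℝ => (q.1.1, Complex.equivRealProdCLM.symm (-q.2, -q.1.2)))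
      (by fun_prop) fun q => by simp; rfl)
  have := good_ite h3 h4 (σ := fun p : B × ℂ => p.2.re) (by fun_prop) fun p hp => by simp [unlog, hp]
  convert this using 1
  funext p
  simp only [dbl, unlog]
  split_ifs <;> first | rfl | (exfalso; linarith)

theorem dbl_neg (k : B × (ℝ × ℝ) → OP E) (b : B) (w : ℂ) : dbl k (b, -w) = dbl k (b, w) := by
  simp only [dbl, Complex.neg_re, Complex.neg_im, neg_neg]
  split_ifs <;> first | rfl | (exfalso; linarith)

end Dbl
end SD

namespace SD
open Filter Topology OnePoint

theorem Good.congr {X S : Type*} [TopologicalSpace X] [TopologicalSpace S] {b : S} {f g : X → S}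
    (hf : Good b f) (h : ∀ x, f x = g x) : Good b g := by
  rwa [← funext h]

theorem tendsto_of_snd {X L Z : Type*} [TopologicalSpace X] [TopologicalSpace L] [TopologicalSpace Z]
    {p : X → L × Z} (h : Tendsto (fun x => (p x).2) (cocompact X) (cocompact Z)) :
    Tendsto p (cocompact X) (cocompact (L × Z)) :=
  tendsto_of_preimage fun C hC => by
    obtain ⟨D, hD, hs⟩ := mem_cocompact.1 (h (mem_cocompact.2 ⟨_, hC.image continuous_snd, subset_rfl⟩))
    refine ⟨D, hD, fun y hy => by_contra fun hn => hs hn ⟨_, hy, rfl⟩⟩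

/-- The continuous retraction-like map to the circle of squared directions. -/
def sqd (v : ℂ) : Circ :=
  if h : v = 0 then ⟨1, by simp⟩ else ⟨v ^ 2 / (‖v‖ ^ 2 : ℝ), by simp [h]⟩

theorem continuousOn_sqd : ContinuousOn sqd {v | v ≠ 0} := by
  rw [continuousOn_iff_continuous_restrict]
  have h : Continuous fun v : {v : ℂ | v ≠ 0} => ((v : ℂ) ^ 2 / (‖(v : ℂ)‖ ^ 2 : ℝ) : ℂ) :=
    Continuous.div (by fun_prop) (by fun_prop) fun v => by
      have := v.2
      rw [mem_setOf_eq] at this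
      simpa using this
  refine (h.subtype_mk fun v => ?_).congr fun v => ?_
  · have : ‖(v : ℂ)‖ ≠ 0 := norm_ne_zero_iff.2 v.2
    simp [this]
  · simp only [restrict_apply, sqd]
    rw [dif_neg v.2]

theorem sqd_neg (v : ℂ) : sqd (-v) = sqd v := by
  simp [sqd]

/-- Truncation of the plane to the disc. -/
def cut (v : ℂ) : Disc := if h : ‖v‖ ≤ 1 then ⟨v, by simpa using h⟩ else ⟨0, by simp⟩

theorem cut_of_le {v : ℂ} (h : ‖v‖ ≤ 1) : (cut v : ℂ) = v := by simp [cut, h]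

section collar
variable {Z E : Type*} [TopologicalSpace Z] [NormedAddCommGroup E] [NormedSpace ℝ E] [FiniteDimensional ℝ E]

/-- Enlarging a map over the disc by a collar carrying a homotopy of its boundary values. -/
def coll (f : RP × Z → OP E) (N : I × (Circ × Z) → OP E) (q : I × (Disc × Z)) : OP E :=
  if (1 + (q.1 : ℝ)) * ‖(q.2.1 : ℂ)‖ ≤ 1 then f (toRP (cut ((1 + (q.1 : ℝ)) • (q.2.1 : ℂ))), q.2.2)
  else N (projIcc 0 1 zero_le_one ((1 + (q.1 : ℝ)) * ‖(q.2.1 : ℂ)‖ - 1), (sqd q.2.1, q.2.2))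

variable {f : RP × Z → OP E} {N : I × (Circ × Z) → OP E}

theorem norm_scale (e : I) (v : ℂ) : ‖(1 + (e : ℝ)) • v‖ = (1 + (e : ℝ)) * ‖v‖ := by
  rw [norm_smul, Real.norm_of_nonneg (by linarith [e.2.1])]

theorem coll_boundary (h0 : ∀ c z, N (0, (c, z)) = f (toRP1 c, z)) (e : I) (v : Disc) (z : Z)
    (h : (1 + (e : ℝ)) * ‖(v : ℂ)‖ = 1) :
    f (toRP (cut ((1 + (e : ℝ)) • (v : ℂ))), z) =
      N (projIcc 0 1 zero_le_one ((1 + (e : ℝ)) * ‖(v : ℂ)‖ - 1), (sqd v, z)) := by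
  rw [h, sub_self, projIcc_left, show ((⟨0, left_mem_Icc.2 zero_le_one⟩ : I)) = 0 from rfl, h0]
  have hn := (norm_scale e v).trans h
  congr 2
  rw [toRP_of_norm (by rw [cut_of_le hn.le, hn])]
  congr 1
  apply Subtype.ext
  have hv : (v : ℂ) ≠ 0 := fun h0 => by simp [h0] at h
  have hv' : ‖(v : ℂ)‖ ≠ 0 := by simpa using hv
  have h1 : (1 + (e : ℝ)) = ‖(v : ℂ)‖⁻¹ := by field_simp; exact h
  simp only [cut_of_le hn.le, sqd, dif_neg hv]
  rw [h1, Complex.real_smul]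
  push_cast
  ring

theorem good_coll (hf : Good ∞ f) (hN : Good ∞ N) (h0 : ∀ c z, N (0, (c, z)) = f (toRP1 c, z)) :
    Good ∞ (coll f N) := by
  have hcl : IsClosed {q : I × (Disc × Z) | (1 + (q.1 : ℝ)) * ‖(q.2.1 : ℂ)‖ ≤ 1} :=
    isClosed_le (by fun_prop) (by fun_prop)
  have hcr : IsClosed {q : I × (Disc × Z) | 1 ≤ (1 + (q.1 : ℝ)) * ‖(q.2.1 : ℂ)‖} :=
    isClosed_le (by fun_prop) (by fun_prop)
  have hZ : Tendsto (fun q : I × (Disc × Z) => q.2.2) (cocompact _) (cocompact Z) :=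
    (tendsto_snd_cocompact Disc).comp (tendsto_snd_cocompact I)
  refine good_union hcl hcr (eq_univ_of_forall fun q => (le_total _ _ : _ ≤ (1:ℝ) ∨ _)) ?_ ?_
  · have hp : Continuous fun q : {q : I × (Disc × Z) | (1 + (q.1 : ℝ)) * ‖(q.2.1 : ℂ)‖ ≤ 1} =>
        (toRP (cut ((1 + (q.1.1 : ℝ)) • (q.1.2.1 : ℂ))), q.1.2.2) := by
      refine (continuous_toRP.comp ?_).prodMk (by fun_prop)
      rw [Topology.IsInducing.subtypeVal.continuous_iff]
      have : Continuous fun q : {q : I × (Disc × Z) | (1 + (q.1 : ℝ)) * ‖(q.2.1 : ℂ)‖ ≤ 1} =>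
        ((1 + (q.1.1 : ℝ)) • (q.1.2.1 : ℂ)) := by fun_prop
      refine this.congr fun q => (cut_of_le ?_).symm
      rw [norm_scale]; exact q.2
    have := hf.comp hp (tendsto_of_snd (hZ.comp hcl.isClosedEmbedding_subtypeVal.tendsto_cocompact))
    exact this.congr fun q => (if_pos q.2).symm
  · have hp : Continuous fun q : {q : I × (Disc × Z) | 1 ≤ (1 + (q.1 : ℝ)) * ‖(q.2.1 : ℂ)‖} =>
        (projIcc (0 : ℝ) 1 zero_le_one ((1 + (q.1.1 : ℝ)) * ‖(q.1.2.1 : ℂ)‖ - 1), (sqd q.1.2.1, q.1.2.2)) := by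
      refine (continuous_projIcc.comp (by fun_prop)).prodMk (Continuous.prodMk ?_ (by fun_prop))
      refine continuousOn_sqd.comp_continuous (by fun_prop) fun q h => ?_
      have := q.2
      rw [mem_setOf_eq, h, norm_zero] at this
      linarith
    have := hN.comp hp (tendsto_of_snd (tendsto_of_snd (hZ.comp hcr.isClosedEmbedding_subtypeVal.tendsto_cocompact)))
    refine this.congr fun q => ?_
    by_cases h : (1 + (q.1.1 : ℝ)) * ‖(q.1.2.1 : ℂ)‖ ≤ 1
    · simp only [coll]; rw [if_pos h, coll_boundary h0 _ _ _ (le_antisymm h q.2)]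
    · simp only [coll]; rw [if_neg h]

theorem coll_neg (e : I) (v w : Disc) (z : Z) (h : toRP v = toRP w) :
    coll f N (e, (v, z)) = coll f N (e, (w, z)) := by
  rcases iota_eq (norm_disc v) (congrArg Subtype.val h) with h1 | ⟨h1, h2⟩
  · rw [Subtype.ext h1]
  · have h3 : ‖(w : ℂ)‖ = 1 := by rw [← h1, h2, norm_neg]
    simp only [coll, h1, h3, mul_one, h2, sqd_neg, norm_neg]
    by_cases h5 : 1 + (e : ℝ) ≤ 1
    · rw [if_pos h5, if_pos h5]
      have h6 : 1 + (e : ℝ) = 1 := le_antisymm h5 (by linarith [e.2.1])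
      rw [h6, one_smul, one_smul]
      have hw : cut w = w := Subtype.ext (cut_of_le h3.le)
      have hv : cut (-w) = v := Subtype.ext (by rw [cut_of_le (by rw [norm_neg, h3]), h2])
      rw [hw, hv, h]
    · rw [if_neg h5, if_neg h5]

end collar
end SD

namespace SD
open Filter Topology OnePoint

variable {B E : Type*} [NormedAddCommGroup B] [NormedSpace ℝ B] [FiniteDimensional ℝ B]
  [NormedAddCommGroup E] [NormedSpace ℝ E] [FiniteDimensional ℝ E]

/-- The inverse of `v ↦ (1 - ‖v‖²)⁻¹ v`. -/
def shr (u : ℂ) : ℂ := (2 / (1 + √(1 + 4 * ‖u‖ ^ 2)) : ℝ) • u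

theorem continuous_shr : Continuous shr := by
  have : Continuous fun u : ℂ => 2 / (1 + √(1 + 4 * ‖u‖ ^ 2)) :=
    Continuous.div (by fun_prop) (by fun_prop) fun u => by positivity
  exact this.smul continuous_id

theorem norm_shr_lt (u : ℂ) : ‖shr u‖ < 1 := by
  rw [shr, norm_smul, Real.norm_of_nonneg (by positivity), div_mul_eq_mul_div, div_lt_one (by positivity)]
  have : 2 * ‖u‖ ≤ √(1 + 4 * ‖u‖ ^ 2) := Real.le_sqrt_of_sq_le (by nlinarith)
  linarith

theorem shr_inv (u : ℂ) : (1 - ‖shr u‖ ^ 2)⁻¹ • shr u = u := by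
  have h := norm_shr_lt u
  have h0 : 0 ≤ 1 + 4 * ‖u‖ ^ 2 := by positivity
  have hs := Real.sq_sqrt h0
  have h1 : 1 - ‖shr u‖ ^ 2 = 2 / (1 + √(1 + 4 * ‖u‖ ^ 2)) := by
    rw [shr, norm_smul, Real.norm_of_nonneg (by positivity)]
    set s := √(1 + 4 * ‖u‖ ^ 2)
    have : 0 ≤ s := Real.sqrt_nonneg _
    field_simp
    nlinarith
  rw [h1, shr, smul_smul, inv_mul_cancel₀ (by positivity), one_smul]

theorem shr_eq {v : ℂ} (h : ‖v‖ < 1) : shr (((1 - ‖v‖ ^ 2)⁻¹ : ℝ) • v) = v := by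
  have h1 : 0 < 1 - ‖v‖ ^ 2 := by nlinarith [norm_nonneg v]
  have h2 : 1 + 4 * ‖((1 - ‖v‖ ^ 2)⁻¹ : ℝ) • v‖ ^ 2 = ((1 + ‖v‖ ^ 2) / (1 - ‖v‖ ^ 2)) ^ 2 := by
    rw [norm_smul, Real.norm_of_nonneg (by positivity)]
    field_simp
    ring
  rw [shr, h2, Real.sqrt_sq (by positivity), smul_smul]
  convert one_smul ℝ v
  field_simp
  ring

theorem norm_fst_RP (p : RP) : ‖(p : ℂ × ℂ).1‖ ≤ 1 := by
  obtain ⟨v, rfl⟩ := toRP_surjective p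
  show ‖(v : ℂ) ^ 2‖ ≤ 1
  rw [norm_pow]
  exact pow_le_one₀ (norm_nonneg _) (norm_disc v)

theorem rr_of_lt (c : Disc) (h : ‖(c : ℂ)‖ < 1) : rr c = (((1 - ‖(c : ℂ)‖)⁻¹ ^ 2 : ℝ) • (c : ℂ) : ℂ) :=
  pm_of_mem (O := {c : Disc | ‖(c : ℂ)‖ < 1}) h

theorem rr_of_eq (c : Disc) (h : ‖(c : ℂ)‖ = 1) : rr c = ∞ :=
  pm_of_notMem (O := {c : Disc | ‖(c : ℂ)‖ < 1}) (by simp [h])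

/-- The square of `qmap`. -/
def rrp (p : RP) : OP ℂ := rr ⟨(p : ℂ × ℂ).1, by simpa using norm_fst_RP p⟩

theorem rrp_toRP (v : Disc) (h : ‖(v : ℂ)‖ < 1) :
    rrp (toRP v) = (((1 - ‖(v : ℂ)‖ ^ 2)⁻¹ ^ 2 : ℝ) • (v : ℂ) ^ 2 : ℂ) := by
  have h1 : ‖(v : ℂ) ^ 2‖ < 1 := by rw [norm_pow]; nlinarith [norm_nonneg (v : ℂ)]
  refine (rr_of_lt ⟨_, by simpa using h1.le⟩ h1).trans ?_
  simp only [norm_pow]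

theorem rrp_toRP_one (v : Disc) (h : ‖(v : ℂ)‖ = 1) : rrp (toRP v) = ∞ :=
  rr_of_eq ⟨(v : ℂ) ^ 2, by simp [h]⟩ (by simp [h])

theorem null_rr_RP : Null ∞ rrp := by
  refine ⟨fun q => rr ⟨(1 - (q.1 : ℝ)) • (q.2 : ℂ × ℂ).1 + ((q.1 : ℝ) : ℂ), ?_⟩, ?_, fun p => ?_, fun p => ?_⟩
  · rw [mem_closedBall_zero_iff]
    have h1 := q.1.2.1
    have h2 := q.1.2.2
    refine (norm_add_le _ _).trans ?_
    rw [norm_smul, Real.norm_of_nonneg (by linarith), Complex.norm_real, Real.norm_of_nonneg h1]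
    nlinarith [norm_fst_RP q.2]
  · have : Continuous fun q : I × RP => (1 - (q.1 : ℝ)) • (q.2 : ℂ × ℂ).1 + ((q.1 : ℝ) : ℂ) := by fun_prop
    exact ⟨good_rr.1.comp (this.subtype_mk _), by simp⟩
  · simp [rrp]
  · exact pm_of_notMem (by simp)

theorem null_of_even {G : ℂ × (B × ℂ) → OP E} (hG : Good ∞ G) (h : ∀ v z, G (-v, z) = G (v, z)) :
    Null ∞ fun q : RP × (B × ℂ) => (sm (qmap q.1) (q.2 : OP (B × ℂ))).elim ∞ G := by
  choose sq hsq using fun s : ℂ => IsAlgClosed.exists_pow_nat_eq s zero_lt_two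
  have key (v : ℂ) (z : B × ℂ) : G (sq (v ^ 2), z) = G (v, z) := by
    rcases sq_eq_sq_iff_eq_or_eq_neg.1 (hsq (v ^ 2)) with h1 | h1
    · rw [h1]
    · rw [h1, h]
  have hp : IsProperMap fun v : ℂ => v ^ 2 := by
    rw [isProperMap_iff_tendsto_cocompact]
    refine ⟨by fun_prop, ?_⟩
    rw [← Metric.cobounded_eq_cocompact, ← comap_norm_atTop, tendsto_comap_iff, comap_norm_atTop, Metric.cobounded_eq_cocompact]
    refine ((tendsto_pow_atTop two_ne_zero).comp (tendsto_norm_cocompact_atTop (E := ℂ))).congr fun v => ?_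
    simp
  have hG2 : Good ∞ fun q : ℂ × (B × ℂ) => G (sq q.1, q.2) := by
    refine Good.of_surj (hp.prodMap (isProperMap_id (X := B × ℂ))) ?_ (hG.congr fun q => (key q.1 q.2).symm)
    exact Function.Surjective.prodMap (fun s => ⟨_, hsq s⟩) Function.surjective_id
  have hn : Null ∞ fun q : RP × (B × ℂ) =>
      sm (rrp q.1) (q.2 : OP (B × ℂ)) := by
    obtain ⟨H, hH, h0, h1⟩ := null_rr_RP
    refine ⟨fun q => sm (H (q.1, q.2.1)) (q.2.2 : OP (B × ℂ)), ?_, fun q => by simp only [h0], fun q => by simp only [h1]; rfl⟩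
    exact (good_sm hH (good_id (E := B × ℂ))).comp (p := fun q : I × (RP × (B × ℂ)) => ((q.1, q.2.1), q.2.2))
      (by fun_prop) (tendsto_of_leftInv (r := fun q => (q.1.1, (q.1.2, q.2))) (by fun_prop) fun _ => rfl)
  convert hn.bind_left hG2 using 1
  funext ⟨p, z⟩
  obtain ⟨v, rfl⟩ := toRP_surjective p
  rcases (norm_disc v).lt_or_eq with hv | hv
  · show (sm (qmap (toRP v)) _).elim _ _ = (sm (rrp (toRP v)) _).elim _ _
    rw [qmap_toRP v hv, rrp_toRP v hv]
    simp only [sm_coe, OnePoint.elim_some]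
    rw [← key (((1 - ‖(v : ℂ)‖ ^ 2)⁻¹ : ℝ) • (v : ℂ))]
    congr 3
    simp only [norm_pow, Complex.real_smul, mul_pow]
    push_cast
    rfl
  · show (sm (qmap (toRP v)) _).elim _ _ = (sm (rrp (toRP v)) _).elim _ _
    rw [qmap_toRP_one v hv, rrp_toRP_one v hv]
    rfl

end SD

namespace SD
open Filter Topology OnePoint

variable {B E : Type*} [NormedAddCommGroup B] [NormedSpace ℝ B] [FiniteDimensional ℝ B]
  [NormedAddCommGroup E] [NormedSpace ℝ E] [FiniteDimensional ℝ E]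

/-- Rotation of the first and last coordinate. -/
def swr (e : ℝ) (q : ℂ × (B × ℂ)) : ℂ × (B × ℂ) :=
  (Real.cos e • q.1 - Real.sin e • q.2.2, (q.2.1, Real.sin e • q.1 + Real.cos e • q.2.2))

theorem swr_inv (e : ℝ) (q : ℂ × (B × ℂ)) : swr (-e) (swr e q) = q := by
  have h := Real.sin_sq_add_cos_sq e
  obtain ⟨v, b, w⟩ := q
  simp only [swr, Real.cos_neg, Real.sin_neg, Prod.mk.injEq, true_and]
  constructor
  · have : (Real.cos e ^ 2 + Real.sin e ^ 2) • v = v := by rw [add_comm, h, one_smul]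
    linear_combination (norm := module) this
  · have : (Real.cos e ^ 2 + Real.sin e ^ 2) • w = w := by rw [add_comm, h, one_smul]
    linear_combination (norm := module) this

theorem htp_swr {G : ℂ × (B × ℂ) → OP E} (hG : Good ∞ G) :
    Htp ∞ G fun q => G (-q.2.2, (q.2.1, q.1)) := by
  refine Htp.mk' (fun e q => G (swr (e * (Real.pi / 2)) q)) ?_ (fun q => ?_) fun q => ?_
  · refine hG.comp (p := fun q : I × (ℂ × (B × ℂ)) => swr (q.1 * (Real.pi / 2)) q.2) (by unfold swr; fun_prop) ?_
    exact (tendsto_snd_cocompact I).comp (tendsto_of_leftInv (p := fun q : I × (ℂ × (B × ℂ)) =>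
      (q.1, swr (q.1 * (Real.pi / 2)) q.2)) (r := fun q => (q.1, swr (-(q.1 * (Real.pi / 2))) q.2))
      (by unfold swr; fun_prop) fun q => by simp only [swr_inv])
  · simp [swr]
  · simp [swr]

theorem good_expand {D : Disc × (B × ℂ) → OP E} (hD : Good ∞ D) (h : ∀ (v : Disc) z, ‖(v : ℂ)‖ = 1 → D (v, z) = ∞) :
    Good ∞ fun q : ℂ × (B × ℂ) => D (cut (shr q.1), q.2) := by
  have hc : Continuous fun u : ℂ => cut (shr u) := by
    rw [Topology.IsInducing.subtypeVal.continuous_iff]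
    exact continuous_shr.congr fun u => (cut_of_le (norm_shr_lt u).le).symm
  refine good_iff.2 ⟨hD.1.comp ((hc.comp continuous_fst).prodMk continuous_snd), fun R => ?_⟩
  have hK := hD.isCompact_le R
  refine ⟨(fun q : Disc × (B × ℂ) => (((1 - ‖(q.1 : ℂ)‖ ^ 2)⁻¹ : ℝ) • (q.1 : ℂ), q.2)) '' _,
    hK.image_of_continuousOn ?_, fun q v hv hR => ⟨_, ⟨v, hR, hv⟩, ?_⟩⟩
  · have c1 : Continuous fun q : Disc × (B × ℂ) => 1 - ‖(q.1 : ℂ)‖ ^ 2 := by fun_prop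
    have c2 : Continuous fun q : Disc × (B × ℂ) => (q.1 : ℂ) := by fun_prop
    refine ContinuousOn.prodMk ((c1.continuousOn.inv₀ ?_).smul c2.continuousOn) continuousOn_snd
    rintro ⟨v, z⟩ ⟨x, -, hx⟩ h0
    have : ‖(v : ℂ)‖ ^ 2 = 1 := by simp only at h0; linarith
    rw [h v z (by nlinarith [norm_nonneg (v : ℂ)])] at hx
    exact infty_ne_coe _ hx
  · simp only [cut_of_le (norm_shr_lt _).le, shr_inv]

theorem null_of_sym {f : RP × (B × ℂ) → OP E} {N : I × (Circ × (B × ℂ)) → OP E} (hf : Good ∞ f) (hN : Good ∞ N)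
    (h0 : ∀ c z, N (0, (c, z)) = f (toRP1 c, z)) (h1 : ∀ c z, N (1, (c, z)) = ∞)
    (hfs : ∀ p b w, f (p, (b, -w)) = f (p, (b, w))) (hNs : ∀ e c b w, N (e, (c, (b, -w))) = N (e, (c, (b, w)))) :
    Null ∞ f := by
  have hC := good_coll hf hN h0
  choose sec hsec using toRP_surjective
  have key (e : I) (v : Disc) (z : B × ℂ) : coll f N (e, (sec (toRP v), z)) = coll f N (e, (v, z)) :=
    coll_neg e _ _ z (hsec _)
  have hA : Good ∞ fun q : I × (RP × (B × ℂ)) => coll f N (q.1, (sec q.2.1, q.2.2)) := by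
    refine Good.of_surj ((isProperMap_id (X := I)).prodMap (isProperMap_toRP (B × ℂ))) ?_
      (hC.congr fun q => (key q.1 q.2.1 q.2.2).symm)
    exact Function.Surjective.prodMap Function.surjective_id (Function.Surjective.prodMap toRP_surjective Function.surjective_id)
  have hD : Good ∞ fun q : Disc × (B × ℂ) => coll f N (1, q) :=
    hC.comp (p := fun q : Disc × (B × ℂ) => ((1 : I), q)) (by fun_prop) (tendsto_of_snd tendsto_id)
  have hb (v : Disc) (z : B × ℂ) (h : ‖(v : ℂ)‖ = 1) : coll f N (1, (v, z)) = ∞ := by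
    simp only [coll, h]
    rw [if_neg (by simp), projIcc_of_right_le _ (by norm_num)]
    exact h1 _ _
  have hF := good_expand hD hb
  have hs (v : Disc) (b : B) (w : ℂ) : coll f N (1, (v, (b, -w))) = coll f N (1, (v, (b, w))) := by
    simp only [coll, hfs, hNs]
  have hG := htp_swr hF
  have hE := null_of_even hG.good_right fun v z => by simp only [hs]
  have h2 := (hG.bind (good_sm good_qmap (good_id (E := B × ℂ)))).null hE
  refine Htp.null ⟨_, hA, fun q => ?_, fun q => rfl⟩ ?_
  · obtain ⟨p, z⟩ := q
    obtain ⟨v, rfl⟩ := toRP_surjective p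
    simp only [key]
    simp only [coll]
    rw [if_pos (by simpa using norm_disc v)]
    congr 2
    rw [show cut ((1 + ((0 : I) : ℝ)) • (v : ℂ)) = v from Subtype.ext (by simp [cut_of_le (norm_disc v)])]
  · convert h2 using 1
    funext ⟨p, z⟩
    obtain ⟨v, rfl⟩ := toRP_surjective p
    simp only [key]
    rcases (norm_disc v).lt_or_eq with hv | hv
    · rw [qmap_toRP v hv]
      simp only [sm_coe, OnePoint.elim_some]
      rw [shr_eq hv, show cut (v : ℂ) = v from Subtype.ext (cut_of_le (norm_disc v))]
    · rw [qmap_toRP_one v hv, hb v z hv]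
      rfl

end SD

namespace SD
open Filter Topology OnePoint
open Module

variable {B E : Type*} [NormedAddCommGroup B] [NormedSpace ℝ B] [FiniteDimensional ℝ B]
  [NormedAddCommGroup E] [NormedSpace ℝ E] [FiniteDimensional ℝ E]

theorem null_dbl {Y : Type*} [TopologicalSpace Y] [T2Space Y] (φ : RP × B ≃ₜ Y) {k : Y × (ℝ × ℝ) → OP E} (hk : Good ∞ k)
    (hN : Null ∞ fun q : (Circ × B) × (ℝ × ℝ) => k (φ (toRP1 q.1.1, q.1.2), q.2)) : Null ∞ (dbl k) := by
  obtain ⟨N, hNg, h0, h1⟩ := hN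
  have hN' : Good ∞ fun q : (I × (Circ × B)) × (ℝ × ℝ) => N (q.1.1, (q.1.2, q.2)) :=
    hNg.comp (by fun_prop) (tendsto_homeo (Homeomorph.prodAssoc I (Circ × B) (ℝ × ℝ)))
  have hd := good_dbl hN'
  have : Null ∞ fun q : RP × (B × ℂ) => dbl k (φ (q.1, q.2.1), q.2.2) := by
    refine null_of_sym (N := fun q => dbl (fun q : (I × (Circ × B)) × (ℝ × ℝ) => N (q.1.1, (q.1.2, q.2)))
      ((q.1, (q.2.1, q.2.2.1)), q.2.2.2)) ?_ ?_ (fun c z => ?_) (fun c z => ?_) (fun p b w => dbl_neg _ _ _)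
      fun e c b w => dbl_neg _ _ _
    · exact (good_dbl hk).comp (by fun_prop) (tendsto_of_leftInv (r := fun q : Y × ℂ => ((φ.symm q.1).1, ((φ.symm q.1).2, q.2)))
        (by fun_prop) fun q => by simp)
    · exact hd.comp (by fun_prop) (tendsto_of_leftInv (r := fun q : (I × (Circ × B)) × ℂ => (q.1.1, (q.1.2.1, (q.1.2.2, q.2))))
        (by fun_prop) fun q => rfl)
    · simp only [dbl, h0]
    · simp only [dbl, h1, ite_self]
  convert this.comp (p := fun q : Y × ℂ => ((φ.symm q.1).1, ((φ.symm q.1).2, q.2))) (by fun_prop)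
    (tendsto_of_leftInv (r := fun q : RP × (B × ℂ) => (φ (q.1, q.2.1), q.2.2)) (by fun_prop) fun q => by simp) using 1
  funext q
  simp

/-- Squaring on the circle. -/
def csq (c : Circ) : Circ := ⟨(c : ℂ) ^ 2, by simp⟩

theorem continuous_csq : Continuous csq := by
  unfold csq; fun_prop

theorem csq_surjective : Function.Surjective csq := fun c => by
  obtain ⟨w, hw⟩ := IsAlgClosed.exists_pow_nat_eq (c : ℂ) zero_lt_two
  have h : ‖w‖ ^ 2 = 1 := by rw [← norm_pow, hw]; simp
  have h1 : ‖w‖ = 1 := by nlinarith [norm_nonneg w]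
  exact ⟨⟨w, by simp [h1]⟩, Subtype.ext hw⟩

def circNeg (c : Circ) : Circ := ⟨-(c : ℂ), by simp⟩

theorem csq_eq {c d : Circ} (h : csq c = csq d) : c = d ∨ c = circNeg d := by
  rcases sq_eq_sq_iff_eq_or_eq_neg.1 (congrArg Subtype.val h) with h | h
  · exact Or.inl (Subtype.ext h)
  · exact Or.inr (Subtype.ext h)

theorem csq_neg (c : Circ) : csq (circNeg c) = csq c := Subtype.ext (neg_sq _)

theorem circ_preconnected : IsPreconnected (univ : Set Circ) := by
  have h : IsPreconnected (Metric.sphere (0 : ℂ) 1) :=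
    isPreconnected_sphere (by rw [← Module.finrank_eq_rank, Complex.finrank_real_complex]; norm_num) 0 1
  exact Subtype.preconnectedSpace h |>.isPreconnected_univ

/-- Cayley transform. -/
def cay (x : OP ℝ) : Circle := x.elim 1 fun x => ⟨(x + Complex.I) / (x - Complex.I), by
  show _ ∈ Metric.sphere (0 : ℂ) 1
  rw [mem_sphere_zero_iff_norm, norm_div, ← Complex.norm_conj (x - Complex.I)]
  have : (starRingEnd ℂ) (x - Complex.I) = x + Complex.I := by simp
  rw [this, div_self]
  intro h
  simpa using congrArg Complex.im (norm_eq_zero.1 h)⟩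

theorem isInducing_circle : Topology.IsInducing (fun z : Circle => (z : ℂ)) := Topology.IsInducing.subtypeVal

theorem sub_I_ne (x : ℝ) : (x : ℂ) - Complex.I ≠ 0 := fun h => by
  simpa using congrArg Complex.im h

theorem continuous_cay : Continuous cay := by
  have hg : Good 1 (fun x : ℝ => cay x) := by
    constructor
    · rw [isInducing_circle.continuous_iff]
      exact Continuous.div (by fun_prop) (by fun_prop) sub_I_ne
    · rw [isInducing_circle.tendsto_nhds_iff]
      have e : ((fun z : Circle => (z : ℂ)) ∘ fun x : ℝ => cay x) = fun x : ℝ => 1 + 2 * Complex.I * ((x : ℂ) - Complex.I)⁻¹ := by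
        funext x
        show ((x : ℂ) + Complex.I) / (x - Complex.I) = _
        have := sub_I_ne x
        field_simp
        ring
      rw [e]
      have h1 : Tendsto (fun x : ℝ => ‖(x : ℂ) - Complex.I‖) (cocompact ℝ) atTop := by
        refine tendsto_atTop_mono (f := fun x : ℝ => ‖x‖ - 1) (fun x => ?_) (tendsto_atTop_add_const_right _ _ (tendsto_norm_cocompact_atTop (E := ℝ)))
        have := norm_sub_norm_le (x : ℂ) Complex.I
        simpa using this
      have h2 : Tendsto (fun x : ℝ => ((x : ℂ) - Complex.I)⁻¹) (cocompact ℝ) (𝓝 0) :=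
        tendsto_zero_iff_norm_tendsto_zero.2 (h1.inv_tendsto_atTop.congr fun x => by simp)
      simpa using (h2.const_mul (2 * Complex.I)).const_add 1
  refine hg.ext.congr fun x => ?_
  induction x using OnePoint.rec <;> rfl

/-- The inverse Cayley transform. -/
def uncay (z : Circle) : OP ℝ := pm {z : Circle | (z : ℂ).re < 1} (fun z => (z : ℂ).im / (1 - (z : ℂ).re)) z

theorem circle_sq (z : Circle) : (z : ℂ).re ^ 2 + (z : ℂ).im ^ 2 = 1 := by
  have := Circle.normSq_coe z
  rw [Complex.normSq_apply] at this
  linarith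

theorem continuous_uncay : Continuous uncay := by
  refine continuous_pm (isOpen_lt (by fun_prop) (by fun_prop)) (ContinuousOn.div (by fun_prop) (by fun_prop) fun z hz => (sub_pos.2 hz).ne') fun R => ?_
  refine ⟨{z | 1 + (z : ℂ).re ≤ R ^ 2 * (1 - (z : ℂ).re)}, isClosed_le (by fun_prop) (by fun_prop), fun z hz => ?_, fun z hz hR => ?_⟩
  · have := circle_sq z
    rw [mem_setOf_eq] at hz ⊢
    by_contra h
    have : (z : ℂ).re = 1 := by nlinarith [sq_nonneg (z : ℂ).im]
    rw [this] at hz; linarith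
  · have := circle_sq z
    rw [mem_setOf_eq] at hz ⊢
    have h1 : 0 < 1 - (z : ℂ).re := sub_pos.2 hz
    have h2 : ((z : ℂ).im / (1 - (z : ℂ).re)) ^ 2 ≤ R ^ 2 := by
      rw [← sq_abs]; exact pow_le_pow_left₀ (abs_nonneg _) hR 2
    rw [div_pow, div_le_iff₀ (by positivity)] at h2
    have h3 : (1 - (z : ℂ).re) * (1 + (z : ℂ).re) ≤ (1 - (z : ℂ).re) * (R ^ 2 * (1 - (z : ℂ).re)) := by nlinarith
    exact le_of_mul_le_mul_left h3 h1

theorem uncay_one : uncay 1 = ∞ := pm_of_notMem (by simp)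

theorem uncay_cay (x : OP ℝ) : uncay (cay x) = x := by
  induction x using OnePoint.rec with
  | infty => exact uncay_one
  | coe x =>
    have h : ((cay x : Circle) : ℂ) = ⟨(x ^ 2 - 1) / (x ^ 2 + 1), 2 * x / (x ^ 2 + 1)⟩ := by
      show ((x : ℂ) + Complex.I) / (x - Complex.I) = _
      rw [div_eq_iff (sub_I_ne x)]
      apply Complex.ext
      · simp; field_simp; ring
      · simp; field_simp; ring
    have hx : 0 < x ^ 2 + 1 := by positivity
    rw [uncay, pm_of_mem]
    · rw [h]; congr 1; simp only; field_simp; ring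
    · rw [mem_setOf_eq, h]; simp only; rw [div_lt_one hx]; linarith

end SD

namespace SD
open Filter Topology OnePoint
open Module

def imReReal : ImRe ℝ ℂ where
  σ := ((ContinuousLinearEquiv.prodComm ℝ ℝ ℝ).trans Complex.equivRealProdCLM.symm)
  one := by apply Complex.ext <;> simp
  sq ξ := by
    apply Complex.ext <;> simp [Complex.sq_norm, Complex.normSq_apply]
  nrm ξ t := by
    simp [Complex.sq_norm, Complex.normSq_apply]; ring

theorem exists_angle {b : Circ → OP ℝ} (h : Null ∞ b) : ∃ θ : Circ → ℝ, Continuous θ ∧ ∀ c, Circle.exp (θ c) = cay (b c) := by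
  obtain ⟨H, hH, h0, h1⟩ := h
  let H' : C(I × Circ, Circle) := ⟨fun q => cay (H (unitInterval.symm q.1, q.2)),
    continuous_cay.comp (hH.1.comp (by fun_prop))⟩
  let z : C(Circ, ℝ) := ⟨fun _ => 0, continuous_const⟩
  have hz : ∀ a, H' (0, a) = Circle.exp (z a) := fun a => by
    show cay (H (unitInterval.symm 0, a)) = Circle.exp 0
    rw [unitInterval.symm_zero, h1, Circle.exp_zero]; rfl
  have hl := Circle.isCoveringMap_exp.liftHomotopy_lifts H' z hz
  refine ⟨fun c => Circle.isCoveringMap_exp.liftHomotopy H' z hz (1, c), by fun_prop, fun c => ?_⟩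
  have := congrFun hl (1, c)
  rw [show b c = H (0, c) from (h0 c).symm]
  simpa [H'] using this

theorem null_of_null_sq {b : Circ → OP ℝ} (hb : Good ∞ b) (h : Null ∞ fun c => b (csq c)) : Null ∞ b := by
  obtain ⟨θ, cθ, eθ⟩ := exists_angle h
  have cneg : Continuous circNeg := by unfold circNeg; fun_prop
  have nn (c : Circ) : circNeg (circNeg c) = c := Subtype.ext (neg_neg _)
  have hper (c : Circ) : ∃ m : ℤ, θ (circNeg c) - θ c = m * (2 * Real.pi) := by
    have := (eθ (circNeg c)).trans ((congrArg _ (congrArg b (csq_neg c))).trans (eθ c).symm)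
    obtain ⟨m, hm⟩ := Circle.exp_eq_exp.1 this
    exact ⟨m, by linarith⟩
  have hsymm (c : Circ) : θ (circNeg c) = θ c := by
    by_contra hne
    have hc : ContinuousOn (fun c => θ (circNeg c) - θ c) univ := by fun_prop
    have key : ∃ c, θ (circNeg c) - θ c = Real.pi := by
      have hb1 : ∀ c, 0 < θ (circNeg c) - θ c → 2 * Real.pi ≤ θ (circNeg c) - θ c := fun c hc => by
        obtain ⟨m, hm⟩ := hper c
        rw [hm] at hc ⊢
        have : (0 : ℝ) < m := by by_contra h; nlinarith [Real.pi_pos]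
        have : (1 : ℝ) ≤ m := by exact_mod_cast Int.add_one_le_of_lt (by exact_mod_cast this : (0 : ℤ) < m)
        nlinarith [Real.pi_pos]
      have main : ∀ c, 0 < θ (circNeg c) - θ c → ∃ c, θ (circNeg c) - θ c = Real.pi := fun c hc0 => by
        have h2 := hb1 c hc0
        have := (circ_preconnected.image _ hc).ordConnected.out (mem_image_of_mem _ (mem_univ (circNeg c))) (mem_image_of_mem _ (mem_univ c))
        obtain ⟨d, -, hd⟩ := this (a := Real.pi) ⟨by simp only [nn]; linarith [Real.pi_pos], by linarith [Real.pi_pos]⟩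
        exact ⟨d, hd⟩
      rcases lt_or_gt_of_ne hne with h | h
      · exact main (circNeg c) (by rw [nn]; linarith)
      · exact main c (by linarith)
    obtain ⟨d, hd⟩ := key
    obtain ⟨m, hm⟩ := hper d
    rw [hd] at hm
    have : (1 : ℝ) = m * 2 := by
      have := Real.pi_pos
      field_simp at hm; linarith
    have : (1 : ℤ) = m * 2 := by exact_mod_cast this
    omega
  choose sec hsec using csq_surjective
  have hs (c : Circ) : θ (sec (csq c)) = θ c := by
    rcases csq_eq (hsec (csq c)) with h | h
    · rw [h]
    · rw [h, hsymm]
  have cψ : Continuous fun c => θ (sec c) := by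
    have hq : Topology.IsQuotientMap csq :=
      (continuous_csq.isClosedMap).isQuotientMap continuous_csq csq_surjective
    rw [hq.continuous_iff]
    exact cθ.congr fun c => (hs c).symm
  refine ⟨fun q => uncay (Circle.exp ((1 - (q.1 : ℝ)) * θ (sec q.2))), ⟨?_, by simp⟩, fun c => ?_, fun c => ?_⟩
  · exact continuous_uncay.comp (Circle.exp.continuous.comp (((by fun_prop : Continuous fun q : I × Circ => 1 - (q.1 : ℝ))).mul (cψ.comp continuous_snd)))
  · simp [eθ, hsec, uncay_cay]
  · simp [uncay_one]

/-- Nullity descends along the self-map `s`. -/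
def SqInj (X : Type*) [TopologicalSpace X] (s : X → X) (E : Type*) [TopologicalSpace E] : Prop :=
  ∀ b : X → OP E, Good ∞ b → (Null ∞ fun x => b (s x)) → Null ∞ b

theorem SqInj.step {P X E : Type*} [NormedAddCommGroup P] [NormedSpace ℝ P] [FiniteDimensional ℝ P] [MetricSpace X] [ProperSpace X]
    [NormedAddCommGroup E] [NormedSpace ℝ E] [FiniteDimensional ℝ E] {s : X → X} (hs : SqInj X s E) (hc : LipCov P X)
    (hsc : Continuous s) (hsp : Tendsto s (cocompact X) (cocompact X))
    (hd : finrank ℝ P + 2 < 2 * (finrank ℝ E + 1))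
    (hinj : ∀ f : X → OP E, Good ∞ f → Null ∞ (Sus f) → Null ∞ f) :
    SqInj (X × ℝ) (Prod.map s id) (E × ℝ) := fun β hβ hN => by
  obtain ⟨b, hb, hh⟩ := freud_surj hc hd hβ
  have hp : Tendsto (Prod.map s (id : ℝ → ℝ)) (cocompact _) (cocompact _) := by
    rw [← coprod_cocompact]; exact hsp.prodMap_coprod tendsto_id
  exact hh.null (hs b hb (hinj _ (hb.comp hsc hsp) (hN.of_htp (hh.comp (by fun_prop) hp)))).sus

end SD

namespace SD
open Module
open Filter Topology OnePoint

theorem continuous_map_homeo {E F : Type*} [TopologicalSpace E] [TopologicalSpace F] (e : E ≃ₜ F) :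
    Continuous (OnePoint.map e) :=
  (OnePoint.continuous_map e.continuous e.map_coclosedCompact.le)

theorem Good.map {X E F : Type*} [TopologicalSpace X] [TopologicalSpace E] [TopologicalSpace F] (e : E ≃ₜ F)
    {f : X → OP E} (hf : Good ∞ f) : Good ∞ fun x => (f x).map e :=
  hf.post (continuous_map_homeo e) rfl

theorem null_map {X E F : Type*} [TopologicalSpace X] [TopologicalSpace E] [TopologicalSpace F] (e : E ≃ₜ F)
    {f : X → OP E} : (Null ∞ fun x => (f x).map e) ↔ Null ∞ f := by
  refine ⟨fun h => ?_, fun h => h.post (continuous_map_homeo e) rfl⟩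
  have h' := h.post (continuous_map_homeo e.symm) (c := ∞) rfl
  convert h' using 1
  funext x
  cases h : f x using OnePoint.rec <;> simp [h]

theorem null_homeo {X Y S : Type*} [TopologicalSpace X] [TopologicalSpace Y] [TopologicalSpace S] {b : S} (e : Y ≃ₜ X)
    {f : X → S} : (Null b fun y => f (e y)) ↔ Null b f :=
  ⟨fun h => by simpa using h.homeo e.symm, fun h => h.homeo e⟩

def ImRe.ofEquiv {E E' A : Type*} [NormedAddCommGroup E] [NormedSpace ℝ E] [NormedAddCommGroup E'] [NormedSpace ℝ E']
    [NormedDivisionRing A] [NormedAlgebra ℝ A] (j : ImRe E A) (e : E' ≃L[ℝ] E) : ImRe E' A where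
  σ := (e.prodCongr (ContinuousLinearEquiv.refl ℝ ℝ)).trans j.σ
  one := by simpa using j.one
  sq ξ := by simpa using j.sq (e ξ)
  nrm ξ t := by simpa using j.nrm (e ξ) t

theorem SqInj.homeo {X X' E E' : Type*} [TopologicalSpace X] [TopologicalSpace X'] [TopologicalSpace E] [TopologicalSpace E']
    {s : X → X} {s' : X' → X'} (h : SqInj X s E) (e : X ≃ₜ X') (hs : ∀ x, e (s x) = s' (e x)) (a : E' ≃ₜ E) :
    SqInj X' s' E' := fun b hb hN => by
  have h1 := h (fun x => (b (e x)).map a) ((hb.comp e.continuous (tendsto_homeo e)).map a) (by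
    have h2 := (null_map a).2 (hN.homeo e)
    simpa only [hs] using h2)
  exact (null_homeo e).1 ((null_map a).1 h1)

theorem lipCov_Circ : LipCov ℝ Circ := by
  refine ⟨fun t => ⟨(Circle.exp t : ℂ), by simp⟩, ⟨1, ?_⟩, fun c => ?_⟩
  · refine LipschitzWith.of_dist_le_mul fun x y => ?_
    rw [Subtype.dist_eq, Complex.dist_eq, NNReal.coe_one, one_mul, Real.dist_eq]
    simp only [Circle.coe_exp]
    have : Complex.exp (x * Complex.I) - Complex.exp (y * Complex.I)
        = Complex.exp (y * Complex.I) * (Complex.exp (Complex.I * (x - y : ℝ)) - 1) := by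
      rw [mul_sub, ← Complex.exp_add]; push_cast; ring_nf
    rw [this, norm_mul, Complex.norm_exp_ofReal_mul_I, one_mul]
    exact Real.norm_exp_I_mul_ofReal_sub_one_le
  · obtain ⟨θ, hθ⟩ := Circle.exp_surjective (Submonoid.unitSphere ℂ |> fun _ => (⟨(c : ℂ), by simp [Submonoid.unitSphere]⟩ : Circle))
    exact ⟨θ, Subtype.ext (by simp [hθ])⟩

theorem sqInj_csq (n : ℕ) : ∀ (W E : Type) [NormedAddCommGroup W] [NormedSpace ℝ W] [FiniteDimensional ℝ W]
    [NormedAddCommGroup E] [NormedSpace ℝ E] [FiniteDimensional ℝ E], finrank ℝ W = n → finrank ℝ E = n + 1 →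
    SqInj (Circ × W) (Prod.map csq id) E := by
  induction n with
  | zero =>
    intro W E _ _ _ _ _ _ hW hE
    haveI : Subsingleton W := finrank_zero_iff.1 hW
    haveI : Unique W := ⟨⟨0⟩, fun _ => Subsingleton.elim _ _⟩
    have e : E ≃L[ℝ] ℝ := ContinuousLinearEquiv.ofFinrankEq (by simp [hE])
    have h : SqInj Circ csq ℝ := fun b hb h => null_of_null_sq hb h
    exact h.homeo (Homeomorph.prodUnique Circ W).symm (fun x => rfl) e.toHomeomorph
  | succ n ih =>
    intro W E _ _ _ _ _ _ hW hE
    have e : E ≃L[ℝ] ((Fin (n + 1) → ℝ) × ℝ) := ContinuousLinearEquiv.ofFinrankEq (by simp [hE])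
    have w : W ≃L[ℝ] ((Fin n → ℝ) × ℝ) := ContinuousLinearEquiv.ofFinrankEq (by simp [hW])
    have h := ih (Fin n → ℝ) (Fin (n + 1) → ℝ) (by simp) (by simp)
    have hc : LipCov (ℝ × (Fin n → ℝ)) (Circ × (Fin n → ℝ)) := lipCov_Circ.prod LipCov.self
    have h' := h.step hc (continuous_csq.prodMap continuous_id) (tendsto_compact_fst fun _ => rfl) (by simp; omega) (by
      intro f hf hN
      rcases Nat.eq_zero_or_pos n with rfl | hn
      · exact (imReReal.ofEquiv (ContinuousLinearEquiv.ofFinrankEq (by simp))).null_of_null_Sus hf hN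
      · exact freud_inj hc (by simp; omega) hf hN)
    exact h'.homeo ((Homeomorph.prodAssoc _ _ _).trans ((Homeomorph.refl _).prodCongr w.toHomeomorph.symm))
      (fun x => rfl) e.toHomeomorph

/-- Families over the projective plane are trivial over the projective line in the stable range. -/
theorem null_toRP1 {V E : Type} [NormedAddCommGroup V] [NormedSpace ℝ V] [FiniteDimensional ℝ V]
    [NormedAddCommGroup E] [NormedSpace ℝ E] [FiniteDimensional ℝ E] (h : finrank ℝ E = finrank ℝ V + 1)
    {κ : RP × V → OP E} (hκ : Good ∞ κ) : Null ∞ fun q : Circ × V => κ (toRP1 q.1, q.2) := by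
  refine sqInj_csq (finrank ℝ V) V E rfl h _ (hκ.comp (by have := continuous_toRP1; fun_prop) (tendsto_compact_fst fun _ => rfl)) ?_
  have hd (t : I) (c : Circ) : (t : ℝ) • (c : ℂ) ∈ Metric.closedBall (0 : ℂ) 1 := by
    simp [abs_of_nonneg t.2.1, t.2.2]
  have hD := hκ.comp (continuous_toRP.prodMap continuous_id) (tendsto_compact_fst (L := RP) (Z := V) fun _ => rfl)
  have key : Good ∞ fun q : I × (Circ × V) => κ (toRP ⟨((1 - (q.1 : ℝ)) : ℝ) • (q.2.1 : ℂ), hd ⟨1 - q.1, by linarith [q.1.2.2], by linarith [q.1.2.1]⟩ q.2.1⟩, q.2.2) := by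
    refine hD.comp (p := fun q : I × (Circ × V) => ((⟨((1 - (q.1 : ℝ)) : ℝ) • (q.2.1 : ℂ), hd ⟨1 - q.1, by linarith [q.1.2.2], by linarith [q.1.2.1]⟩ q.2.1⟩ : Disc), q.2.2)) ?_ ?_
    · exact (Continuous.subtype_mk (by fun_prop) _).prodMk (by fun_prop)
    · refine tendsto_of_preimage fun C hC => ⟨univ ×ˢ (univ ×ˢ (Prod.snd '' C)), isCompact_univ.prod (isCompact_univ.prod (hC.image continuous_snd)), fun y hy => ⟨trivial, trivial, _, hy, rfl⟩⟩
  refine Htp.null ⟨_, key, fun q => ?_, fun q => rfl⟩ ?_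
  · congr 2
    rw [toRP_of_norm (by simp)]
    congr 1
    exact Subtype.ext (by simp [csq])
  · have h0 : Null ∞ fun v : V => κ (toRP ⟨0, by simp⟩, v) :=
      null_of_dim_lt LipCov.self (by omega) (hκ.comp (by fun_prop) (tendsto_of_snd tendsto_id))
    convert h0.comp continuous_snd (tendsto_snd_cocompact Circ) using 4
    exact Subtype.ext (by simp)

end SD

namespace SD
open Module
open Filter Topology OnePoint
open scoped Quaternion
local notation "T3" => ℝ × ℝ × ℝ
local notation "T4" => ℝ × ℝ × ℝ × ℝ

def quatL : ((ℂ × ℝ) × ℝ) ≃ₗ[ℝ] ℍ[ℝ] where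
  toFun p := ⟨p.2, p.1.1.re, p.1.1.im, p.1.2⟩
  invFun q := ((⟨q.imI, q.imJ⟩, q.imK), q.re)
  map_add' p q := rfl
  map_smul' c p := by
    ext
    · rfl
    · exact Complex.smul_re c p.1.1
    · exact Complex.smul_im c p.1.1
    · rfl
  left_inv p := rfl
  right_inv q := rfl

theorem quatL_re (p) : (quatL p).re = p.2 := rfl
theorem quatL_imI (p) : (quatL p).imI = p.1.1.re := rfl
theorem quatL_imJ (p) : (quatL p).imJ = p.1.1.im := rfl
theorem quatL_imK (p) : (quatL p).imK = p.1.2 := rfl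

def imReQuat : ImRe (ℂ × ℝ) ℍ[ℝ] where
  σ := quatL.toContinuousLinearEquiv
  one := by ext <;> rfl
  sq ξ := by
    have h := Quaternion.normSq_eq_norm_mul_self (quatL (ξ, 0))
    have h' : (quatL.toContinuousLinearEquiv (ξ, (0 : ℝ))) = quatL (ξ, 0) := rfl
    rw [h', pow_two, ← h, Quaternion.normSq_def']
    ext <;> simp [quatL_re, quatL_imI, quatL_imJ, quatL_imK] <;> ring
  nrm ξ t := by
    have h (t : ℝ) : (quatL.toContinuousLinearEquiv (ξ, t)) = quatL (ξ, t) := rfl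
    simp only [h, pow_two, ← Quaternion.normSq_eq_norm_mul_self]
    simp only [Quaternion.normSq_def']
    simp only [quatL_re, quatL_imI, quatL_imJ, quatL_imK]; ring

def assoc5 (Y : Type*) [TopologicalSpace Y] : (((((Y × ℝ) × ℝ) × ℝ) × ℝ) × ℝ) ≃ₜ Y × (T4 × ℝ) where
  toFun q := (q.1.1.1.1.1, ((q.1.1.1.1.2, q.1.1.1.2, q.1.1.2, q.1.2), q.2))
  invFun q := (((((q.1, q.2.1.1), q.2.1.2.1), q.2.1.2.2.1), q.2.1.2.2.2), q.2.2)
  left_inv q := rfl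
  right_inv q := rfl
  continuous_toFun := by fun_prop
  continuous_invFun := by fun_prop

theorem sus5 {Y E : Type*} [TopologicalSpace Y] [TopologicalSpace E] {g : Y → OP E}
    (h : Null ∞ fun q : Y × (T4 × ℝ) => sm (g q.1) (q.2 : OP (T4 × ℝ))) :
    Null ∞ (Sus (Sus (Sus (Sus (Sus g))))) := by
  have h' := (null_map (assoc5 E).symm).2 (h.homeo (assoc5 Y))
  convert h' using 1
  funext q
  obtain ⟨⟨⟨⟨⟨y, a⟩, b⟩, c⟩, d⟩, e⟩ := q
  simp only [Sus, assoc5, Homeomorph.homeomorph_mk_coe]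
  cases h : g y using OnePoint.rec <;> rfl

variable {Y P : Type*} [MetricSpace Y] [ProperSpace Y] [NormedAddCommGroup P] [NormedSpace ℝ P] [FiniteDimensional ℝ P]

theorem null_Sus_of_sm (hc : LipCov P Y) (hd : finrank ℝ P ≤ 4) {g : Y → OP ℂ} (hg : Good ∞ g)
    (h : Null ∞ fun q : Y × (T4 × ℝ) => sm (g q.1) (q.2 : OP (T4 × ℝ))) : Null ∞ (Sus g) := by
  have h1 := good_Sus hg
  have h2 := good_Sus h1
  have h3 := good_Sus h2
  have h4 := good_Sus h3
  have c1 := hc.prod (LipCov.self (P := ℝ))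
  have c2 := c1.prod (LipCov.self (P := ℝ))
  have c3 := c2.prod (LipCov.self (P := ℝ))
  have c4 := c3.prod (LipCov.self (P := ℝ))
  have n4 := freud_inj c4 (by simp; omega) h4 (sus5 h)
  have n3 := freud_inj c3 (by simp; omega) h3 n4
  have n2 := freud_inj c2 (by simp; omega) h2 n3
  exact imReQuat.null_of_null_Sus h1 n2

theorem null_of_eq {Z S : Type*} [TopologicalSpace Z] [TopologicalSpace S] {b : S} {f : Z → S} (h : ∀ z, f z = b) : Null b f := by
  rw [funext h]
  exact Htp.refl ⟨continuous_const, tendsto_const_nhds⟩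

theorem desusp {B : Type} [NormedAddCommGroup B] [NormedSpace ℝ B] [FiniteDimensional ℝ B] (φ : RP × B ≃ₜ Y)
    (hc : LipCov P Y) (hd : finrank ℝ P ≤ 4) {g : Y → OP ℂ} (hg : Good ∞ g)
    {H : I × ((Y × ℝ) × ℝ) → OP (ℂ × ℝ)} (hH : Good ∞ H) (h0 : ∀ z, H (0, z) = Sus (gplus g) z) (h1 : ∀ z, H (1, z) = ∞)
    (hB : finrank ℝ B ≤ 1 ∨ ∀ e c b x t, H (e, ((φ (toRP1 c, b), x), t)) = ∞) : Null ∞ (Sus g) := by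
  obtain ⟨k, hk, hki, hkn⟩ := k_lemma hH h0 h1 hg
  refine null_Sus_of_sm hc hd hg (hkn ?_)
  let ψ : RP × (B × T3) ≃ₜ Y × T3 := (Homeomorph.prodAssoc _ _ _).symm.trans (φ.prodCongr (Homeomorph.refl _))
  refine null_dbl ψ hk ?_
  have hψ (r : RP) (b : B) (a : T3) : ψ (r, (b, a)) = (φ (r, b), a) := rfl
  rcases hB with hB | hB
  · let χ : RP × ((B × T3) × (ℝ × ℝ)) ≃ₜ (Y × T3) × (ℝ × ℝ) := (Homeomorph.prodAssoc _ _ _).symm.trans (ψ.prodCongr (Homeomorph.refl _))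
    have hκ : Good ∞ fun q : RP × ((B × T3) × (ℝ × ℝ)) => k (χ q) := hk.comp χ.continuous (tendsto_homeo χ)
    have key : Null ∞ fun q : Circ × ((B × T3) × (ℝ × ℝ)) => k (χ (toRP1 q.1, q.2)) := by
      rcases Nat.le_one_iff_eq_zero_or_eq_one.1 hB with hB | hB
      · exact null_of_dim_lt (lipCov_Circ.prod LipCov.self) (by simp [hB])
          (hκ.comp (p := fun q : Circ × ((B × T3) × (ℝ × ℝ)) => (toRP1 q.1, q.2)) (by have := continuous_toRP1; fun_prop) (tendsto_compact_fst fun _ => rfl))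
      · exact null_toRP1 (by simp [hB]) hκ
    exact key.homeo (Homeomorph.prodAssoc _ _ _)
  · refine null_of_eq fun q => ?_
    exact (hki _ (fun e x t => hB e q.1.1 q.1.2.1 x t) _ _)

end SD

namespace SD
open Module
open Filter Topology OnePoint

theorem tendsto_cocompact_of_compact {K X : Type*} [TopologicalSpace K] [TopologicalSpace X] [CompactSpace K] (p : K → X) :
    Tendsto p (cocompact K) (cocompact X) := by
  rw [cocompact_eq_bot]; exact tendsto_bot

/-- A nonvanishing function on the disc cannot be odd on the boundary. -/
theorem not_odd {μ : Disc → ℂ} (hμ : Continuous μ) (h0 : ∀ v, μ v ≠ 0)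
    (hodd : ∀ c d : Disc, ‖(c : ℂ)‖ = 1 → (d : ℂ) = -c → μ d = -μ c) : False := by
  have hd (t : I) (v : Disc) : (t : ℝ) • (v : ℂ) ∈ Metric.closedBall (0 : ℂ) 1 := by
    have := norm_disc v
    rw [mem_closedBall_zero_iff, norm_smul, Real.norm_of_nonneg t.2.1]
    exact mul_le_one₀ t.2.2 (norm_nonneg _) this
  let B : Disc → Circle := fun v => ⟨(‖μ v‖⁻¹ : ℝ) • μ v, by
    show _ ∈ Metric.sphere (0 : ℂ) 1
    rw [mem_sphere_zero_iff_norm, norm_smul, norm_inv, norm_norm, inv_mul_cancel₀ (norm_ne_zero_iff.2 (h0 v))]⟩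
  have hB : Continuous B := Continuous.subtype_mk ((hμ.norm.inv₀ fun v => norm_ne_zero_iff.2 (h0 v)).smul hμ) _
  let H' : C(I × Disc, Circle) := ⟨fun q => B ⟨(q.1 : ℝ) • (q.2 : ℂ), hd q.1 q.2⟩, hB.comp (Continuous.subtype_mk (by fun_prop) _)⟩
  obtain ⟨z0, hz0⟩ := Circle.exp_surjective (B ⟨0, by simp⟩)
  let z : C(Disc, ℝ) := ⟨fun _ => z0, continuous_const⟩
  have hz : ∀ a, H' (0, a) = Circle.exp (z a) := fun a => by
    show B _ = Circle.exp z0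
    rw [hz0]; congr 1; exact Subtype.ext (by simp)
  have hl := Circle.isCoveringMap_exp.liftHomotopy_lifts H' z hz
  set θ : Disc → ℝ := fun v => Circle.isCoveringMap_exp.liftHomotopy H' z hz (1, v) with hθ
  have cθ : Continuous θ := by fun_prop
  have eθ (v : Disc) : Circle.exp (θ v) = B v := by
    have := congrFun hl (1, v)
    exact this.trans (congrArg B (Subtype.ext (by simp)))
  let inc : Circ → Disc := fun c => ⟨c, Metric.sphere_subset_closedBall c.2⟩
  have cinc : Continuous inc := Continuous.subtype_mk continuous_subtype_val _
  have cneg : Continuous circNeg := by unfold circNeg; fun_prop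
  have nn (c : Circ) : circNeg (circNeg c) = c := Subtype.ext (neg_neg _)
  have hc : ContinuousOn (fun c => θ (inc (circNeg c)) - θ (inc c)) univ := by fun_prop
  have hne (c : Circ) : θ (inc (circNeg c)) - θ (inc c) ≠ 0 := fun h => by
    have h1 : B (inc (circNeg c)) = B (inc c) := by rw [← eθ, ← eθ, sub_eq_zero.1 h]
    have h2 : μ (inc (circNeg c)) = - μ (inc c) := hodd _ _ (by simp [inc]) rfl
    have h3 := congrArg Subtype.val h1
    simp only [B, h2, norm_neg, smul_neg] at h3
    have h4 := (self_eq_neg.1 h3.symm)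
    rcases smul_eq_zero.1 h4 with h | h
    · exact h0 _ (norm_eq_zero.1 (inv_eq_zero.1 h))
    · exact h0 _ h
  have key (c : Circ) (h : 0 < θ (inc (circNeg c)) - θ (inc c)) : False := by
    have := (circ_preconnected.image _ hc).ordConnected.out (mem_image_of_mem _ (mem_univ (circNeg c))) (mem_image_of_mem _ (mem_univ c))
    obtain ⟨d, -, hd⟩ := this (a := 0) ⟨by simp only [nn]; linarith, h.le⟩
    exact hne d hd
  rcases lt_or_gt_of_ne (hne ⟨1, by simp⟩) with h | h
  · exact key (circNeg ⟨1, by simp⟩) (by rw [nn]; linarith)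
  · exact key _ h

theorem not_null_qmap : ¬ Null ∞ qmap := fun hN => by
  set j := imReReal
  obtain ⟨H, hH, h0, h1⟩ := (null_map j.σ.symm.toHomeomorph).2 hN
  obtain ⟨⟨δ, hδ, hd⟩, -⟩ := j.unif_P hH
  obtain ⟨n, hn⟩ := exists_nat_one_div_lt hδ
  let t : ℕ → I := fun k => projIcc 0 1 zero_le_one (1 - k / (n + 1))
  have ht0 : t 0 = 1 := by simp [t]
  have ht1 : t (n + 1) = 0 := by
    have : ((n : ℝ) + 1) ≠ 0 := by positivity
    simp [t, div_self this]
  have htd (k : ℕ) : dist (t (k + 1)) (t k) < δ := by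
    refine lt_of_le_of_lt ((LipschitzWith.projIcc zero_le_one).dist_le_mul _ _) ?_
    rw [Real.dist_eq]
    have : (1 - ((k + 1 : ℕ) : ℝ) / (n + 1) - (1 - k / (n + 1))) = -(1 / (n + 1)) := by push_cast; ring
    rw [this, abs_neg, abs_of_pos (by positivity)]
    simpa using hn
  let u : RP → ℂ × ℂ := fun p => j.V (fun k => H (t k, p)) (n + 1)
  have cu : Continuous u := (j.good_V (z := fun k p => H (t k, p)) (fun k => hH.comp (by fun_prop) (tendsto_cocompact_of_compact _)) _).1
  have hu (p : RP) : u p ≠ 0 := by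
    refine j.V_ne_zero ?_ fun k _ => hd _ _ ?_
    · show ‖j.P (H (t 0, p)) - _‖ < _
      rw [ht0, h1]
      simp [ImRe.P]
    · rw [Prod.dist_eq, dist_self]; exact max_lt (htd k) hδ
  have hP (p : RP) : j.P ((qmap p).map j.σ.symm.toHomeomorph) (u p) = u p := by
    have := j.P_V (fun k => H (t k, p)) (n + 1)
    simp only [ht1, h0] at this
    exact this
  let μ : Disc → ℂ := fun v => (starRingEnd ℂ) (v : ℂ) * (u (toRP v)).1 + ((1 - ‖(v : ℂ)‖ ^ 2 : ℝ) : ℂ) * (u (toRP v)).2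
  have cuv := cu.comp continuous_toRP
  have hinf (v : Disc) (h : ‖(v : ℂ)‖ = 1) : (u (toRP v)).2 = 0 := by
    have := hP (toRP v)
    rw [qmap_toRP_one v h] at this
    exact (congrArg Prod.snd this).symm
  refine not_odd (μ := μ) ?_ (fun v hv => ?_) fun c d hc hcd => ?_
  · have h1 : Continuous fun v : Disc => (u (toRP v)).1 := cuv.fst
    have h2 : Continuous fun v : Disc => (u (toRP v)).2 := cuv.snd
    have h3 : Continuous fun v : Disc => (starRingEnd ℂ) (v : ℂ) := Complex.continuous_conj.comp continuous_subtype_val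
    have h4 : Continuous fun v : Disc => ((1 - ‖(v : ℂ)‖ ^ 2 : ℝ) : ℂ) := by fun_prop
    exact (h3.mul h1).add (h4.mul h2)
  · rcases (norm_disc v).eq_or_lt with h | h
    · have h2 := hinf v h
      refine hu (toRP v) (Prod.ext ?_ h2)
      simp only [μ, h2, mul_zero, add_zero, mul_eq_zero] at hv
      rcases hv with hv | hv
      · simp only [map_eq_zero] at hv
        rw [hv] at h; simp at h
      · exact hv
    · have := hP (toRP v)
      have hr : 0 < 1 - ‖(v : ℂ)‖ ^ 2 := by nlinarith [norm_nonneg (v : ℂ)]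
      rw [qmap_toRP v h] at this
      change j.P0 (j.σ.symm _) _ = _ at this
      rw [j.P0_apply] at this
      have hb : j.bar (j.σ.symm (((1 - ‖(v : ℂ)‖ ^ 2)⁻¹ : ℝ) • (v : ℂ))) = ((1 - ‖(v : ℂ)‖ ^ 2)⁻¹ : ℝ) • (starRingEnd ℂ) (v : ℂ) := by
        generalize (1 - ‖(v : ℂ)‖ ^ 2)⁻¹ = r
        apply Complex.ext <;> simp [ImRe.bar, j, imReReal]
      have hw : j.bar (j.σ.symm (((1 - ‖(v : ℂ)‖ ^ 2)⁻¹ : ℝ) • (v : ℂ))) * (u (toRP v)).1 + (u (toRP v)).2 = 0 := by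
        rw [hb]
        have : ((1 - ‖(v : ℂ)‖ ^ 2 : ℝ) : ℂ) ≠ 0 := by exact_mod_cast hr.ne'
        refine (mul_eq_zero.1 ?_).resolve_left this
        rw [← hv]
        simp only [μ, Complex.real_smul]
        rw [Complex.ofReal_inv]
        field_simp
      rw [hw] at this
      exact hu _ (by rw [← this]; simp)
  · have hcd' : toRP d = toRP c := by
      rw [toRP_of_norm hc, toRP_of_norm (v := d) (by rw [hcd, norm_neg, hc])]
      congr 1; exact Subtype.ext (by simp [hcd])
    simp only [μ, hcd', hinf c hc, hcd]
    simp
end SD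

namespace SD
open Module
open Filter Topology OnePoint

theorem qmap_toRP1 (c : Circ) : qmap (toRP1 c) = ∞ := by
  obtain ⟨d, hd⟩ := csq_surjective c
  have h := toRP_of_norm (v := ⟨(d : ℂ), Metric.sphere_subset_closedBall d.2⟩) (by simp)
  have h2 : toRP1 c = toRP ⟨(d : ℂ), Metric.sphere_subset_closedBall d.2⟩ := by
    rw [h]; congr 1; rw [← hd]; rfl
  rw [h2]
  exact qmap_toRP_one _ (by simp)

/-- The third iterate of the Hopf construction. -/
def eta3 : (((ℂ × ℝ) × ℝ) × ℝ) → OP ℂ := gplus (gplus (gplus fun z : ℂ => (z : OP ℂ)))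

theorem gplus_congr {Y Y' : Type*} {g : Y → OP ℂ} {g' : Y' → OP ℂ} {y : Y} {y' : Y'}
    (h : g y = g' y') (t : ℝ) : gplus g (y, t) = gplus g' (y', t) := by
  simp only [gplus, Sus, h]

theorem Sus_congr {Y Y' E : Type*} [TopologicalSpace E] {g : Y → OP E} {g' : Y' → OP E} {y : Y} {y' : Y'}
    (h : g y = g' y') (t : ℝ) : Sus g (y, t) = Sus g' (y', t) := by
  simp only [Sus, h]

theorem gplus_infty {Y : Type*} {g : Y → OP ℂ} {y : Y} (h : g y = ∞) (t : ℝ) : gplus g (y, t) = ∞ := by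
  show (sm (g y) _).elim ∞ etab = ∞
  rw [h]; rfl

theorem Sus_infty {Y E : Type*} [TopologicalSpace E] {g : Y → OP E} {y : Y} (h : g y = ∞) (t : ℝ) : Sus g (y, t) = ∞ := by
  show sm (g y) _ = ∞
  rw [h]; rfl

theorem not_null_Sus_eta3 : ¬ Null ∞ (Sus eta3) := fun ⟨H, hH, h0, h1⟩ => by
  have g0 := good_qmap
  have g1 := good_gplus g0
  have g2 := good_gplus g1
  have c0 := lipCov_RP
  have c1 := c0.prod (LipCov.self (P := ℝ))
  have c2 := c1.prod (LipCov.self (P := ℝ))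
  let Q : ((((RP × ℝ) × ℝ) × ℝ) × ℝ) → OP ((((ℂ × ℝ) × ℝ) × ℝ) × ℝ) := Sus (Sus (Sus (Sus qmap)))
  have hQ : Good ∞ Q := good_Sus (good_Sus (good_Sus (good_Sus g0)))
  have hQi (p : RP) (h : qmap p = ∞) (a b x t : ℝ) : Q ((((p, a), b), x), t) = ∞ :=
    Sus_infty (Sus_infty (Sus_infty (Sus_infty h a) b) x) t
  have hQc (p : RP) (v : ℂ) (h : qmap p = v) (a b x t : ℝ) : Q ((((p, a), b), x), t) = ((((v, a), b), x), t) := by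
    simp only [Q, Sus, h, sm_coe]
  have hH' : Good ∞ fun q : I × ((((RP × ℝ) × ℝ) × ℝ) × ℝ) => (pr q.1 (Q q.2)).elim ∞ H := hH.bind (good_pr hQ)
  have n2 : Null ∞ (Sus (gplus (gplus qmap))) := by
    refine desusp (Y := (RP × ℝ) × ℝ) (B := ℝ × ℝ) (Homeomorph.prodAssoc _ _ _).symm c2 (by simp) g2 hH' (fun z => ?_) (fun z => ?_)
      (Or.inr fun e c b x t => ?_)
    · obtain ⟨⟨⟨⟨p, a⟩, b⟩, x⟩, t⟩ := z
      cases h : qmap p using OnePoint.rec with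
      | infty =>
        simp only [hQi p h]
        exact (Sus_infty (gplus_infty (gplus_infty (gplus_infty h a) b) x) t).symm
      | coe v =>
        simp only [hQc p v h]
        refine (h0 _).trans ?_
        exact Sus_congr (gplus_congr (gplus_congr (gplus_congr h.symm a) b) x) t
    · obtain ⟨⟨⟨⟨p, a⟩, b⟩, x⟩, t⟩ := z
      cases h : qmap p using OnePoint.rec with
      | infty => simp only [hQi p h]; rfl
      | coe v => simp only [hQc p v h]; exact h1 _
    · have := hQi (toRP1 c) (qmap_toRP1 c) b.1 b.2 x t
      show (pr e (Q ((((toRP1 c, b.1), b.2), x), t))).elim ∞ H = ∞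
      rw [this]; rfl
  obtain ⟨H, hH, h0, h1⟩ := n2
  have n1 : Null ∞ (Sus (gplus qmap)) :=
    desusp (Y := RP × ℝ) (B := ℝ) (Homeomorph.refl _) c1 (by simp) g1 hH h0 h1 (Or.inl (by simp))
  obtain ⟨H, hH, h0, h1⟩ := n1
  have n0 : Null ∞ (Sus qmap) :=
    desusp (Y := RP) (B := Fin 0 → ℝ) (Homeomorph.prodUnique _ _) c0 (by simp) g0 hH h0 h1 (Or.inl (by simp))
  exact not_null_qmap (freud_inj c0 (by simp) g0 n0)
end SD

namespace SD
open Module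
open Filter Topology OnePoint
open scoped Quaternion

def qmk (a b c d : ℝ) : ℍ[ℝ] := ⟨a, b, c, d⟩

@[simp] theorem qmk_re (a b c d : ℝ) : (qmk a b c d).re = a := rfl
@[simp] theorem qmk_imI (a b c d : ℝ) : (qmk a b c d).imI = b := rfl
@[simp] theorem qmk_imJ (a b c d : ℝ) : (qmk a b c d).imJ = c := rfl
@[simp] theorem qmk_imK (a b c d : ℝ) : (qmk a b c d).imK = d := rfl

/-- The quaternion unit `i`. -/
def qi : ℍ[ℝ] := qmk 0 1 0 0

/-- `t + b p`, a quaternion of norm `√(t² + b²)` for a unit imaginary `p`. -/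
def qlin (b t : ℝ) (p : ℍ[ℝ]) : ℍ[ℝ] := t • 1 + b • p

def qth (b t : ℝ) (p : ℍ[ℝ]) : ℍ[ℝ] := (t ^ 2 + b ^ 2)⁻¹ • (qlin (-b) t p * qlin b t qi)

def qeta (b t : ℝ) (p : ℍ[ℝ]) : ℍ[ℝ] := (t ^ 2 + b ^ 2)⁻¹ • (qlin (-b) t p * qi * qlin b t p)

def qpi (b : ℝ) (z : ℂ) : ℍ[ℝ] :=
  (z.re ^ 2 + z.im ^ 2 + b ^ 2)⁻¹ • qmk 0 (z.re ^ 2 + z.im ^ 2 - b ^ 2) (2 * b * z.re) (2 * b * z.im)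

/-- Unit imaginary quaternions. -/
def UIm (p : ℍ[ℝ]) : Prop := p.re = 0 ∧ p.imI ^ 2 + p.imJ ^ 2 + p.imK ^ 2 = 1

theorem uim_qi : UIm qi := by simp [UIm, qi]

theorem UIm.norm {p : ℍ[ℝ]} (h : UIm p) : ‖p‖ = 1 := by
  have := Quaternion.normSq_eq_norm_mul_self p
  rw [Quaternion.normSq_def', h.1] at this
  nlinarith [norm_nonneg p, h.2]

theorem normSq_qlin {b t : ℝ} {p : ℍ[ℝ]} (h : UIm p) : Quaternion.normSq (qlin b t p) = t ^ 2 + b ^ 2 := by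
  simp [Quaternion.normSq_def', qlin, h.1]
  linear_combination b ^ 2 * h.2

theorem norm_qlin {b t : ℝ} {p : ℍ[ℝ]} (h : UIm p) : ‖qlin b t p‖ = √(t ^ 2 + b ^ 2) := by
  rw [← normSq_qlin h, Quaternion.normSq_eq_norm_mul_self, Real.sqrt_mul_self (norm_nonneg _)]

theorem norm_qth {b t : ℝ} {p : ℍ[ℝ]} (h : UIm p) (hb : 0 < t ^ 2 + b ^ 2) : ‖qth b t p‖ = 1 := by
  rw [qth, norm_smul, norm_mul, norm_qlin h, norm_qlin uim_qi, neg_sq, Real.mul_self_sqrt hb.le, Real.norm_of_nonneg (by positivity),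
    inv_mul_cancel₀ hb.ne']

theorem uim_qeta {b t : ℝ} {p : ℍ[ℝ]} (h : UIm p) (hb : 0 < t ^ 2 + b ^ 2) : UIm (qeta b t p) := by
  obtain ⟨h0, h1⟩ := h
  have hn : Quaternion.normSq (qeta b t p) = 1 := by
    rw [Quaternion.normSq_eq_norm_mul_self, qeta, norm_smul, norm_mul, norm_mul, norm_qlin ⟨h0, h1⟩, norm_qlin ⟨h0, h1⟩, uim_qi.norm, neg_sq,
      mul_one, Real.mul_self_sqrt hb.le, Real.norm_of_nonneg (by positivity), inv_mul_cancel₀ hb.ne', one_mul]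
  have hr : (qeta b t p).re = 0 := by
    simp [qeta, qlin, qi, h0, Quaternion.re_mul]
    ring_nf; simp
  rw [Quaternion.normSq_def', hr] at hn
  exact ⟨hr, by linarith⟩

theorem uim_qpi {b : ℝ} {z : ℂ} (hb : 0 < z.re ^ 2 + z.im ^ 2 + b ^ 2) : UIm (qpi b z) := by
  refine ⟨by simp [qpi], ?_⟩
  simp only [qpi, Quaternion.imI_smul, Quaternion.imJ_smul, Quaternion.imK_smul, smul_eq_mul]
  have := hb.ne'
  simp only [qmk_imI, qmk_imJ, qmk_imK]
  field_simp
  ring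

theorem qlin_mul_qi (b t : ℝ) : qlin (-b) t qi * qlin b t qi = (t ^ 2 + b ^ 2) • 1 := by
  ext <;> simp [qlin, qi] <;> ring

theorem norm_qth_sub {b t : ℝ} {p : ℍ[ℝ]} (hb0 : 0 ≤ b) (hb : 0 < t ^ 2 + b ^ 2) :
    ‖qth b t p - 1‖ = b / √(t ^ 2 + b ^ 2) * ‖p - qi‖ := by
  have h1 : qth b t p - 1 = ((t ^ 2 + b ^ 2)⁻¹ * b) • ((qi - p) * qlin b t qi) := by
    have : (1 : ℍ[ℝ]) = (t ^ 2 + b ^ 2)⁻¹ • (qlin (-b) t qi * qlin b t qi) := by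
      rw [qlin_mul_qi, smul_smul, inv_mul_cancel₀ hb.ne', one_smul]
    conv_lhs => rw [this, qth, ← smul_sub, ← sub_mul]
    rw [mul_smul]
    congr 1
    rw [← smul_mul_assoc]
    congr 1
    simp only [qlin]
    module
  rw [h1, norm_smul, norm_mul, norm_mul, norm_qlin uim_qi, norm_sub_rev, Real.norm_of_nonneg (inv_nonneg.2 hb.le), Real.norm_of_nonneg hb0]
  have := Real.sq_sqrt hb.le
  have h2 := Real.sqrt_pos.2 hb
  nth_rw 1 [← this]
  field_simp

theorem qlin_mul {p : ℍ[ℝ]} (h : UIm p) (b t : ℝ) : qlin (-b) t p * qlin b t p = (t ^ 2 + b ^ 2) • 1 := by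
  obtain ⟨h0, h1⟩ := h
  ext <;> simp [qlin, h0] <;> first | linear_combination b ^ 2 * h1 | ring

theorem norm_qeta_sub {b t : ℝ} {p : ℍ[ℝ]} (h : UIm p) (hb0 : 0 ≤ b) (hb : 0 < t ^ 2 + b ^ 2) :
    ‖qeta b t p - qi‖ ≤ b / √(t ^ 2 + b ^ 2) * (2 * ‖p - qi‖) := by
  have h1 : qeta b t p - qi = ((t ^ 2 + b ^ 2)⁻¹ * b) • ((qi * (p - qi) - (p - qi) * qi) * qlin b t p) := by
    have : qi = (t ^ 2 + b ^ 2)⁻¹ • (qi * (qlin (-b) t p * qlin b t p)) := by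
      rw [qlin_mul h, mul_smul_comm, mul_one, smul_smul, inv_mul_cancel₀ hb.ne', one_smul]
    conv_lhs => rw [qeta]; rhs; rw [this]
    rw [← smul_sub, ← mul_assoc qi, ← sub_mul, mul_smul]
    congr 1
    rw [← smul_mul_assoc]
    congr 1
    simp only [qlin, mul_sub, sub_mul, add_mul, mul_add, smul_mul_assoc, mul_smul_comm, one_mul, mul_one, neg_smul, neg_mul, mul_neg]
    module
  rw [h1, norm_smul, norm_mul, norm_mul, norm_qlin h, Real.norm_of_nonneg (inv_nonneg.2 hb.le), Real.norm_of_nonneg hb0]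
  have h3 : ‖qi * (p - qi) - (p - qi) * qi‖ ≤ 2 * ‖p - qi‖ := by
    refine (norm_sub_le _ _).trans ?_
    rw [norm_mul, norm_mul, uim_qi.norm]; linarith
  have := Real.sq_sqrt hb.le
  have h2 := Real.sqrt_pos.2 hb
  nth_rw 1 [← this]
  calc _ = b / √(t ^ 2 + b ^ 2) * ‖qi * (p - qi) - (p - qi) * qi‖ := by field_simp
    _ ≤ _ := by gcongr

theorem norm_qpi_sub {b : ℝ} {z : ℂ} (hb0 : 0 ≤ b) (hb : 0 < ‖z‖ ^ 2 + b ^ 2) :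
    ‖qpi b z - qi‖ = b / √(‖z‖ ^ 2 + b ^ 2) * 2 := by
  have hz : ‖z‖ ^ 2 = z.re ^ 2 + z.im ^ 2 := by rw [Complex.sq_norm, Complex.normSq_apply]; ring
  rw [← sq_eq_sq₀ (norm_nonneg _) (by positivity), sq, ← Quaternion.normSq_eq_norm_mul_self, Quaternion.normSq_def', mul_pow, div_pow, Real.sq_sqrt hb.le, hz]
  rw [hz] at hb
  simp [qpi, qi]
  have := hb.ne'
  field_simp
  ring

end SD

namespace SD
open Module
open Filter Topology OnePoint
open scoped Quaternion

/-- Cutoff function, deformed to the constant `1`. -/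
def bs (s r : ℝ) : ℝ := (1 - s) * (max (1 - r) 0) ^ 2 + s

theorem bs_nonneg {s : ℝ} (h0 : 0 ≤ s) (h1 : s ≤ 1) (r : ℝ) : 0 ≤ bs s r :=
  add_nonneg (mul_nonneg (by linarith) (sq_nonneg _)) h0

theorem bs_le_one {s : ℝ} (h0 : 0 ≤ s) (h1 : s ≤ 1) {r : ℝ} (hr : 0 ≤ r) : bs s r ≤ 1 := by
  have h2 : max (1 - r) 0 ≤ 1 := max_le (by linarith) zero_le_one
  have h3 : (max (1 - r) 0) ^ 2 ≤ 1 := pow_le_one₀ (le_max_right _ _) h2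
  unfold bs; nlinarith

theorem bs_pos {s : ℝ} (h0 : 0 ≤ s) (h1 : s ≤ 1) {r : ℝ} (hr : 0 ≤ r) : 0 < r + bs s r ^ 2 := by
  rcases hr.eq_or_lt with rfl | h
  · simp [bs]
  · positivity

theorem bs_one (r : ℝ) : bs 1 r = 1 := by simp [bs]

def sq0 (s : ℝ) (z : ℂ) : ℍ[ℝ] := qpi (bs s (z.re ^ 2 + z.im ^ 2)) z
def sqe (s t : ℝ) (p : ℍ[ℝ]) : ℍ[ℝ] := qeta (bs s (t ^ 2)) t p
def sqt (s t : ℝ) (p : ℍ[ℝ]) : ℍ[ℝ] := qth (bs s (t ^ 2)) t p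

abbrev V5 := ((ℂ × ℝ) × ℝ) × ℝ

/-- A map `ℝ⁵ → S²` in the homotopy class of `eta3`. -/
def gS (s : ℝ) (w : V5) : ℍ[ℝ] := sqe s w.2 (sqe s w.1.2 (sqe s w.1.1.2 (sq0 s w.1.1.1)))
def qS (s : ℝ) (w : V5 × ℝ) : ℍ[ℝ] := sqt s w.2 (gS s w.1)

section
variable {s : ℝ}

theorem uim_sq0 (h0 : 0 ≤ s) (h1 : s ≤ 1) (z : ℂ) : UIm (sq0 s z) := uim_qpi (bs_pos h0 h1 (by positivity))
theorem uim_sqe (h0 : 0 ≤ s) (h1 : s ≤ 1) (t : ℝ) {p : ℍ[ℝ]} (h : UIm p) : UIm (sqe s t p) := uim_qeta h (bs_pos h0 h1 (by positivity))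
theorem uim_gS (h0 : 0 ≤ s) (h1 : s ≤ 1) (w : V5) : UIm (gS s w) :=
  uim_sqe h0 h1 _ (uim_sqe h0 h1 _ (uim_sqe h0 h1 _ (uim_sq0 h0 h1 _)))
theorem norm_qS (h0 : 0 ≤ s) (h1 : s ≤ 1) (w : V5 × ℝ) : ‖qS s w‖ = 1 := norm_qth (uim_gS h0 h1 _) (bs_pos h0 h1 (by positivity))

theorem exists_decay (h0 : 0 ≤ s) (h1 : s ≤ 1) (t : ℝ) : ∃ a, bs s (t ^ 2) / √(t ^ 2 + bs s (t ^ 2) ^ 2) = a ∧ 0 ≤ a ∧ a ≤ 1 ∧ |t| * a ≤ 1 := by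
  have hb := bs_nonneg h0 h1 (t ^ 2)
  have hb1 := bs_le_one h0 h1 (sq_nonneg t)
  have hp := Real.sqrt_pos.2 (bs_pos h0 h1 (sq_nonneg t))
  have e1 : bs s (t ^ 2) ≤ √(t ^ 2 + bs s (t ^ 2) ^ 2) := Real.le_sqrt_of_sq_le (by nlinarith [sq_nonneg t])
  have e2 : |t| ≤ √(t ^ 2 + bs s (t ^ 2) ^ 2) := Real.le_sqrt_of_sq_le (by rw [sq_abs]; nlinarith)
  refine ⟨_, rfl, by positivity, (div_le_one hp).2 e1, ?_⟩
  rw [← mul_div_assoc, div_le_one hp]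
  nlinarith [abs_nonneg t]

theorem norm_mul_norm_qS_sub (h0 : 0 ≤ s) (h1 : s ≤ 1) (w : V5 × ℝ) : ‖w‖ * ‖qS s w - 1‖ ≤ 16 := by
  obtain ⟨⟨⟨⟨z, x⟩, y⟩, t⟩, u⟩ := w
  obtain ⟨a1, e1, p1, l1, m1⟩ := exists_decay h0 h1 ‖z‖
  obtain ⟨a2, e2, p2, l2, m2⟩ := exists_decay h0 h1 x
  obtain ⟨a3, e3, p3, l3, m3⟩ := exists_decay h0 h1 y
  obtain ⟨a4, e4, p4, l4, m4⟩ := exists_decay h0 h1 t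
  obtain ⟨a5, e5, p5, l5, m5⟩ := exists_decay h0 h1 u
  have hz : ‖z‖ ^ 2 = z.re ^ 2 + z.im ^ 2 := by rw [Complex.sq_norm, Complex.normSq_apply]; ring
  have n1 : ‖sq0 s z - qi‖ = a1 * 2 := by
    rw [sq0, ← hz, norm_qpi_sub (bs_nonneg h0 h1 _) (bs_pos h0 h1 (sq_nonneg _)), e1]
  have n2 := norm_qeta_sub (uim_sq0 h0 h1 z) (bs_nonneg h0 h1 _) (bs_pos h0 h1 (sq_nonneg x))
  have n3 := norm_qeta_sub (uim_sqe h0 h1 x (uim_sq0 h0 h1 z)) (bs_nonneg h0 h1 _) (bs_pos h0 h1 (sq_nonneg y))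
  have n4 := norm_qeta_sub (uim_sqe h0 h1 y (uim_sqe h0 h1 x (uim_sq0 h0 h1 z))) (bs_nonneg h0 h1 _) (bs_pos h0 h1 (sq_nonneg t))
  have n5 := norm_qth_sub (p := gS s (((z, x), y), t)) (bs_nonneg h0 h1 _) (bs_pos h0 h1 (sq_nonneg u))
  rw [e2] at n2; rw [e3] at n3; rw [e4] at n4; rw [e5] at n5
  change ‖sqe s _ _ - qi‖ ≤ _ at n2 n3 n4
  rw [n1] at n2
  have k3 := n3.trans (mul_le_mul_of_nonneg_left (mul_le_mul_of_nonneg_left n2 zero_le_two) p3)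
  have k4 := n4.trans (mul_le_mul_of_nonneg_left (mul_le_mul_of_nonneg_left k3 zero_le_two) p4)
  have k5 := mul_le_mul_of_nonneg_left k4 p5
  change ‖_‖ * ‖qth _ _ (gS s (((z, x), y), t)) - 1‖ ≤ 16
  have k6 : ‖qth (bs s (u ^ 2)) u (gS s (((z, x), y), t)) - 1‖ ≤ 16 * (a1 * a2 * a3 * a4 * a5) := by
    rw [n5]; refine k5.trans (le_of_eq ?_); ring
  refine (mul_le_mul_of_nonneg_left k6 (norm_nonneg _)).trans ?_
  suffices ‖((((z, x), y), t), u)‖ * (a1 * a2 * a3 * a4 * a5) ≤ 1 by linarith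
  rw [abs_norm] at m1
  simp only [Prod.norm_def, Real.norm_eq_abs]
  have key : ∀ m a b c d e : ℝ, 0 ≤ a → 0 ≤ b → 0 ≤ c → 0 ≤ d → 0 ≤ e → a ≤ 1 → b ≤ 1 → c ≤ 1 → d ≤ 1 → m * e ≤ 1 →
      m * (a * b * c * d * e) ≤ 1 := fun m a b c d e ha hb hc hd he la lb lc ld lm => by
    have q : a * b * c * d ≤ 1 := mul_le_one₀ (mul_le_one₀ (mul_le_one₀ la hb lb) hc lc) hd ld
    have q0 : 0 ≤ a * b * c * d := by positivity
    calc m * (a * b * c * d * e) = (a * b * c * d) * (m * e) := by ring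
      _ ≤ (a * b * c * d) * 1 := mul_le_mul_of_nonneg_left lm q0
      _ ≤ 1 := by linarith
  rcases max_choice (max (max (max ‖z‖ |x|) |y|) |t|) |u| with h | h <;> rw [h]
  · rcases max_choice (max (max ‖z‖ |x|) |y|) |t| with h | h <;> rw [h]
    · rcases max_choice (max ‖z‖ |x|) |y| with h | h <;> rw [h]
      · rcases max_choice ‖z‖ |x| with h | h <;> rw [h]
        · rw [show a1 * a2 * a3 * a4 * a5 = a2 * a3 * a4 * a5 * a1 by ring]; apply key <;> assumption
        · rw [show a1 * a2 * a3 * a4 * a5 = a1 * a3 * a4 * a5 * a2 by ring]; apply key <;> assumption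
      · rw [show a1 * a2 * a3 * a4 * a5 = a1 * a2 * a4 * a5 * a3 by ring]; apply key <;> assumption
    · rw [show a1 * a2 * a3 * a4 * a5 = a1 * a2 * a3 * a5 * a4 by ring]; apply key <;> assumption
  · apply key <;> assumption

end

abbrev S3 := Metric.sphere (0 : ℍ[ℝ]) 1

def one3 : S3 := ⟨1, by simp⟩

theorem continuous_bs {X : Type*} [TopologicalSpace X] {s r : X → ℝ} (hs : Continuous s) (hr : Continuous r) :
    Continuous fun x => bs (s x) (r x) := by unfold bs; fun_prop

theorem continuous_qmk {X : Type*} [TopologicalSpace X] {a b c d : X → ℝ} (ha : Continuous a) (hb : Continuous b)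
    (hc : Continuous c) (hd : Continuous d) : Continuous fun x => qmk (a x) (b x) (c x) (d x) := by
  have : ∀ x, qmk (a x) (b x) (c x) (d x) = a x • qmk 1 0 0 0 + b x • qmk 0 1 0 0 + c x • qmk 0 0 1 0 + d x • qmk 0 0 0 1 := fun x => by
    ext <;> simp
  simp only [this]
  fun_prop

theorem continuous_qlin {X : Type*} [TopologicalSpace X] {b t : X → ℝ} {p : X → ℍ[ℝ]} (hb : Continuous b) (ht : Continuous t)
    (hp : Continuous p) : Continuous fun x => qlin (b x) (t x) (p x) := by unfold qlin; fun_prop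

section
variable {X : Type*} [TopologicalSpace X] {s t : X → ℝ} {p : X → ℍ[ℝ]}

theorem continuous_sqe (h0 : ∀ x, 0 ≤ s x) (h1 : ∀ x, s x ≤ 1) (hs : Continuous s) (ht : Continuous t) (hp : Continuous p) : Continuous fun x => sqe (s x) (t x) (p x) := by
  have hb := continuous_bs hs (ht.pow 2)
  exact (((ht.pow 2).add (hb.pow 2)).inv₀ fun x => (bs_pos (h0 x) (h1 x) (sq_nonneg _)).ne').smul
    (((continuous_qlin hb.neg ht hp).mul continuous_const).mul (continuous_qlin hb ht hp))

theorem continuous_sqt (h0 : ∀ x, 0 ≤ s x) (h1 : ∀ x, s x ≤ 1) (hs : Continuous s) (ht : Continuous t) (hp : Continuous p) : Continuous fun x => sqt (s x) (t x) (p x) := by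
  have hb := continuous_bs hs (ht.pow 2)
  exact (((ht.pow 2).add (hb.pow 2)).inv₀ fun x => (bs_pos (h0 x) (h1 x) (sq_nonneg _)).ne').smul
    ((continuous_qlin hb.neg ht hp).mul (continuous_qlin hb ht continuous_const))

end

theorem continuous_sq0 {X : Type*} [TopologicalSpace X] {s : X → ℝ} {z : X → ℂ} (h0 : ∀ x, 0 ≤ s x) (h1 : ∀ x, s x ≤ 1) (hs : Continuous s)
    (hz : Continuous z) : Continuous fun x => sq0 (s x) (z x) := by
  have c1 : Continuous fun x => (z x).re := Complex.continuous_re.comp hz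
  have c2 : Continuous fun x => (z x).im := Complex.continuous_im.comp hz
  have hb := continuous_bs hs ((c1.pow 2).add (c2.pow 2))
  exact ((((c1.pow 2).add (c2.pow 2)).add (hb.pow 2)).inv₀ fun x => (bs_pos (h0 x) (h1 x) (add_nonneg (sq_nonneg _) (sq_nonneg _))).ne').smul
    (continuous_qmk continuous_const (by fun_prop) (by fun_prop) (by fun_prop))

theorem continuous_qS {X : Type*} [TopologicalSpace X] {s : X → ℝ} {w : X → V5 × ℝ} (h0 : ∀ x, 0 ≤ s x) (h1 : ∀ x, s x ≤ 1)
    (hs : Continuous s) (hw : Continuous w) : Continuous fun x => qS (s x) (w x) := by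
  unfold qS gS
  exact continuous_sqt h0 h1 hs (by fun_prop) (continuous_sqe h0 h1 hs (by fun_prop) (continuous_sqe h0 h1 hs (by fun_prop)
    (continuous_sqe h0 h1 hs (by fun_prop) (continuous_sq0 h0 h1 hs (by fun_prop)))))

def q3 (s : I) (w : V5 × ℝ) : S3 := ⟨qS s w, by simpa using norm_qS s.2.1 s.2.2 w⟩

theorem good_q3 : Good one3 fun p : I × (V5 × ℝ) => q3 p.1 p.2 := by
  refine ⟨(continuous_qS (fun p => p.1.2.1) (fun p => p.1.2.2) (by fun_prop) continuous_snd).subtype_mk _, ?_⟩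
  rw [tendsto_subtype_rng, tendsto_iff_norm_sub_tendsto_zero]
  have h : Tendsto (fun p : I × (V5 × ℝ) => ‖p.2‖) (cocompact _) atTop :=
    (tendsto_norm_cocompact_atTop (E := V5 × ℝ)).comp (tendsto_snd_cocompact I)
  refine squeeze_zero' (Eventually.of_forall fun _ => norm_nonneg _) ?_ (Tendsto.const_div_atTop h 16)
  filter_upwards [h.eventually_gt_atTop 0] with p hp
  rw [le_div_iff₀ hp, mul_comm]
  exact norm_mul_norm_qS_sub p.1.2.1 p.1.2.2 p.2

theorem htp_q3 : Htp one3 (q3 0) (q3 1) := ⟨_, good_q3, fun _ => rfl, fun _ => rfl⟩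

end SD

namespace SD
open Module
open Filter Topology OnePoint
open scoped Quaternion

/-- Inverse stereographic projections, in the conventions of `qS`. -/
def io3 (x : ℂ × ℝ) : S3 :=
  ⟨qth 1 x.2 (qpi 1 x.1), by simpa using norm_qth (uim_qpi (by positivity)) (by positivity)⟩

theorem io3_val (x : ℂ × ℝ) {D : ℝ} (hD : D = (1 + x.1.re ^ 2 + x.1.im ^ 2) * (1 + x.2 ^ 2)) : (io3 x : ℍ[ℝ]) =
    qmk (1 - 2 / D) (2 * x.2 / D) (-2 * (x.2 * x.1.re + x.1.im) / D) (2 * (x.1.re - x.2 * x.1.im) / D) := by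
  obtain ⟨z, t⟩ := x
  have h1 : 1 + z.re ^ 2 + z.im ^ 2 ≠ 0 := by positivity
  have h2 : 1 + t ^ 2 ≠ 0 := by positivity
  have h3 : z.re ^ 2 + z.im ^ 2 + 1 ≠ 0 := by positivity
  have h4 : t ^ 2 + 1 ≠ 0 := by positivity
  subst hD
  ext <;> simp [io3, qth, qlin, qpi, qi, Quaternion.re_mul, Quaternion.imI_mul, Quaternion.imJ_mul, Quaternion.imK_mul] <;> field_simp <;> ring

theorem io3_injective : Function.Injective io3 := by
  intro x y h
  have h := congrArg Subtype.val h
  rw [io3_val x rfl, io3_val y rfl] at h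
  have hx : 0 < (1 + x.1.re ^ 2 + x.1.im ^ 2) * (1 + x.2 ^ 2) := by positivity
  have hy : 0 < (1 + y.1.re ^ 2 + y.1.im ^ 2) * (1 + y.2 ^ 2) := by positivity
  generalize (1 + x.1.re ^ 2 + x.1.im ^ 2) * (1 + x.2 ^ 2) = D at h hx
  generalize (1 + y.1.re ^ 2 + y.1.im ^ 2) * (1 + y.2 ^ 2) = D' at h hy
  have e0 := congrArg QuaternionAlgebra.re h
  have e1 := congrArg QuaternionAlgebra.imI h
  have e2 := congrArg QuaternionAlgebra.imJ h
  have e3 := congrArg QuaternionAlgebra.imK h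
  simp only [qmk_re, qmk_imI, qmk_imJ, qmk_imK] at e0 e1 e2 e3
  have hD : D = D' := by
    have : 2 / D = 2 / D' := by linarith
    field_simp at this; linarith
  subst hD
  have f1 : x.2 = y.2 := by field_simp at e1; linarith
  rw [f1] at e2 e3
  have f2 : y.2 * x.1.re + x.1.im = y.2 * y.1.re + y.1.im := by field_simp at e2; linarith
  have f3 : x.1.re - y.2 * x.1.im = y.1.re - y.2 * y.1.im := by field_simp at e3; linarith
  have hp : 1 + y.2 ^ 2 ≠ 0 := by positivity
  refine Prod.ext (Complex.ext (mul_left_cancel₀ hp ?_) (mul_left_cancel₀ hp ?_)) f1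
  · linear_combination y.2 * f2 + f3
  · linear_combination f2 - y.2 * f3

theorem io3_ne (x : ℂ × ℝ) : io3 x ≠ one3 := fun h => by
  have h := congrArg (fun q : S3 => q.1.re) h
  simp only [io3_val x rfl, one3, qmk_re, Quaternion.re_one] at h
  have hx : 0 < (1 + x.1.re ^ 2 + x.1.im ^ 2) * (1 + x.2 ^ 2) := by positivity
  have : 0 < 2 / ((1 + x.1.re ^ 2 + x.1.im ^ 2) * (1 + x.2 ^ 2)) := by positivity
  linarith

theorem exists_io3 {q : S3} (hq : q ≠ one3) : ∃ x, io3 x = q := by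
  obtain ⟨q, hn⟩ := q
  have hn' : q.re ^ 2 + q.imI ^ 2 + q.imJ ^ 2 + q.imK ^ 2 = 1 := by
    rw [← Quaternion.normSq_def', Quaternion.normSq_eq_norm_mul_self, mem_sphere_zero_iff_norm.1 hn, mul_one]
  have h0 : q.re < 1 := by
    by_contra hc
    refine hq (Subtype.ext ?_)
    have k0 : q.re = 1 := by nlinarith [sq_nonneg q.imI, sq_nonneg q.imJ, sq_nonneg q.imK]
    rw [k0] at hn'
    have k1 : q.imI = 0 := by nlinarith [sq_nonneg q.imI, sq_nonneg q.imJ, sq_nonneg q.imK]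
    have k2 : q.imJ = 0 := by nlinarith [sq_nonneg q.imI, sq_nonneg q.imJ, sq_nonneg q.imK]
    have k3 : q.imK = 0 := by nlinarith [sq_nonneg q.imI, sq_nonneg q.imJ, sq_nonneg q.imK]
    ext <;> simp [one3, k0, k1, k2, k3]
  have h1 : 1 - q.re ≠ 0 := by linarith
  obtain ⟨t, ht⟩ : ∃ t, t = q.imI / (1 - q.re) := ⟨_, rfl⟩
  obtain ⟨a, ha⟩ : ∃ a, a = -q.imJ / (1 - q.re) := ⟨_, rfl⟩
  obtain ⟨b, hb⟩ : ∃ b, b = q.imK / (1 - q.re) := ⟨_, rfl⟩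
  have hp : 1 + t ^ 2 ≠ 0 := by positivity
  have hD : 2 / (1 - q.re) = (1 + ((t * a + b) / (1 + t ^ 2)) ^ 2 + ((a - t * b) / (1 + t ^ 2)) ^ 2) * (1 + t ^ 2) := by
    have : (1 + ((t * a + b) / (1 + t ^ 2)) ^ 2 + ((a - t * b) / (1 + t ^ 2)) ^ 2) * (1 + t ^ 2) = 1 + t ^ 2 + a ^ 2 + b ^ 2 := by
      field_simp; ring
    rw [this, ht, ha, hb]
    field_simp
    linear_combination -hn'
  have ex : t * ((t * a + b) / (1 + t ^ 2)) + (a - t * b) / (1 + t ^ 2) = a := by field_simp; ring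
  have ey : (t * a + b) / (1 + t ^ 2) - t * ((a - t * b) / (1 + t ^ 2)) = b := by field_simp; ring
  refine ⟨(⟨(t * a + b) / (1 + t ^ 2), (a - t * b) / (1 + t ^ 2)⟩, t), Subtype.ext ?_⟩
  rw [io3_val _ hD]
  simp only [ex, ey]
  ext <;> simp <;> simp only [ht, ha, hb] <;> field_simp

theorem good_io3 : Good one3 io3 := by
  have hv : ∀ x : ℂ × ℝ, (io3 x : ℍ[ℝ]) = _ := fun x => io3_val x rfl
  have c : Continuous fun x : ℂ × ℝ => (1 + x.1.re ^ 2 + x.1.im ^ 2) * (1 + x.2 ^ 2) := by fun_prop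
  have hD : ∀ x : ℂ × ℝ, (1 + x.1.re ^ 2 + x.1.im ^ 2) * (1 + x.2 ^ 2) ≠ 0 := fun x => by positivity
  refine ⟨Continuous.subtype_mk ?_ _, ?_⟩
  · refine Continuous.congr ?_ fun x => (hv x).symm
    exact continuous_qmk (by fun_prop (disch := exact hD)) (Continuous.div (by fun_prop) c hD) (Continuous.div (by fun_prop) c hD)
      (Continuous.div (by fun_prop) c hD)
  · rw [tendsto_subtype_rng, tendsto_iff_norm_sub_tendsto_zero]
    have h : Tendsto (fun x : ℂ × ℝ => ‖x‖) (cocompact _) atTop := tendsto_norm_cocompact_atTop (E := ℂ × ℝ)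
    refine squeeze_zero' (Eventually.of_forall fun _ => norm_nonneg _) ?_ (Tendsto.const_div_atTop h 2)
    filter_upwards [h.eventually_gt_atTop 0] with x hx
    rw [le_div_iff₀ hx, mul_comm]
    obtain ⟨a, e1, p1, l1, m1⟩ := exists_decay zero_le_one le_rfl ‖x.1‖
    obtain ⟨b, e2, p2, l2, m2⟩ := exists_decay zero_le_one le_rfl x.2
    have k1 := norm_qth_sub (t := x.2) (p := qpi 1 x.1) zero_le_one (by positivity)
    have k2 := norm_qpi_sub (z := x.1) zero_le_one (by positivity)
    rw [bs_one] at e1 e2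
    rw [k2, e1, e2] at k1
    change _ * ‖qth 1 x.2 (qpi 1 x.1) - 1‖ ≤ 2
    rw [k1, Prod.norm_def]
    rw [abs_norm] at m1
    rcases max_choice ‖x.1‖ ‖x.2‖ with h | h <;> rw [h]
    · nlinarith [mul_le_mul m1 l2 p2 zero_le_one]
    · rw [Real.norm_eq_abs]; nlinarith [mul_le_mul m2 l1 p1 zero_le_one]

/-- `S³` as the one-point compactification of `ℂ × ℝ`. -/
def homS3 : OP (ℂ × ℝ) ≃ₜ S3 :=
  Continuous.homeoOfEquivCompactToT2 (f := Equiv.ofBijective (fun x : OP (ℂ × ℝ) => x.elim one3 io3) ⟨by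
    intro x y h
    cases x using OnePoint.rec with
    | infty => cases y using OnePoint.rec with
      | infty => rfl
      | coe y => exact absurd h.symm (io3_ne y)
    | coe x => cases y using OnePoint.rec with
      | infty => exact absurd h (io3_ne x)
      | coe y => exact congrArg _ (io3_injective h), by
    intro q
    by_cases hq : q = one3
    · exact ⟨∞, hq.symm⟩
    · obtain ⟨x, hx⟩ := exists_io3 hq
      exact ⟨x, hx⟩⟩) good_io3.ext

theorem homS3_infty : homS3 ∞ = one3 := rfl

/-- The corresponding identification of the one-point compactification of `ℂ` with `S²`. -/
def io2 (x : OP ℂ) : ℍ[ℝ] := x.elim qi (qpi 1)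

theorem qeta_qi (t : ℝ) : qeta 1 t qi = qi := by
  rw [qeta, show qlin (-1) t qi * qi = qi * qlin (-1) t qi by simp only [qlin, mul_add, add_mul, mul_smul_comm, smul_mul_assoc, mul_one, one_mul],
    mul_assoc, qlin_mul_qi, mul_smul_comm, mul_one, smul_smul, inv_mul_cancel₀ (by positivity), one_smul]

theorem qth_qi (t : ℝ) : qth 1 t qi = 1 := by
  rw [qth, qlin_mul_qi, smul_smul, inv_mul_cancel₀ (by positivity), one_smul]

theorem io2_etab (z : ℂ) (t : ℝ) : io2 (etab (z, t)) = qeta 1 t (qpi 1 z) := by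
  have h4 : t ^ 2 + 1 ≠ 0 := by positivity
  have h3 : z.re ^ 2 + z.im ^ 2 + 1 ≠ 0 := by positivity
  by_cases hz : z = 0
  · subst hz
    rw [etab, pm_of_notMem (by simp)]
    change qi = _
    ext <;> simp [qeta, qlin, qpi, qi, Quaternion.re_mul, Quaternion.imI_mul, Quaternion.imJ_mul, Quaternion.imK_mul] <;> field_simp
    ring
  · rw [etab, pm_of_mem (by simpa using hz)]
    change qpi 1 _ = _
    have hz' := sq_ne hz
    have hs := reta_sq_add z.re z.im t hz'
    obtain ⟨D, hD⟩ : ∃ D, D = (z.re ^ 2 + z.im ^ 2 + 1) ^ 2 * (t ^ 2 + 1) / (4 * (z.re ^ 2 + z.im ^ 2)) := ⟨_, rfl⟩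
    have hs' : reta z.re z.im t ^ 2 + imeta z.re z.im t ^ 2 = D - 1 := by
      rw [hs, hD]; field_simp; ring
    have hD0 : D ≠ 0 := by rw [hD]; positivity
    have hv : qpi 1 ⟨reta z.re z.im t, imeta z.re z.im t⟩ = D⁻¹ • qmk 0 (D - 2) (2 * reta z.re z.im t) (2 * imeta z.re z.im t) := by
      simp only [qpi, hs']
      congr 2 <;> ring
    rw [hv, hD]
    ext <;> simp [reta, imeta, qeta, qlin, qpi, qi, Quaternion.re_mul, Quaternion.imI_mul, Quaternion.imJ_mul, Quaternion.imK_mul] <;> field_simp <;> first | ring1 | (ring_nf; simp)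

theorem io2_gplus {Y : Type*} (g : Y → OP ℂ) (y : Y) (t : ℝ) : io2 (gplus g (y, t)) = qeta 1 t (io2 (g y)) := by
  unfold gplus Sus
  dsimp only
  cases h : g y using OnePoint.rec with
  | infty => exact (qeta_qi t).symm
  | coe z => exact io2_etab z t

theorem q3_one (w : V5 × ℝ) : q3 1 w = homS3 (Sus eta3 w) := by
  have h1 : gS 1 w.1 = io2 (eta3 w.1) := by
    unfold eta3
    obtain ⟨⟨⟨⟨z, x⟩, y⟩, t⟩, u⟩ := w
    rw [io2_gplus, io2_gplus, io2_gplus]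
    simp only [gS, sqe, sq0, bs_one]
    rfl
  have h2 : ((q3 1 w : S3) : ℍ[ℝ]) = qth 1 w.2 (gS 1 w.1) := by
    change qS (1 : ℝ) w = _
    simp only [qS, sqt, bs_one]
  refine Subtype.ext ?_
  rw [h2, h1]
  unfold Sus
  cases h : eta3 w.1 using OnePoint.rec with
  | infty => exact qth_qi _
  | coe z => rfl

theorem not_null_q3 : ¬ Null one3 (q3 0) := fun h => not_null_Sus_eta3 <| by
  have h2 := (h.of_htp htp_q3).post homS3.symm.continuous (c := ∞) ((Homeomorph.symm_apply_eq _).2 homS3_infty.symm)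
  simpa [q3_one] using h2

end SD

namespace SD
open Module
open Filter Topology OnePoint
open scoped Quaternion

def mp (x : ℝ) : ℝ := max x 0

theorem hasDerivAt_mp_sq (x : ℝ) : HasDerivAt (fun x => mp x ^ 2) (2 * mp x) x := by
  rcases lt_trichotomy x 0 with h | rfl | h
  · rw [mp, max_eq_right h.le, mul_zero]
    refine (hasDerivAt_const x (0 : ℝ)).congr_of_eventuallyEq ?_
    filter_upwards [gt_mem_nhds h] with y hy
    simp [mp, max_eq_right hy.le]
  · rw [hasDerivAt_iff_isLittleO]
    refine Asymptotics.isLittleO_iff.2 fun c hc => ?_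
    filter_upwards [Metric.ball_mem_nhds (0 : ℝ) hc] with y hy
    have hy : |y| < c := by simpa using hy
    have h1 : mp y ≤ |y| := max_le (le_abs_self y) (abs_nonneg y)
    have h2 : 0 ≤ mp y := le_max_right _ _
    simp only [mp, max_self, Real.norm_eq_abs, sub_zero] at *
    rw [abs_of_nonneg (by simp)]
    norm_num
    nlinarith [abs_nonneg y]
  · rw [mp, max_eq_left h.le]
    have : HasDerivAt (fun x : ℝ => x ^ 2) (2 * x) x := by simpa using hasDerivAt_pow 2 x
    refine this.congr_of_eventuallyEq ?_
    filter_upwards [lt_mem_nhds h] with y hy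
    simp [mp, max_eq_left hy.le]

theorem continuous_mp : Continuous mp := continuous_id.max continuous_const

theorem contDiff_mp_sq : ContDiff ℝ 1 fun x => mp x ^ 2 := by
  refine contDiff_one_iff_deriv.2 ⟨fun x => (hasDerivAt_mp_sq x).differentiableAt, ?_⟩
  rw [funext fun x => (hasDerivAt_mp_sq x).deriv]
  exact continuous_const.mul continuous_mp

theorem bs_zero (r : ℝ) : bs 0 r = mp (1 - r) ^ 2 := by simp [bs, mp]

theorem bs_zero_of_le {r : ℝ} (h : 1 ≤ r) : bs 0 r = 0 := by simp [bs_zero, mp, h]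

section
variable {X : Type*} [NormedAddCommGroup X] [NormedSpace ℝ X]

theorem contDiff_bs {r : X → ℝ} (hr : ContDiff ℝ 1 r) : ContDiff ℝ 1 fun x => bs 0 (r x) := by
  simp only [bs_zero]
  exact contDiff_mp_sq.comp (contDiff_const.sub hr)

theorem contDiff_qmk {a b c d : X → ℝ} (ha : ContDiff ℝ 1 a) (hb : ContDiff ℝ 1 b) (hc : ContDiff ℝ 1 c) (hd : ContDiff ℝ 1 d) :
    ContDiff ℝ 1 fun x => qmk (a x) (b x) (c x) (d x) := by
  have : ∀ x, qmk (a x) (b x) (c x) (d x) = a x • qmk 1 0 0 0 + b x • qmk 0 1 0 0 + c x • qmk 0 0 1 0 + d x • qmk 0 0 0 1 := fun x => by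
    ext <;> simp
  simp only [this]
  fun_prop

theorem contDiff_qlin {b t : X → ℝ} {p : X → ℍ[ℝ]} (hb : ContDiff ℝ 1 b) (ht : ContDiff ℝ 1 t) (hp : ContDiff ℝ 1 p) :
    ContDiff ℝ 1 fun x => qlin (b x) (t x) (p x) := by unfold qlin; fun_prop

theorem contDiff_sqe {t : X → ℝ} {p : X → ℍ[ℝ]} (ht : ContDiff ℝ 1 t) (hp : ContDiff ℝ 1 p) : ContDiff ℝ 1 fun x => sqe 0 (t x) (p x) := by
  have hb := contDiff_bs (ht.pow 2)
  exact (((ht.pow 2).add (hb.pow 2)).inv fun x => (bs_pos le_rfl zero_le_one (sq_nonneg _)).ne').smul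
    (((contDiff_qlin hb.neg ht hp).mul contDiff_const).mul (contDiff_qlin hb ht hp))

theorem contDiff_sqt {t : X → ℝ} {p : X → ℍ[ℝ]} (ht : ContDiff ℝ 1 t) (hp : ContDiff ℝ 1 p) : ContDiff ℝ 1 fun x => sqt 0 (t x) (p x) := by
  have hb := contDiff_bs (ht.pow 2)
  exact (((ht.pow 2).add (hb.pow 2)).inv fun x => (bs_pos le_rfl zero_le_one (sq_nonneg _)).ne').smul
    ((contDiff_qlin hb.neg ht hp).mul (contDiff_qlin hb ht contDiff_const))

theorem contDiff_sq0 {z : X → ℂ} (hz : ContDiff ℝ 1 z) : ContDiff ℝ 1 fun x => sq0 0 (z x) := by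
  have c1 : ContDiff ℝ 1 fun x => (z x).re := Complex.reCLM.contDiff.comp hz
  have c2 : ContDiff ℝ 1 fun x => (z x).im := Complex.imCLM.contDiff.comp hz
  have hb := contDiff_bs ((c1.pow 2).add (c2.pow 2))
  exact ((((c1.pow 2).add (c2.pow 2)).add (hb.pow 2)).inv fun x =>
    (bs_pos le_rfl zero_le_one (add_nonneg (sq_nonneg _) (sq_nonneg _))).ne').smul
    (contDiff_qmk contDiff_const (by fun_prop) (by fun_prop) (by fun_prop))

end

theorem contDiff_gS : ContDiff ℝ 1 (gS 0) :=
  contDiff_sqe (by fun_prop) (contDiff_sqe (by fun_prop) (contDiff_sqe (by fun_prop) (contDiff_sq0 (by fun_prop))))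

theorem contDiff_sqt' : ContDiff ℝ 1 fun x : ℝ × ℍ[ℝ] => sqt 0 x.1 x.2 := contDiff_sqt contDiff_fst contDiff_snd

theorem sqe_of_le {t : ℝ} (p : ℍ[ℝ]) (h : 1 ≤ |t|) : sqe 0 t p = qi := by
  have : t ≠ 0 := by rintro rfl; simp at h; linarith
  rw [sqe, bs_zero_of_le (by rw [← sq_abs]; nlinarith)]
  simp [qeta, qlin, smul_smul]
  field_simp
  simp

theorem sqt_of_le {t : ℝ} (p : ℍ[ℝ]) (h : 1 ≤ |t|) : sqt 0 t p = 1 := by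
  have : t ≠ 0 := by rintro rfl; simp at h; linarith
  rw [sqt, bs_zero_of_le (by rw [← sq_abs]; nlinarith)]
  simp [qth, qlin, smul_smul]
  field_simp
  simp

theorem sqe_qi (t : ℝ) : sqe 0 t qi = qi := by
  have h := norm_qeta_sub (t := t) uim_qi (bs_nonneg le_rfl zero_le_one (t ^ 2)) (bs_pos le_rfl zero_le_one (sq_nonneg _))
  rw [sub_self, norm_zero, mul_zero, mul_zero] at h
  exact sub_eq_zero.1 (norm_le_zero_iff.1 h)

theorem sqt_qi (t : ℝ) : sqt 0 t qi = 1 := by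
  have h := norm_qth_sub (t := t) (p := qi) (bs_nonneg le_rfl zero_le_one (t ^ 2)) (bs_pos le_rfl zero_le_one (sq_nonneg _))
  rw [sub_self, norm_zero, mul_zero] at h
  exact sub_eq_zero.1 (norm_eq_zero.1 h)

theorem sq0_of_le {z : ℂ} (h : 1 ≤ ‖z‖) : sq0 0 z = qi := by
  have hz : ‖z‖ ^ 2 = z.re ^ 2 + z.im ^ 2 := by rw [Complex.sq_norm, Complex.normSq_apply]; ring
  have : z.re ^ 2 + z.im ^ 2 ≠ 0 := by rw [← hz]; positivity
  rw [sq0, bs_zero_of_le (by rw [← hz]; nlinarith)]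
  ext <;> simp [qpi, qi]
  field_simp

theorem qS_of_le {w : V5 × ℝ} (h : 1 ≤ ‖w‖) : qS 0 w = 1 := by
  obtain ⟨⟨⟨⟨z, x⟩, y⟩, t⟩, u⟩ := w
  simp only [Prod.norm_def, le_max_iff, Real.norm_eq_abs] at h
  simp only [qS, gS]
  rcases h with (((h | h) | h) | h) | h
  · rw [sq0_of_le h, sqe_qi, sqe_qi, sqe_qi, sqt_qi]
  · rw [sqe_of_le _ h, sqe_qi, sqe_qi, sqt_qi]
  · rw [sqe_of_le _ h, sqe_qi, sqt_qi]
  · rw [sqe_of_le _ h, sqt_qi]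
  · rw [sqt_of_le _ h]

/-- The tangent plane of `S²` at a unit imaginary quaternion. -/
theorem UIm.exists_basis {p : ℍ[ℝ]} (hp : UIm p) : ∃ e₁ e₂ : ℍ[ℝ], ‖e₁‖ = 1 ∧ ‖e₂‖ = 1 ∧
    ∀ q : ℍ[ℝ], ⟪(1 : ℍ[ℝ]), q⟫ = 0 → ⟪p, q⟫ = 0 → q = ⟪e₁, q⟫ • e₁ + ⟪e₂, q⟫ • e₂ := by
  have hli : LinearIndependent ℝ ![(1 : ℍ[ℝ]), p] := by
    rw [LinearIndependent.pair_iff]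
    intro s t h
    have h1 := congrArg QuaternionAlgebra.re h
    simp [hp.1] at h1
    subst h1
    have h2 : t • p = 0 := by simpa using h
    refine ⟨rfl, (smul_eq_zero.1 h2).resolve_right fun h0 => ?_⟩
    have := hp.norm
    simp [h0] at this
  have hr : finrank ℝ (Submodule.span ℝ (Set.range ![(1 : ℍ[ℝ]), p])) = 2 := by rw [finrank_span_eq_card hli]; rfl
  have h4 : finrank ℝ ℍ[ℝ] = 4 := Quaternion.finrank_eq_four
  have := Submodule.finrank_add_finrank_orthogonal (Submodule.span ℝ (Set.range ![(1 : ℍ[ℝ]), p]))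
  have hK : finrank ℝ (Submodule.span ℝ (Set.range ![(1 : ℍ[ℝ]), p]))ᗮ = 2 := by omega
  set K := (Submodule.span ℝ (Set.range ![(1 : ℍ[ℝ]), p]))ᗮ
  let b := (stdOrthonormalBasis ℝ K).reindex (finCongr hK)
  refine ⟨b 0, b 1, b.orthonormal.1 0, b.orthonormal.1 1, fun q h1 h2 => ?_⟩
  have hq : q ∈ K := by
    rw [Submodule.mem_orthogonal]
    intro u hu
    refine Submodule.span_induction (p := fun u _ => ⟪u, q⟫ = 0) ?_ (by simp) (fun x y _ _ hx hy => by rw [inner_add_left, hx, hy, add_zero])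
      (fun a x _ hx => by rw [inner_smul_left, hx, mul_zero]) hu
    rintro _ ⟨i, rfl⟩
    fin_cases i
    · exact h1
    · exact h2
  have := congrArg Subtype.val (b.sum_repr' ⟨q, hq⟩)
  rw [Fin.sum_univ_two] at this
  exact this.symm

theorem inner_fderiv_gS (w v : V5) : ⟪(1 : ℍ[ℝ]), fderiv ℝ (gS 0) w v⟫ = 0 ∧ ⟪gS 0 w, fderiv ℝ (gS 0) w v⟫ = 0 := by
  have hd : HasFDerivAt (gS 0) _ w := (contDiff_gS.differentiable one_ne_zero w).hasFDerivAt
  constructor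
  · have h1 := (hasFDerivAt_const (1 : ℍ[ℝ]) w).inner ℝ hd
    have h2 : (fun w => ⟪(1 : ℍ[ℝ]), gS 0 w⟫) = fun _ => 0 := funext fun w => by
      simp [Quaternion.inner_def, (uim_gS le_rfl zero_le_one w).1]
    rw [h2] at h1
    have := congrArg (fun L => L v) (h1.unique (hasFDerivAt_const _ _))
    simpa using this
  · have h1 := hd.inner ℝ hd
    have h2 : (fun w => ⟪gS 0 w, gS 0 w⟫) = fun _ => 1 := funext fun w => by
      rw [real_inner_self_eq_norm_sq, (uim_gS le_rfl zero_le_one w).norm, one_pow]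
    rw [h2] at h1
    have := congrArg (fun L => L v) (h1.unique (hasFDerivAt_const _ _))
    simp at this
    rw [real_inner_comm] at this
    simp [real_inner_comm] at this ⊢
    linarith

theorem contDiff_qS : ContDiff ℝ 1 (qS 0) := contDiff_sqt contDiff_snd (contDiff_gS.comp contDiff_fst)

theorem exists_factor : ∃ C : ℝ, 0 ≤ C ∧ ∀ w : V5 × ℝ, ‖w‖ ≤ 1 → ∃ (a p₁ p₂ : ℍ[ℝ]) (β₁ β₂ : V5 →L[ℝ] ℝ), ‖a‖ ≤ C ∧ ‖p₁‖ ≤ C ∧ ‖p₂‖ ≤ C ∧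
    ‖β₁‖ ≤ C ∧ ‖β₂‖ ≤ C ∧ ∀ v r, fderiv ℝ (qS 0) w (v, r) = r • a + β₁ v • p₁ + β₂ v • p₂ := by
  obtain ⟨C₁, h₁⟩ := (isCompact_closedBall (0 : V5) 1).exists_bound_of_continuousOn (contDiff_gS.continuous_fderiv one_ne_zero).continuousOn
  obtain ⟨C₂, h₂⟩ := (isCompact_closedBall (0 : ℝ × ℍ[ℝ]) 1).exists_bound_of_continuousOn
    (contDiff_sqt'.continuous_fderiv one_ne_zero).continuousOn
  refine ⟨max (max C₁ C₂) 0, le_max_right _ _, fun w hw => ?_⟩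
  have hw1 : ‖w.1‖ ≤ 1 := (le_max_left _ _).trans hw
  have hw2 : ‖w.2‖ ≤ 1 := (le_max_right _ _).trans hw
  have hu := uim_gS le_rfl zero_le_one w.1
  have k1 := h₁ w.1 (by simpa using hw1)
  have k2 := h₂ (w.2, gS 0 w.1) (by simpa [Prod.norm_def, hu.norm] using hw2)
  have l1 : C₁ ≤ max (max C₁ C₂) 0 := (le_max_left _ _).trans (le_max_left _ _)
  have l2 : C₂ ≤ max (max C₁ C₂) 0 := (le_max_right _ _).trans (le_max_left _ _)
  obtain ⟨e₁, e₂, n₁, n₂, hb⟩ := hu.exists_basis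
  set L := fderiv ℝ (fun x : ℝ × ℍ[ℝ] => sqt 0 x.1 x.2) (w.2, gS 0 w.1)
  set G := fderiv ℝ (gS 0) w.1
  have bL : ∀ x : ℝ × ℍ[ℝ], ‖x‖ = 1 → ‖L x‖ ≤ max (max C₁ C₂) 0 := fun x hx =>
    ((L.le_opNorm x).trans (by rw [hx, mul_one]; exact k2)).trans l2
  have bG : ∀ e : ℍ[ℝ], ‖e‖ = 1 → ‖(innerSL ℝ e).comp G‖ ≤ max (max C₁ C₂) 0 := fun e he =>
    ((ContinuousLinearMap.opNorm_comp_le _ _).trans (by rw [innerSL_apply_norm, he, one_mul]; exact k1)).trans l1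
  refine ⟨L (1, 0), L (0, e₁), L (0, e₂), (innerSL ℝ e₁).comp G, (innerSL ℝ e₂).comp G, bL _ (by simp [Prod.norm_def]),
    bL _ (by simp [Prod.norm_def, n₁]), bL _ (by simp [Prod.norm_def, n₂]), bG _ n₁, bG _ n₂, fun v r => ?_⟩
  have hd : HasFDerivAt (qS 0) (L.comp ((ContinuousLinearMap.snd ℝ V5 ℝ).prod (G.comp (ContinuousLinearMap.fst ℝ V5 ℝ)))) w := by
    have hg : HasFDerivAt (gS 0) G w.1 := (contDiff_gS.differentiable one_ne_zero w.1).hasFDerivAt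
    have hL : HasFDerivAt (fun x : ℝ × ℍ[ℝ] => sqt 0 x.1 x.2) L (w.2, gS 0 w.1) :=
      (contDiff_sqt'.differentiable one_ne_zero _).hasFDerivAt
    exact hL.comp w (hasFDerivAt_snd.prodMk (hg.comp w hasFDerivAt_fst))
  rw [hd.fderiv]
  simp only [ContinuousLinearMap.comp_apply, ContinuousLinearMap.prod_apply, ContinuousLinearMap.coe_snd', ContinuousLinearMap.coe_fst',
    innerSL_apply_apply]
  obtain ⟨i1, i2⟩ := inner_fderiv_gS w.1 v
  have hv : G v = ⟪e₁, G v⟫ • e₁ + ⟪e₂, G v⟫ • e₂ := hb _ i1 i2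
  have : ((r, G v) : ℝ × ℍ[ℝ]) = r • (1, 0) + ⟪e₁, G v⟫ • (0, e₁) + ⟪e₂, G v⟫ • (0, e₂) := by
    ext1
    · simp
    · simpa using hv
  rw [this, map_add, map_add, _root_.map_smul, _root_.map_smul, _root_.map_smul]

end SD

namespace SD
open Module
open Filter Topology OnePoint

theorem abs_det_three_le {M : Matrix (Fin 3) (Fin 3) ℝ} {b : Fin 3 → ℝ} (h : ∀ i k, |M i k| ≤ b k) :
    |M.det| ≤ 6 * (b 0 * b 1 * b 2) := by
  have hb : ∀ σ : Equiv.Perm (Fin 3), |((Equiv.Perm.sign σ : ℤ) : ℝ) * ∏ i, M (σ i) i| ≤ b 0 * b 1 * b 2 := fun σ => by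
    have h1 : |((Equiv.Perm.sign σ : ℤ) : ℝ)| = 1 := by
      rcases Int.units_eq_one_or (Equiv.Perm.sign σ) with e | e <;> simp [e]
    rw [abs_mul, h1, one_mul, Finset.abs_prod, ← Fin.prod_univ_three]
    exact Finset.prod_le_prod (fun i _ => abs_nonneg _) fun i _ => h _ _
  rw [Matrix.det_apply']
  refine (Finset.abs_sum_le_sum_abs _ _).trans ((Finset.sum_le_sum fun σ _ => hb σ).trans_eq ?_)
  rw [Finset.sum_const, Finset.card_univ, Fintype.card_perm, Fintype.card_fin, nsmul_eq_mul]
  norm_num [Nat.factorial]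

theorem lamNorm_three_le {E F : Type*} [NormedAddCommGroup E] [InnerProductSpace ℝ E] [NormedAddCommGroup F]
    [InnerProductSpace ℝ F] {A : E →ₗ[ℝ] F} {φ : Fin 3 → E → ℝ} {p : Fin 3 → F} {b : Fin 3 → ℝ} {C : ℝ} (hC : 0 ≤ C)
    (hp : ∀ k, ‖p k‖ ≤ C) (hb : ∀ k, 0 ≤ b k) (hφ : ∀ k v, |φ k v| ≤ b k * ‖v‖) (hA : ∀ v, A v = ∑ k, φ k v • p k) :
    lamNorm 3 A ≤ 18 * (b 0 * b 1 * b 2) * C ^ 3 := by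
  have hB : 0 ≤ b 0 * b 1 * b 2 := mul_nonneg (mul_nonneg (hb 0) (hb 1)) (hb 2)
  refine Real.iSup_le (fun v => Real.sqrt_le_iff.2 ⟨by positivity, ?_⟩) (by positivity)
  set M : Matrix (Fin 3) (Fin 3) ℝ := Matrix.of fun i k => φ k (v.1 i)
  set G : Matrix (Fin 3) (Fin 3) ℝ := Matrix.of fun k l => ⟪p k, p l⟫
  have hM : |M.det| ≤ 6 * (b 0 * b 1 * b 2) := abs_det_three_le fun i k => by
    simpa [v.2.1 i, M] using hφ k (v.1 i)
  have hG : |G.det| ≤ 6 * (C ^ 2 * C ^ 2 * C ^ 2) := abs_det_three_le (b := fun _ => C ^ 2) fun k l => by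
    refine (abs_real_inner_le_norm _ _).trans ?_
    rw [sq]
    exact mul_le_mul (hp k) (hp l) (norm_nonneg _) hC
  have e : (Matrix.of fun i j => ⟪A (v.1 i), A (v.1 j)⟫) = M * G * M.transpose := by
    ext i j
    simp only [Matrix.of_apply, hA, sum_inner, inner_sum, Matrix.mul_apply, Matrix.transpose_apply, Finset.sum_mul, M, G,
      real_inner_smul_left, real_inner_smul_right]
    exact Finset.sum_congr rfl fun _ _ => Finset.sum_congr rfl fun _ _ => by ring
  rw [e, Matrix.det_mul, Matrix.det_mul, Matrix.det_transpose]
  have h1 : M.det * G.det * M.det ≤ |M.det| ^ 2 * |G.det| := by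
    rw [sq_abs]
    nlinarith [le_abs_self G.det, sq_nonneg M.det]
  have h2 : |M.det| ^ 2 * |G.det| ≤ (6 * (b 0 * b 1 * b 2)) ^ 2 * (6 * (C ^ 2 * C ^ 2 * C ^ 2)) := by gcongr
  refine h1.trans (h2.trans ?_)
  have : 0 ≤ ((b 0 * b 1 * b 2) * C ^ 3) ^ 2 := sq_nonneg _
  nlinarith

end SD

namespace SD
open Module
open Filter Topology OnePoint

/-- A `C¹` step from `0` to `1`, with derivative supported in `[-1/2, 1/2]`. -/
def stp (x : ℝ) : ℝ := 2 * mp (x + 1 / 2) ^ 2 - 4 * mp x ^ 2 + 2 * mp (x - 1 / 2) ^ 2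

theorem stp_of_le {x : ℝ} (h : x ≤ -1 / 2) : stp x = 0 := by
  simp only [stp, mp]
  rw [max_eq_right (by linarith), max_eq_right (by linarith), max_eq_right (by linarith)]
  ring

theorem stp_of_ge {x : ℝ} (h : 1 / 2 ≤ x) : stp x = 1 := by
  simp only [stp, mp]
  rw [max_eq_left (by linarith), max_eq_left (by linarith), max_eq_left (by linarith)]
  ring

theorem stp_of_nonpos {x : ℝ} (h : -1 / 2 ≤ x) (h' : x ≤ 0) : stp x = 1 / 2 + 2 * x * (1 + x) := by
  simp only [stp, mp]
  rw [max_eq_left (by linarith), max_eq_right (by linarith), max_eq_right (by linarith)]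
  ring

theorem stp_of_nonneg {x : ℝ} (h : x ≤ 1 / 2) (h' : 0 ≤ x) : stp x = 1 / 2 + 2 * x * (1 - x) := by
  simp only [stp, mp]
  rw [max_eq_left (by linarith), max_eq_left (by linarith), max_eq_right (by linarith)]
  ring

theorem stp_mem (x : ℝ) : 0 ≤ stp x ∧ stp x ≤ 1 := by
  rcases le_total x (-1 / 2) with h | h
  · simp [stp_of_le h]
  rcases le_total (1 / 2) x with h' | h'
  · simp [stp_of_ge h']
  rcases le_total x 0 with h2 | h2
  · rw [stp_of_nonpos h h2]
    constructor <;> nlinarith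
  · rw [stp_of_nonneg h' h2]
    constructor <;> nlinarith

theorem abs_le_stp {x : ℝ} (h : |stp x - 1 / 2| < 1 / 2) : |x| ≤ |stp x - 1 / 2| := by
  rcases le_total x (-1 / 2) with h1 | h1
  · norm_num [stp_of_le h1] at h
  rcases le_total (1 / 2) x with h' | h'
  · norm_num [stp_of_ge h'] at h
  rcases le_total x 0 with h2 | h2
  · rw [stp_of_nonpos h1 h2, abs_of_nonpos h2, abs_of_nonpos] <;> nlinarith
  · rw [stp_of_nonneg h' h2, abs_of_nonneg h2, abs_of_nonneg] <;> nlinarith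

theorem exists_hasDerivAt_stp (x : ℝ) : ∃ k : ℝ, |k| ≤ 2 ∧ HasDerivAt stp k x := by
  have h1 : HasDerivAt (fun x => mp (x + 1 / 2) ^ 2) (2 * mp (x + 1 / 2)) x :=
    (hasDerivAt_mp_sq (x + 1 / 2)).comp_add_const x (1 / 2)
  have h2 : HasDerivAt (fun x => mp (x - 1 / 2) ^ 2) (2 * mp (x - 1 / 2)) x :=
    (hasDerivAt_mp_sq (x - 1 / 2)).comp_sub_const x (1 / 2)
  refine ⟨_, ?_, ((h1.const_mul 2).sub ((hasDerivAt_mp_sq x).const_mul 4)).add (h2.const_mul 2)⟩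
  rw [abs_le]
  rcases le_total x (-1 / 2) with h | h
  · simp only [mp]
    rw [max_eq_right (by linarith), max_eq_right (by linarith), max_eq_right (by linarith)]
    norm_num
  rcases le_total (1 / 2) x with h' | h'
  · simp only [mp]
    rw [max_eq_left (by linarith), max_eq_left (by linarith), max_eq_left (by linarith)]
    constructor <;> linarith
  rcases le_total x 0 with h2 | h2
  · simp only [mp]
    rw [max_eq_left (by linarith), max_eq_right (by linarith), max_eq_right (by linarith)]
    constructor <;> linarith
  · simp only [mp]
    rw [max_eq_left (by linarith), max_eq_left (by linarith), max_eq_right (by linarith)]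
    constructor <;> linarith

theorem contDiff_stp : ContDiff ℝ 1 stp :=
  ((contDiff_const.mul (contDiff_mp_sq.comp (contDiff_id.add contDiff_const))).sub (contDiff_const.mul contDiff_mp_sq)).add
    (contDiff_const.mul (contDiff_mp_sq.comp (contDiff_id.sub contDiff_const)))

/-- The squared distance to the origin. -/
def rh (z : ℂ) : ℝ := z.re ^ 2 + z.im ^ 2

theorem contDiff_rh : ContDiff ℝ 1 rh :=
  (Complex.reCLM.contDiff.pow 2).add (Complex.imCLM.contDiff.pow 2)

/-- The angular correction: half of `1 - stp`, with the sign of the imaginary part. -/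
def stw (z : ℂ) : ℝ := (if 0 ≤ z.im then 1 else -1) * (1 - stp z.re) / 2

/-- The winding coordinate and the height coordinate of a stage. -/
def stm (N : ℝ) (z : ℂ) : ℝ := N * rh z - stw z

def stn (N : ℝ) (z : ℂ) : ℝ := stm N z - round (stm N z)

def stt (N : ℝ) (z : ℂ) : ℝ := 2 * (rh z - 5 / 2 - stn N z / N)

theorem abs_stn_le (N : ℝ) (z : ℂ) : |stn N z| ≤ 1 / 2 := abs_sub_round _

theorem rh_bounds {N : ℝ} (hN : 1 ≤ N) {z : ℂ} (h : |stt N z| ≤ 2) : 1 ≤ rh z ∧ rh z ≤ 4 := by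
  have h1 : |stn N z / N| ≤ 1 / 2 := by
    rw [abs_div, abs_of_pos (by linarith : 0 < N), div_le_iff₀ (by linarith)]
    linarith [abs_stn_le N z]
  rw [stt, abs_le] at h
  rw [abs_le] at h1
  constructor <;> linarith

theorem abs_re_im_le {z : ℂ} (h : rh z ≤ 4) : |z.re| ≤ 2 ∧ |z.im| ≤ 2 := by
  rw [rh] at h
  constructor <;> refine abs_le_of_sq_le_sq (by nlinarith [sq_nonneg z.re, sq_nonneg z.im]) (by norm_num)

/-- The local smooth branches of the winding coordinate. -/
def brn (N e : ℝ) (z : ℂ) : ℝ := N * rh z - e * (1 - stp z.re) / 2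

theorem contDiff_brn (N e : ℝ) : ContDiff ℝ 1 (brn N e) :=
  (contDiff_const.mul contDiff_rh).sub
    ((contDiff_const.mul (contDiff_const.sub (contDiff_stp.comp Complex.reCLM.contDiff))).div_const 2)

theorem exists_brn (N : ℝ) {z : ℂ} (h : 1 ≤ rh z) : ∃ e : ℝ, |e| = 1 ∧ ∀ᶠ w in 𝓝 z, ∃ l : ℤ, stm N w = brn N e w + l := by
  rcases lt_trichotomy z.im 0 with hi | hi | hi
  · refine ⟨-1, by simp, ?_⟩
    filter_upwards [Complex.continuous_im.continuousAt.eventually (gt_mem_nhds hi)] with w hw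
    exact ⟨0, by simp [stm, stw, brn, not_le.2 hw]⟩
  · have : 1 ≤ z.re ^ 2 := by simpa [rh, hi] using h
    refine ⟨1, by simp, ?_⟩
    rcases le_total 0 z.re with hr | hr
    · have : 1 / 2 < z.re := by nlinarith
      filter_upwards [Complex.continuous_re.continuousAt.eventually (lt_mem_nhds this)] with w hw
      exact ⟨0, by simp [stm, stw, brn, stp_of_ge hw.le]⟩
    · have : z.re < -1 / 2 := by nlinarith
      filter_upwards [Complex.continuous_re.continuousAt.eventually (gt_mem_nhds this)] with w hw
      by_cases h0 : 0 ≤ w.im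
      · exact ⟨0, by simp [stm, stw, brn, h0]⟩
      · refine ⟨1, ?_⟩
        simp only [stm, stw, brn, h0, stp_of_le hw.le, if_false]
        push_cast
        ring
  · refine ⟨1, by simp, ?_⟩
    filter_upwards [Complex.continuous_im.continuousAt.eventually (lt_mem_nhds hi)] with w hw
    exact ⟨0, by simp [stm, stw, brn, hw.le]⟩

theorem round_eq_of_abs_lt {x : ℝ} {c : ℤ} (h : |x - c| < 1 / 2) : round x = c := by
  rw [abs_lt] at h
  rw [round_eq, Int.floor_eq_iff]
  constructor <;> linarith

theorem eventually_large (N : ℝ) {z : ℂ} (h : 1 ≤ rh z) (h2 : |stn N z| = 1 / 2) : ∀ᶠ w in 𝓝 z, 3 / 8 < |stn N w| := by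
  obtain ⟨e, -, he⟩ := exists_brn N h
  obtain ⟨l, hl⟩ := he.self_of_nhds
  have hc : ∀ᶠ w in 𝓝 z, |brn N e w - brn N e z| < 1 / 8 := by
    have := (contDiff_brn N e).continuous.continuousAt (x := z)
    simpa [Real.dist_eq] using Metric.tendsto_nhds.1 this (1 / 8) (by norm_num)
  filter_upwards [he, hc] with w ⟨k, hk⟩ hw
  have h3 : |stm N z - (round (stm N w) - k + l : ℤ)| ≥ 1 / 2 := by
    rw [← h2, stn]
    exact round_le _ _
  push_cast at h3
  rw [stn]
  have e1 : stm N z - (round (stm N w) - k + l) = (stm N w - round (stm N w)) - (brn N e w - brn N e z) := by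
    rw [hl]
    linear_combination -hk
  rw [e1] at h3
  have := abs_sub (stm N w - round (stm N w)) (brn N e w - brn N e z)
  linarith

theorem stage_smooth {N : ℝ} (hN : 1 ≤ N) {z : ℂ} (h : 1 ≤ rh z) (h4 : rh z ≤ 4) (h2 : |stn N z| < 1 / 2) :
    ContDiffAt ℝ 1 (stn N) z ∧ ContDiffAt ℝ 1 (stt N) z ∧ ‖fderiv ℝ (stn N) z‖ ≤ 9 * N ∧
      ∃ k : ℝ, |k| ≤ 2 / N ∧ HasFDerivAt (stt N) (k • Complex.reCLM) z := by
  obtain ⟨e, he1, he⟩ := exists_brn N h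
  obtain ⟨l, hl⟩ := he.self_of_nhds
  have hN0 : N ≠ 0 := by linarith
  set c := round (brn N e z)
  have hc : ∀ᶠ w in 𝓝 z, |brn N e w - c| < 1 / 2 := by
    refine ((contDiff_brn N e).continuous.sub continuous_const).abs.continuousAt.eventually (gt_mem_nhds ?_)
    rw [stn, hl, round_add_intCast] at h2
    push_cast at h2
    rwa [add_sub_add_right_eq_sub] at h2
  have hn : ∀ᶠ w in 𝓝 z, stn N w = brn N e w - c := by
    filter_upwards [he, hc] with w ⟨k, hk⟩ hw
    rw [stn, hk, round_add_intCast, round_eq_of_abs_lt hw]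
    push_cast
    ring
  have ht : ∀ᶠ w in 𝓝 z, stt N w = e / N * (1 - stp w.re) + (2 * c / N - 5) := by
    filter_upwards [hn] with w hw
    rw [stt, hw, brn]
    field_simp
    ring
  have hn' : (stn N) =ᶠ[𝓝 z] fun w => brn N e w - c := hn
  have ht' : (stt N) =ᶠ[𝓝 z] fun w => e / N * (1 - stp w.re) + (2 * c / N - 5) := ht
  obtain ⟨k, hk, hd⟩ := exists_hasDerivAt_stp z.re
  have hs : HasFDerivAt (fun w : ℂ => stp w.re) (k • Complex.reCLM) z :=
    hd.comp_hasFDerivAt z Complex.reCLM.hasFDerivAt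
  refine ⟨((contDiff_brn N e).contDiffAt.sub contDiffAt_const).congr_of_eventuallyEq hn', ?_, ?_, -(e / N * k), ?_, ?_⟩
  · refine ContDiffAt.congr_of_eventuallyEq (ContDiff.contDiffAt ?_) ht'
    exact (contDiff_const.mul (contDiff_const.sub (contDiff_stp.comp Complex.reCLM.contDiff))).add contDiff_const
  · have hr : HasFDerivAt rh (((2 : ℕ) * z.re ^ 1) • Complex.reCLM + ((2 : ℕ) * z.im ^ 1) • Complex.imCLM) z := by
      refine HasFDerivAt.congr_fderiv (((Complex.reCLM.hasFDerivAt (x := z)).pow 2).add ((Complex.imCLM.hasFDerivAt (x := z)).pow 2)) ?_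
      ext v <;> simp
    have hb := ((hr.const_mul N).sub (((hs.const_sub 1).const_mul e).mul_const (1 / 2))).sub_const (c : ℝ)
    have : (stn N) =ᶠ[𝓝 z] fun w => N * rh w - e * (1 - stp w.re) * (1 / 2) - c := by
      filter_upwards [hn] with w hw
      rw [hw, brn]
      ring
    rw [(hb.congr_of_eventuallyEq this).fderiv]
    obtain ⟨hx, hy⟩ := abs_re_im_le h4
    refine ContinuousLinearMap.opNorm_le_bound _ (by linarith) fun v => ?_
    have hv := Complex.abs_re_le_norm v
    have hv' := Complex.abs_im_le_norm v
    simp only [ContinuousLinearMap.sub_apply, ContinuousLinearMap.smul_apply, ContinuousLinearMap.add_apply, smul_eq_mul,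
      Complex.reCLM_apply, Complex.imCLM_apply, ContinuousLinearMap.neg_apply, Real.norm_eq_abs]
    have e1 : N * ((2 : ℕ) * z.re ^ 1 * v.re + (2 : ℕ) * z.im ^ 1 * v.im) - 1 / 2 * (e * -(k * v.re)) =
      N * (2 * (z.re * v.re)) + N * (2 * (z.im * v.im)) + 1 / 2 * (e * (k * v.re)) := by push_cast; ring
    rw [e1]
    have b1 : |z.re * v.re| ≤ 2 * ‖v‖ := by rw [abs_mul]; gcongr
    have b2 : |z.im * v.im| ≤ 2 * ‖v‖ := by rw [abs_mul]; gcongr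
    have b3 : |e * (k * v.re)| ≤ 2 * ‖v‖ := by rw [abs_mul, he1, one_mul, abs_mul]; gcongr
    have hv0 := norm_nonneg v
    rw [abs_le] at *
    constructor <;> nlinarith
  · rw [abs_neg, abs_mul, abs_div, he1, abs_of_pos (by linarith : 0 < N), div_mul_eq_mul_div, one_mul]
    gcongr
  · have := ((hs.const_sub 1).const_mul (e / N)).add_const (2 * c / N - 5)
    refine (this.congr_of_eventuallyEq ht').congr_fderiv ?_
    ext v <;> simp [mul_assoc]

/-- Every point either has a neighbourhood on which one coordinate is large, or is a point of smoothness. -/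
theorem stage_cases {N : ℝ} (hN : 1 ≤ N) (z : ℂ) :
    (∀ᶠ w in 𝓝 z, 2 < |stt N w| ∨ 3 / 8 < |stn N w|) ∨ (1 ≤ rh z ∧ rh z ≤ 4 ∧ |stn N z| < 1 / 2) := by
  by_cases h1 : rh z < 1
  · left
    filter_upwards [contDiff_rh.continuous.continuousAt.eventually (gt_mem_nhds h1)] with w hw
    by_contra! h
    linarith [(rh_bounds hN h.1).1]
  by_cases h4 : 4 < rh z
  · left
    filter_upwards [contDiff_rh.continuous.continuousAt.eventually (lt_mem_nhds h4)] with w hw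
    by_contra! h
    linarith [(rh_bounds hN h.1).2]
  push Not at h1 h4
  rcases (abs_stn_le N z).lt_or_eq with h | h
  · exact Or.inr ⟨h1, h4, h⟩
  · exact Or.inl ((eventually_large N h1 h).mono fun w hw => Or.inr hw)

/-- The frequencies for which the stage has exactly one zero. -/
def Freq (N : ℝ) : Prop := 1 ≤ N ∧ ∃ j : ℤ, 5 / 2 * N = j + 1 / 4

theorem stage_inj {N : ℝ} (hN : Freq N) {z : ℂ} (h : N * |stt N z| < 1 / 2) :
    |z.re| ≤ N * |stt N z| ∧ |z.im - √(5 / 2)| ≤ (1 + N) * |stt N z| + |stn N z| := by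
  obtain ⟨hN, j, hj⟩ := hN
  have hN0 : 0 < N := by linarith
  set τ := stt N z with hτ
  have e1 : τ * N / 2 = stw z - 1 / 4 + (round (stm N z) - j : ℤ) := by
    rw [hτ, stt, stn]
    field_simp
    have : stm N z = N * rh z - stw z := rfl
    push_cast
    linear_combination (-8 : ℝ) * this - 8 * hj
  have hη : |τ * N / 2| < 1 / 4 := by
    rw [abs_div, abs_mul, abs_of_pos hN0, abs_two]
    linarith
  generalize round (stm N z) - j = l at e1
  obtain ⟨s0, s1⟩ := stp_mem z.re
  rw [abs_lt] at hη
  have him : 0 ≤ z.im := by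
    by_contra hi
    simp only [stw, hi, if_false] at e1
    have l0 : (0 : ℝ) < l := by linarith
    have l1 : (l : ℝ) < 1 := by linarith
    have l0' : 0 < l := by exact_mod_cast l0
    have l1' : l < 1 := by exact_mod_cast l1
    omega
  simp only [stw, him, if_true] at e1
  have hl : l = 0 := by
    have l0 : (-1 : ℝ) < l := by linarith
    have l1 : (l : ℝ) < 1 := by linarith
    have l0' : -1 < l := by exact_mod_cast l0
    have l1' : l < 1 := by exact_mod_cast l1
    omega
  rw [hl, Int.cast_zero, add_zero] at e1
  have e2 : stp z.re - 1 / 2 = -(τ * N) := by linear_combination 2 * e1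
  have e3 : |stp z.re - 1 / 2| = N * |τ| := by rw [e2, abs_neg, abs_mul, abs_of_pos hN0, mul_comm]
  have hx : |z.re| ≤ N * |τ| := e3 ▸ abs_le_stp (by rw [e3]; exact h)
  refine ⟨hx, ?_⟩
  have hs : √(5 / 2 : ℝ) ^ 2 = 5 / 2 := Real.sq_sqrt (by norm_num)
  have hs1 : 1 ≤ √(5 / 2 : ℝ) := Real.one_le_sqrt.2 (by norm_num)
  have e4 : (z.im - √(5 / 2)) * (z.im + √(5 / 2)) = τ / 2 + stn N z / N - z.re ^ 2 := by
    have : τ = 2 * (rh z - 5 / 2 - stn N z / N) := hτ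
    rw [rh] at this
    linear_combination -this / 2 - hs
  have b1 : |stn N z / N| ≤ |stn N z| := by
    rw [abs_div, abs_of_pos hN0]
    exact div_le_self (abs_nonneg _) hN
  have b2 : z.re ^ 2 ≤ N * |τ| := by
    rw [← sq_abs]
    nlinarith [abs_nonneg z.re]
  have b3 : |z.im - √(5 / 2)| ≤ |(z.im - √(5 / 2)) * (z.im + √(5 / 2))| := by
    rw [abs_mul]
    refine le_mul_of_one_le_right (abs_nonneg _) ?_
    rw [abs_of_nonneg (by linarith)]
    linarith
  refine b3.trans ?_
  rw [e4]
  have := sq_nonneg z.re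
  have := neg_abs_le τ
  have := le_abs_self τ
  have := abs_nonneg τ
  rw [abs_le] at b1
  rw [abs_le]
  constructor <;> nlinarith

theorem stage_zero {N : ℝ} (hN : Freq N) : stn N ⟨0, √(5 / 2)⟩ = 0 ∧ stt N ⟨0, √(5 / 2)⟩ = 0 := by
  obtain ⟨hN, j, hj⟩ := hN
  have hr : rh ⟨0, √(5 / 2)⟩ = 5 / 2 := by
    simp only [rh]
    rw [Real.sq_sqrt (by norm_num)]
    norm_num
  have hs : stm N ⟨0, √(5 / 2)⟩ = j := by
    rw [stm, hr, stw, stp_of_nonneg (by norm_num) le_rfl]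
    simp only [Real.sqrt_nonneg, if_true]
    linarith
  have hn : stn N ⟨0, √(5 / 2)⟩ = 0 := by rw [stn, hs]; simp
  exact ⟨hn, by rw [stt, hn, hr]; simp⟩

theorem exists_freq (B : ℝ) : ∃ N, Freq N ∧ B ≤ N := by
  obtain ⟨j, hj⟩ := exists_nat_ge (3 * |B| + 3)
  refine ⟨2 / 5 * (j + 1 / 4), ⟨?_, j, ?_⟩, ?_⟩
  · linarith [abs_nonneg B]
  · push_cast
    ring
  · linarith [le_abs_self B, abs_nonneg B]

end SD

namespace SD
open Module
open Filter Topology OnePoint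
open scoped Quaternion

section Pair

variable {E : Type*} [NormedAddCommGroup E] [NormedSpace ℝ E] {N K : ℝ} {a b : E → ℝ} {y : E}

/-- The complex-valued map with given real and imaginary parts. -/
def cpr (a b : E → ℝ) (y : E) : ℂ := ⟨a y, b y⟩

theorem cpr_eq (a b : E → ℝ) : cpr a b = fun y => Complex.equivRealProdCLM.symm (a y, b y) := rfl

theorem contDiffAt_cpr (ha : ContDiffAt ℝ 1 a y) (hb : ContDiffAt ℝ 1 b y) : ContDiffAt ℝ 1 (cpr a b) y := by
  rw [cpr_eq]
  exact Complex.equivRealProdCLM.symm.contDiff.contDiffAt.comp y (ha.prodMk hb)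

theorem hasFDerivAt_cpr {a' b' : E →L[ℝ] ℝ} (ha : HasFDerivAt a a' y) (hb : HasFDerivAt b b' y) :
    HasFDerivAt (cpr a b) (Complex.equivRealProdCLM.symm.toContinuousLinearMap ∘L a'.prod b') y := by
  rw [cpr_eq]
  exact Complex.equivRealProdCLM.symm.hasFDerivAt.comp y (ha.prodMk hb)

theorem norm_fderiv_cpr_le (ha : DifferentiableAt ℝ a y) (hb : DifferentiableAt ℝ b y) :
    ‖fderiv ℝ (cpr a b) y‖ ≤ ‖fderiv ℝ a y‖ + ‖fderiv ℝ b y‖ := by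
  rw [(hasFDerivAt_cpr ha.hasFDerivAt hb.hasFDerivAt).fderiv]
  refine ContinuousLinearMap.opNorm_le_bound _ (by positivity) fun v => ?_
  refine (Complex.norm_le_abs_re_add_abs_im _).trans ?_
  rw [add_mul]
  exact add_le_add ((fderiv ℝ a y).le_opNorm v) ((fderiv ℝ b y).le_opNorm v)

theorem step_cases (hN : 1 ≤ N) (ha : ContDiffAt ℝ 1 a y) (hb : ContDiffAt ℝ 1 b y) (hK : ‖fderiv ℝ a y‖ ≤ K)
    (hK8 : K ≤ 8) (hb8 : ‖fderiv ℝ b y‖ ≤ 8) :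
    (∀ᶠ w in 𝓝 y, 2 < |stt N (cpr a b w)| ∨ 3 / 8 < |stn N (cpr a b w)|) ∨
      (ContDiffAt ℝ 1 (fun w => stn N (cpr a b w)) y ∧ ContDiffAt ℝ 1 (fun w => stt N (cpr a b w)) y ∧
        ‖fderiv ℝ (fun w => stn N (cpr a b w)) y‖ ≤ 144 * N ∧ ‖fderiv ℝ (fun w => stt N (cpr a b w)) y‖ ≤ 2 / N * K) := by
  have hz := contDiffAt_cpr ha hb
  have hda := ha.differentiableAt one_ne_zero
  have hdb := hb.differentiableAt one_ne_zero
  rcases stage_cases hN (cpr a b y) with h | ⟨h1, h4, h2⟩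
  · exact Or.inl (hz.continuousAt.eventually h)
  obtain ⟨c1, c2, c3, k, hk, c4⟩ := stage_smooth hN h1 h4 h2
  refine Or.inr ⟨c1.comp y hz, c2.comp y hz, ?_, ?_⟩
  · have := (c1.differentiableAt one_ne_zero).hasFDerivAt.comp y (hz.differentiableAt one_ne_zero).hasFDerivAt
    rw [show (fun w => stn N (cpr a b w)) = stn N ∘ cpr a b from rfl, this.fderiv]
    refine (ContinuousLinearMap.opNorm_comp_le _ _).trans ?_
    have h16 : ‖fderiv ℝ (cpr a b) y‖ ≤ 16 := (norm_fderiv_cpr_le hda hdb).trans (by linarith)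
    calc _ ≤ (9 * N) * 16 := by gcongr
      _ = _ := by ring
  · have := c4.comp y (hasFDerivAt_cpr hda.hasFDerivAt hdb.hasFDerivAt)
    rw [show (fun w => stt N (cpr a b w)) = stt N ∘ cpr a b from rfl, this.fderiv]
    have e : (k • Complex.reCLM) ∘L (Complex.equivRealProdCLM.symm.toContinuousLinearMap ∘L (fderiv ℝ a y).prod (fderiv ℝ b y)) =
        k • fderiv ℝ a y := by
      ext v
      simp
    rw [e, norm_smul, Real.norm_eq_abs]
    gcongr

theorem norm_fderiv_prodMk_le {F G : Type*} [NormedAddCommGroup F] [NormedSpace ℝ F] [NormedAddCommGroup G] [NormedSpace ℝ G]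
    {f : E → F} {g : E → G} (hf : DifferentiableAt ℝ f y) (hg : DifferentiableAt ℝ g y) (h1 : ‖fderiv ℝ f y‖ ≤ K)
    (h2 : ‖fderiv ℝ g y‖ ≤ K) : ‖fderiv ℝ (fun y => (f y, g y)) y‖ ≤ K := by
  rw [(hf.hasFDerivAt.prodMk hg.hasFDerivAt).fderiv, ContinuousLinearMap.opNorm_prod]
  exact max_le h1 h2

end Pair

section Chi

variable {N : ℝ}

/-- Rescaled coordinates. -/
def cor (i : Fin 6) (y : EucA 6) : ℝ := 8 * y i

def ch1 : EucA 6 → ℂ := cpr (cor 0) (cor 1)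
def ch2 (N : ℝ) : EucA 6 → ℂ := cpr (fun y => stt N (ch1 y)) (cor 2)
def ch3 (N : ℝ) : EucA 6 → ℂ := cpr (fun y => stt N (ch2 N y)) (cor 3)

/-- The chart-like map obtained from three stages. -/
def chi (N : ℝ) (y : EucA 6) : V5 × ℝ :=
  ((((cpr (cor 4) (cor 5) y, 3 * stn N (ch1 y)), 3 * stn N (ch2 N y)), 3 * stn N (ch3 N y)), stt N (ch3 N y))

theorem contDiff_cor (i : Fin 6) : ContDiff ℝ 1 (cor i) :=
  contDiff_const.mul (EuclideanSpace.proj i : EucA 6 →L[ℝ] ℝ).contDiff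

theorem norm_fderiv_cor_le (i : Fin 6) (y : EucA 6) : ‖fderiv ℝ (cor i) y‖ ≤ 8 := by
  have : HasFDerivAt (cor i) ((8 : ℝ) • (EuclideanSpace.proj i : EucA 6 →L[ℝ] ℝ)) y :=
    (EuclideanSpace.proj i : EucA 6 →L[ℝ] ℝ).hasFDerivAt.const_mul 8
  rw [this.fderiv]
  refine ContinuousLinearMap.opNorm_le_bound _ (by norm_num) fun v => ?_
  have := PiLp.norm_apply_le v i
  simpa [abs_mul] using this

theorem chi_bounds (y : EucA 6) : ‖cpr (cor 4) (cor 5) y‖ ≤ ‖chi N y‖ ∧ 3 * |stn N (ch1 y)| ≤ ‖chi N y‖ ∧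
    3 * |stn N (ch2 N y)| ≤ ‖chi N y‖ ∧ 3 * |stn N (ch3 N y)| ≤ ‖chi N y‖ ∧ |stt N (ch3 N y)| ≤ ‖chi N y‖ := by
  have e : ∀ x : ℝ, ‖3 * x‖ = 3 * |x| := fun x => by rw [norm_mul, Real.norm_eq_abs, Real.norm_eq_abs]; norm_num
  simp only [← e]
  simp only [chi, Prod.norm_def, Real.norm_eq_abs]
  refine ⟨?_, ?_, ?_, ?_, ?_⟩ <;> simp [le_max_iff]

theorem two_lt_of_re (hN : 1 ≤ N) {z : ℂ} (h : 2 < |z.re|) : 2 < |stt N z| := by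
  by_contra! h'
  exact absurd (abs_re_im_le (rh_bounds hN h').2).1 (not_le.2 h)

theorem chi_cases (hN : 2 ≤ N) (y : EucA 6) : (∀ᶠ w in 𝓝 y, 1 ≤ ‖chi N w‖) ∨
    (ContDiffAt ℝ 1 (chi N) y ∧ ‖fderiv ℝ (fun y => (chi N y).1) y‖ ≤ 432 * N ∧
      ‖fderiv ℝ (fun y => (chi N y).2) y‖ ≤ 64 / N ^ 3) := by
  have hN1 : 1 ≤ N := by linarith
  have hN2 : 2 / N ≤ 1 := (div_le_one (by linarith)).2 hN
  have hN0 : 0 ≤ 2 / N := by positivity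
  have cc := fun i => (contDiff_cor i).contDiffAt (x := y)
  rcases step_cases hN1 (cc 0) (cc 1) (norm_fderiv_cor_le 0 y) le_rfl (norm_fderiv_cor_le 1 y) with h | ⟨a1, a2, a3, a4⟩
  · left
    filter_upwards [h] with w hw
    obtain ⟨-, b1, -, -, b2⟩ := chi_bounds (N := N) w
    rcases hw with hw | hw
    · have := two_lt_of_re (z := ch3 N w) hN1 (two_lt_of_re (z := ch2 N w) hN1 hw)
      linarith
    · have : 3 / 8 < |stn N (ch1 w)| := hw
      linarith
  have k1 : 2 / N * 8 ≤ 8 := by linarith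
  rcases step_cases hN1 a2 (cc 2) a4 k1 (norm_fderiv_cor_le 2 y) with h | ⟨b1, b2, b3, b4⟩
  · left
    filter_upwards [h] with w hw
    obtain ⟨-, -, b1, -, b2⟩ := chi_bounds (N := N) w
    rcases hw with hw | hw
    · have := two_lt_of_re (z := ch3 N w) hN1 hw
      linarith
    · have : 3 / 8 < |stn N (ch2 N w)| := hw
      linarith
  have k2 : 2 / N * (2 / N * 8) ≤ 8 := by nlinarith
  rcases step_cases hN1 b2 (cc 3) b4 k2 (norm_fderiv_cor_le 3 y) with h | ⟨c1, c2, c3, c4⟩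
  · left
    filter_upwards [h] with w hw
    obtain ⟨-, -, -, b1, b2⟩ := chi_bounds (N := N) w
    rcases hw with hw | hw
    · have : 2 < |stt N (ch3 N w)| := hw
      linarith
    · have : 3 / 8 < |stn N (ch3 N w)| := hw
      linarith
  right
  have cz := contDiffAt_cpr (cc 4) (cc 5)
  have three : ∀ {f : EucA 6 → ℝ}, ContDiffAt ℝ 1 f y → ‖fderiv ℝ f y‖ ≤ 144 * N →
      ContDiffAt ℝ 1 (fun w => 3 * f w) y ∧ ‖fderiv ℝ (fun w => 3 * f w) y‖ ≤ 432 * N := fun {f} hf h => by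
    refine ⟨contDiffAt_const.mul hf, ?_⟩
    rw [((hf.differentiableAt one_ne_zero).hasFDerivAt.const_mul 3).fderiv, norm_smul]
    norm_num
    linarith
  have d : ∀ {F : Type} [NormedAddCommGroup F] [NormedSpace ℝ F] {f : EucA 6 → F}, ContDiffAt ℝ 1 f y → DifferentiableAt ℝ f y :=
    fun {F} _ _ {f} hf => hf.differentiableAt one_ne_zero
  obtain ⟨a1', a3'⟩ := three a1 a3
  obtain ⟨b1', b3'⟩ := three b1 b3
  obtain ⟨c1', c3'⟩ := three c1 c3
  refine ⟨(((cz.prodMk a1').prodMk b1').prodMk c1').prodMk c2, ?_, ?_⟩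
  · refine norm_fderiv_prodMk_le (d ((cz.prodMk a1').prodMk b1')) (d c1') ?_ c3'
    refine norm_fderiv_prodMk_le (d (cz.prodMk a1')) (d b1') ?_ b3'
    refine norm_fderiv_prodMk_le (d cz) (d a1') ?_ a3'
    refine (norm_fderiv_cpr_le (d (cc 4)) (d (cc 5))).trans ?_
    linarith [norm_fderiv_cor_le 4 y, norm_fderiv_cor_le 5 y]
  · refine c4.trans (le_of_eq ?_)
    field_simp
    norm_num

/-- The unique zero of `chi`. -/
def yst : EucA 6 := !₂[0, √(5 / 2) / 8, √(5 / 2) / 8, √(5 / 2) / 8, 0, 0]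

theorem norm_le_three_mul {v : EucA 6} {M : ℝ} (hM : 0 ≤ M) (h : ∀ i, |v i| ≤ M) : ‖v‖ ≤ 3 * M := by
  refine abs_le_of_sq_le_sq (a := ‖v‖) ?_ (by positivity) |>.trans' (le_abs_self _)
  rw [EuclideanSpace.norm_sq_eq]
  have : ∀ i, ‖v i‖ ^ 2 ≤ M ^ 2 := fun i => pow_le_pow_left₀ (norm_nonneg _) (h i) 2
  refine (Finset.sum_le_sum fun i _ => this i).trans ?_
  simp
  nlinarith [sq_nonneg M]

theorem chi_small (hN : 1 ≤ N) {y : EucA 6} (h : ‖chi N y‖ ≤ 1) : rh (ch1 y) ≤ 4 ∧ rh (ch2 N y) ≤ 4 ∧ rh (ch3 N y) ≤ 4 := by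
  obtain ⟨-, -, -, -, b⟩ := chi_bounds (N := N) y
  have h3 := (rh_bounds hN (b.trans (h.trans one_le_two))).2
  have h2 := (rh_bounds hN (abs_re_im_le h3).1).2
  exact ⟨(rh_bounds hN (abs_re_im_le h2).1).2, h2, h3⟩

theorem norm_lt_half (hN : 1 ≤ N) {y : EucA 6} (h : ‖chi N y‖ ≤ 1) : ‖y‖ < 1 / 2 := by
  obtain ⟨h1, h2, h3⟩ := chi_small hN h
  have h4 : rh (cpr (cor 4) (cor 5) y) ≤ 1 := by
    have := (chi_bounds (N := N) y).1.trans h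
    have e := Complex.sq_norm_sub_sq_re (cpr (cor 4) (cor 5) y)
    rw [rh, ← e]
    nlinarith [norm_nonneg (cpr (cor 4) (cor 5) y)]
  refine lt_of_pow_lt_pow_left₀ 2 (by norm_num) ?_
  rw [EuclideanSpace.norm_sq_eq, Fin.sum_univ_six]
  simp only [rh, ch1, ch2, ch3, cpr, cor, Real.norm_eq_abs, sq_abs] at *
  have := sq_nonneg (stt N { re := 8 * y 0, im := 8 * y 1 })
  have := sq_nonneg (stt N { re := stt N { re := 8 * y 0, im := 8 * y 1 }, im := 8 * y 2 })
  nlinarith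

theorem chi_inj (hN : Freq N) {y : EucA 6} (h : ‖chi N y‖ ≤ 1) : ‖y - yst‖ ≤ 3 * (N ^ 3 * ‖chi N y‖) := by
  have hN1 := hN.1
  obtain ⟨hr1, hr2, hr3⟩ := chi_small hN1 h
  obtain ⟨bz, b1, b2, b3, b4⟩ := chi_bounds (N := N) y
  generalize ‖chi N y‖ = δ at *
  have hδ : 0 ≤ δ := (abs_nonneg _).trans b4
  have hs : √(5 / 2 : ℝ) ≤ 2 := Real.sqrt_le_iff.2 ⟨by norm_num, by norm_num⟩
  have hs0 : 0 ≤ √(5 / 2 : ℝ) := Real.sqrt_nonneg _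
  have p1 : 1 ≤ N ^ 2 := one_le_pow₀ hN1
  have p2 : N ^ 2 ≤ N ^ 3 := pow_le_pow_right₀ hN1 (by norm_num)
  have p3 : N ≤ N ^ 2 := by nlinarith
  have z4 := (Complex.abs_re_le_norm _).trans bz
  have z5 := (Complex.abs_im_le_norm _).trans bz
  have key : |8 * y 0| ≤ 8 * (N ^ 3 * δ) ∧ |8 * y 1 - √(5 / 2)| ≤ 8 * (N ^ 3 * δ) ∧ |8 * y 2 - √(5 / 2)| ≤ 8 * (N ^ 3 * δ) ∧
      |8 * y 3 - √(5 / 2)| ≤ 8 * (N ^ 3 * δ) ∧ |8 * y 4| ≤ 8 * (N ^ 3 * δ) ∧ |8 * y 5| ≤ 8 * (N ^ 3 * δ) := by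
    have hδN : δ ≤ N ^ 3 * δ := le_mul_of_one_le_left hδ (by linarith)
    have z4' : |8 * y 4| ≤ δ := z4
    have z5' : |8 * y 5| ≤ δ := z5
    by_cases hd : N ^ 3 * δ < 1 / 2
    · have q2 : N ^ 2 * δ ≤ N ^ 3 * δ := by gcongr
      have q1 : N * δ ≤ N ^ 2 * δ := by gcongr
      have r3 : N * |stt N (ch3 N y)| ≤ N * δ := by gcongr
      obtain ⟨s3, s3'⟩ := stage_inj hN (z := ch3 N y) (by linarith)
      have t2 : |stt N (ch2 N y)| ≤ N * δ := s3.trans r3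
      have t2' : N * |stt N (ch2 N y)| ≤ N ^ 2 * δ := by nlinarith
      obtain ⟨s2, s2'⟩ := stage_inj hN (z := ch2 N y) (by linarith)
      have t1 : |stt N (ch1 y)| ≤ N ^ 2 * δ := s2.trans t2'
      have t1' : N * |stt N (ch1 y)| ≤ N ^ 3 * δ := by nlinarith
      obtain ⟨s1, s1'⟩ := stage_inj hN (z := ch1 y) (by linarith)
      have u0 : |8 * y 0| ≤ N * |stt N (ch1 y)| := s1
      have u1 : |8 * y 1 - √(5 / 2)| ≤ (1 + N) * |stt N (ch1 y)| + |stn N (ch1 y)| := s1'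
      have u2 : |8 * y 2 - √(5 / 2)| ≤ (1 + N) * |stt N (ch2 N y)| + |stn N (ch2 N y)| := s2'
      have u3 : |8 * y 3 - √(5 / 2)| ≤ (1 + N) * |stt N (ch3 N y)| + |stn N (ch3 N y)| := s3'
      have := abs_nonneg (stn N (ch1 y))
      have := abs_nonneg (stn N (ch2 N y))
      have := abs_nonneg (stn N (ch3 N y))
      refine ⟨?_, ?_, ?_, ?_, ?_, ?_⟩ <;> linarith
    · have B : ∀ x : ℝ, |x| ≤ 2 → |x| ≤ 8 * (N ^ 3 * δ) ∧ |x - √(5 / 2)| ≤ 8 * (N ^ 3 * δ) := fun x hx => by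
        rw [abs_le] at hx
        simp only [abs_le]
        refine ⟨⟨?_, ?_⟩, ?_, ?_⟩ <;> linarith
      exact ⟨(B _ (abs_re_im_le hr1).1).1, (B _ (abs_re_im_le hr1).2).2, (B _ (abs_re_im_le hr2).2).2,
        (B _ (abs_re_im_le hr3).2).2, by linarith, by linarith⟩
  obtain ⟨k0, k1, k2, k3, k4, k5⟩ := key
  have e : ∀ {x a : ℝ}, |8 * x - a| ≤ 8 * (N ^ 3 * δ) → |x - a / 8| ≤ N ^ 3 * δ := fun {x a} h => by
    rw [show 8 * x - a = 8 * (x - a / 8) by ring, abs_mul, abs_of_pos (by norm_num : (0 : ℝ) < 8)] at h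
    linarith
  have e0 : ∀ {x : ℝ}, |8 * x| ≤ 8 * (N ^ 3 * δ) → |x - 0| ≤ N ^ 3 * δ := fun {x} h => by
    simpa using e (x := x) (a := 0) (by simpa using h)
  refine norm_le_three_mul (by positivity) fun i => ?_
  fin_cases i
  exacts [e0 k0, e k1, e k2, e k3, e0 k4, e0 k5]

theorem chi_yst (hN : Freq N) : chi N yst = 0 := by
  obtain ⟨h1, h2⟩ := stage_zero hN
  have c0 : cor 0 yst = 0 := by simp [cor, yst]
  have c1 : cor 1 yst = √(5 / 2) := mul_div_cancel₀ _ (by norm_num)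
  have c2 : cor 2 yst = √(5 / 2) := mul_div_cancel₀ _ (by norm_num)
  have c3 : cor 3 yst = √(5 / 2) := mul_div_cancel₀ _ (by norm_num)
  have c4 : cor 4 yst = 0 := by simp [cor, yst]
  have c5 : cor 5 yst = 0 := by simp [cor, yst]
  have d1 : ch1 yst = ⟨0, √(5 / 2)⟩ := by rw [ch1, cpr, c0, c1]
  have d2 : ch2 N yst = ⟨0, √(5 / 2)⟩ := by rw [ch2, cpr, c2, d1, h2]
  have d3 : ch3 N yst = ⟨0, √(5 / 2)⟩ := by rw [ch3, cpr, c3, d2, h2]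
  rw [chi, cpr, c4, c5, d1, d2, d3, h1, h2, mul_zero]
  rfl

end Chi

end SD

namespace SD
open Module
open Filter Topology OnePoint
open scoped Quaternion

section FN

variable {N : ℝ}

/-- The map `ℝ⁶ → S³` of small `3`-dilation. -/
def fN (N : ℝ) (y : EucA 6) : ℍ[ℝ] := qS 0 (chi N y)

theorem fN_cases (hN : 2 ≤ N) (y : EucA 6) : (∀ᶠ w in 𝓝 y, 1 ≤ ‖chi N w‖) ∨
    (‖chi N y‖ ≤ 1 ∧ ContDiffAt ℝ 1 (chi N) y ∧ ‖fderiv ℝ (fun y => (chi N y).1) y‖ ≤ 432 * N ∧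
      ‖fderiv ℝ (fun y => (chi N y).2) y‖ ≤ 64 / N ^ 3) := by
  rcases chi_cases hN y with h | h
  · exact Or.inl h
  rcases le_or_gt ‖chi N y‖ 1 with h1 | h1
  · exact Or.inr ⟨h1, h⟩
  · exact Or.inl ((h.1.continuousAt.norm.eventually (lt_mem_nhds h1)).mono fun w hw => hw.le)

theorem fN_of_le {y : EucA 6} (h : 1 ≤ ‖chi N y‖) : fN N y = 1 := qS_of_le h

theorem fN_of_half_le (hN : 2 ≤ N) {y : EucA 6} (h : 1 / 2 ≤ ‖y‖) : fN N y = 1 :=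
  fN_of_le <| not_lt.1 fun h' => absurd (norm_lt_half (by linarith) h'.le) (not_lt.2 h)

theorem contDiff_fN (hN : 2 ≤ N) : ContDiff ℝ 1 (fN N) := contDiff_iff_contDiffAt.2 fun y => by
  rcases fN_cases hN y with h | h
  · exact (contDiffAt_const (c := (1 : ℍ[ℝ]))).congr_of_eventuallyEq (h.mono fun w hw => fN_of_le hw)
  · exact contDiff_qS.contDiffAt.comp y h.2.1

theorem exists_fN_factor : ∃ C : ℝ, 0 ≤ C ∧ ∀ N : ℝ, 2 ≤ N → ∀ y : EucA 6,
    ∃ (φ : Fin 3 → EucA 6 →L[ℝ] ℝ) (p : Fin 3 → ℍ[ℝ]), (∀ k, ‖p k‖ ≤ C) ∧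
      (∀ k, ‖φ k‖ ≤ ![64 / N ^ 3, C * (432 * N), C * (432 * N)] k) ∧ ∀ v, fderiv ℝ (fN N) y v = ∑ k, φ k v • p k := by
  obtain ⟨C, hC, hf⟩ := exists_factor
  refine ⟨C, hC, fun N hN y => ?_⟩
  have hN0 : 0 < N := by linarith
  rcases fN_cases hN y with h | ⟨h1, h2, h3, h4⟩
  · refine ⟨0, 0, fun k => by simpa using hC, fun k => ?_, fun v => ?_⟩
    · have a1 : 0 ≤ 64 / N ^ 3 := by positivity
      have a2 : 0 ≤ C * (432 * N) := by positivity
      fin_cases k <;> simpa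
    · have : fN N =ᶠ[𝓝 y] fun _ => 1 := h.mono fun w hw => fN_of_le hw
      simp [this.fderiv_eq]
  · obtain ⟨a, p₁, p₂, β₁, β₂, ha, hp1, hp2, hb1, hb2, hd⟩ := hf _ h1
    have hc := h2.differentiableAt one_ne_zero
    have hD : HasFDerivAt (fN N) (fderiv ℝ (qS 0) (chi N y) ∘L fderiv ℝ (chi N) y) y :=
      (contDiff_qS.differentiable one_ne_zero (chi N y)).hasFDerivAt.comp y hc.hasFDerivAt
    have e1 : fderiv ℝ (fun y => (chi N y).1) y = (ContinuousLinearMap.fst ℝ V5 ℝ) ∘L fderiv ℝ (chi N) y :=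
      (hasFDerivAt_fst.comp y hc.hasFDerivAt).fderiv
    have e2 : fderiv ℝ (fun y => (chi N y).2) y = (ContinuousLinearMap.snd ℝ V5 ℝ) ∘L fderiv ℝ (chi N) y :=
      (hasFDerivAt_snd.comp y hc.hasFDerivAt).fderiv
    refine ⟨![fderiv ℝ (fun y => (chi N y).2) y, β₁ ∘L fderiv ℝ (fun y => (chi N y).1) y, β₂ ∘L fderiv ℝ (fun y => (chi N y).1) y],
      ![a, p₁, p₂], fun k => ?_, fun k => ?_, fun v => ?_⟩
    · fin_cases k <;> simpa
    · have b : ∀ β : V5 →L[ℝ] ℝ, ‖β‖ ≤ C → ‖β ∘L fderiv ℝ (fun y => (chi N y).1) y‖ ≤ C * (432 * N) := fun β hβ =>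
        (ContinuousLinearMap.opNorm_comp_le _ _).trans (by gcongr)
      fin_cases k
      exacts [h4, b _ hb1, b _ hb2]
    · rw [hD.fderiv, e1, e2, Fin.sum_univ_three]
      exact hd _ _

/-- The rescalings of `chi` at its zero, extended by the derivative. -/
def zoo (N : ℝ) (p : ℝ × EucA 6) : V5 × ℝ :=
  if p.1 = 0 then fderiv ℝ (chi N) yst p.2 else p.1⁻¹ • chi N (yst + p.1 • p.2)

theorem contDiffAt_yst (hN : Freq N) (h2 : 2 ≤ N) : ContDiffAt ℝ 1 (chi N) yst := by
  rcases fN_cases h2 yst with h | h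
  · have := h.self_of_nhds
    norm_num [chi_yst hN] at this
  · exact h.2.1

theorem continuousAt_zoo_zero (hN : Freq N) (h2 : 2 ≤ N) (y : EucA 6) : ContinuousAt (zoo N) (0, y) := by
  have hd := ((contDiffAt_yst hN h2).differentiableAt one_ne_zero).hasFDerivAt
  set A := fderiv ℝ (chi N) yst with hA
  have h0 : Tendsto (fun p : ℝ × EucA 6 => zoo N p - A p.2) (𝓝 (0, y)) (𝓝 0) := by
    refine Metric.tendsto_nhds.2 fun ε hε => ?_
    have hB : 0 < ‖y‖ + 1 := by positivity
    have hl := Asymptotics.isLittleO_iff.1 (hasFDerivAt_iff_isLittleO.1 hd) (c := ε / (2 * (‖y‖ + 1))) (by positivity)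
    have ht : Tendsto (fun p : ℝ × EucA 6 => yst + p.1 • p.2) (𝓝 (0, y)) (𝓝 yst) := by
      have : Continuous fun p : ℝ × EucA 6 => yst + p.1 • p.2 := by fun_prop
      simpa using this.tendsto (0, y)
    have hy : ∀ᶠ p : ℝ × EucA 6 in 𝓝 (0, y), ‖p.2‖ < ‖y‖ + 1 :=
      continuous_snd.norm.continuousAt.eventually (gt_mem_nhds (show ‖y‖ < ‖y‖ + 1 by linarith))
    filter_upwards [ht.eventually hl, hy] with p h1 h3
    rw [dist_zero_right, zoo]
    split_ifs with hp
    · simpa [hA] using hε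
    · rw [chi_yst hN, sub_zero, add_sub_cancel_left, _root_.map_smul, norm_smul] at h1
      have e : p.1⁻¹ • chi N (yst + p.1 • p.2) - A p.2 = p.1⁻¹ • (chi N (yst + p.1 • p.2) - p.1 • A p.2) := by
        rw [smul_sub, inv_smul_smul₀ hp]
      rw [e, norm_smul, norm_inv]
      have hp' : 0 < ‖p.1‖ := norm_pos_iff.2 hp
      rw [inv_mul_lt_iff₀ hp']
      refine h1.trans_lt ?_
      rw [mul_left_comm]
      refine mul_lt_mul_of_pos_left ?_ hp'
      rw [div_mul_eq_mul_div, div_lt_iff₀ (by positivity)]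
      nlinarith [norm_nonneg p.2]
  have h1 : Tendsto (fun p : ℝ × EucA 6 => A p.2) (𝓝 (0, y)) (𝓝 (A y)) :=
    (A.continuous.comp continuous_snd).tendsto (0, y)
  have := h0.add h1
  simp only [sub_add_cancel, zero_add] at this
  rw [ContinuousAt]
  convert this using 2
  simp [zoo, hA]

theorem continuousAt_qS_zoo (hN : Freq N) (h2 : 2 ≤ N) {p : ℝ × EucA 6} (hp : 0 ≤ p.1) (hp1 : p.1 ≤ 1) :
    ContinuousWithinAt (fun p => qS 0 (zoo N p)) (Icc 0 1 ×ˢ univ) p := by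
  obtain ⟨s, y⟩ := p
  rcases hp.eq_or_lt with h | h
  · simp only at h
    subst h
    exact (contDiff_qS.continuous.continuousAt.comp (continuousAt_zoo_zero hN h2 y)).continuousWithinAt
  have hs : ∀ᶠ p : ℝ × EucA 6 in 𝓝 (s, y), 0 < p.1 := continuous_fst.continuousAt.eventually (lt_mem_nhds h)
  have hc : Continuous fun p : ℝ × EucA 6 => yst + p.1 • p.2 := by fun_prop
  rcases fN_cases h2 (yst + s • y) with h' | h'
  · refine ContinuousWithinAt.congr_of_eventuallyEq (continuousWithinAt_const (b := (1 : ℍ[ℝ]))) ?_ ?_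
    · filter_upwards [nhdsWithin_le_nhds (hc.continuousAt.eventually h'), nhdsWithin_le_nhds hs, self_mem_nhdsWithin] with p h1 h3 h4
      refine qS_of_le ?_
      rw [zoo, if_neg h3.ne', norm_smul, norm_inv, Real.norm_of_nonneg h3.le]
      exact one_le_mul_of_one_le_of_one_le ((one_le_inv₀ h3).2 h4.1.2) h1
    · refine qS_of_le ?_
      rw [zoo, if_neg h.ne', norm_smul, norm_inv, Real.norm_of_nonneg h.le]
      exact one_le_mul_of_one_le_of_one_le ((one_le_inv₀ h).2 hp1) h'.self_of_nhds
  · have h3 : ContinuousAt (fun p : ℝ × EucA 6 => p.1⁻¹ • chi N (yst + p.1 • p.2)) (s, y) :=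
      (continuousAt_fst.inv₀ h.ne').smul (ContinuousAt.comp (f := fun p : ℝ × EucA 6 => yst + p.1 • p.2) (x := (s, y)) h'.2.1.continuousAt hc.continuousAt)
    have h4 : ContinuousAt (zoo N) (s, y) := h3.congr (hs.mono fun p hp => by simp only [zoo, if_neg (ne_of_gt hp)])
    exact (contDiff_qS.continuous.continuousAt.comp h4).continuousWithinAt

theorem norm_le_zoo (hN : Freq N) (h2 : 2 ≤ N) {p : ℝ × EucA 6} (hp : 0 ≤ p.1) (hp1 : p.1 ≤ 1) (h : p.1 = 0 ∨ ‖zoo N p‖ ≤ 1) :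
    ‖p.2‖ ≤ 3 * (N ^ 3 * ‖zoo N p‖) := by
  have key : ∀ {s : ℝ} {y : EucA 6}, 0 < s → s ≤ 1 → ‖chi N (yst + s • y)‖ ≤ 1 → ‖y‖ ≤ 3 * (N ^ 3 * ‖zoo N (s, y)‖) := by
    intro s y hs hs1 h
    have := chi_inj hN h
    rw [add_sub_cancel_left, norm_smul, Real.norm_of_nonneg hs.le] at this
    rw [zoo, if_neg hs.ne', norm_smul, norm_inv, Real.norm_of_nonneg hs.le]
    refine le_of_mul_le_mul_left (this.trans_eq ?_) hs
    field_simp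
  obtain ⟨s, y⟩ := p
  rcases hp.eq_or_lt with h0 | h0
  · simp only at h0
    subst h0
    have hc : Tendsto (fun s : ℝ => (s, y)) (𝓝[>] 0) (𝓝 (0, y)) :=
      ((continuous_id.prodMk continuous_const).tendsto (0 : ℝ)).mono_left nhdsWithin_le_nhds
    have h1 := ((continuousAt_zoo_zero hN h2 y).tendsto.comp hc).norm
    refine ge_of_tendsto ((h1.const_mul (N ^ 3)).const_mul 3) ?_
    have hd : Tendsto (fun s : ℝ => chi N (yst + s • y)) (𝓝[>] 0) (𝓝 0) := by
      have : Continuous fun s : ℝ => yst + s • y := by fun_prop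
      have h3 := (this.tendsto 0).mono_left (nhdsWithin_le_nhds (s := Ioi 0))
      rw [zero_smul, add_zero] at h3
      simpa [chi_yst hN, Function.comp_def] using (contDiffAt_yst hN h2).continuousAt.tendsto.comp h3
    have hd1 : ∀ᶠ s in 𝓝[>] (0 : ℝ), ‖chi N (yst + s • y)‖ < 1 :=
      hd.norm.eventually (gt_mem_nhds (by simp))
    filter_upwards [hd1, Ioo_mem_nhdsGT (zero_lt_one' ℝ)] with s h3 h4
    exact key h4.1 h4.2.le h3.le
  · refine key h0 hp1 ?_
    have := h.resolve_left h0.ne'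
    rw [zoo, if_neg h0.ne', norm_smul, norm_inv, Real.norm_of_nonneg h0.le, inv_mul_le_iff₀ h0, mul_one] at this
    exact this.trans hp1

theorem not_null_fN (hN : Freq N) (h2 : 2 ≤ N) : ¬ Null one3 fun y => q3 0 (chi N y) := fun hnull => by
  set A := fderiv ℝ (chi N) yst with hA
  have hz : ∀ y, zoo N (0, y) = A y := fun y => by simp [zoo, hA]
  have hker : A.toLinearMap.ker = ⊥ := LinearMap.ker_eq_bot'.2 fun y hy => by
    have := norm_le_zoo hN h2 (p := (0, y)) le_rfl zero_le_one (Or.inl rfl)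
    rw [hz, show A y = 0 from hy] at this
    simpa using this
  have hdim : finrank ℝ (EucA 6) = finrank ℝ (V5 × ℝ) := by
    simp [V5, Complex.finrank_real_complex]
  set e := (LinearMap.linearEquivOfInjective A.toLinearMap (LinearMap.ker_eq_bot.1 hker) hdim).toContinuousLinearEquiv.toHomeomorph
  have he : ∀ y, e y = A y := fun y => rfl
  have hv : ∀ w, (q3 0 w : ℍ[ℝ]) = qS 0 w := fun w => rfl
  have hH : Htp one3 (fun y => q3 0 (e y)) fun y => q3 0 (chi N (yst + y)) := by
    refine ⟨fun p => q3 0 (zoo N (p.1, p.2)), ⟨?_, ?_⟩, fun y => ?_, fun y => ?_⟩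
    · refine Continuous.subtype_mk (f := fun p : I × EucA 6 => qS 0 (zoo N (p.1, p.2))) ?_ _
      have hc : ContinuousOn (fun p => qS 0 (zoo N p)) (Icc 0 1 ×ˢ univ) := fun p hp => continuousAt_qS_zoo hN h2 hp.1.1 hp.1.2
      exact hc.comp_continuous ((continuous_subtype_val.comp continuous_fst).prodMk continuous_snd) fun p => ⟨p.1.2, mem_univ _⟩
    · refine tendsto_const_nhds.congr' ?_
      have h : Tendsto (fun p : I × EucA 6 => ‖p.2‖) (cocompact _) atTop :=
        (tendsto_norm_cocompact_atTop (E := EucA 6)).comp (tendsto_snd_cocompact I)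
      filter_upwards [h.eventually_gt_atTop (3 * N ^ 3)] with p hp
      refine Subtype.ext ?_
      rw [hv]
      refine (qS_of_le (le_of_not_ge fun h' => ?_)).symm
      have := norm_le_zoo hN h2 (p := (p.1, p.2)) p.1.2.1 p.1.2.2 (Or.inr h')
      have h3 : 0 ≤ N ^ 3 := pow_nonneg (by linarith) 3
      nlinarith
    · simp [hz, he]
    · simp [zoo]
  have h1 := ((null_homeo (Homeomorph.addLeft yst)).2 hnull).of_htp hH.symm
  exact not_null_q3 ((null_homeo e).1 h1)

end FN

end SD

namespace SD
open Module
open Filter Topology OnePoint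
open scoped Quaternion

/-- The standard isometry `ℍ ≃ ℝ⁴`. -/
def qL : ℍ[ℝ] ≃ₗᵢ[ℝ] EucA 4 := Quaternion.linearIsometryEquivTuple

theorem null_of_sphereNullhomotopic {F : EucA 7 → EucA 4} {c : EucA 6 → usph 7} (hc : Continuous c) {e : usph 7}
    (hce : Tendsto c (cocompact _) (𝓝 e)) (hFe : F e = qL 1) {f : EucA 6 → S3} (hf : ∀ y, F (c y) = qL (f y))
    (h : SphereNullhomotopic F) : Null one3 f := by
  obtain ⟨b, hb, H, hH, hT, h0, h1⟩ := h
  have hn : ∀ (t : I) (x : usph 7), ‖qL.symm (H t x)‖ = 1 := fun t x => by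
    rw [LinearIsometryEquiv.norm_map]
    exact mem_sphere_zero_iff_norm.1 (hT t t.2 x.2)
  have hs : ∀ {q : ℍ[ℝ]}, ‖q‖ = 1 → q * star q = 1 := fun {q} hq => by
    rw [Quaternion.self_mul_star, Quaternion.normSq_eq_norm_mul_self, hq]
    norm_num
  let Φ : I × usph 7 → S3 := fun p => ⟨qL.symm (H p.1 p.2) * star (qL.symm (H p.1 e)), by simp [hn]⟩
  have hΦ : Continuous Φ := by
    have k1 : Continuous fun p : I × usph 7 => H p.1 p.2 :=
      hH.comp_continuous (f := fun p : I × usph 7 => ((p.1 : ℝ), (p.2 : EucA 7))) (by fun_prop) fun p => ⟨p.1.2, p.2.2⟩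
    have k2 : Continuous fun p : I × usph 7 => H p.1 e :=
      hH.comp_continuous (f := fun p : I × usph 7 => ((p.1 : ℝ), (e : EucA 7))) (by fun_prop) fun p => ⟨p.1.2, e.2⟩
    exact ((qL.symm.continuous.comp k1).mul (continuous_star.comp (qL.symm.continuous.comp k2))).subtype_mk _
  have hΦe : ∀ t, Φ (t, e) = one3 := fun t => Subtype.ext (hs (hn t e))
  refine ⟨fun p => Φ (p.1, c p.2), ⟨by fun_prop, fun U hU => ?_⟩, fun y => Subtype.ext ?_, fun y => Subtype.ext ?_⟩
  · have hE : ∀ᶠ x in 𝓝 e, ∀ t ∈ (univ : Set I), Φ (t, x) ∈ U := by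
      refine isCompact_univ.eventually_forall_of_forall_eventually fun t _ => ?_
      have k : ContinuousAt (fun q : usph 7 × I => Φ (q.2, q.1)) (e, t) := (hΦ.comp continuous_swap).continuousAt
      exact k.eventually (by simpa [hΦe] using hU)
    have := (hce.comp (tendsto_snd_cocompact I)).eventually hE
    exact this.mono fun p hp => hp p.1 (mem_univ _)
  · change qL.symm (H 0 (c y)) * star (qL.symm (H 0 e)) = f y
    rw [h0 (c y).2, h0 e.2, hf, hFe]
    simp
  · change qL.symm (H 1 (c y)) * star (qL.symm (H 1 e)) = 1
    rw [h1 (c y).2, h1 e.2]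
    exact hs (by rw [LinearIsometryEquiv.norm_map]; exact mem_sphere_zero_iff_norm.1 hb)

/-- Forgetting the last coordinate. -/
def pr6 : EucA 7 →L[ℝ] EucA 6 :=
  (PiLp.continuousLinearEquiv 2 ℝ fun _ : Fin 6 => ℝ).symm.toContinuousLinearMap ∘L
    ContinuousLinearMap.pi fun i => EuclideanSpace.proj i.castSucc

theorem pr6_apply (x : EucA 7) (i : Fin 6) : pr6 x i = x i.castSucc := rfl

theorem norm_sq_pr6 (x : EucA 7) : ‖x‖ ^ 2 = ‖pr6 x‖ ^ 2 + x 6 ^ 2 := by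
  simp only [EuclideanSpace.norm_sq_eq, Fin.sum_univ_castSucc (n := 6), pr6_apply, Real.norm_eq_abs, sq_abs]
  rfl

theorem norm_pr6_le (x : EucA 7) : ‖pr6 x‖ ≤ ‖x‖ := by
  refine (sq_le_sq₀ (norm_nonneg _) (norm_nonneg _)).1 ?_
  linarith [norm_sq_pr6 x, sq_nonneg (x 6)]

/-- Appending a last coordinate. -/
def ap7 (y : EucA 6) (h : ℝ) : EucA 7 := WithLp.toLp 2 (Fin.snoc (α := fun _ => ℝ) y h)

theorem pr6_ap7 (y : EucA 6) (h : ℝ) : pr6 (ap7 y h) = y := by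
  ext i
  rw [pr6_apply]
  exact Fin.snoc_castSucc (α := fun _ => ℝ) h y i

theorem ap7_six (y : EucA 6) (h : ℝ) : ap7 y h 6 = h := Fin.snoc_last (α := fun _ => ℝ) h y

theorem continuous_ap7 : Continuous fun p : EucA 6 × ℝ => ap7 p.1 p.2 := by
  refine (PiLp.continuous_toLp 2 _).comp (continuous_pi fun i => ?_)
  refine Fin.lastCases ?_ (fun j => ?_) i
  · simp only [Fin.snoc_last]
    exact continuous_snd
  · simp only [Fin.snoc_castSucc]
    fun_prop

theorem mem_usph_ap7 {y : EucA 6} {h : ℝ} (e : ‖y‖ ^ 2 + h ^ 2 = 1) : ap7 y h ∈ usph 7 := by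
  refine mem_sphere_zero_iff_norm.2 ?_
  have := norm_sq_pr6 (ap7 y h)
  rw [pr6_ap7, ap7_six, e] at this
  exact (pow_eq_one_iff_of_nonneg (norm_nonneg _) two_ne_zero).1 this

section Wrap

/-- The last coordinate of the parametrisation of the sphere by `ℝ⁶`. -/
def wrh (y : EucA 6) : ℝ := √(1 - ‖y‖ ^ 2) - √(1 - (max 1 ‖y‖ ^ 2)⁻¹)

theorem wrap_mem (y : EucA 6) : ap7 ((max 1 ‖y‖ ^ 2)⁻¹ • y) (wrh y) ∈ usph 7 := by
  refine mem_usph_ap7 ?_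
  rw [norm_smul, wrh]
  rcases le_total ‖y‖ 1 with h | h
  · rw [max_eq_left h]
    have : 0 ≤ 1 - ‖y‖ ^ 2 := by nlinarith [norm_nonneg y]
    norm_num [Real.sq_sqrt this]
  · rw [max_eq_right h, Real.sqrt_eq_zero_of_nonpos (by nlinarith), zero_sub, neg_sq, Real.sq_sqrt, norm_inv, norm_pow, norm_norm]
    · have : ‖y‖ ≠ 0 := by linarith
      field_simp
      ring
    · rw [sub_nonneg]
      exact inv_le_one_of_one_le₀ (one_le_pow₀ h)

/-- The parametrisation of the sphere by `ℝ⁶`. -/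
def wrap (y : EucA 6) : usph 7 := ⟨_, wrap_mem y⟩

theorem continuous_wrap : Continuous wrap := by
  have h : ∀ y : EucA 6, max 1 ‖y‖ ^ 2 ≠ 0 := fun y => by positivity
  have c1 : Continuous fun y : EucA 6 => (max 1 ‖y‖ ^ 2)⁻¹ :=
    Continuous.inv₀ ((continuous_const.max continuous_norm).pow 2) h
  refine Continuous.subtype_mk (continuous_ap7.comp (f := fun y : EucA 6 => ((max 1 ‖y‖ ^ 2)⁻¹ • y, wrh y)) ?_) _
  unfold wrh
  fun_prop

/-- The south pole. -/
def spole : usph 7 := ⟨ap7 0 (-1), mem_usph_ap7 (by norm_num)⟩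

theorem tendsto_wrap : Tendsto wrap (cocompact _) (𝓝 spole) := by
  rw [tendsto_subtype_rng]
  have hN := tendsto_norm_cocompact_atTop (E := EucA 6)
  have k1 : Tendsto (fun y : EucA 6 => (max 1 ‖y‖ ^ 2)⁻¹ • y) (cocompact _) (𝓝 0) := by
    rw [tendsto_zero_iff_norm_tendsto_zero]
    refine (tendsto_inv_atTop_zero.comp hN).congr' ?_
    filter_upwards [hN.eventually_ge_atTop 1] with y hy
    rw [norm_smul, max_eq_right hy, norm_inv, norm_pow, norm_norm, Function.comp_apply]
    have : ‖y‖ ≠ 0 := by linarith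
    field_simp
  have k2 : Tendsto wrh (cocompact _) (𝓝 (-1)) := by
    have h1 : Tendsto (fun r : ℝ => 0 - √(1 - (r ^ 2)⁻¹)) atTop (𝓝 (-1)) := by
      have := (tendsto_inv_atTop_zero.comp (tendsto_pow_atTop (α := ℝ) two_ne_zero)).const_sub 1
      simpa [Function.comp_def] using (this.sqrt).const_sub 0
    refine (h1.comp hN).congr' ?_
    filter_upwards [hN.eventually_ge_atTop 1] with y hy
    rw [wrh, max_eq_right hy, Real.sqrt_eq_zero_of_nonpos (by nlinarith)]
    rfl
  exact (continuous_ap7.tendsto (0, -1)).comp (k1.prodMk_nhds k2)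

end Wrap

section Sphere

variable {N : ℝ}

/-- A cutoff in the last coordinate. -/
def scut (r : ℝ) : ℝ := stp (4 * r - 3 / 2)

theorem scut_of_le {r : ℝ} (h : r ≤ 1 / 4) : scut r = 0 := stp_of_le (by linarith)

theorem scut_of_ge {r : ℝ} (h : 1 / 2 ≤ r) : scut r = 1 := stp_of_ge (by linarith)

theorem contDiff_scut : ContDiff ℝ 1 scut :=
  contDiff_stp.comp ((contDiff_const.mul contDiff_id).sub contDiff_const)

/-- The quaternionic form of the map of small `3`-dilation. -/
def sG (N : ℝ) (x : EucA 7) : ℍ[ℝ] := 1 + scut (x 6) • (fN N (pr6 x) - 1)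

theorem contDiff_scut_six : ContDiff ℝ 1 fun x : EucA 7 => scut (x 6) :=
  contDiff_scut.comp (EuclideanSpace.proj (6 : Fin 7) : EucA 7 →L[ℝ] ℝ).contDiff

theorem contDiff_sG (hN : 2 ≤ N) : ContDiff ℝ 1 (sG N) :=
  contDiff_const.add (contDiff_scut_six.smul (((contDiff_fN hN).comp pr6.contDiff).sub contDiff_const))

theorem sG_of_ge {x : EucA 7} (h : 1 / 2 ≤ x 6) : sG N x = fN N (pr6 x) := by simp [sG, scut_of_ge h]

theorem sG_of_le {x : EucA 7} (h : x 6 ≤ 1 / 4) : sG N x = 1 := by simp [sG, scut_of_le h]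

theorem sG_of_half_le (hN : 2 ≤ N) {x : EucA 7} (h : 1 / 2 ≤ ‖pr6 x‖) : sG N x = 1 := by simp [sG, fN_of_half_le hN h]

theorem sphere_cases {x : EucA 7} (hx : x ∈ usph 7) : 1 / 2 ≤ ‖pr6 x‖ ∨ 1 / 2 < x 6 ∨ x 6 < 1 / 4 := by
  by_contra! h
  have h1 := norm_sq_pr6 x
  rw [mem_sphere_zero_iff_norm.1 hx] at h1
  nlinarith [norm_nonneg (pr6 x)]

theorem norm_sG (hN : 2 ≤ N) {x : EucA 7} (hx : x ∈ usph 7) : ‖sG N x‖ = 1 := by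
  rcases sphere_cases hx with h | h | h
  · simp [sG_of_half_le hN h]
  · rw [sG_of_ge h.le]
    exact norm_qS le_rfl zero_le_one _
  · simp [sG_of_le h.le]

theorem sG_wrap (hN : 2 ≤ N) (y : EucA 6) : sG N (wrap y) = fN N y := by
  have hp : pr6 (wrap y) = (max 1 ‖y‖ ^ 2)⁻¹ • y := pr6_ap7 _ _
  have h6 : (wrap y : EucA 7) 6 = wrh y := ap7_six _ _
  rcases le_total ‖y‖ 1 with h | h
  · rw [max_eq_left h, one_pow, inv_one, one_smul] at hp
    rcases le_or_gt (1 / 2) ‖y‖ with h' | h'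
    · rw [sG_of_half_le hN (by rw [hp]; exact h'), fN_of_half_le hN h']
    · rw [sG_of_ge, hp]
      rw [h6, wrh, max_eq_left h]
      norm_num
      refine Real.le_sqrt_of_sq_le ?_
      nlinarith [norm_nonneg y]
  · rw [fN_of_half_le hN (by linarith), sG_of_le]
    rw [h6, wrh, Real.sqrt_eq_zero_of_nonpos (by nlinarith)]
    linarith [Real.sqrt_nonneg (1 - (max 1 ‖y‖ ^ 2)⁻¹)]

theorem exists_hasFDerivAt_sG (hN : 2 ≤ N) {x : EucA 7} (hx : x ∈ usph 7) :
    ∃ r : ℝ, |r| ≤ 1 ∧ HasFDerivAt (sG N) (r • (fderiv ℝ (fN N) (pr6 x) ∘L pr6)) x := by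
  have hf : HasFDerivAt (fun x => fN N (pr6 x)) (fderiv ℝ (fN N) (pr6 x) ∘L pr6) x :=
    (((contDiff_fN hN).differentiable one_ne_zero _).hasFDerivAt).comp x pr6.hasFDerivAt
  have h6 : Continuous fun x : EucA 7 => x 6 := by fun_prop
  rcases sphere_cases hx with h | h | h
  · refine ⟨scut (x 6), ?_, ?_⟩
    · obtain ⟨h0, h1⟩ := stp_mem (4 * x 6 - 3 / 2)
      exact abs_le.2 ⟨by rw [scut]; linarith, h1⟩
    · have h1 := (contDiff_scut_six.differentiable one_ne_zero x).hasFDerivAt.smul (hf.sub_const 1)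
      rw [fN_of_half_le hN h, sub_self] at h1
      refine (h1.const_add 1).congr_fderiv ?_
      ext v <;> simp
  · refine ⟨1, by simp, ?_⟩
    refine (hf.congr_of_eventuallyEq ((h6.continuousAt.eventually (lt_mem_nhds h)).mono fun w hw => sG_of_ge hw.le)).congr_fderiv ?_
    exact ContinuousLinearMap.ext fun v => (one_smul ℝ (fderiv ℝ (fN N) (pr6 x) (pr6 v))).symm
  · refine ⟨0, by simp, ?_⟩
    refine ((hasFDerivAt_const (1 : ℍ[ℝ]) x).congr_of_eventuallyEq ((h6.continuousAt.eventually (gt_mem_nhds h)).mono fun w hw => sG_of_le hw.le)).congr_fderiv ?_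
    exact ContinuousLinearMap.ext fun v => (zero_smul ℝ (fderiv ℝ (fN N) (pr6 x) (pr6 v))).symm

theorem exists_kDilation_le : ∃ K : ℝ, 0 ≤ K ∧ ∀ N : ℝ, 2 ≤ N → kDilation 3 (fun x => qL (sG N x)) ≤ K / N := by
  obtain ⟨C, hC, hf⟩ := exists_fN_factor
  refine ⟨18 * 64 * 432 ^ 2 * C ^ 5, by positivity, fun N hN => ?_⟩
  have hN0 : 0 < N := by linarith
  refine Real.iSup_le (fun x => ?_) (by positivity)
  obtain ⟨r, hr, hd⟩ := exists_hasFDerivAt_sG hN x.2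
  obtain ⟨φ, p, hp, hφ, he⟩ := hf N hN (pr6 x)
  have hd' : HasFDerivAt (fun x => qL (sG N x)) (qL.toContinuousLinearEquiv.toContinuousLinearMap ∘L
    (r • (fderiv ℝ (fN N) (pr6 x) ∘L pr6))) (x : EucA 7) := qL.toContinuousLinearEquiv.hasFDerivAt.comp _ hd
  rw [hd'.fderiv]
  have hb : ∀ k : Fin 3, 0 ≤ ![64 / N ^ 3, C * (432 * N), C * (432 * N)] k := fun k => (norm_nonneg _).trans (hφ k)
  have hφ' : ∀ (k : Fin 3) (v : (ℝ ∙ (x : EucA 7))ᗮ), |r * φ k (pr6 v)| ≤ ![64 / N ^ 3, C * (432 * N), C * (432 * N)] k * ‖v‖ := fun k v => by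
    rw [abs_mul]
    calc _ ≤ 1 * (‖φ k‖ * ‖pr6 v‖) := by gcongr; exact (φ k).le_opNorm _
      _ ≤ _ := by rw [one_mul]; exact mul_le_mul (hφ k) (norm_pr6_le _) (norm_nonneg _) (hb k)
  refine (lamNorm_three_le (p := fun k => qL (p k)) hC (fun k => by simpa using hp k) hb hφ' fun v => ?_).trans_eq ?_
  · change qL (r • fderiv ℝ (fN N) (pr6 x) (pr6 v)) = _
    rw [he, Finset.smul_sum, map_sum]
    simp [smul_smul]
  · simp
    field_simp

end Sphere

end SD

/-- For every `ε > 0` there exists a homotopically non-trivial `C¹` map from `S^6` to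
`S^3` with `3`-dilation less than `ε`.  (The class of such a map is a non-trivial element of `π₆(S³) ≅ ℤ/12` which is the suspension of a class in `π₅(S²)`.)
(`S^6 = usph 7 ⊆ ℝ^7`, `S^3 = usph 4 ⊆ ℝ^4`; a `C¹` map of spheres is
represented by a `C¹` ambient map sending the unit sphere to the unit sphere.) -/
theorem nontrivial_small_3dilation_S6_S3 :
    ∀ ε : ℝ, 0 < ε →
      ∃ F : EucA 7 → EucA 4,
        ContDiff ℝ 1 F ∧
        MapsTo F (usph 7) (usph 4) ∧
        ¬ SphereNullhomotopic F ∧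
        kDilation 3 F < ε := by
  intro ε hε
  obtain ⟨K, hK, hdil⟩ := SD.exists_kDilation_le
  obtain ⟨N, hN, hB⟩ := SD.exists_freq (2 + (K + 1) / ε)
  have h2 : 2 ≤ N := by
    have : 0 ≤ (K + 1) / ε := by positivity
    linarith
  refine ⟨fun x => SD.qL (SD.sG N x), SD.qL.contDiff.comp (SD.contDiff_sG h2), fun x hx => ?_, fun h => ?_, ?_⟩
  · exact mem_sphere_zero_iff_norm.2 (by rw [LinearIsometryEquiv.norm_map, SD.norm_sG h2 hx])
  · refine SD.not_null_fN hN h2 (SD.null_of_sphereNullhomotopic SD.continuous_wrap SD.tendsto_wrap ?_ (fun y => ?_) h)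
    · have h6 : (SD.spole : EucA 7) 6 ≤ 1 / 4 := (SD.ap7_six 0 (-1)).trans_le (by norm_num)
      rw [SD.sG_of_le h6]
    · rw [SD.sG_wrap h2]
      rfl
  · refine (hdil N h2).trans_lt ?_
    rw [div_lt_iff₀ (by linarith)]
    have : K + 1 ≤ ε * N := by
      rw [mul_comm, ← div_le_iff₀ hε]
      linarith
    linarith
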